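/- Let M > 0 be fixed and set Q₁ := (log x)^{M+1}. Then for all x ≥ 2 and all Q with x(log x)^{-M} ≤ Q ≤ x, ∑_{q ≤ Q₁} (1/φ(q))·log(2Q/q)·∑_{χ primitive mod q} |ψ'_K(x, χ∘N)|² ≪ x·Q·log x, where the inner sum is over primitive Dirichlet characters modulo q and the implied constant depends only on K and M. -/

import Mathlib

/-!
Setting: `K` is a number field, Galois over `ℚ`, with ring of integers `𝓞 K`.
We formalize the objects from Smith, "A generalization of the
Barban-Davenport-Halberstam Theorem to number fields".
-/

open NumberField Ideal
open scoped Classical BigOperators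

noncomputable section

/-- `𝔞` is a (positive) power of a nonzero prime ideal of `𝓞 K`. -/
def IsPrimeIdealPower {K : Type*} [Field K] [NumberField K] (𝔞 : Ideal (𝓞 K)) : Prop :=
  ∃ (𝔭 : Ideal (𝓞 K)) (m : ℕ), 𝔭.IsPrime ∧ 𝔭 ≠ ⊥ ∧ 1 ≤ m ∧ 𝔞 = 𝔭 ^ m

/-- The von Mangoldt function on ideals of `𝓞 K`: `Λ_K(𝔭^m) = log N𝔭`, and `0` otherwise.
(For `𝔞 = 𝔭^m` with `𝔭` prime, the radical of `𝔞` is `𝔭`.) -/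
def LambdaK (K : Type*) [Field K] [NumberField K] (𝔞 : Ideal (𝓞 K)) : ℝ :=
  if IsPrimeIdealPower 𝔞 then Real.log (absNorm 𝔞.radical) else 0

/-- `ψ_K(x; q, a) = ∑_{N𝔭^m ≤ x, N𝔭^m ≡ a (mod q)} log N𝔭`. -/
def psiK (K : Type*) [Field K] [NumberField K] (x : ℝ) (q : ℕ) (a : ZMod q) : ℝ :=
  ∑' 𝔞 : Ideal (𝓞 K),
    if (absNorm 𝔞 : ℝ) ≤ x ∧ ((absNorm 𝔞 : ZMod q) = a) then LambdaK K 𝔞 else 0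

/-- `G_q`: the image of `Gal(K(ζ_q)/K)` in `(ℤ/qℤ)ˣ` under restriction to `ℚ(ζ_q)` followed
by the canonical isomorphism `Gal(ℚ(ζ_q)/ℚ) ≅ (ℤ/qℤ)ˣ`; concretely, the range of the map
sending `σ ∈ Gal(K(ζ_q)/K)` to the exponent `a ∈ (ℤ/qℤ)ˣ` with `σ(ζ_q) = ζ_q^a`. -/
def Gq (K : Type*) [Field K] [NumberField K] (q : ℕ) : Subgroup (ZMod q)ˣ :=
  if h : 0 < q then
    haveI : NeZero q := ⟨h.ne'⟩
    haveI : NeZero (((⟨q, h⟩ : ℕ+) : ℕ) : K) := ⟨Nat.cast_ne_zero.mpr h.ne'⟩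
    ((IsCyclotomicExtension.zeta_spec (⟨q, h⟩ : ℕ+) K
        (CyclotomicField (⟨q, h⟩ : ℕ+) K)).autToPow K).range
  else ⊥

/-- `φ_K(q) = |G_q|`. -/
def phiK (K : Type*) [Field K] [NumberField K] (q : ℕ) : ℕ :=
  Nat.card (Gq K q)

/-- `ψ_K(x, χ∘N) = ∑_{N𝔞 ≤ x} χ(N𝔞) Λ_K(𝔞)`. -/
def psiKChi (K : Type*) [Field K] [NumberField K] (x : ℝ) {q : ℕ}
    (χ : DirichletCharacter ℂ q) : ℂ :=
  ∑' 𝔞 : Ideal (𝓞 K),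
    if (absNorm 𝔞 : ℝ) ≤ x then χ (absNorm 𝔞 : ZMod q) * (LambdaK K 𝔞 : ℂ) else 0

/-- `ψ'_K(x, χ∘N)`: equals `ψ_K(x, χ∘N) − x` when `χ` is trivial on `G_q`,
and `ψ_K(x, χ∘N)` otherwise. -/
def psiKChi' (K : Type*) [Field K] [NumberField K] (x : ℝ) {q : ℕ}
    (χ : DirichletCharacter ℂ q) : ℂ :=
  if ∀ a ∈ Gq K q, χ (a : ZMod q) = 1 then psiKChi K x χ - x else psiKChi K x χ

/-- The common residue degree `f(K/ℚ; p)` of the primes of `K` above `p`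
(well-defined when `K/ℚ` is Galois): any prime `𝔭` above `p` has `N𝔭 = p^f`. -/
def resDeg (K : Type*) [Field K] [NumberField K] (p : ℕ) : ℕ :=
  if h : ∃ 𝔭 : Ideal (𝓞 K), 𝔭.IsPrime ∧ 𝔭 ≠ ⊥ ∧ (p : 𝓞 K) ∈ 𝔭 then
    (absNorm h.choose).factorization p
  else 0

/-- `D_K(n)`: the number of prime ideal powers `𝔭^m` of `𝓞 K` with `N𝔭^m = n`. -/
def DK (K : Type*) [Field K] [NumberField K] (n : ℕ) : ℕ :=
  Nat.card {𝔞 : Ideal (𝓞 K) // IsPrimeIdealPower 𝔞 ∧ absNorm 𝔞 = n}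

/-- `Λ_K^*(n) = f(K/ℚ; p) · log p` if `n = p^k` is a prime power, and `0` otherwise. -/
def LambdaStarK (K : Type*) [Field K] [NumberField K] (n : ℕ) : ℝ :=
  if IsPrimePow n then (resDeg K n.minFac : ℝ) * Real.log n.minFac else 0

end

/-! ### Dirichlet series with a power-saving summatory function -/

/-- The summatory function of `f` minus the linear main term `c t`. -/
noncomputable def sumRem (f : ℕ → ℂ) (c : ℂ) (t : ℝ) : ℂ :=
  ∑ k ∈ Finset.Icc 1 ⌊t⌋₊, f k - c * t

/-- The difference between the Dirichlet series of `f` and `c s / (s - 1)`, as an integral. -/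
noncomputable def remFun (f : ℕ → ℂ) (c : ℂ) (s : ℂ) : ℂ :=
  s * ∫ t in Set.Ioi (1 : ℝ), sumRem f c t * (t : ℂ) ^ (-(s + 1))

theorem measurable_sumRem (f : ℕ → ℂ) (c : ℂ) : Measurable (sumRem f c) := by
  unfold sumRem
  refine Measurable.sub ?_ (by fun_prop)
  exact (measurable_from_nat (f := fun n : ℕ => ∑ k ∈ Finset.Icc 1 n, f k)).comp Nat.measurable_floor

theorem integrableOn_sumRem_mul_cpow {f : ℕ → ℂ} {c : ℂ} {A δ : ℝ}
    (hS : ∀ t : ℝ, 1 ≤ t → ‖sumRem f c t‖ ≤ A * t ^ (1 - δ)) {s : ℂ} (hs : 1 - δ < s.re) :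
    MeasureTheory.IntegrableOn (fun t : ℝ => sumRem f c t * (t : ℂ) ^ (-(s + 1))) (Set.Ioi 1) := by
  have h1 : MeasureTheory.IntegrableOn (fun t : ℝ => A * t ^ (1 - δ + (-s.re - 1))) (Set.Ioi 1) :=
    (integrableOn_Ioi_rpow_of_lt (by linarith) one_pos).const_mul A
  refine MeasureTheory.Integrable.mono' h1 ?_ ?_
  · refine ((measurable_sumRem f c).mul ?_).aestronglyMeasurable
    exact Measurable.pow_const (by fun_prop) _
  · filter_upwards [MeasureTheory.ae_restrict_mem measurableSet_Ioi] with t ht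
    have ht0 : (0 : ℝ) < t := one_pos.trans ht
    rw [norm_mul, Complex.norm_cpow_eq_rpow_re_of_pos ht0, Real.rpow_add ht0, ← mul_assoc]
    have : (-(s + 1)).re = -s.re - 1 := by simp; ring
    rw [this]
    gcongr
    exact hS t ht.le

theorem norm_remFun_le {f : ℕ → ℂ} {c : ℂ} {A δ : ℝ}
    (hS : ∀ t : ℝ, 1 ≤ t → ‖sumRem f c t‖ ≤ A * t ^ (1 - δ)) {s : ℂ} (hs : 1 - δ < s.re) :
    ‖remFun f c s‖ ≤ ‖s‖ * (A / (s.re - 1 + δ)) := by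
  unfold remFun
  rw [norm_mul]
  gcongr
  have h1 : MeasureTheory.IntegrableOn (fun t : ℝ => A * t ^ (1 - δ + (-s.re - 1))) (Set.Ioi 1) :=
    (integrableOn_Ioi_rpow_of_lt (by linarith) one_pos).const_mul A
  refine (MeasureTheory.norm_integral_le_of_norm_le h1 ?_).trans ?_
  · filter_upwards [MeasureTheory.ae_restrict_mem measurableSet_Ioi] with t ht
    have ht0 : (0 : ℝ) < t := one_pos.trans ht
    rw [norm_mul, Complex.norm_cpow_eq_rpow_re_of_pos ht0, Real.rpow_add ht0, ← mul_assoc]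
    have : (-(s + 1)).re = -s.re - 1 := by simp; ring
    rw [this]
    gcongr
    exact hS t ht.le
  · rw [MeasureTheory.integral_const_mul, integral_Ioi_rpow_of_lt (by linarith) one_pos]
    apply le_of_eq
    have h3 : s.re - 1 + δ ≠ 0 := by linarith
    have h4 : 1 - δ + (-s.re - 1) + 1 ≠ 0 := by linarith
    rw [Real.one_rpow]
    rw [mul_div_assoc', div_eq_div_iff h4 h3]
    ring

theorem differentiableAt_remFun {f : ℕ → ℂ} {c : ℂ} {A δ : ℝ}
    (hS : ∀ t : ℝ, 1 ≤ t → ‖sumRem f c t‖ ≤ A * t ^ (1 - δ)) {s : ℂ} (hs : 1 - δ < s.re) :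
    DifferentiableAt ℂ (remFun f c) s := by
  set g : ℝ → ℂ := (Set.Ioi (1 : ℝ)).indicator (sumRem f c) with hg
  have hmel : ∀ z : ℂ, remFun f c z = z * mellin g (-z) := by
    intro z
    unfold remFun mellin
    congr 1
    have : ∀ t : ℝ, (t : ℂ) ^ (-z - 1) • g t
        = (Set.Ioi (1 : ℝ)).indicator (fun t : ℝ => sumRem f c t * (t : ℂ) ^ (-(z + 1))) t := by
      intro t
      by_cases ht : t ∈ Set.Ioi (1 : ℝ)
      · simp only [hg, Set.indicator_of_mem ht, smul_eq_mul]
        rw [mul_comm, neg_add']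
      · simp only [hg, Set.indicator_of_notMem ht, smul_zero]
    simp_rw [this]
    rw [MeasureTheory.setIntegral_indicator measurableSet_Ioi]
    congr 2
    ext t
    simp only [Set.mem_inter_iff, Set.mem_Ioi]
    exact ⟨fun h => ⟨one_pos.trans h, h⟩, fun h => h.2⟩
  have hO : g =O[Filter.atTop] fun t : ℝ => t ^ (-(δ - 1)) := by
    refine Asymptotics.IsBigO.of_bound A ?_
    filter_upwards [Filter.eventually_gt_atTop (1 : ℝ)] with t ht
    rw [hg, Set.indicator_of_mem (show t ∈ Set.Ioi (1 : ℝ) from ht), neg_sub,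
      Real.norm_of_nonneg (Real.rpow_nonneg (by linarith) _)]
    exact hS t ht.le
  have h0 : g =O[nhdsWithin 0 (Set.Ioi 0)] fun t : ℝ => t ^ (-((-s).re - 1)) := by
    refine Asymptotics.IsBigO.of_bound 0 ?_
    have : ∀ᶠ t : ℝ in nhdsWithin 0 (Set.Ioi 0), t < 1 :=
      nhdsWithin_le_nhds (eventually_lt_nhds one_pos)
    filter_upwards [this] with t ht
    rw [hg, Set.indicator_of_notMem (by simpa using ht.le)]
    simp
  have hloc : MeasureTheory.LocallyIntegrableOn g (Set.Ioi 0) := by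
    have hb : ∀ R : ℝ, MeasureTheory.IntegrableOn g (Set.Icc 0 R) := by
      intro R
      have hsub : ∀ t ∈ Set.Icc (0:ℝ) R, ‖g t‖ ≤ |A| * (1 + |R| ^ |1 - δ|) := by
        intro t ht
        by_cases h1 : t ∈ Set.Ioi (1:ℝ)
        · have h1' : 1 < t := h1
          rw [hg, Set.indicator_of_mem h1]
          refine (hS t h1'.le).trans ?_
          have : t ^ (1 - δ) ≤ |R| ^ |1 - δ| := by
            refine (Real.rpow_le_rpow_of_exponent_le h1'.le (le_abs_self _)).trans ?_
            exact Real.rpow_le_rpow (by linarith) (ht.2.trans (le_abs_self _)) (abs_nonneg _)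
          have h0 : 0 ≤ t ^ (1 - δ) := Real.rpow_nonneg (by linarith) _
          calc A * t ^ (1 - δ) ≤ |A| * t ^ (1 - δ) := by gcongr; exact le_abs_self _
            _ ≤ _ := by gcongr; linarith
        · rw [hg, Set.indicator_of_notMem h1]
          simp only [norm_zero]
          positivity
      refine MeasureTheory.Measure.integrableOn_of_bounded (M := |A| * (1 + |R| ^ |1 - δ|))
        (by simp) ?_ ?_
      · exact ((measurable_sumRem f c).indicator measurableSet_Ioi).aestronglyMeasurable
      · filter_upwards [MeasureTheory.ae_restrict_mem measurableSet_Icc] with t ht using hsub t ht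
    rw [MeasureTheory.locallyIntegrableOn_iff (by exact isOpen_Ioi.isLocallyClosed)]
    intro k hk hkc
    obtain ⟨R, hR⟩ := hkc.bddAbove
    exact (hb R).mono_set fun t ht => ⟨(hk ht).le, hR ht⟩
  have hd := mellin_differentiableAt_of_isBigO_rpow hloc hO (s := -s) (by simp; linarith) h0
    (by simp)
  have : remFun f c = fun z => z * mellin g (-z) := funext hmel
  rw [this]
  exact differentiableAt_id.mul (hd.comp s differentiableAt_id.neg)

theorem LSeries_eq_add_remFun {f : ℕ → ℂ} {c : ℂ} {A δ : ℝ} (hδ : 0 < δ)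
    (hS : ∀ t : ℝ, 1 ≤ t → ‖sumRem f c t‖ ≤ A * t ^ (1 - δ)) {s : ℂ} (hs : 1 < s.re)
    (hsum : LSeriesSummable f s) :
    LSeries f s = c * (s / (s - 1)) + remFun f c s := by
  have hO : (fun n : ℕ => ∑ k ∈ Finset.Icc 1 n, f k) =O[Filter.atTop] fun n => (n : ℝ) ^ (1 : ℝ) := by
    refine Asymptotics.IsBigO.of_bound (|A| + ‖c‖) ?_
    filter_upwards [Filter.eventually_ge_atTop 1] with n hn
    have hn' : (1 : ℝ) ≤ n := by exact_mod_cast hn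
    have h := hS n hn'
    rw [sumRem, Nat.floor_natCast] at h
    have h2 : ‖∑ k ∈ Finset.Icc 1 n, f k‖ ≤ A * (n : ℝ) ^ (1 - δ) + ‖c‖ * n := by
      calc _ = ‖(∑ k ∈ Finset.Icc 1 n, f k - c * ((n : ℝ) : ℂ)) + c * ((n : ℝ) : ℂ)‖ := by ring_nf
        _ ≤ _ := norm_add_le _ _
        _ ≤ _ := by gcongr; simp
    rw [Real.rpow_one, Real.norm_of_nonneg (by positivity)]
    refine h2.trans ?_
    have : (n : ℝ) ^ (1 - δ) ≤ n := by
      calc (n : ℝ) ^ (1 - δ) ≤ (n : ℝ) ^ (1 : ℝ) :=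
            Real.rpow_le_rpow_of_exponent_le hn' (by linarith)
        _ = n := Real.rpow_one _
    calc _ ≤ |A| * (n : ℝ) ^ (1 - δ) + ‖c‖ * n := by gcongr; exact le_abs_self _
      _ ≤ |A| * n + ‖c‖ * n := by gcongr
      _ = _ := by ring
  rw [LSeries_eq_mul_integral f zero_le_one hs hsum hO, remFun]
  have hs0 : s - 1 ≠ 0 := by
    intro h
    rw [sub_eq_zero] at h
    simp [h] at hs
  have hint := integrableOn_sumRem_mul_cpow hS (s := s) (by linarith)
  have hint2 : MeasureTheory.IntegrableOn (fun t : ℝ => c * (t : ℂ) ^ (-s)) (Set.Ioi 1) :=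
    ((integrableOn_Ioi_cpow_iff one_pos).mpr (by simpa using hs)).const_mul c
  have : ∫ t in Set.Ioi (1 : ℝ), (∑ k ∈ Finset.Icc 1 ⌊t⌋₊, f k) * (t : ℂ) ^ (-(s + 1))
      = (∫ t in Set.Ioi (1 : ℝ), sumRem f c t * (t : ℂ) ^ (-(s + 1)))
        + ∫ t in Set.Ioi (1 : ℝ), c * (t : ℂ) ^ (-s) := by
    rw [← MeasureTheory.integral_add hint hint2]
    refine MeasureTheory.setIntegral_congr_fun measurableSet_Ioi fun t ht => ?_
    have ht0 : (t : ℂ) ≠ 0 := by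
      have : (1 : ℝ) < t := ht
      exact_mod_cast (by linarith : t ≠ 0)
    have : (t : ℂ) ^ (-s) = t * (t : ℂ) ^ (-(s + 1)) := by
      rw [show -s = 1 + (-(s + 1)) by ring, Complex.cpow_add _ _ ht0, Complex.cpow_one]
    simp only [sumRem]
    rw [this]
    ring
  rw [this, MeasureTheory.integral_const_mul, integral_Ioi_cpow_of_lt (by simpa using hs) one_pos]
  simp only [Complex.ofReal_one, Complex.one_cpow]
  have h5 : -s + 1 ≠ 0 := by
    intro h; apply hs0; linear_combination -h
  field_simp
  ring

/-! ### Twists of a nonnegative arithmetic function with a power-saving summatory function -/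

/-- `u` is a unimodular-or-zero multiplicative twist of `r` whose twisted summatory function
is `c t` up to `B t ^ (1 - δ)`. -/
structure IsTwist (r : ℕ → ℝ) (δ : ℝ) (u : ℕ →* ℂ) (c : ℂ) (B : ℝ) : Prop where
  norm_le : ∀ n, ‖u n‖ ≤ 1
  one_le : 1 ≤ B
  bound : ∀ t : ℝ, 1 ≤ t → ‖sumRem (fun n => u n * r n) c t‖ ≤ B * t ^ (1 - δ)

/-- A nonnegative arithmetic function whose summatory function is `κ t + O(t ^ (1 - δ))`. -/
structure TwistBase (r : ℕ → ℝ) (κ δ A₀ : ℝ) : Prop where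
  nonneg : ∀ n, 0 ≤ r n
  map_one : r 1 = 1
  δ_pos : 0 < δ
  δ_le : δ ≤ 1
  κ_pos : 0 < κ
  twist : IsTwist r δ 1 κ A₀

/-- The coefficients of the twisted Dirichlet series. -/
noncomputable def twCoeff (r : ℕ → ℝ) (u : ℕ →* ℂ) : ℕ → ℂ := fun n => u n * r n

section
variable {r : ℕ → ℝ} {κ δ A₀ : ℝ}

theorem IsTwist.bound' {u : ℕ →* ℂ} {c : ℂ} {B : ℝ} (h : IsTwist r δ u c B) (t : ℝ) (ht : 1 ≤ t) :
    ‖sumRem (twCoeff r u) c t‖ ≤ B * t ^ (1 - δ) := h.bound t ht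

theorem TwistBase.norm_sum_le (h : TwistBase r κ δ A₀) {t : ℝ} (ht : 1 ≤ t) :
    ∑ k ∈ Finset.Icc 1 ⌊t⌋₊, r k ≤ κ * t + A₀ * t ^ (1 - δ) := by
  have h1 := h.twist.bound t ht
  have h2 : sumRem (fun n => (1 : ℕ →* ℂ) n * r n) κ t
      = ((∑ k ∈ Finset.Icc 1 ⌊t⌋₊, r k - κ * t : ℝ) : ℂ) := by
    simp [sumRem]
  rw [h2, Complex.norm_real] at h1
  have := (le_abs_self _).trans h1
  linarith

theorem TwistBase.summable (h : TwistBase r κ δ A₀) {s : ℂ} (hs : 1 < s.re) :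
    LSeriesSummable (fun n => (r n : ℂ)) s := by
  refine LSeriesSummable_of_sum_norm_bigO_and_nonneg (r := 1) ?_ h.nonneg zero_le_one hs
  refine Asymptotics.IsBigO.of_bound (κ + A₀) ?_
  filter_upwards [Filter.eventually_ge_atTop 1] with n hn
  have hn' : (1 : ℝ) ≤ n := by exact_mod_cast hn
  have h1 := h.norm_sum_le hn'
  rw [Nat.floor_natCast] at h1
  rw [Real.norm_of_nonneg (Finset.sum_nonneg fun i _ => h.nonneg i), Real.rpow_one,
    Real.norm_of_nonneg (by positivity)]
  refine h1.trans ?_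
  have h2 : (n : ℝ) ^ (1 - δ) ≤ n := by
    calc (n : ℝ) ^ (1 - δ) ≤ (n : ℝ) ^ (1 : ℝ) :=
          Real.rpow_le_rpow_of_exponent_le hn' (by linarith [h.δ_pos])
      _ = n := Real.rpow_one _
  have h3 := h.twist.one_le
  nlinarith

theorem IsTwist.norm_twCoeff_le {u : ℕ →* ℂ} {c : ℂ} {B : ℝ}
    (h : IsTwist r δ u c B) (n : ℕ) : ‖twCoeff r u n‖ ≤ ‖((r n : ℝ) : ℂ)‖ := by
  rw [twCoeff, norm_mul]
  exact mul_le_of_le_one_left (norm_nonneg _) (h.norm_le n)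

theorem IsTwist.summable (hb : TwistBase r κ δ A₀) {u : ℕ →* ℂ} {c : ℂ} {B : ℝ}
    (h : IsTwist r δ u c B) {s : ℂ} (hs : 1 < s.re) : LSeriesSummable (twCoeff r u) s :=
  Summable.of_norm_bounded (hb.summable hs).norm fun n =>
    LSeries.norm_term_le s (h.norm_twCoeff_le n)

theorem IsTwist.norm_c_le (hb : TwistBase r κ δ A₀) {u : ℕ →* ℂ} {c : ℂ} {B : ℝ}
    (h : IsTwist r δ u c B) : ‖c‖ ≤ κ := by
  have key : ∀ t : ℝ, 1 ≤ t → ‖c‖ - κ ≤ (B + A₀) * t ^ (-δ) := by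
    intro t ht
    have ht0 : 0 < t := by linarith
    have h1 := h.bound t ht
    have h2 := hb.norm_sum_le ht
    have h3 : ‖c * (t : ℂ)‖ ≤ B * t ^ (1 - δ) + (κ * t + A₀ * t ^ (1 - δ)) := by
      calc ‖c * (t : ℂ)‖ = ‖∑ k ∈ Finset.Icc 1 ⌊t⌋₊, u k * (r k : ℂ)
              - sumRem (fun n => u n * r n) c t‖ := by simp [sumRem]
        _ ≤ ‖∑ k ∈ Finset.Icc 1 ⌊t⌋₊, u k * (r k : ℂ)‖ + _ := norm_sub_le _ _
        _ ≤ ∑ k ∈ Finset.Icc 1 ⌊t⌋₊, r k + B * t ^ (1 - δ) := by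
            gcongr
            refine norm_sum_le_of_le _ fun k _ => ?_
            have := h.norm_twCoeff_le k
            rwa [twCoeff, Complex.norm_real, Real.norm_of_nonneg (hb.nonneg k)] at this
        _ ≤ _ := by linarith
    rw [norm_mul, Complex.norm_real, Real.norm_of_nonneg ht0.le] at h3
    have h4 : t ^ (1 - δ) = t * t ^ (-δ) := by
      rw [sub_eq_add_neg, Real.rpow_add ht0, Real.rpow_one]
    rw [h4] at h3
    have : t * (‖c‖ - κ) ≤ t * ((B + A₀) * t ^ (-δ)) := by linarith
    exact le_of_mul_le_mul_left this ht0
  have hlim : Filter.Tendsto (fun t : ℝ => (B + A₀) * t ^ (-δ)) Filter.atTop (nhds ((B + A₀) * 0)) :=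
    (tendsto_rpow_neg_atTop hb.δ_pos).const_mul _
  rw [mul_zero] at hlim
  have := ge_of_tendsto hlim (Filter.eventually_atTop.mpr ⟨1, fun t ht => key t ht⟩)
  linarith

/-- The analytic part of the twisted Dirichlet series. -/
noncomputable def twRem (r : ℕ → ℝ) (u : ℕ →* ℂ) (c : ℂ) : ℂ → ℂ := remFun (twCoeff r u) c

theorem IsTwist.LSeries_eq (hb : TwistBase r κ δ A₀) {u : ℕ →* ℂ} {c : ℂ} {B : ℝ}
    (h : IsTwist r δ u c B) {s : ℂ} (hs : 1 < s.re) :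
    LSeries (twCoeff r u) s = c * (s / (s - 1)) + twRem r u c s :=
  LSeries_eq_add_remFun hb.δ_pos h.bound' hs (h.summable hb hs)

theorem IsTwist.differentiableAt {u : ℕ →* ℂ} {c : ℂ} {B : ℝ}
    (h : IsTwist r δ u c B) {s : ℂ} (hs : 1 - δ < s.re) : DifferentiableAt ℂ (twRem r u c) s :=
  differentiableAt_remFun h.bound' hs

theorem norm_LSeries_le_of_le {f : ℕ → ℂ} {g : ℕ → ℝ} (hfg : ∀ n, ‖f n‖ ≤ g n) {σ : ℝ} {s : ℂ}
    (hs : σ ≤ s.re) (hσ : LSeriesSummable (fun n => (g n : ℂ)) σ) :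
    ‖LSeries f s‖ ≤ ∑' n, ‖LSeries.term (fun n => (g n : ℂ)) σ n‖ := by
  have hle : ∀ n, ‖LSeries.term f s n‖ ≤ ‖LSeries.term (fun n => (g n : ℂ)) σ n‖ := by
    intro n
    refine (LSeries.norm_term_le_of_re_le_re f (s := (σ : ℂ)) (by simpa using hs) n).trans ?_
    refine LSeries.norm_term_le σ ?_
    rw [Complex.norm_real]
    exact (hfg n).trans (le_abs_self _)
  exact tsum_of_norm_bounded hσ.norm.hasSum hle

theorem IsTwist.norm_LSeries_le (hb : TwistBase r κ δ A₀) {u : ℕ →* ℂ} {c : ℂ} {B : ℝ}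
    (h : IsTwist r δ u c B) {σ : ℝ} (hσ : 1 < σ) {s : ℂ} (hs : σ ≤ s.re) :
    ‖LSeries (twCoeff r u) s‖ ≤ ∑' n, ‖LSeries.term (fun n => (r n : ℂ)) σ n‖ :=
  norm_LSeries_le_of_le (fun n => by
    have := h.norm_twCoeff_le n
    rwa [Complex.norm_real, Real.norm_of_nonneg (hb.nonneg n)] at this) hs
    (hb.summable (by simpa using hσ))

theorem norm_div_sub_one_le {σ : ℝ} (hσ : 1 < σ) {s : ℂ} (hs : σ ≤ s.re) :
    ‖s / (s - 1)‖ ≤ 1 + 1 / (σ - 1) := by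
  have h0 : σ - 1 ≤ ‖s - 1‖ := by
    refine le_trans ?_ (Complex.re_le_norm _)
    simpa using hs
  have h1 : s - 1 ≠ 0 := by
    rw [← norm_pos_iff]; linarith
  have : s / (s - 1) = 1 + 1 / (s - 1) := by field_simp; ring
  rw [this]
  refine (norm_add_le _ _).trans ?_
  rw [norm_one, norm_div, norm_one]
  gcongr

/-- Uniform bound of the analytic part right of the line `Re s = 1`. -/
theorem TwistBase.exists_norm_twRem_le_right (hb : TwistBase r κ δ A₀) {σ : ℝ} (hσ : 1 < σ) :
    ∃ D : ℝ, 1 ≤ D ∧ ∀ (u : ℕ →* ℂ) (c : ℂ) (B : ℝ), IsTwist r δ u c B →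
      ∀ s : ℂ, σ ≤ s.re → ‖twRem r u c s‖ ≤ D := by
  have hD0 : 0 ≤ ∑' n, ‖LSeries.term (fun n => (r n : ℂ)) σ n‖ := tsum_nonneg fun _ => norm_nonneg _
  have hκ := hb.κ_pos
  have hσ' : 0 < σ - 1 := by linarith
  refine ⟨1 + ∑' n, ‖LSeries.term (fun n => (r n : ℂ)) σ n‖ + κ * (1 + 1 / (σ - 1)), ?_, ?_⟩
  · have : 0 ≤ κ * (1 + 1 / (σ - 1)) := by positivity
    linarith
  intro u c B h s hs
  have h1 := h.LSeries_eq hb (s := s) (by linarith)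
  have h2 : twRem r u c s = LSeries (twCoeff r u) s - c * (s / (s - 1)) := by rw [h1]; ring
  rw [h2]
  refine (norm_sub_le _ _).trans ?_
  have h3 := h.norm_LSeries_le hb hσ hs
  have h4 : ‖c * (s / (s - 1))‖ ≤ κ * (1 + 1 / (σ - 1)) := by
    rw [norm_mul]
    exact mul_le_mul (h.norm_c_le hb) (norm_div_sub_one_le hσ hs) (norm_nonneg _) hκ.le
  linarith

theorem one_add_mul_exp_neg_sq_le (v : ℝ) : (1 + |v|) * Real.exp (-v ^ 2) ≤ 2 := by
  have h1 : (1 + |v|) ≤ 2 * (1 + v ^ 2) := by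
    nlinarith [sq_abs v, sq_nonneg (|v| - 1/2), abs_nonneg v]
  have h2 : 1 + v ^ 2 ≤ Real.exp (v ^ 2) := by linarith [Real.add_one_le_exp (v ^ 2)]
  have h3 : Real.exp (v ^ 2) * Real.exp (-v ^ 2) = 1 := by
    rw [← Real.exp_add]; simp
  have h4 := Real.exp_pos (-v ^ 2)
  nlinarith

/-- Convexity bound: close to the line `Re s = 1` the analytic part is at most an arbitrarily
small power of the conductor. -/
theorem TwistBase.exists_norm_twRem_le (hb : TwistBase r κ δ A₀) {ε : ℝ} (hε : 0 < ε) :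
    ∃ η D : ℝ, 0 < η ∧ 2 * η ≤ δ ∧ 1 ≤ D ∧ ∀ (u : ℕ →* ℂ) (c : ℂ) (B : ℝ), IsTwist r δ u c B →
      ∀ s : ℂ, 1 - η ≤ s.re → ‖twRem r u c s‖ ≤ D * (B * (2 + |s.im|)) ^ ε := by
  wlog hε1 : ε ≤ 1 generalizing ε
  · obtain ⟨η, D, h1, h2, h3, h4⟩ := this one_pos le_rfl
    refine ⟨η, D, h1, h2, h3, fun u c B h s hs => (h4 u c B h s hs).trans ?_⟩
    have := h.one_le
    gcongr
    · nlinarith [abs_nonneg s.im]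
    · linarith
  have hδ := hb.δ_pos
  have hδ1 := hb.δ_le
  set η := ε * δ / 4 with hη
  have hη0 : 0 < η := by positivity
  have hηδ : 4 * η ≤ δ := by
    have : ε * δ ≤ 1 * δ := by gcongr
    rw [hη]; linarith
  obtain ⟨D₂, hD₂, hD₂'⟩ := hb.exists_norm_twRem_le_right (σ := 1 + η) (by linarith)
  set C₁ : ℝ := 2 / δ * (2 * Real.exp 4) with hC₁
  have hE : 1 ≤ Real.exp 4 := Real.one_le_exp (by norm_num)
  have hC₁1 : 1 ≤ C₁ := by
    have : 1 ≤ 2 / δ := by rw [le_div_iff₀ hδ]; linarith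
    rw [hC₁]
    nlinarith
  refine ⟨η, C₁ ^ ε * (Real.exp 4 * D₂), hη0, by linarith, ?_, ?_⟩
  · have h1 := Real.one_le_rpow hC₁1 hε.le
    have h2 : 1 ≤ Real.exp 4 * D₂ := by nlinarith
    nlinarith
  intro u c B h s hs
  have hB := h.one_le
  have hX : 1 ≤ B * (2 + |s.im|) := by nlinarith [abs_nonneg s.im]
  have hXε : 1 ≤ (B * (2 + |s.im|)) ^ ε := Real.one_le_rpow hX hε.le
  have hCε : 1 ≤ C₁ ^ ε := Real.one_le_rpow hC₁1 hε.le
  by_cases hs1 : 1 + η ≤ s.re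
  · refine (hD₂' u c B h s hs1).trans ?_
    calc D₂ ≤ 1 * (1 * D₂) * 1 := by simp
      _ ≤ _ := by gcongr
  push Not at hs1
  set t₀ := s.im with ht₀
  set F : ℂ → ℂ := fun z => twRem r u c z * Complex.exp ((z - t₀ * Complex.I) ^ 2) with hF
  have hexp : ∀ z : ℂ, ‖Complex.exp ((z - t₀ * Complex.I) ^ 2)‖
      = Real.exp (z.re ^ 2) * Real.exp (-(z.im - t₀) ^ 2) := by
    intro z
    rw [Complex.norm_exp, ← Real.exp_add]
    congr 1
    simp [sq]
    ring
  set X := B * (2 + |t₀|) with hXdef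
  have hl : (1 - δ / 2 : ℝ) < 1 + η := by linarith
  have hre : ∀ z : ℂ, z ∈ Complex.HadamardThreeLines.verticalClosedStrip (1 - δ / 2) (1 + η) →
      Real.exp (z.re ^ 2) ≤ Real.exp 4 := by
    intro z hz
    have hz' : 1 - δ / 2 ≤ z.re ∧ z.re ≤ 1 + η := hz
    apply Real.exp_le_exp.mpr
    nlinarith [hz'.1, hz'.2]
  have hall : ∀ z : ℂ, z ∈ Complex.HadamardThreeLines.verticalClosedStrip (1 - δ / 2) (1 + η) →
      ‖F z‖ ≤ C₁ * X := by
    intro z hz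
    have hz' : 1 - δ / 2 ≤ z.re ∧ z.re ≤ 1 + η := hz
    rw [hF]
    simp only
    rw [norm_mul, hexp]
    have h1 : ‖twRem r u c z‖ ≤ ‖z‖ * (B / (z.re - 1 + δ)) :=
      norm_remFun_le h.bound' (by linarith)
    have h2 : B / (z.re - 1 + δ) ≤ 2 / δ * B := by
      rw [div_le_iff₀ (by linarith)]
      have : 1 ≤ 2 / δ * (z.re - 1 + δ) := by
        rw [div_mul_eq_mul_div, le_div_iff₀ hδ]; linarith
      nlinarith
    have h3 : ‖z‖ ≤ (2 + |t₀|) * (1 + |z.im - t₀|) := by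
      have a1 := Complex.norm_le_abs_re_add_abs_im z
      have a2 : |z.re| ≤ 2 := by rw [abs_le]; constructor <;> linarith
      have a3 : |z.im| ≤ |z.im - t₀| + |t₀| := by
        calc |z.im| = |(z.im - t₀) + t₀| := by ring_nf
          _ ≤ _ := abs_add_le _ _
      nlinarith [abs_nonneg t₀, abs_nonneg (z.im - t₀),
        mul_nonneg (abs_nonneg t₀) (abs_nonneg (z.im - t₀))]
    have h4 := hre z hz
    have h5 := one_add_mul_exp_neg_sq_le (z.im - t₀)
    calc ‖twRem r u c z‖ * (Real.exp (z.re ^ 2) * Real.exp (-(z.im - t₀) ^ 2))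
        ≤ ((2 + |t₀|) * (1 + |z.im - t₀|) * (2 / δ * B)) *
            (Real.exp 4 * Real.exp (-(z.im - t₀) ^ 2)) := by
          gcongr
          exact h1.trans (mul_le_mul h3 h2 (div_nonneg (by linarith) (by linarith))
            (by positivity))
      _ = (2 / δ * Real.exp 4 * X) * ((1 + |z.im - t₀|) * Real.exp (-(z.im - t₀) ^ 2)) := by
          rw [hXdef]; ring
      _ ≤ (2 / δ * Real.exp 4 * X) * 2 := by gcongr
      _ = C₁ * X := by rw [hC₁]; ring
  have hdiff : ∀ z : ℂ, 1 - δ / 2 ≤ z.re → DifferentiableAt ℂ F z := by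
    intro z hz
    refine (h.differentiableAt (by linarith)).mul ?_
    fun_prop
  have hdc : DiffContOnCl ℂ F (Complex.HadamardThreeLines.verticalStrip (1 - δ / 2) (1 + η)) := by
    refine DifferentiableOn.diffContOnCl fun z hz => (hdiff z ?_).differentiableWithinAt
    have hz2 : z ∈ Complex.re ⁻¹' Set.Ici (1 - δ / 2) := by
      refine closure_minimal ?_ (isClosed_Ici.preimage Complex.continuous_re) hz
      intro w hw
      exact (show 1 - δ / 2 < w.re from hw.1).le
    exact hz2
  have hsmem : s ∈ Complex.HadamardThreeLines.verticalClosedStrip (1 - δ / 2) (1 + η) :=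
    ⟨by linarith, hs1.le⟩
  have main := Complex.HadamardThreeLines.norm_le_interp_of_mem_verticalClosedStrip' hl hsmem hdc
    ⟨C₁ * X, by rintro _ ⟨z, hz, rfl⟩; exact hall z hz⟩ (a := C₁ * X) (b := Real.exp 4 * D₂)
    (fun z hz => hall z (by
      have : z.re = 1 - δ / 2 := hz
      exact ⟨this.ge, by linarith⟩))
    (fun z hz => by
      have hz1 : z.re = 1 + η := hz
      rw [hF]
      simp only
      rw [norm_mul, hexp, mul_comm]
      have b1 := hD₂' u c B h z hz1.ge
      have b2 := hre z ⟨by linarith, hz1.le⟩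
      have b3 : Real.exp (-(z.im - t₀) ^ 2) ≤ 1 := Real.exp_le_one_iff.mpr (by nlinarith [sq_nonneg (z.im - t₀)])
      have b4 := Real.exp_pos (z.re ^ 2)
      have b5 : Real.exp (z.re ^ 2) * Real.exp (-(z.im - t₀) ^ 2) ≤ Real.exp 4 * 1 := by gcongr
      rw [mul_one] at b5
      gcongr)
  have hFs : ‖twRem r u c s‖ ≤ ‖F s‖ := by
    rw [hF]
    simp only
    rw [norm_mul, hexp]
    have : 1 ≤ Real.exp (s.re ^ 2) * Real.exp (-(s.im - t₀) ^ 2) := by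
      rw [ht₀]; simp [sq_nonneg]
    exact le_mul_of_one_le_right (norm_nonneg _) this
  refine hFs.trans (main.trans ?_)
  have hCX : 1 ≤ C₁ * X := by nlinarith
  have hθ1 : 1 - (s.re - (1 - δ / 2)) / (1 + η - (1 - δ / 2)) ≤ ε := by
    rw [sub_le_iff_le_add, ← sub_le_iff_le_add', le_div_iff₀ (by linarith)]
    have : ε * δ = 4 * η := by rw [hη]; ring
    nlinarith
  have hθ2 : (s.re - (1 - δ / 2)) / (1 + η - (1 - δ / 2)) ≤ 1 := by
    rw [div_le_one (by linarith)]; linarith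
  have hED : 1 ≤ Real.exp 4 * D₂ := by nlinarith
  calc _ ≤ (C₁ * X) ^ ε * (Real.exp 4 * D₂) ^ (1 : ℝ) := by
        gcongr
    _ = _ := by
        rw [Real.rpow_one, Real.mul_rpow (by linarith) (by linarith)]; ring
end

/-! ### Logarithms of twisted Dirichlet series -/

/-- `b` is the von Mangoldt function attached to `r`. -/
structure IsMangoldt (r b : ℕ → ℝ) : Prop where
  nonneg : ∀ n, 0 ≤ b n
  conv : ∀ n, n ≠ 0 → ∑ p ∈ n.divisorsAntidiagonal, b p.1 * r p.2 = r n * Real.log n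

section
variable {r b : ℕ → ℝ} {κ δ A₀ : ℝ}

theorem IsMangoldt.one_eq (hm : IsMangoldt r b) (hb : TwistBase r κ δ A₀) : b 1 = 0 := by
  have := hm.conv 1 one_ne_zero
  simpa [hb.map_one] using this

theorem IsMangoldt.le (hm : IsMangoldt r b) (hb : TwistBase r κ δ A₀) {n : ℕ} (hn : n ≠ 0) :
    b n ≤ r n * Real.log n := by
  rw [← hm.conv n hn]
  have h1 : (n, 1) ∈ n.divisorsAntidiagonal := by simp [hn]
  have := Finset.single_le_sum (f := fun p : ℕ × ℕ => b p.1 * r p.2)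
    (fun p _ => mul_nonneg (hm.nonneg _) (hb.nonneg _)) h1
  simpa [hb.map_one] using this

/-- The coefficients of the logarithm of the Dirichlet series of `r`. -/
noncomputable def logCoeff (b : ℕ → ℝ) : ℕ → ℝ := fun n => b n / Real.log n

theorem IsMangoldt.logCoeff_nonneg (hm : IsMangoldt r b) (n : ℕ) : 0 ≤ logCoeff b n :=
  div_nonneg (hm.nonneg n) (Real.log_natCast_nonneg n)

theorem IsMangoldt.logCoeff_le (hm : IsMangoldt r b) (hb : TwistBase r κ δ A₀) {n : ℕ}
    (hn : n ≠ 0) : logCoeff b n ≤ r n := by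
  rcases Nat.lt_or_ge 1 n with h | h
  · have : 0 < Real.log n := Real.log_pos (by exact_mod_cast h)
    rw [logCoeff, div_le_iff₀ this]
    exact hm.le hb hn
  · have : n = 1 := by omega
    subst this
    simp [logCoeff, hb.nonneg]

theorem IsMangoldt.logCoeff_mul_log (hm : IsMangoldt r b) (hb : TwistBase r κ δ A₀) {n : ℕ}
    (hn : n ≠ 0) : Real.log n * logCoeff b n = b n := by
  rcases Nat.lt_or_ge 1 n with h | h
  · have : 0 < Real.log n := Real.log_pos (by exact_mod_cast h)
    rw [logCoeff]; field_simp
  · have : n = 1 := by omega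
    subst this
    simp [hm.one_eq hb]

theorem LSeriesSummable_of_le {f g : ℕ → ℂ} {s : ℂ} (hg : LSeriesSummable g s)
    (h : ∀ n, n ≠ 0 → ‖f n‖ ≤ ‖g n‖) : LSeriesSummable f s := by
  refine Summable.of_norm_bounded hg.norm fun n => ?_
  rcases eq_or_ne n 0 with rfl | hn
  · simp
  · exact LSeries.norm_term_le s (h n hn)

theorem norm_mul_ofReal_le {z : ℂ} (hz : ‖z‖ ≤ 1) {a a' : ℝ} (ha : 0 ≤ a) (haa : a ≤ a') :
    ‖z * (a : ℂ)‖ ≤ ‖((a' : ℝ) : ℂ)‖ := by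
  rw [norm_mul, Complex.norm_real, Complex.norm_real, Real.norm_of_nonneg ha,
    Real.norm_of_nonneg (ha.trans haa)]
  nlinarith [norm_nonneg z]

theorem TwistBase.summable_twCoeff (hb : TwistBase r κ δ A₀) {u : ℕ →* ℂ} (hu : ∀ n, ‖u n‖ ≤ 1)
    {s : ℂ} (hs : 1 < s.re) : LSeriesSummable (twCoeff r u) s :=
  LSeriesSummable_of_le (hb.summable hs) fun n _ => norm_mul_ofReal_le (hu n) (hb.nonneg n) le_rfl

theorem IsMangoldt.summable_logCoeff (hm : IsMangoldt r b) (hb : TwistBase r κ δ A₀) {u : ℕ →* ℂ}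
    (hu : ∀ n, ‖u n‖ ≤ 1) {s : ℂ} (hs : 1 < s.re) :
    LSeriesSummable (twCoeff (logCoeff b) u) s :=
  LSeriesSummable_of_le (hb.summable hs) fun n hn =>
    norm_mul_ofReal_le (hu n) (hm.logCoeff_nonneg n) (hm.logCoeff_le hb hn)

theorem abscissa_lt_of_forall {f : ℕ → ℂ} (h : ∀ s : ℂ, 1 < s.re → LSeriesSummable f s) {x : ℝ}
    (hx : 1 < x) : LSeries.abscissaOfAbsConv f < x := by
  have : LSeries.abscissaOfAbsConv f ≤ ((1 : ℝ) : EReal) :=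
    LSeries.abscissaOfAbsConv_le_of_forall_lt_LSeriesSummable fun y hy => h y (by simpa using hy)
  exact this.trans_lt (by exact_mod_cast hx)

theorem IsMangoldt.logMul_eq (hm : IsMangoldt r b) (hb : TwistBase r κ δ A₀) (u : ℕ →* ℂ) {n : ℕ}
    (hn : n ≠ 0) : LSeries.logMul (twCoeff (logCoeff b) u) n = twCoeff b u n := by
  rw [LSeries.logMul, twCoeff, twCoeff, ← hm.logCoeff_mul_log hb hn, ← Complex.ofReal_natCast,
    ← Complex.ofReal_log (Nat.cast_nonneg n)]
  push_cast
  ring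

theorem IsMangoldt.summable (hm : IsMangoldt r b) (hb : TwistBase r κ δ A₀) {u : ℕ →* ℂ}
    (hu : ∀ n, ‖u n‖ ≤ 1) {s : ℂ} (hs : 1 < s.re) : LSeriesSummable (twCoeff b u) s := by
  rw [← LSeriesSummable_congr s (fun hn => hm.logMul_eq hb u hn)]
  exact LSeriesSummable_logMul_of_lt_re
    (abscissa_lt_of_forall (fun s hs => hm.summable_logCoeff hb hu hs) hs)

theorem IsMangoldt.hasDerivAt_log (hm : IsMangoldt r b) (hb : TwistBase r κ δ A₀) {u : ℕ →* ℂ}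
    (hu : ∀ n, ‖u n‖ ≤ 1) {s : ℂ} (hs : 1 < s.re) :
    HasDerivAt (LSeries (twCoeff (logCoeff b) u)) (-LSeries (twCoeff b u) s) s := by
  have := LSeries_hasDerivAt
    (abscissa_lt_of_forall (fun s hs => hm.summable_logCoeff hb hu hs) hs)
  rwa [LSeries_congr (fun hn => hm.logMul_eq hb u hn)] at this

theorem IsMangoldt.hasDerivAt (hm : IsMangoldt r b) (hb : TwistBase r κ δ A₀) {u : ℕ →* ℂ}
    (hu : ∀ n, ‖u n‖ ≤ 1) {s : ℂ} (hs : 1 < s.re) :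
    HasDerivAt (LSeries (twCoeff r u))
      (-(LSeries (twCoeff b u) s * LSeries (twCoeff r u) s)) s := by
  have := LSeries_hasDerivAt (abscissa_lt_of_forall (fun s hs => hb.summable_twCoeff hu hs) hs)
  rw [← LSeries_convolution' (hm.summable hb hu hs) (hb.summable_twCoeff hu hs)]
  rwa [LSeries_congr (g := LSeries.convolution (twCoeff b u) (twCoeff r u))] at this
  intro n hn
  rw [LSeries.convolution_def]
  simp only [twCoeff, LSeries.logMul]
  have h1 : ∀ p ∈ n.divisorsAntidiagonal, u p.1 * (b p.1 : ℂ) * (u p.2 * (r p.2 : ℂ))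
      = u n * ((b p.1 * r p.2 : ℝ) : ℂ) := by
    intro p hp
    rw [← (Nat.mem_divisorsAntidiagonal.mp hp).1, map_mul]
    push_cast
    ring
  rw [Finset.sum_congr rfl h1, ← Finset.mul_sum, ← Complex.ofReal_sum, hm.conv n hn,
    ← Complex.ofReal_natCast, ← Complex.ofReal_log (Nat.cast_nonneg n)]
  push_cast
  ring

/-- The twisted Dirichlet series is the exponential of its logarithm. -/
theorem IsMangoldt.LSeries_eq_exp (hm : IsMangoldt r b) (hb : TwistBase r κ δ A₀) {u : ℕ →* ℂ}
    (hu : ∀ n, ‖u n‖ ≤ 1) {s : ℂ} (hs : 1 < s.re) :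
    LSeries (twCoeff r u) s = Complex.exp (LSeries (twCoeff (logCoeff b) u) s) := by
  set G : ℂ → ℂ := fun s => LSeries (twCoeff r u) s *
    Complex.exp (-LSeries (twCoeff (logCoeff b) u) s) with hG
  have hder : ∀ z : ℂ, 1 < z.re → HasDerivAt G 0 z := by
    intro z hz
    have := (hm.hasDerivAt hb hu hz).mul (hm.hasDerivAt_log hb hu hz).neg.cexp
    refine this.congr_deriv ?_
    simp only [Pi.neg_apply]
    ring
  have hopen : IsOpen {z : ℂ | 1 < z.re} := isOpen_lt continuous_const Complex.continuous_re
  have hconst : ∀ z : ℂ, 1 < z.re → G z = G s := fun z hz =>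
    hopen.is_const_of_deriv_eq_zero (convex_halfSpace_re_gt 1).isPreconnected
      (fun w hw => (hder w hw).differentiableAt.differentiableWithinAt)
      (fun w hw => (hder w hw).deriv) hz hs
  have h1 : Filter.Tendsto (fun x : ℝ => LSeries (twCoeff r u) x) Filter.atTop
      (nhds (twCoeff r u 1)) :=
    LSeries.tendsto_atTop ((abscissa_lt_of_forall
      (fun s hs => hb.summable_twCoeff hu hs) (x := 2) (by norm_num)).trans (EReal.coe_lt_top _))
  have h2 : Filter.Tendsto (fun x : ℝ => LSeries (twCoeff (logCoeff b) u) x) Filter.atTop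
      (nhds (twCoeff (logCoeff b) u 1)) :=
    LSeries.tendsto_atTop ((abscissa_lt_of_forall
      (fun s hs => hm.summable_logCoeff hb hu hs) (x := 2) (by norm_num)).trans (EReal.coe_lt_top _))
  have h3 : twCoeff r u 1 = 1 := by simp [twCoeff, hb.map_one]
  have h4 : twCoeff (logCoeff b) u 1 = 0 := by simp [twCoeff, logCoeff]
  rw [h3] at h1
  rw [h4] at h2
  have h5 : Filter.Tendsto (fun x : ℝ => G x) Filter.atTop (nhds (1 * Complex.exp (-0))) :=
    h1.mul ((Complex.continuous_exp.tendsto _).comp h2.neg)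
  have h6 : Filter.Tendsto (fun x : ℝ => G x) Filter.atTop (nhds (G s)) := by
    refine tendsto_const_nhds.congr' ?_
    filter_upwards [Filter.eventually_gt_atTop (1 : ℝ)] with x hx
    exact (hconst x (by simpa using hx)).symm
  have h7 : G s = 1 := by
    have := tendsto_nhds_unique h6 h5
    simpa using this
  rw [hG] at h7
  simp only at h7
  rw [Complex.exp_neg] at h7
  have h8 := Complex.exp_ne_zero (LSeries (twCoeff (logCoeff b) u) s)
  field_simp at h7
  exact h7

theorem IsMangoldt.log_deriv (hm : IsMangoldt r b) (hb : TwistBase r κ δ A₀) {u : ℕ →* ℂ}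
    (hu : ∀ n, ‖u n‖ ≤ 1) {s : ℂ} (hs : 1 < s.re) :
    LSeries (twCoeff b u) s = -(deriv (LSeries (twCoeff r u)) s / LSeries (twCoeff r u) s) := by
  rw [(hm.hasDerivAt hb hu hs).deriv]
  have : LSeries (twCoeff r u) s ≠ 0 := by
    rw [hm.LSeries_eq_exp hb hu hs]; exact Complex.exp_ne_zero _
  field_simp

theorem re_term_eq (a : ℕ → ℝ) (u : ℕ →* ℂ) (σ t : ℝ) (n : ℕ) (hn : n ≠ 0) :
    LSeries.term (twCoeff a u) (σ + t * Complex.I) n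
      = ((a n * (n : ℝ) ^ (-σ) : ℝ) : ℂ) * (u n * (n : ℂ) ^ (-(t * Complex.I))) := by
  rw [LSeries.term_of_ne_zero hn, twCoeff, div_eq_mul_inv, ← Complex.cpow_neg, neg_add,
    Complex.cpow_add _ _ (by exact_mod_cast hn), Complex.ofReal_mul,
    Complex.ofReal_cpow (Nat.cast_nonneg n)]
  push_cast
  ring

/-- The classical `3-4-1` inequality. -/
theorem IsMangoldt.one_le_three_four_one (hm : IsMangoldt r b) (hb : TwistBase r κ δ A₀)
    {u : ℕ →* ℂ} (hu : ∀ n, ‖u n‖ ≤ 1) {σ : ℝ} (hσ : 1 < σ) (t : ℝ) :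
    1 ≤ ‖LSeries (twCoeff r 1) σ‖ ^ 3 * ‖LSeries (twCoeff r u) (σ + t * Complex.I)‖ ^ 4 *
      ‖LSeries (twCoeff r (u ^ 2)) (σ + 2 * t * Complex.I)‖ := by
  have h1 : ∀ n, ‖(1 : ℕ →* ℂ) n‖ ≤ 1 := fun n => by simp
  have hu2 : ∀ n, ‖(u ^ 2) n‖ ≤ 1 := fun n => by
    rw [MonoidHom.pow_apply, norm_pow]; exact pow_le_one₀ (norm_nonneg _) (hu n)
  have e0 : (1 : ℝ) < ((σ : ℂ)).re := by simpa using hσ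
  have e1 : (1 : ℝ) < ((σ : ℂ) + t * Complex.I).re := by simpa using hσ
  have e2 : (1 : ℝ) < ((σ : ℂ) + 2 * t * Complex.I).re := by simpa using hσ
  rw [hm.LSeries_eq_exp hb h1 e0, hm.LSeries_eq_exp hb hu e1, hm.LSeries_eq_exp hb hu2 e2,
    Complex.norm_exp, Complex.norm_exp, Complex.norm_exp, ← Real.exp_nat_mul, ← Real.exp_nat_mul,
    ← Real.exp_add, ← Real.exp_add]
  apply Real.one_le_exp
  have s0 := Complex.hasSum_re (hm.summable_logCoeff hb h1 e0).hasSum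
  have s1 := Complex.hasSum_re (hm.summable_logCoeff hb hu e1).hasSum
  have s2 := Complex.hasSum_re (hm.summable_logCoeff hb hu2 e2).hasSum
  have s3 := ((s0.mul_left ((3 : ℕ) : ℝ)).add (s1.mul_left ((4 : ℕ) : ℝ))).add s2
  refine s3.nonneg fun n => ?_
  rcases eq_or_ne n 0 with rfl | hn
  · simp
  have t0 := re_term_eq (logCoeff b) 1 σ 0 n hn
  have t1 := re_term_eq (logCoeff b) u σ t n hn
  have t2 := re_term_eq (logCoeff b) (u ^ 2) σ (2 * t) n hn
  simp only [Complex.ofReal_zero, zero_mul, add_zero, neg_zero, Complex.cpow_zero, mul_one,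
    MonoidHom.one_apply] at t0
  set w := u n * (n : ℂ) ^ (-(t * Complex.I)) with hw
  have hw2 : (u ^ 2) n * (n : ℂ) ^ (-((2 * t : ℝ) * Complex.I)) = w ^ 2 := by
    rw [hw, mul_pow, MonoidHom.pow_apply, ← Complex.cpow_nat_mul]
    congr 2
    push_cast
    ring
  rw [hw2] at t2
  push_cast at t2
  rw [t0, t1, t2]
  have hwn : ‖w‖ ≤ 1 := by
    rw [hw, norm_mul, Complex.norm_natCast_cpow_of_pos (Nat.pos_of_ne_zero hn)]
    simpa using hu n
  have hA : 0 ≤ logCoeff b n * (n : ℝ) ^ (-σ) :=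
    mul_nonneg (hm.logCoeff_nonneg n) (Real.rpow_nonneg (Nat.cast_nonneg n) _)
  set A := logCoeff b n * (n : ℝ) ^ (-σ) with hAdef
  have hnorm : w.re ^ 2 + w.im ^ 2 ≤ 1 := by
    have : ‖w‖ ^ 2 ≤ 1 := pow_le_one₀ (norm_nonneg _) hwn
    rw [Complex.sq_norm, Complex.normSq_apply] at this
    nlinarith
  have hAA : ((logCoeff b n : ℝ) : ℂ) * (((n : ℝ) ^ (-σ) : ℝ) : ℂ) = (A : ℂ) := by
    rw [hAdef]; push_cast; ring
  rw [hAA, Complex.re_ofReal_mul, Complex.re_ofReal_mul, Complex.ofReal_re]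
  have hre : (w ^ 2).re = w.re ^ 2 - w.im ^ 2 := by simp [sq]
  rw [hre]
  push_cast
  nlinarith [mul_nonneg hA (sq_nonneg (w.re + 1)),
    mul_nonneg hA (by linarith : 0 ≤ 1 - (w.re ^ 2 + w.im ^ 2))]

/-- The trivial lower bound for a twisted Dirichlet series. -/
theorem IsMangoldt.one_le_mul_norm (hm : IsMangoldt r b) (hb : TwistBase r κ δ A₀)
    {u : ℕ →* ℂ} (hu : ∀ n, ‖u n‖ ≤ 1) {σ : ℝ} (hσ : 1 < σ) (t : ℝ) :
    1 ≤ ‖LSeries (twCoeff r 1) σ‖ * ‖LSeries (twCoeff r u) (σ + t * Complex.I)‖ := by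
  have h1 : ∀ n, ‖(1 : ℕ →* ℂ) n‖ ≤ 1 := fun n => by simp
  have e0 : (1 : ℝ) < ((σ : ℂ)).re := by simpa using hσ
  have e1 : (1 : ℝ) < ((σ : ℂ) + t * Complex.I).re := by simpa using hσ
  rw [hm.LSeries_eq_exp hb h1 e0, hm.LSeries_eq_exp hb hu e1,
    Complex.norm_exp, Complex.norm_exp, ← Real.exp_add]
  apply Real.one_le_exp
  have s0 := Complex.hasSum_re (hm.summable_logCoeff hb h1 e0).hasSum
  have s1 := Complex.hasSum_re (hm.summable_logCoeff hb hu e1).hasSum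
  refine (s0.add s1).nonneg fun n => ?_
  rcases eq_or_ne n 0 with rfl | hn
  · simp
  have t0 := re_term_eq (logCoeff b) 1 σ 0 n hn
  have t1 := re_term_eq (logCoeff b) u σ t n hn
  simp only [Complex.ofReal_zero, zero_mul, add_zero, neg_zero, Complex.cpow_zero, mul_one,
    MonoidHom.one_apply] at t0
  set w := u n * (n : ℂ) ^ (-(t * Complex.I)) with hw
  rw [t0, t1]
  have hwn : ‖w‖ ≤ 1 := by
    rw [hw, norm_mul, Complex.norm_natCast_cpow_of_pos (Nat.pos_of_ne_zero hn)]
    simpa using hu n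
  have hA : 0 ≤ logCoeff b n * (n : ℝ) ^ (-σ) :=
    mul_nonneg (hm.logCoeff_nonneg n) (Real.rpow_nonneg (Nat.cast_nonneg n) _)
  rw [Complex.re_ofReal_mul, Complex.ofReal_re]
  have := (abs_le.mp ((Complex.abs_re_le_norm w).trans hwn)).1
  nlinarith
end

/-! ### Derivative bounds and lower bounds -/

section
variable {r b : ℕ → ℝ} {κ δ A₀ : ℝ}

theorem one_le_cond {B : ℝ} (hB : 1 ≤ B) (t : ℝ) : 1 ≤ B * (2 + |t|) := by
  nlinarith [abs_nonneg t]

/-- Bounds for the analytic part and its derivative near the line `Re s = 1`. -/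
theorem TwistBase.exists_norm_deriv_twRem_le (hb : TwistBase r κ δ A₀) {ε : ℝ} (hε : 0 < ε) :
    ∃ η D : ℝ, 0 < η ∧ 2 * η ≤ δ ∧ 1 ≤ D ∧ ∀ (u : ℕ →* ℂ) (c : ℂ) (B : ℝ), IsTwist r δ u c B →
      ∀ s : ℂ, 1 - η ≤ s.re → ‖twRem r u c s‖ ≤ D * (B * (2 + |s.im|)) ^ ε ∧
        ‖deriv (twRem r u c) s‖ ≤ D * (B * (2 + |s.im|)) ^ ε := by
  obtain ⟨η, D, h1, h2, h3, h4⟩ := hb.exists_norm_twRem_le hε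
  have hδ1 := hb.δ_le
  have hDD : D ≤ D * 2 ^ ε / (η / 2) := by
    rw [le_div_iff₀ (by positivity)]
    have : 1 ≤ (2 : ℝ) ^ ε := Real.one_le_rpow (by norm_num) hε.le
    nlinarith
  refine ⟨η / 2, D * 2 ^ ε / (η / 2), by positivity, by linarith, h3.trans hDD, ?_⟩
  intro u c B h s hs
  have hX := one_le_cond h.one_le s.im
  refine ⟨(h4 u c B h s (by linarith)).trans ?_, ?_⟩
  · gcongr
  have key := Complex.norm_deriv_le_of_forall_mem_sphere_norm_le (f := twRem r u c) (c := s)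
    (R := η / 2) (C := D * 2 ^ ε * (B * (2 + |s.im|)) ^ ε) (by positivity) ?_ ?_
  · refine key.trans (le_of_eq ?_)
    ring
  · refine DifferentiableOn.diffContOnCl fun z hz => (h.differentiableAt ?_).differentiableWithinAt
    have hz' := Metric.closure_ball_subset_closedBall hz
    rw [Metric.mem_closedBall, dist_eq_norm] at hz'
    have := (abs_le.mp ((Complex.abs_re_le_norm (z - s)).trans hz')).1
    rw [Complex.sub_re] at this
    linarith
  · intro z hz
    rw [Metric.mem_sphere, dist_eq_norm] at hz
    have hz1 := (abs_le.mp ((Complex.abs_re_le_norm (z - s)).trans hz.le)).1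
    have hz2 := ((Complex.abs_im_le_norm (z - s)).trans hz.le)
    rw [Complex.sub_re] at hz1
    rw [Complex.sub_im] at hz2
    refine (h4 u c B h z (by linarith)).trans ?_
    rw [mul_assoc, ← Real.mul_rpow (by norm_num) (by linarith)]
    have h5 : |z.im| ≤ |z.im - s.im| + |s.im| := by
      calc |z.im| = |(z.im - s.im) + s.im| := by ring_nf
        _ ≤ _ := abs_add_le _ _
    have hB := h.one_le
    have h6 : B * (2 + |z.im|) ≤ 2 * (B * (2 + |s.im|)) := by
      nlinarith [abs_nonneg s.im, mul_nonneg (by linarith : 0 ≤ B) (abs_nonneg s.im)]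
    have := one_le_cond hB z.im
    gcongr

theorem TwistBase.exists_norm_LSeries_one_le (hb : TwistBase r κ δ A₀) :
    ∃ C : ℝ, 1 ≤ C ∧ ∀ σ : ℝ, 1 < σ → σ ≤ 2 →
      ‖LSeries (twCoeff r 1) σ‖ ≤ C / (σ - 1) := by
  have hδ := hb.δ_pos
  have hκ := hb.κ_pos
  have hA := hb.twist.one_le
  refine ⟨1 + 2 * κ + 2 * (A₀ / δ), ?_, ?_⟩
  · have : 0 ≤ A₀ / δ := by positivity
    linarith
  intro σ hσ hσ2
  have e0 : (1 : ℝ) < ((σ : ℂ)).re := by simpa using hσ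
  rw [hb.twist.LSeries_eq hb e0]
  have h1 : ‖twRem r 1 κ σ‖ ≤ ‖(σ : ℂ)‖ * (A₀ / ((σ : ℂ).re - 1 + δ)) :=
    norm_remFun_le hb.twist.bound' (by linarith)
  rw [Complex.norm_real, Complex.ofReal_re, Real.norm_of_nonneg (by linarith)] at h1
  have h2 : A₀ / (σ - 1 + δ) ≤ A₀ / δ := by gcongr; linarith
  have h3 := norm_div_sub_one_le hσ (s := (σ : ℂ)) (by simp)
  refine (norm_add_le _ _).trans ?_
  rw [norm_mul, Complex.norm_real, Real.norm_of_nonneg hκ.le]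
  have hs : 0 < σ - 1 := by linarith
  have h4 : 1 ≤ 1 / (σ - 1) := by rw [le_div_iff₀ hs]; linarith
  have h5 : 0 ≤ A₀ / δ := by positivity
  have h6 : ‖twRem r 1 κ σ‖ ≤ 2 * (A₀ / δ) := by
    refine h1.trans ?_
    exact mul_le_mul hσ2 h2 (by positivity) (by norm_num)
  calc κ * ‖(σ : ℂ) / (σ - 1)‖ + ‖twRem r 1 κ σ‖
      ≤ κ * (1 + 1 / (σ - 1)) + 2 * (A₀ / δ) := by gcongr
    _ ≤ (1 + 2 * κ + 2 * (A₀ / δ)) * (1 / (σ - 1)) := by nlinarith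
    _ = _ := by ring

theorem norm_div_sub_one_le_of_im {τ : ℝ} (hτ : 0 < τ) (hτ1 : τ ≤ 1) {s : ℂ} (hs : τ ≤ |s.im|) :
    ‖s / (s - 1)‖ ≤ 2 / τ := by
  have h0 : τ ≤ ‖s - 1‖ := by
    refine hs.trans (le_trans (le_of_eq ?_) (Complex.abs_im_le_norm _))
    simp
  have h1 : s - 1 ≠ 0 := by
    rw [← norm_pos_iff]; linarith
  have : s / (s - 1) = 1 + 1 / (s - 1) := by field_simp; ring
  rw [this]
  refine (norm_add_le _ _).trans ?_
  rw [norm_one, norm_div, norm_one]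
  have h2 : 1 / ‖s - 1‖ ≤ 1 / τ := by gcongr
  have h3 : 1 ≤ 1 / τ := by rw [le_div_iff₀ hτ]; linarith
  calc 1 + 1 / ‖s - 1‖ ≤ 1 / τ + 1 / τ := by gcongr
    _ = _ := by ring

/-- Lower bound for twisted Dirichlet series away from possible poles and exceptional zeros. -/
theorem IsMangoldt.exists_norm_LSeries_ge (hm : IsMangoldt r b) (hb : TwistBase r κ δ A₀)
    {ε : ℝ} (hε : 0 < ε) :
    ∃ c₀ : ℝ, 0 < c₀ ∧ ∀ (u : ℕ →* ℂ) (c c₂ : ℂ) (B : ℝ), IsTwist r δ u c B →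
      IsTwist r δ (u ^ 2) c₂ B → ∀ σ t τ : ℝ, 1 < σ → σ ≤ 2 → 0 < τ → τ ≤ 1 →
      (c = 0 ∨ τ ≤ |t|) → (c₂ = 0 ∨ τ ≤ |t|) →
      c₀ / ((B * (2 + |t|)) ^ ε / τ) ^ 7 ≤ ‖LSeries (twCoeff r u) (σ + t * Complex.I)‖ := by
  obtain ⟨η, D, hη, hηδ, hD, hH⟩ := hb.exists_norm_deriv_twRem_le hε
  obtain ⟨Cz, hCz, hZ⟩ := hb.exists_norm_LSeries_one_le
  have hκ := hb.κ_pos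
  set D' := κ + D with hD'
  have hD'1 : 1 ≤ D' := by linarith
  have h2ε : 1 ≤ (2 : ℝ) ^ ε := Real.one_le_rpow (by norm_num) hε.le
  set C₂ := 2 * κ + D * 2 ^ ε with hC₂
  have hC₂1 : 1 ≤ C₂ := by nlinarith
  set Γ := Cz ^ 3 * C₂ with hΓ
  have hΓ1 : 1 ≤ Γ := one_le_mul_of_one_le_of_one_le (one_le_pow₀ hCz) hC₂1
  set α := 1 / (2 * Γ * D') with hα
  have hα0 : 0 < α := by positivity
  have hα1 : α ≤ 1 := by
    rw [hα, div_le_one (by positivity)]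
    nlinarith
  refine ⟨α ^ 3 / (2 * Γ), by positivity, ?_⟩
  intro u c c₂ B h h2 σ t τ hσ hσ2 hτ hτ1 hc hc₂
  have hX := one_le_cond h.one_le t
  set X := (B * (2 + |t|)) ^ ε with hXdef
  have hX1 : 1 ≤ X := Real.one_le_rpow hX hε.le
  set Y := X / τ with hY
  have hτ' : 1 ≤ 1 / τ := by rw [le_div_iff₀ hτ]; linarith
  have hXY : X ≤ Y := by
    rw [hY, le_div_iff₀ hτ]; nlinarith
  have hY1 : 1 ≤ Y := hX1.trans hXY
  have hτY : 1 / τ ≤ Y := by rw [hY]; gcongr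
  have hY0 : 0 < Y := by linarith
  set x₀ := α ^ 4 / Y ^ 9 with hx₀
  have hx₀0 : 0 < x₀ := by positivity
  have hx₀1 : x₀ ≤ 1 := by
    rw [hx₀, div_le_one (by positivity)]
    exact (pow_le_one₀ hα0.le hα1).trans (one_le_pow₀ hY1)
  set σ₁ := max σ (1 + x₀) with hσ₁
  have hσ₁1 : 1 + x₀ ≤ σ₁ := le_max_right _ _
  have hσ₁2 : σ₁ ≤ 2 := max_le hσ2 (by linarith)
  have hσ₁σ : σ ≤ σ₁ := le_max_left _ _
  have h3 := hm.one_le_three_four_one hb h.norm_le (σ := σ₁) (by linarith) t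
  have h4 := hZ σ₁ (by linarith) hσ₁2
  -- the bound for the square of the twist
  have h5 : ‖LSeries (twCoeff r (u ^ 2)) (σ₁ + 2 * t * Complex.I)‖ ≤ C₂ * Y := by
    have him : ((σ₁ : ℂ) + 2 * t * Complex.I).im = 2 * t := by simp
    have hre : ((σ₁ : ℂ) + 2 * t * Complex.I).re = σ₁ := by simp
    rw [h2.LSeries_eq hb (by rw [hre]; linarith)]
    refine (norm_add_le _ _).trans ?_
    have a1 : ‖c₂ * (((σ₁ : ℂ) + 2 * t * Complex.I) / ((σ₁ : ℂ) + 2 * t * Complex.I - 1))‖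
        ≤ 2 * κ * Y := by
      rcases hc₂ with hc₂ | hc₂
      · rw [hc₂, zero_mul, norm_zero]; positivity
      · rw [norm_mul]
        have := norm_div_sub_one_le_of_im hτ hτ1 (s := (σ₁ : ℂ) + 2 * t * Complex.I)
          (by rw [him, abs_mul, abs_two]; linarith [abs_nonneg t])
        calc _ ≤ κ * (2 / τ) := mul_le_mul (h2.norm_c_le hb) this (norm_nonneg _) hκ.le
          _ = 2 * κ * (1 / τ) := by ring
          _ ≤ _ := by gcongr
    have a2 := (hH _ _ _ h2 ((σ₁ : ℂ) + 2 * t * Complex.I) (by rw [hre]; linarith)).1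
    rw [him] at a2
    have a3 : (B * (2 + |2 * t|)) ^ ε ≤ 2 ^ ε * X := by
      rw [hXdef, ← Real.mul_rpow (by norm_num) (by linarith)]
      have := one_le_cond h.one_le (2 * t)
      refine Real.rpow_le_rpow (by linarith) ?_ hε.le
      rw [abs_mul, abs_two]
      nlinarith [h.one_le]
    calc _ ≤ 2 * κ * Y + D * (2 ^ ε * X) := by gcongr; exact a2.trans (by gcongr)
      _ ≤ 2 * κ * Y + D * (2 ^ ε * Y) := by gcongr
      _ = _ := by rw [hC₂]; ring
  set v := ‖LSeries (twCoeff r u) (σ₁ + t * Complex.I)‖ with hv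
  have hv0 : 0 ≤ v := norm_nonneg _
  have hw : α ^ 3 / (Γ * Y ^ 7) ≤ v := by
    rw [← pow_le_pow_iff_left₀ (by positivity) hv0 (n := 4) (by norm_num)]
    have hx : 0 < σ₁ - 1 := by linarith
    have b1 : 1 ≤ (Cz / (σ₁ - 1)) ^ 3 * v ^ 4 * (C₂ * Y) := by
      refine h3.trans ?_
      gcongr
    have b2 : (σ₁ - 1) ^ 3 ≤ Γ * Y * v ^ 4 := by
      have : (σ₁ - 1) ^ 3 * 1 ≤ (σ₁ - 1) ^ 3 * ((Cz / (σ₁ - 1)) ^ 3 * v ^ 4 * (C₂ * Y)) := by gcongr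
      rw [mul_one] at this
      refine this.trans (le_of_eq ?_)
      rw [hΓ]; field_simp
    have b3 : x₀ ^ 3 ≤ (σ₁ - 1) ^ 3 := by gcongr; linarith
    have b4 : x₀ ^ 3 ≤ Γ ^ 4 * Y * v ^ 4 := by
      refine b3.trans (b2.trans ?_)
      gcongr
      exact le_self_pow₀ hΓ1 (by norm_num)
    rw [div_pow, div_le_iff₀ (by positivity)]
    have b5 : x₀ ^ 3 * Y ^ 27 = (α ^ 3) ^ 4 := by rw [hx₀]; field_simp
    rw [← b5]
    calc x₀ ^ 3 * Y ^ 27 ≤ Γ ^ 4 * Y * v ^ 4 * Y ^ 27 := by gcongr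
      _ = _ := by ring
  have hfin : α ^ 3 / (2 * Γ) / Y ^ 7 = α ^ 3 / (Γ * Y ^ 7) / 2 := by field_simp
  rw [hfin]
  rcases le_total (1 + x₀) σ with hcase | hcase
  · have : σ₁ = σ := max_eq_left hcase
    rw [← this]
    have : 0 ≤ α ^ 3 / (Γ * Y ^ 7) := by positivity
    linarith
  have hσ₁e : σ₁ = 1 + x₀ := max_eq_right hcase
  have hdiff : ‖LSeries (twCoeff r u) (σ₁ + t * Complex.I)
      - LSeries (twCoeff r u) (σ + t * Complex.I)‖
      ≤ D' * Y ^ 2 * ‖((σ₁ : ℂ) + t * Complex.I) - (σ + t * Complex.I)‖ := by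
    set S : Set ℂ := {z | 1 < z.re} ∩ {z | z.im = t} with hS
    have hcs : Convex ℝ S := (convex_halfSpace_re_gt 1).inter (convex_hyperplane
      (f := Complex.im) ⟨fun _ _ => rfl, fun c x => by simp⟩ t)
    have hev : ∀ z : ℂ, 1 < z.re → LSeries (twCoeff r u) =ᶠ[nhds z]
        fun z => c * (z / (z - 1)) + twRem r u c z := by
      intro z hz
      filter_upwards [(isOpen_lt continuous_const Complex.continuous_re).mem_nhds hz] with w hw
      exact h.LSeries_eq hb hw
    have hhas : ∀ z : ℂ, 1 < z.re → HasDerivAt (LSeries (twCoeff r u))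
        (c * (-1 / (z - 1) ^ 2) + deriv (twRem r u c) z) z := by
      intro z hz
      have hz1 : z - 1 ≠ 0 := by
        intro hh
        rw [sub_eq_zero] at hh
        simp [hh] at hz
      have hd1 : HasDerivAt (fun z : ℂ => z / (z - 1)) (-1 / (z - 1) ^ 2) z := by
        have := (hasDerivAt_id z).div ((hasDerivAt_id z).sub_const 1) hz1
        refine this.congr_deriv ?_
        simp only [id]
        ring
      have := (hd1.const_mul c).add
        (h.differentiableAt (s := z) (by linarith [hb.δ_pos])).hasDerivAt
      exact this.congr_of_eventuallyEq (hev z hz)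
    refine hcs.norm_image_sub_le_of_norm_deriv_le (fun z hz => (hhas z hz.1).differentiableAt)
      (fun z hz => ?_) ⟨by simpa using hσ, by simp⟩ ⟨by simp; linarith, by simp⟩
    have hz1 : 1 < z.re := hz.1
    have hz2 : z.im = t := hz.2
    rw [(hhas z hz.1).deriv]
    refine (norm_add_le _ _).trans ?_
    have a2 := (hH _ _ _ h z (by linarith)).2
    rw [hz2] at a2
    have a1 : ‖c * (-1 / (z - 1) ^ 2)‖ ≤ κ * Y ^ 2 := by
      rcases hc with hc | hc
      · rw [hc, zero_mul, norm_zero]; positivity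
      · have h0 : τ ≤ ‖z - 1‖ := by
          refine hc.trans (le_trans (le_of_eq ?_) (Complex.abs_im_le_norm _))
          simp [hz2]
        rw [norm_mul, norm_div, norm_neg, norm_one, norm_pow]
        have : 1 / ‖z - 1‖ ^ 2 ≤ Y ^ 2 := by
          calc 1 / ‖z - 1‖ ^ 2 ≤ 1 / τ ^ 2 := by gcongr
            _ = (1 / τ) ^ 2 := by rw [div_pow, one_pow]
            _ ≤ _ := by gcongr
        exact mul_le_mul (h.norm_c_le hb) this (by positivity) hκ.le
    have a3 : X ≤ Y ^ 2 := hXY.trans (le_self_pow₀ hY1 (by norm_num))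
    calc _ ≤ κ * Y ^ 2 + D * Y ^ 2 := by gcongr; exact a2.trans (by gcongr)
      _ = _ := by rw [hD']; ring
  have hn : ‖((σ₁ : ℂ) + t * Complex.I) - (σ + t * Complex.I)‖ ≤ x₀ := by
    rw [add_sub_add_right_eq_sub, ← Complex.ofReal_sub, Complex.norm_real,
      Real.norm_of_nonneg (by linarith)]
    linarith
  have hd2 : D' * Y ^ 2 * x₀ ≤ α ^ 3 / (Γ * Y ^ 7) / 2 := by
    apply le_of_eq
    have : D' * α = 1 / (2 * Γ) := by rw [hα]; field_simp
    calc D' * Y ^ 2 * x₀ = (D' * α) * α ^ 3 / Y ^ 7 := by rw [hx₀]; field_simp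
      _ = _ := by rw [this]; field_simp
  have hd3 : ‖LSeries (twCoeff r u) (σ₁ + t * Complex.I)
      - LSeries (twCoeff r u) (σ + t * Complex.I)‖ ≤ α ^ 3 / (Γ * Y ^ 7) / 2 := by
    refine hdiff.trans (le_trans ?_ hd2)
    gcongr
  have hd4 := norm_sub_norm_le (LSeries (twCoeff r u) (σ₁ + t * Complex.I))
    (LSeries (twCoeff r u) (σ + t * Complex.I))
  linarith
end

/-! ### Estermann's lower bound for residues -/

open scoped ComplexOrder in
/-- A Dirichlet series with nonnegative coefficients and a simple pole at `1` which is not positive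
at a point `β < 1` has a residue that is not too small. -/
theorem residue_ge_of_nonpos {a : ℕ → ℂ} (ha : 0 ≤ a) (ha1 : 1 ≤ (a 1).re)
    (hs : ∀ s : ℂ, 1 < s.re → LSeriesSummable a s) {g : ℂ → ℂ} {lam η M β : ℝ} (hη : 0 < η)
    (hg : ∀ s ∈ Metric.closedBall (2 : ℂ) (1 + η), DifferentiableAt ℂ g s)
    (hF : ∀ s : ℂ, 1 < s.re → LSeries a s = g s + lam * (s - 1)⁻¹)
    (hM : ∀ s ∈ Metric.closedBall (2 : ℂ) (1 + η), ‖g s‖ ≤ M)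
    (hβ : 1 - η / 2 ≤ β) (hβ1 : β < 1) (hneg : (g β).re ≤ lam / (1 - β)) {N : ℕ} (hN1 : 1 ≤ N)
    (hN : M * (((1 + η / 2) / (1 + η)) ^ N * (1 - (1 + η / 2) / (1 + η))⁻¹) ≤ 1 / 2) :
    (1 - β) / 2 * Real.exp (-((1 - β) * N)) ≤ lam := by
  have hM0 : 0 ≤ M := (norm_nonneg _).trans (hM 2 (by simp; linarith))
  have hR : 0 < 1 + η := by linarith
  set ρ := (1 + η / 2) / (1 + η) with hρ
  have hρ0 : 0 < ρ := by positivity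
  have hρ1 : ρ < 1 := by rw [hρ, div_lt_one hR]; linarith
  have habs : LSeries.abscissaOfAbsConv a < (2 : ℝ) := abscissa_lt_of_forall hs (by norm_num)
  set d : ℕ → ℂ := fun m => (m.factorial : ℂ)⁻¹ * ((-1) ^ m * iteratedDeriv m g 2) with hd
  have hdiffOn : DifferentiableOn ℂ g (Metric.ball 2 (1 + η)) := fun z hz =>
    (hg z (Metric.ball_subset_closedBall hz)).differentiableWithinAt
  have hdc : DiffContOnCl ℂ g (Metric.ball 2 (1 + η)) := by
    refine DifferentiableOn.diffContOnCl fun z hz => (hg z ?_).differentiableWithinAt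
    exact Metric.closure_ball_subset_closedBall hz
  -- upper bounds
  have hdub : ∀ m, ‖d m‖ ≤ M / (1 + η) ^ m := by
    intro m
    have h1 := Complex.norm_iteratedDeriv_le_of_forall_mem_sphere_norm_le m hR hdc
      (fun z hz => hM z (Metric.sphere_subset_closedBall hz))
    simp only [hd]
    rw [norm_mul, norm_mul, norm_pow, norm_neg, norm_one, one_pow, one_mul, norm_inv,
      Complex.norm_natCast]
    have hf : (0 : ℝ) < m.factorial := by exact_mod_cast m.factorial_pos
    calc (m.factorial : ℝ)⁻¹ * ‖iteratedDeriv m g 2‖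
        ≤ (m.factorial : ℝ)⁻¹ * (m.factorial * M / (1 + η) ^ m) := by gcongr
      _ = _ := by field_simp
  -- lower bounds
  have hiter : ∀ m, iteratedDeriv m (LSeries a) 2
      = iteratedDeriv m g 2 + lam * ((-1) ^ m * m.factorial) := by
    intro m
    have hev : LSeries a =ᶠ[nhds 2] fun s => g s + (lam : ℂ) * (s - 1)⁻¹ := by
      filter_upwards [(isOpen_lt continuous_const Complex.continuous_re).mem_nhds
        (show (1 : ℝ) < (2 : ℂ).re by simp)] with w hw
      exact hF w hw
    rw [hev.iteratedDeriv_eq m]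
    have hga : AnalyticAt ℂ g 2 :=
      hdiffOn.analyticAt (Metric.isOpen_ball.mem_nhds (Metric.mem_ball_self hR))
    have hia : AnalyticAt ℂ (fun s : ℂ => (s - 1)⁻¹) 2 :=
      (analyticAt_id.sub analyticAt_const).inv (by norm_num)
    have hia2 : AnalyticAt ℂ (fun s : ℂ => (lam : ℂ) * (s - 1)⁻¹) 2 := analyticAt_const.mul hia
    rw [iteratedDeriv_fun_add hga.contDiffAt hia2.contDiffAt,
      iteratedDeriv_const_mul _ hia.contDiffAt]
    congr 2
    have := iter_deriv_inv_linear_sub m (1 : ℂ) 1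
    simp only [one_mul, one_pow, mul_one] at this
    rw [iteratedDeriv_eq_iterate, this]
    norm_num
  have hdeq : ∀ m, d m = (m.factorial : ℂ)⁻¹ * ((-1) ^ m * iteratedDeriv m (LSeries a) 2) - lam := by
    intro m
    have hf : (m.factorial : ℂ) ≠ 0 := by exact_mod_cast m.factorial_ne_zero
    have hsq : ((-1 : ℂ) ^ m) * (-1) ^ m = 1 := by rw [← mul_pow]; simp
    simp only [hd]
    rw [hiter m]
    field_simp
    linear_combination (-(lam : ℂ) * m.factorial) * hsq
  have hdlb : ∀ m, -lam ≤ (d m).re := by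
    intro m
    have h1 := LSeries.iteratedDeriv_alternating ha habs m
    rw [Complex.le_def] at h1
    have h2 := h1.1
    rw [hdeq m]
    have h3 : ((m.factorial : ℂ)⁻¹) = (((m.factorial : ℝ)⁻¹ : ℝ) : ℂ) := by push_cast; rfl
    rw [h3, Complex.sub_re, Complex.re_ofReal_mul, Complex.ofReal_re]
    have h4 : 0 ≤ (m.factorial : ℝ)⁻¹ := by positivity
    have := mul_nonneg h4 h2
    simp only [Complex.ofReal_ofNat] at this
    linarith
  have hd0 : 1 - lam ≤ (d 0).re := by
    rw [hdeq 0]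
    simp only [Nat.factorial_zero, Nat.cast_one, inv_one, pow_zero, one_mul, iteratedDeriv_zero,
      Complex.sub_re, Complex.ofReal_re]
    have h1 := Complex.hasSum_re (hs 2 (by simp)).hasSum
    have h2 := le_hasSum h1 1 (fun n _ => by
      have h3 := LSeries.term_nonneg (ha n) 2
      rw [Complex.le_def] at h3
      simpa using h3.1)
    have h4 : LSeries.term a 2 1 = a 1 := by simp [LSeries.term]
    rw [h4] at h2
    have h5 : LSeries a 2 = ∑' n, LSeries.term a 2 n := rfl
    rw [h5]
    linarith
  -- the Taylor expansion at `β`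
  have h2β : 1 < 2 - β := by linarith
  have hβmem : (β : ℂ) ∈ Metric.ball (2 : ℂ) (1 + η) := by
    rw [Metric.mem_ball, dist_eq_norm, show (β : ℂ) - 2 = ((β - 2 : ℝ) : ℂ) by push_cast; ring,
      Complex.norm_real, Real.norm_eq_abs, abs_of_neg (by linarith)]
    linarith
  have hT := Complex.hasSum_taylorSeries_on_ball hdiffOn hβmem
  have hT' : HasSum (fun m => (d m).re * (2 - β) ^ m) (g β).re := by
    have := Complex.hasSum_re hT
    convert this using 2 with m
    have h1 : (m.factorial : ℂ)⁻¹ • ((β : ℂ) - 2) ^ m • iteratedDeriv m g 2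
        = (((2 - β) ^ m : ℝ) : ℂ) * d m := by
      have : ((β : ℂ) - 2) ^ m = (-1) ^ m * (((2 - β) ^ m : ℝ) : ℂ) := by
        push_cast
        rw [← mul_pow]
        ring
      simp only [hd, smul_eq_mul]
      rw [this]
      ring
    rw [h1, Complex.re_ofReal_mul, mul_comm]
  set f : ℕ → ℝ := fun m => (d m).re * (2 - β) ^ m with hf
  have hsplit := hT'.summable.sum_add_tsum_nat_add N
  rw [hT'.tsum_eq] at hsplit
  have hgeo : HasSum (fun m => -(M * ρ ^ N) * ρ ^ m) (-(M * ρ ^ N) * (1 - ρ)⁻¹) :=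
    (hasSum_geometric_of_lt_one hρ0.le hρ1).mul_left _
  have htail : -(1 / 2 : ℝ) ≤ ∑' m, f (m + N) := by
    refine le_trans (b := -(M * ρ ^ N) * (1 - ρ)⁻¹) (by linarith) ?_
    refine hasSum_le (fun m => ?_) hgeo ((summable_nat_add_iff N).mpr hT'.summable).hasSum
    have h1 := (abs_le.mp ((Complex.abs_re_le_norm (d (m + N))).trans (hdub (m + N)))).1
    have h2 : M / (1 + η) ^ (m + N) * (2 - β) ^ (m + N) ≤ M * ρ ^ (m + N) := by
      rw [div_mul_eq_mul_div, mul_div_assoc, ← div_pow]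
      gcongr
      rw [hρ]
      gcongr
      linarith
    have h3 : 0 ≤ (2 - β) ^ (m + N) := by positivity
    have h4 : -(M * ρ ^ N) * ρ ^ m = -(M * ρ ^ (m + N)) := by rw [pow_add]; ring
    rw [h4, hf]
    nlinarith
  have hfin : 1 - lam * ∑ m ∈ Finset.range N, (2 - β) ^ m ≤ ∑ m ∈ Finset.range N, f m := by
    have h1 : ∀ m ∈ Finset.range N, (if m = 0 then 1 else 0) - lam * (2 - β) ^ m ≤ f m := by
      intro m _
      split_ifs with h
      · subst h
        simpa [hf] using hd0
      · have h3 : 0 ≤ (2 - β) ^ m := by positivity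
        have := mul_le_mul_of_nonneg_right (hdlb m) h3
        simp only [hf]
        linarith
    have h2 := Finset.sum_le_sum h1
    rw [Finset.sum_sub_distrib, ← Finset.mul_sum, Finset.sum_ite_eq' (Finset.range N) 0] at h2
    rwa [if_pos (Finset.mem_range.mpr (by omega))] at h2
  rw [geom_sum_eq (by linarith)] at hfin
  have h1β : 0 < 1 - β := by linarith
  have hkey : 1 / 2 ≤ lam * (2 - β) ^ N / (1 - β) := by
    have e1 : lam * (((2 - β) ^ N - 1) / (2 - β - 1)) = lam * (2 - β) ^ N / (1 - β) - lam / (1 - β) := by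
      rw [show 2 - β - 1 = 1 - β by ring]
      field_simp
    linarith
  rw [le_div_iff₀ h1β] at hkey
  have hpos : 0 < (2 - β) ^ N := by positivity
  have hlam : 0 < lam := by
    by_contra hcon
    push Not at hcon
    have := mul_nonpos_of_nonpos_of_nonneg hcon hpos.le
    linarith
  have hexp : (2 - β) ^ N ≤ Real.exp ((1 - β) * N) := by
    rw [mul_comm, Real.exp_nat_mul]
    gcongr
    linarith [Real.add_one_le_exp (1 - β)]
  have h6 : (1 - β) / 2 ≤ lam * Real.exp ((1 - β) * N) := by
    have := mul_le_mul_of_nonneg_left hexp hlam.le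
    linarith
  calc (1 - β) / 2 * Real.exp (-((1 - β) * N))
      ≤ lam * Real.exp ((1 - β) * N) * Real.exp (-((1 - β) * N)) := by gcongr
    _ = lam := by rw [mul_assoc, ← Real.exp_add]; simp

/-! ### Nonnegativity of products of quadratic twists -/

/-- The twisted coefficients as an arithmetic function. -/
noncomputable def twAF (r : ℕ → ℝ) (u : ℕ →* ℂ) : ArithmeticFunction ℂ :=
  ⟨fun n => if n = 0 then 0 else u n * r n, if_pos rfl⟩

theorem twAF_apply (r : ℕ → ℝ) (u : ℕ →* ℂ) {n : ℕ} (hn : n ≠ 0) : twAF r u n = u n * r n :=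
  if_neg hn

theorem LSeries_twAF (r : ℕ → ℝ) (u : ℕ →* ℂ) (s : ℂ) :
    LSeries (twAF r u) s = LSeries (twCoeff r u) s :=
  LSeries_congr (fun {n} hn => by rw [twAF_apply r u hn]; rfl) s

/-- `B` is the coefficient sequence of minus the logarithmic derivative of the Dirichlet series
with coefficients `P`. -/
def IsLogDer (P B : ArithmeticFunction ℂ) : Prop :=
  ∀ n, P n * Real.log n = (B * P) n

theorem IsLogDer.mul {P P' B B' : ArithmeticFunction ℂ} (h : IsLogDer P B) (h' : IsLogDer P' B') :
    IsLogDer (P * P') (B + B') := by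
  intro n
  set ℓ : ArithmeticFunction ℂ := ⟨fun n => (Real.log n : ℂ), by simp⟩ with hℓ
  have hP : P.pmul ℓ = B * P := by ext n; exact h n
  have hP' : P'.pmul ℓ = B' * P' := by ext n; exact h' n
  have : (P * P').pmul ℓ = P.pmul ℓ * P' + P * P'.pmul ℓ := by
    ext n
    simp only [ArithmeticFunction.pmul_apply, ArithmeticFunction.mul_apply,
      ArithmeticFunction.add_apply]
    rw [Finset.sum_mul, ← Finset.sum_add_distrib]
    refine Finset.sum_congr rfl fun p hp => ?_
    have hpn := Nat.mem_divisorsAntidiagonal.mp hp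
    have h1 : (p.1 : ℝ) ≠ 0 := by
      have := left_ne_zero_of_mul (hpn.1 ▸ hpn.2); exact_mod_cast this
    have h2 : (p.2 : ℝ) ≠ 0 := by
      have := right_ne_zero_of_mul (hpn.1 ▸ hpn.2); exact_mod_cast this
    have : ℓ n = ℓ p.1 + ℓ p.2 := by
      simp only [hℓ, ArithmeticFunction.coe_mk]
      rw [← hpn.1, Nat.cast_mul, Real.log_mul h1 h2]; push_cast; rfl
    rw [this]; ring
  have h2 : (P * P').pmul ℓ = (B + B') * (P * P') := by
    rw [this, hP, hP']; ring
  have := DFunLike.congr_fun h2 n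
  exact this

theorem IsMangoldt.isLogDer {r b : ℕ → ℝ} (hm : IsMangoldt r b) (u : ℕ →* ℂ) :
    IsLogDer (twAF r u) (twAF b u) := by
  intro n
  rcases eq_or_ne n 0 with rfl | hn
  · simp
  · rw [twAF_apply r u hn, ArithmeticFunction.mul_apply, mul_assoc, ← Complex.ofReal_mul,
      ← hm.conv n hn, Complex.ofReal_sum, Finset.mul_sum]
    refine Finset.sum_congr rfl fun p hp => ?_
    have hpn := Nat.mem_divisorsAntidiagonal.mp hp
    have h1 := left_ne_zero_of_mul (hpn.1 ▸ hpn.2)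
    have h2 := right_ne_zero_of_mul (hpn.1 ▸ hpn.2)
    rw [twAF_apply b u h1, twAF_apply r u h2, ← hpn.1, map_mul]
    push_cast; ring

open scoped ComplexOrder in
theorem IsLogDer.nonneg {P B : ArithmeticFunction ℂ} (h : IsLogDer P B) (hP : P 1 = 1)
    (hB : ∀ n, 0 ≤ B n) (hB1 : B 1 = 0) (n : ℕ) : 0 ≤ P n := by
  induction n using Nat.strong_induction_on with
  | _ n ih =>
    rcases Nat.lt_or_ge 1 n with hn | hn
    · have hlog : 0 < Real.log n := Real.log_pos (by exact_mod_cast hn)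
      have h1 : 0 ≤ P n * Real.log n := by
        rw [h n, ArithmeticFunction.mul_apply]
        refine Finset.sum_nonneg fun p hp => ?_
        have hpn := Nat.mem_divisorsAntidiagonal.mp hp
        rcases eq_or_ne p.1 1 with h1 | h1
        · simp [h1, hB1]
        · refine mul_nonneg (hB _) (ih _ ?_)
          have h10 := left_ne_zero_of_mul (hpn.1 ▸ hpn.2)
          have h20 := right_ne_zero_of_mul (hpn.1 ▸ hpn.2)
          rw [← hpn.1]
          exact lt_mul_of_one_lt_left (by omega) (by omega)
      rw [Complex.le_def] at h1 ⊢
      simp only [Complex.zero_re, Complex.zero_im, Complex.re_mul_ofReal,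
        Complex.im_mul_ofReal] at h1 ⊢
      refine ⟨nonneg_of_mul_nonneg_left h1.1 hlog, ?_⟩
      rcases mul_eq_zero.mp h1.2.symm with h2 | h2
      · exact h2.symm
      · exact absurd h2 hlog.ne'
    · interval_cases n
      · simp
      · rw [hP]; exact zero_le_one

theorem remFun_ofReal_im {f : ℕ → ℂ} (hf : ∀ n, (f n).im = 0) (σ : ℝ) : (remFun f 0 σ).im = 0 := by
  have h : ∀ t ∈ Set.Ioi (1 : ℝ), sumRem f 0 t * (t : ℂ) ^ (-((σ : ℂ) + 1))
      = (((∑ k ∈ Finset.Icc 1 ⌊t⌋₊, (f k).re) * t ^ (-(σ + 1)) : ℝ) : ℂ) := by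
    intro t ht
    have ht0 : (0 : ℝ) ≤ t := zero_le_one.trans (le_of_lt ht)
    rw [sumRem, zero_mul, sub_zero, Complex.ofReal_mul, Complex.ofReal_cpow ht0]
    push_cast
    congr 1
    exact Finset.sum_congr rfl fun k _ => Complex.ext rfl (by simp [hf])
  rw [remFun, MeasureTheory.setIntegral_congr_fun measurableSet_Ioi h, integral_complex_ofReal,
    ← Complex.ofReal_mul, Complex.ofReal_im]

section
variable {r b : ℕ → ℝ} {κ δ A₀ : ℝ}

/-- A lower bound for the value at `1` of the cofactor of the base Dirichlet series. -/
theorem TwistBase.exists_cofactor_ge (hb : TwistBase r κ δ A₀) {η : ℝ} (hη : 0 < η)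
    (hηδ : 2 * η ≤ δ) :
    ∃ c₀ C₁ : ℝ, 0 < c₀ ∧ 0 < C₁ ∧ ∀ (a : ArithmeticFunction ℂ) (P : ℂ → ℂ) (M β : ℝ),
      (∀ n, 0 ≤ (a n).re ∧ (a n).im = 0) → a 1 = 1 →
      (∀ s : ℂ, 1 < s.re → LSeriesSummable a s) →
      (∀ s : ℂ, 1 < s.re → LSeries a s = LSeries (twCoeff r 1) s * P s) →
      (∀ s : ℂ, 1 - δ < s.re → DifferentiableAt ℂ P s) → 1 ≤ M →
      (∀ s ∈ Metric.closedBall (2 : ℂ) (1 + η), ‖P s‖ ≤ M ∧ ‖deriv P s‖ ≤ M) →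
      (P 1).im = 0 → 1 - η / 2 ≤ β → β < 1 →
      ((κ * (β / (β - 1)) + twRem r 1 κ β) * P β).re ≤ 0 →
      c₀ * (1 - β) * M ^ (-(C₁ * (1 - β))) ≤ (P 1).re := by
  have hκ := hb.κ_pos
  have hδ := hb.δ_pos
  have hδ1 := hb.δ_le
  have hA : 0 < A₀ := one_pos.trans_le hb.twist.one_le
  set ρ := (1 + η / 2) / (1 + η) with hρ
  have hρ0 : 0 < ρ := by positivity
  have hρ1 : ρ < 1 := by rw [hρ, div_lt_one (by linarith)]; linarith
  have hlρ : 0 < -Real.log ρ := by linarith [Real.log_neg hρ0 hρ1]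
  set D := 4 * (A₀ / (δ / 2)) with hD
  have hD0 : 0 < D := by positivity
  set G := 2 * κ + D with hG
  set K₀ := |Real.log (2 * G / (1 - ρ))| / (-Real.log ρ) + 2 with hK₀
  have hK₀0 : 0 < K₀ := by positivity
  refine ⟨Real.exp (-K₀) / (2 * κ), 1 / (-Real.log ρ), by positivity, by positivity, ?_⟩
  intro a P M β ha ha1 hsum hF hP hM1 hbd him hβ hβ1 hneg
  have hmem : ∀ s ∈ Metric.closedBall (2 : ℂ) (1 + η), 1 - η ≤ s.re ∧ ‖s‖ ≤ 4 := by
    intro s hs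
    rw [Metric.mem_closedBall, dist_eq_norm] at hs
    constructor
    · have := (Complex.abs_re_le_norm (s - 2)).trans hs
      rw [abs_le] at this
      simp at this
      linarith [this.1]
    · calc ‖s‖ = ‖(s - 2) + 2‖ := by ring_nf
        _ ≤ ‖s - 2‖ + ‖(2 : ℂ)‖ := norm_add_le _ _
        _ ≤ 4 := by rw [Complex.norm_ofNat]; linarith
  have h1mem : (1 : ℂ) ∈ Metric.closedBall (2 : ℂ) (1 + η) := by
    rw [Metric.mem_closedBall, dist_eq_norm]; norm_num; linarith
  set g : ℂ → ℂ := fun s => κ * P s + twRem r 1 κ s * P s + κ * dslope P 1 s with hg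
  have hden : ∀ s : ℂ, s ≠ 1 → dslope P 1 s = (P s - P 1) / (s - 1) := by
    intro s hs
    rw [dslope_of_ne _ hs, slope_def_field]
  have hid : ∀ s : ℂ, s ≠ 1 → (κ * (s / (s - 1)) + twRem r 1 κ s) * P s
      = g s + ((κ * (P 1).re : ℝ) : ℂ) * (s - 1)⁻¹ := by
    intro s hs
    have hs' : s - 1 ≠ 0 := sub_ne_zero.mpr hs
    have hP1 : (((P 1).re : ℝ) : ℂ) = P 1 := Complex.ext rfl (by simp [him])
    simp only [hg]
    rw [hden s hs, Complex.ofReal_mul, hP1]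
    field_simp
    ring
  have hPon : DifferentiableOn ℂ P {s : ℂ | 1 - δ < s.re} := fun s hs =>
    (hP s hs).differentiableWithinAt
  have hopen : IsOpen {s : ℂ | 1 - δ < s.re} := isOpen_lt continuous_const Complex.continuous_re
  have hdsl : DifferentiableOn ℂ (dslope P 1) {s : ℂ | 1 - δ < s.re} :=
    (Complex.differentiableOn_dslope (hopen.mem_nhds (by simpa using hδ))).mpr hPon
  have hgd : ∀ s ∈ Metric.closedBall (2 : ℂ) (1 + η), DifferentiableAt ℂ g s := by
    intro s hs
    have hs1 : 1 - δ < s.re := by linarith [(hmem s hs).1]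
    have h1 := hP s hs1
    have h2 := hb.twist.differentiableAt hs1
    have h3 : DifferentiableAt ℂ (dslope P 1) s := hdsl.differentiableAt (hopen.mem_nhds hs1)
    exact ((h1.const_mul _).add (h2.mul h1)).add (h3.const_mul _)
  have hgM : ∀ s ∈ Metric.closedBall (2 : ℂ) (1 + η), ‖g s‖ ≤ G * M := by
    intro s hs
    obtain ⟨hs1, hs4⟩ := hmem s hs
    have h1 := (hbd s hs).1
    have h2 : ‖twRem r 1 κ s‖ ≤ D := by
      refine (norm_remFun_le hb.twist.bound' (by linarith)).trans ?_
      rw [hD]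
      have : A₀ / (s.re - 1 + δ) ≤ A₀ / (δ / 2) := by gcongr; linarith
      exact mul_le_mul hs4 this (div_nonneg hA.le (by linarith)) (by norm_num)
    have h3 : ‖dslope P 1 s‖ ≤ M := by
      rcases eq_or_ne s 1 with rfl | hs'
      · rw [dslope_same]; exact (hbd 1 h1mem).2
      · rw [hden s hs', norm_div, div_le_iff₀ (norm_pos_iff.mpr (sub_ne_zero.mpr hs'))]
        exact (convex_closedBall (2 : ℂ) (1 + η)).norm_image_sub_le_of_norm_deriv_le
          (fun z hz => hP z (by linarith [(hmem z hz).1])) (fun z hz => (hbd z hz).2) h1mem hs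
    calc ‖g s‖ ≤ ‖(κ : ℂ) * P s‖ + ‖twRem r 1 κ s * P s‖ + ‖(κ : ℂ) * dslope P 1 s‖ :=
          norm_add₃_le
      _ ≤ κ * M + D * M + κ * M := by
          simp only [norm_mul, Complex.norm_real, Real.norm_of_nonneg hκ.le]
          gcongr
      _ = G * M := by rw [hG]; ring
  have hG0 : 0 < G := by positivity
  have hGM : 0 < G * M := by positivity
  set X := Real.log (2 * (G * M) / (1 - ρ)) / (-Real.log ρ) with hX
  set N := ⌈X⌉₊ + 1 with hN
  have hNX : X ≤ N := by
    rw [hN]; push_cast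
    linarith [Nat.le_ceil X]
  have h1ρ : 0 < 1 - ρ := by linarith
  have hNb : (G * M) * (ρ ^ N * (1 - ρ)⁻¹) ≤ 1 / 2 := by
    have h1 : ρ ^ N ≤ (1 - ρ) / (2 * (G * M)) := by
      rw [← Real.log_le_log_iff (by positivity) (by positivity), Real.log_pow]
      have h2 : Real.log ((1 - ρ) / (2 * (G * M))) = -Real.log (2 * (G * M) / (1 - ρ)) := by
        rw [← Real.log_inv, inv_div]
      rw [h2]
      rw [hX, div_le_iff₀ hlρ] at hNX
      linarith
    calc (G * M) * (ρ ^ N * (1 - ρ)⁻¹) ≤ (G * M) * ((1 - ρ) / (2 * (G * M)) * (1 - ρ)⁻¹) := by gcongr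
      _ = 1 / 2 := by field_simp
  have hmain := residue_ge_of_nonpos (a := a) (g := g) (lam := κ * (P 1).re) (M := G * M) (N := N)
    (fun n => Complex.le_def.mpr ⟨(ha n).1, (ha n).2.symm⟩) (by rw [ha1]; simp) hsum hη hgd
    (fun s hs => by
      rw [hF s hs, hb.twist.LSeries_eq hb hs]
      exact hid s (by rintro rfl; simp at hs)) hgM hβ hβ1
    (by
      have h1 := hid β (by
        intro h
        have := congrArg Complex.re h
        simp at this; linarith)
      rw [h1] at hneg
      have h2 : (((κ * (P 1).re : ℝ) : ℂ) * ((β : ℂ) - 1)⁻¹).re = κ * (P 1).re * (β - 1)⁻¹ := by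
        rw [← Complex.ofReal_one, ← Complex.ofReal_sub, ← Complex.ofReal_inv, ← Complex.ofReal_mul,
          Complex.ofReal_re]
      rw [Complex.add_re, h2] at hneg
      have h3 : (β - 1)⁻¹ = -(1 - β)⁻¹ := by rw [← neg_sub, inv_neg]
      rw [h3] at hneg
      rw [div_eq_mul_inv]
      linarith) (by omega) hNb
  have hNle : (N : ℝ) ≤ K₀ + Real.log M / (-Real.log ρ) := by
    have h1 : X ≤ |Real.log (2 * G / (1 - ρ))| / (-Real.log ρ) + Real.log M / (-Real.log ρ) := by
      rw [hX, ← add_div]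
      gcongr
      have : 2 * (G * M) / (1 - ρ) = (2 * G / (1 - ρ)) * M := by ring
      rw [this, Real.log_mul (by positivity) (by positivity)]
      gcongr
      exact le_abs_self _
    have h0 : 0 ≤ |Real.log (2 * G / (1 - ρ))| / (-Real.log ρ) + Real.log M / (-Real.log ρ) := by
      have := Real.log_nonneg hM1
      positivity
    have h2 : (⌈X⌉₊ : ℝ) ≤ |Real.log (2 * G / (1 - ρ))| / (-Real.log ρ) + Real.log M / (-Real.log ρ) + 1 := by
      rcases le_or_gt 0 X with hX0 | hX0
      · linarith [Nat.ceil_lt_add_one hX0]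
      · rw [Nat.ceil_eq_zero.mpr hX0.le]; push_cast; linarith
    rw [hN, hK₀]; push_cast; linarith
  have h1β : 0 < 1 - β := by linarith
  have hβη : 1 - β ≤ 1 := by linarith
  have hexp : Real.exp (-K₀) * M ^ (-(1 / (-Real.log ρ) * (1 - β))) ≤ Real.exp (-((1 - β) * N)) := by
    rw [Real.rpow_def_of_pos (by linarith), ← Real.exp_add]
    gcongr
    have h1 : (1 - β) * N ≤ (1 - β) * (K₀ + Real.log M / (-Real.log ρ)) := by gcongr
    have h2 : (1 - β) * K₀ ≤ K₀ := by nlinarith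
    have h3 : Real.log M * (-(1 / (-Real.log ρ) * (1 - β))) = -((1 - β) * (Real.log M / (-Real.log ρ))) := by
      ring
    rw [h3]
    linarith
  have h4 : (1 - β) / 2 * (Real.exp (-K₀) * M ^ (-(1 / (-Real.log ρ) * (1 - β)))) ≤ κ * (P 1).re :=
    le_trans (by gcongr) hmain
  have h5 : Real.exp (-K₀) / (2 * κ) * (1 - β) * M ^ (-(1 / (-Real.log ρ) * (1 - β)))
      = ((1 - β) / 2 * (Real.exp (-K₀) * M ^ (-(1 / (-Real.log ρ) * (1 - β))))) / κ := by
    field_simp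
  rw [h5, div_le_iff₀ hκ]
  linarith


theorem quadratic_im_eq_zero {u : ℕ →* ℂ} (hu : ∀ n, r n ≠ 0 → u n = 0 ∨ u n = 1 ∨ u n = -1)
    (n : ℕ) : (twCoeff r u n).im = 0 := by
  rw [twCoeff]
  by_cases h : r n = 0
  · simp [h]
  · rcases hu n h with h | h | h <;> simp [h]

theorem IsMangoldt.ne_zero (hm : IsMangoldt r b) (hb : TwistBase r κ δ A₀) {n : ℕ} (hn : n ≠ 0)
    (h : b n ≠ 0) : r n ≠ 0 := by
  intro h0
  have := hm.le hb hn
  rw [h0, zero_mul] at this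
  exact h (le_antisymm this (hm.nonneg n))

theorem TwistBase.summable_twAF (hb : TwistBase r κ δ A₀) {u : ℕ →* ℂ} (hu : ∀ n, ‖u n‖ ≤ 1)
    {s : ℂ} (hs : 1 < s.re) : LSeriesSummable (twAF r u) s :=
  (LSeriesSummable_congr s fun {n} hn => by rw [twAF_apply r u hn]; rfl).mpr
    (hb.summable_twCoeff hu hs)

theorem IsTwist.LSeries_twAF_eq (hb : TwistBase r κ δ A₀) {u : ℕ →* ℂ} {B : ℝ}
    (h : IsTwist r δ u 0 B) {s : ℂ} (hs : 1 < s.re) : LSeries (twAF r u) s = twRem r u 0 s := by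
  rw [LSeries_twAF, h.LSeries_eq hb hs, zero_mul, zero_add]

theorem im_le_of_mem_closedBall {η : ℝ} (hη : η ≤ 1) {s : ℂ}
    (hs : s ∈ Metric.closedBall (2 : ℂ) (1 + η)) : 1 - η ≤ s.re ∧ |s.im| ≤ 2 := by
  rw [Metric.mem_closedBall, dist_eq_norm] at hs
  have h1 := (Complex.abs_re_le_norm (s - 2)).trans hs
  have h2 := (Complex.abs_im_le_norm (s - 2)).trans hs
  simp only [Complex.sub_re, Complex.sub_im, Complex.re_ofNat, Complex.im_ofNat, sub_zero] at h1 h2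
  rw [abs_le] at h1
  exact ⟨by linarith [h1.1], by linarith⟩

theorem rpow_neg_mul_le {E B p C x : ℝ} (hE : 1 ≤ E) (hB : 1 ≤ B) (hC : 0 < C)
    (hx1 : x ≤ 1) :
    E ^ (-C) * B ^ (-(C * p * x)) ≤ (E * B ^ p) ^ (-(C * x)) := by
  rw [Real.mul_rpow (by linarith) (by positivity), ← Real.rpow_mul (by linarith)]
  have h1 : E ^ (-C) ≤ E ^ (-(C * x)) :=
    Real.rpow_le_rpow_of_exponent_le hE (by nlinarith)
  have h2 : p * (-(C * x)) = -(C * p * x) := by ring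
  rw [h2]
  gcongr

/-- Lower bound for a quadratic twist at `1`. -/
theorem IsMangoldt.exists_quadratic_ge (hm : IsMangoldt r b) (hb : TwistBase r κ δ A₀) :
    ∃ η c₀ C₁ : ℝ, 0 < η ∧ 2 * η ≤ δ ∧ 0 < c₀ ∧ 0 < C₁ ∧ ∀ (u : ℕ →* ℂ) (B β : ℝ),
      IsTwist r δ u 0 B → (∀ n, r n ≠ 0 → u n = 0 ∨ u n = 1 ∨ u n = -1) →
      1 - η ≤ β → β < 1 → ((κ * (β / (β - 1)) + twRem r 1 κ β) * twRem r u 0 β).re ≤ 0 →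
      c₀ * (1 - β) * B ^ (-(C₁ * (1 - β))) ≤ (twRem r u 0 1).re := by
  obtain ⟨η, D, hη, hηδ, hD, hH⟩ := hb.exists_norm_deriv_twRem_le one_pos
  have hδ1 := hb.δ_le
  obtain ⟨c₀, C₁, hc₀, hC₁, hmain⟩ := hb.exists_cofactor_ge hη hηδ
  have hE : 1 ≤ D * 4 := by linarith
  refine ⟨η / 2, c₀ * (D * 4) ^ (-C₁), C₁, by positivity, by linarith, by positivity, hC₁, ?_⟩
  intro u B β hu hq hβ hβ1 hneg
  have hB := hu.one_le
  have hone : ∀ n, ‖(1 : ℕ →* ℂ) n‖ ≤ 1 := by simp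
  have hlog := (hm.isLogDer 1).mul (hm.isLogDer u)
  have hnn := hlog.nonneg (by
      simp [ArithmeticFunction.mul_apply, twAF_apply, hb.map_one])
    (fun n => by
      rcases eq_or_ne n 0 with rfl | hn
      · simp
      · rw [ArithmeticFunction.add_apply, twAF_apply _ _ hn, twAF_apply _ _ hn, Complex.le_def]
        have := hm.nonneg n
        by_cases h : b n = 0
        · simp [h]
        · rcases hq n (hm.ne_zero hb hn h) with h | h | h <;> simp [h] <;> linarith)
    (by simp [twAF_apply, hm.one_eq hb])
  have := hmain (twAF r 1 * twAF r u) (twRem r u 0) (D * 4 * B ^ (1 : ℝ)) β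
    (fun n => by
      have := Complex.le_def.mp (hnn n)
      exact ⟨this.1, this.2.symm⟩)
    (by simp [ArithmeticFunction.mul_apply, twAF_apply, hb.map_one])
    (fun s hs => ArithmeticFunction.LSeriesSummable_mul (hb.summable_twAF hone hs)
      (hb.summable_twAF hu.norm_le hs))
    (fun s hs => by
      rw [ArithmeticFunction.LSeries_mul' (hb.summable_twAF hone hs)
        (hb.summable_twAF hu.norm_le hs), hu.LSeries_twAF_eq hb hs, LSeries_twAF])
    (fun s hs => hu.differentiableAt hs)
    (by rw [Real.rpow_one]; nlinarith)
    (fun s hs => by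
      obtain ⟨h1, h2⟩ := im_le_of_mem_closedBall (by linarith) hs
      have h3 : D * (B * (2 + |s.im|)) ^ (1 : ℝ) ≤ D * 4 * B ^ (1 : ℝ) := by
        rw [Real.rpow_one, Real.rpow_one]
        have : B * (2 + |s.im|) ≤ B * 4 := by gcongr; linarith
        nlinarith
      exact ⟨(hH u 0 B hu s h1).1.trans h3, (hH u 0 B hu s h1).2.trans h3⟩)
    (by simpa [twRem] using remFun_ofReal_im (quadratic_im_eq_zero hq) 1) (by linarith) hβ1 hneg
  refine le_trans ?_ this
  have h1 := rpow_neg_mul_le (p := 1) hE hB hC₁ (x := 1 - β) (by linarith)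
  rw [mul_one] at h1
  calc c₀ * (D * 4) ^ (-C₁) * (1 - β) * B ^ (-(C₁ * (1 - β)))
      = c₀ * (1 - β) * ((D * 4) ^ (-C₁) * B ^ (-(C₁ * (1 - β)))) := by ring
    _ ≤ _ := by
      have : 0 < 1 - β := by linarith
      gcongr

/-- Lower bound for a product of three quadratic twists at `1`, given a zero of one of them. -/
theorem IsMangoldt.exists_quadratic_mul_ge (hm : IsMangoldt r b) (hb : TwistBase r κ δ A₀) :
    ∃ η c₀ C₁ : ℝ, 0 < η ∧ 2 * η ≤ δ ∧ 0 < c₀ ∧ 0 < C₁ ∧ ∀ (u v : ℕ →* ℂ) (B β : ℝ),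
      IsTwist r δ u 0 B → (∀ n, r n ≠ 0 → u n = 0 ∨ u n = 1 ∨ u n = -1) →
      IsTwist r δ v 0 B → (∀ n, r n ≠ 0 → v n = 0 ∨ v n = 1 ∨ v n = -1) →
      IsTwist r δ (u * v) 0 B → 1 - η ≤ β → β < 1 → twRem r u 0 β = 0 →
      c₀ * (1 - β) * B ^ (-(C₁ * (1 - β))) ≤
        ‖twRem r u 0 1‖ * ‖twRem r v 0 1‖ * ‖twRem r (u * v) 0 1‖ := by
  obtain ⟨η, D, hη, hηδ, hD, hH⟩ := hb.exists_norm_deriv_twRem_le one_pos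
  have hδ1 := hb.δ_le
  obtain ⟨c₀, C₁, hc₀, hC₁, hmain⟩ := hb.exists_cofactor_ge hη hηδ
  have hE : 1 ≤ 3 * (D * 4) ^ 3 := by
    have : 1 ≤ (D * 4) ^ 3 := one_le_pow₀ (by linarith)
    linarith
  refine ⟨η / 2, c₀ * (3 * (D * 4) ^ 3) ^ (-C₁), C₁ * 3, by positivity, by linarith, by positivity,
    by positivity, ?_⟩
  intro u v B β hu hqu hv hqv huv hβ hβ1 hzero
  have hB := hu.one_le
  have hquv : ∀ n, r n ≠ 0 → (u * v) n = 0 ∨ (u * v) n = 1 ∨ (u * v) n = -1 := by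
    intro n hn
    rw [MonoidHom.mul_apply]
    rcases hqu n hn with h | h | h <;> rcases hqv n hn with h' | h' | h' <;> simp [h, h']
  have hone : ∀ n, ‖(1 : ℕ →* ℂ) n‖ ≤ 1 := by simp
  have hlog := (hm.isLogDer 1).mul ((hm.isLogDer u).mul ((hm.isLogDer v).mul (hm.isLogDer (u * v))))
  have hone' : (twAF r 1 * (twAF r u * (twAF r v * twAF r (u * v)))) 1 = 1 := by
    simp [ArithmeticFunction.mul_apply, twAF_apply, hb.map_one]
  have hnn := hlog.nonneg hone'
    (fun n => by
      rcases eq_or_ne n 0 with rfl | hn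
      · simp
      · simp only [ArithmeticFunction.add_apply, twAF_apply _ _ hn]
        rw [Complex.le_def]
        have := hm.nonneg n
        by_cases h : b n = 0
        · simp [h]
        · have hr := hm.ne_zero hb hn h
          rcases hqu n hr with h | h | h <;> rcases hqv n hr with h' | h' | h' <;>
            simp [h, h'] <;> linarith)
    (by simp [twAF_apply, hm.one_eq hb])
  have sU := fun s (hs : 1 < s.re) => hb.summable_twAF hu.norm_le (s := s) hs
  have sV := fun s (hs : 1 < s.re) => hb.summable_twAF hv.norm_le (s := s) hs
  have sW := fun s (hs : 1 < s.re) => hb.summable_twAF huv.norm_le (s := s) hs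
  have sVW := fun s (hs : 1 < s.re) => ArithmeticFunction.LSeriesSummable_mul (sV s hs) (sW s hs)
  have sUVW := fun s (hs : 1 < s.re) => ArithmeticFunction.LSeriesSummable_mul (sU s hs) (sVW s hs)
  set U := twRem r u 0
  set V := twRem r v 0
  set W := twRem r (u * v) 0
  have hreal : ∀ w : ℕ →* ℂ, (∀ n, r n ≠ 0 → w n = 0 ∨ w n = 1 ∨ w n = -1) →
      (twRem r w 0 1).im = 0 := fun w hw => by
    simpa [twRem] using remFun_ofReal_im (quadratic_im_eq_zero hw) 1
  have := hmain (twAF r 1 * (twAF r u * (twAF r v * twAF r (u * v)))) (fun s => U s * (V s * W s))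
    (3 * (D * 4) ^ 3 * B ^ (3 : ℝ)) β
    (fun n => by
      have := Complex.le_def.mp (hnn n)
      exact ⟨this.1, this.2.symm⟩) hone'
    (fun s hs => ArithmeticFunction.LSeriesSummable_mul (hb.summable_twAF hone hs) (sUVW s hs))
    (fun s hs => by
      rw [ArithmeticFunction.LSeries_mul' (hb.summable_twAF hone hs) (sUVW s hs),
        ArithmeticFunction.LSeries_mul' (sU s hs) (sVW s hs),
        ArithmeticFunction.LSeries_mul' (sV s hs) (sW s hs), hu.LSeries_twAF_eq hb hs,
        hv.LSeries_twAF_eq hb hs, huv.LSeries_twAF_eq hb hs, LSeries_twAF])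
    (fun s hs => (hu.differentiableAt hs).mul ((hv.differentiableAt hs).mul (huv.differentiableAt hs)))
    (one_le_mul_of_one_le_of_one_le hE (Real.one_le_rpow hB (by norm_num)))
    (fun s hs => by
      obtain ⟨h1, h2⟩ := im_le_of_mem_closedBall (by linarith) hs
      set Y := D * 4 * B with hY
      have hY0 : 0 ≤ Y := by positivity
      have hYE : 3 * (D * 4) ^ 3 * B ^ (3 : ℝ) = 3 * Y ^ 3 := by
        rw [hY, show (3 : ℝ) = ((3 : ℕ) : ℝ) by norm_num, Real.rpow_natCast]; ring
      have h3 : D * (B * (2 + |s.im|)) ^ (1 : ℝ) ≤ Y := by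
        rw [Real.rpow_one]
        have : B * (2 + |s.im|) ≤ B * 4 := by gcongr; linarith
        nlinarith
      obtain ⟨u1, u2⟩ := hH u 0 B hu s h1
      obtain ⟨v1, v2⟩ := hH v 0 B hv s h1
      obtain ⟨w1, w2⟩ := hH (u * v) 0 B huv s h1
      have u1 := u1.trans h3
      have u2 := u2.trans h3
      have v1 := v1.trans h3
      have v2 := v2.trans h3
      have w1 := w1.trans h3
      have w2 := w2.trans h3
      have hsδ : 1 - δ < s.re := by linarith
      have p3 : ∀ x y z : ℂ, ‖x‖ ≤ Y → ‖y‖ ≤ Y → ‖z‖ ≤ Y → ‖x * (y * z)‖ ≤ Y ^ 3 := by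
        intro x y z hx hy hz
        rw [norm_mul, norm_mul]
        calc ‖x‖ * (‖y‖ * ‖z‖) ≤ Y * (Y * Y) := by gcongr
          _ = Y ^ 3 := by ring
      rw [hYE]
      constructor
      · exact (p3 _ _ _ u1 v1 w1).trans (by nlinarith [pow_nonneg hY0 3])
      · have hd := (hu.differentiableAt hsδ).hasDerivAt.mul
          ((hv.differentiableAt hsδ).hasDerivAt.mul (huv.differentiableAt hsδ).hasDerivAt)
        have hd' : deriv (fun s => U s * (V s * W s)) s
            = deriv U s * (V s * W s) + U s * (deriv V s * W s + V s * deriv W s) := hd.deriv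
        rw [hd', mul_add, ← add_assoc]
        refine norm_add₃_le.trans ?_
        have := p3 _ _ _ u2 v1 w1
        have := p3 _ _ _ u1 v2 w1
        have := p3 _ _ _ u1 v1 w2
        linarith)
    (by
      have h1 := hreal u hqu
      have h2 := hreal v hqv
      have h3 := hreal (u * v) hquv
      simp [U, V, W, Complex.mul_im, h1, h2, h3])
    (by linarith) hβ1 (by
      rw [hzero]; simp)
  have hfin := this.trans (Complex.re_le_norm _)
  rw [norm_mul, norm_mul, ← mul_assoc] at hfin
  refine le_trans ?_ hfin
  have h1 := rpow_neg_mul_le (p := 3) hE hB hC₁ (x := 1 - β) (by linarith)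
  calc c₀ * (3 * (D * 4) ^ 3) ^ (-C₁) * (1 - β) * B ^ (-(C₁ * 3 * (1 - β)))
      = c₀ * (1 - β) * ((3 * (D * 4) ^ 3) ^ (-C₁) * B ^ (-(C₁ * 3 * (1 - β)))) := by ring
    _ ≤ _ := by
      have : 0 < 1 - β := by linarith
      gcongr

end

/-! ### Siegel's lower bound -/

/-- A Dirichlet character as a multiplicative function on the natural numbers. -/
noncomputable def charHom {q : ℕ} (χ : DirichletCharacter ℂ q) : ℕ →* ℂ :=
  χ.toMonoidHom.comp (Nat.castRingHom (ZMod q)).toMonoidHom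

theorem charHom_apply {q : ℕ} (χ : DirichletCharacter ℂ q) (n : ℕ) : charHom χ n = χ (n : ZMod q) :=
  rfl

theorem charHom_pow {q : ℕ} (χ : DirichletCharacter ℂ q) (k : ℕ) (hk : k ≠ 0) :
    charHom (χ ^ k) = charHom χ ^ k := by
  ext n
  rw [charHom_apply, MonoidHom.pow_apply, charHom_apply, MulChar.pow_apply' χ hk]

theorem charHom_changeLevel_mul {q₁ q₂ : ℕ} (χ₁ : DirichletCharacter ℂ q₁)
    (χ₂ : DirichletCharacter ℂ q₂) :
    charHom (DirichletCharacter.changeLevel (Nat.dvd_mul_right q₁ q₂) χ₁ *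
      DirichletCharacter.changeLevel (Nat.dvd_mul_left q₂ q₁) χ₂) = charHom χ₁ * charHom χ₂ := by
  ext n
  rw [charHom_apply, MonoidHom.mul_apply, charHom_apply, charHom_apply, MulChar.mul_apply]
  by_cases hn : IsUnit (n : ZMod (q₁ * q₂))
  · obtain ⟨a, ha⟩ := hn
    rw [← ha, DirichletCharacter.changeLevel_eq_cast_of_dvd χ₁ (Nat.dvd_mul_right q₁ q₂),
      DirichletCharacter.changeLevel_eq_cast_of_dvd χ₂ (Nat.dvd_mul_left q₂ q₁), ha,
      ZMod.cast_natCast (Nat.dvd_mul_right q₁ q₂), ZMod.cast_natCast (Nat.dvd_mul_left q₂ q₁)]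
  · rw [MulChar.map_nonunit _ hn, zero_mul]
    rw [ZMod.isUnit_iff_coprime, Nat.coprime_mul_iff_right, not_and_or] at hn
    rcases hn with hn | hn
    · rw [MulChar.map_nonunit χ₁ (by rwa [ZMod.isUnit_iff_coprime]), zero_mul]
    · rw [MulChar.map_nonunit χ₂ (by rwa [ZMod.isUnit_iff_coprime]), mul_zero]

/-- The hypotheses on the twists of `r` by Dirichlet characters used in the proof of the
Siegel–Walfisz theorem: `c q χ` is the mean value of `χ r`. -/
structure CharFamily (r b : ℕ → ℝ) (κ δ A₀ A : ℝ) (E : ℕ)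
    (c : ∀ q : ℕ, DirichletCharacter ℂ q → ℂ) : Prop where
  base : TwistBase r κ δ A₀
  mangoldt : IsMangoldt r b
  twist : ∀ (q : ℕ) (χ : DirichletCharacter ℂ q), 1 ≤ q →
    IsTwist r δ (charHom χ) (c q χ) (A * (q : ℝ) ^ E)
  eq_one : ∀ (q : ℕ) (χ : DirichletCharacter ℂ q), 1 ≤ q → c q χ ≠ 0 →
    ∀ n : ℕ, n.Coprime q → r n ≠ 0 → χ (n : ZMod q) = 1
  ne_zero : ∀ (q : ℕ) (χ : DirichletCharacter ℂ q), 1 ≤ q → c q χ = 0 →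
    twRem r (charHom χ) 0 1 ≠ 0
  finite : ∀ (q₁ : ℕ) (χ₁ : DirichletCharacter ℂ q₁), 1 ≤ q₁ →
    {p : Σ q : ℕ, DirichletCharacter ℂ q | 1 ≤ p.1 ∧ p.2.IsPrimitive ∧
      c (q₁ * p.1) (DirichletCharacter.changeLevel (Nat.dvd_mul_right q₁ p.1) χ₁ *
        DirichletCharacter.changeLevel (Nat.dvd_mul_left p.1 q₁) p.2) ≠ 0}.Finite

theorem IsTwist.mono {r : ℕ → ℝ} {δ : ℝ} {u : ℕ →* ℂ} {c : ℂ} {B B' : ℝ} (h : IsTwist r δ u c B)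
    (hB : B ≤ B') : IsTwist r δ u c B' where
  norm_le := h.norm_le
  one_le := h.one_le.trans hB
  bound t ht := (h.bound t ht).trans (by gcongr)

theorem LSeries_ofReal_im {f : ℕ → ℂ} (hf : ∀ n, (f n).im = 0) (σ : ℝ)
    (hs : LSeriesSummable f σ) : (LSeries f σ).im = 0 := by
  rw [LSeries, Complex.im_tsum hs]
  refine (tsum_congr fun n => ?_).trans tsum_zero
  rcases eq_or_ne n 0 with rfl | hn
  · simp
  · rw [LSeries.term_of_ne_zero hn]
    have h1 : f n = ((f n).re : ℂ) := Complex.ext rfl (by simp [hf])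
    have h2 : ((n : ℂ) ^ (σ : ℂ)) = (((n : ℝ) ^ σ : ℝ) : ℂ) := by
      rw [Complex.ofReal_cpow (Nat.cast_nonneg n)]; simp
    rw [h1, h2, ← Complex.ofReal_div, Complex.ofReal_im]

section
variable {r b : ℕ → ℝ} {κ δ A₀ A : ℝ} {E : ℕ} {c : ∀ q : ℕ, DirichletCharacter ℂ q → ℂ}

theorem CharFamily.one_le_A (h : CharFamily r b κ δ A₀ A E c) : 1 ≤ A := by
  simpa using (h.twist 1 1 le_rfl).one_le

theorem CharFamily.quadratic (h : CharFamily r b κ δ A₀ A E c) {q : ℕ} (hq : 1 ≤ q)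
    {χ : DirichletCharacter ℂ q} (h2 : c q (χ ^ 2) ≠ 0) (n : ℕ) (hn : r n ≠ 0) :
    charHom χ n = 0 ∨ charHom χ n = 1 ∨ charHom χ n = -1 := by
  rw [charHom_apply]
  by_cases hc : n.Coprime q
  · right
    have := h.eq_one q (χ ^ 2) hq h2 n hc hn
    rw [MulChar.pow_apply' χ two_ne_zero] at this
    simpa using this
  · left
    exact MulChar.map_nonunit _ (by rwa [ZMod.isUnit_iff_coprime])

/-- A quadratic twist without zeros on `[β, 1]` is positive at `β`. -/
theorem IsMangoldt.twRem_nonneg (hm : IsMangoldt r b) (hb : TwistBase r κ δ A₀) {u : ℕ →* ℂ}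
    {B β : ℝ} (hu : IsTwist r δ u 0 B) (hq : ∀ n, r n ≠ 0 → u n = 0 ∨ u n = 1 ∨ u n = -1)
    (hβ : 1 - δ < β) (hz : ∀ σ : ℝ, β ≤ σ → σ ≤ 1 → twRem r u 0 σ ≠ 0) (hβ2 : β ≤ 1) :
    0 ≤ (twRem r u 0 β).re ∧ (twRem r u 0 β).im = 0 := by
  have him : ∀ σ : ℝ, (twRem r u 0 σ).im = 0 := fun σ => remFun_ofReal_im (quadratic_im_eq_zero hq) σ
  refine ⟨?_, him β⟩
  by_contra! hneg
  have hL : ∀ σ : ℝ, 1 < σ → LSeries (twCoeff r u) σ = twRem r u 0 σ := by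
    intro σ hσ
    rw [hu.LSeries_eq hb (by simpa using hσ), zero_mul, zero_add]
  have hpos : 0 < (twRem r u 0 (2 : ℝ)).re := by
    have h2 : (1 : ℝ) < ((2 : ℝ) : ℂ).re := by simp
    rw [← hL 2 (by norm_num), hm.LSeries_eq_exp hb hu.norm_le h2, Complex.exp_re]
    have : (LSeries (twCoeff (logCoeff b) u) ((2 : ℝ) : ℂ)).im = 0 := by
      refine LSeries_ofReal_im (fun n => ?_) 2 (hm.summable_logCoeff hb hu.norm_le h2)
      rw [twCoeff]
      rcases eq_or_ne n 0 with rfl | hn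
      · simp [logCoeff]
      by_cases h : b n = 0
      · simp [logCoeff, h]
      · rcases hq n (hm.ne_zero hb hn h) with h | h | h <;> simp [h]
    rw [this, Real.cos_zero, mul_one]
    exact Real.exp_pos _
  have hcont : ContinuousOn (fun σ : ℝ => (twRem r u 0 σ).re) (Set.Icc β 2) := by
    intro σ hσ
    have h1 := (hu.differentiableAt (s := (σ : ℂ)) (by simpa using hβ.trans_le hσ.1)).continuousAt
    have h2 : ContinuousAt (fun σ : ℝ => twRem r u 0 σ) σ :=
      ContinuousAt.comp (f := fun σ : ℝ => (σ : ℂ)) h1 Complex.continuous_ofReal.continuousAt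
    exact (Complex.continuous_re.continuousAt.comp h2).continuousWithinAt
  obtain ⟨σ, hσ, hσ0⟩ := intermediate_value_Icc (by linarith : β ≤ 2) hcont
    (show (0 : ℝ) ∈ Set.Icc _ _ from ⟨hneg.le, hpos.le⟩)
  have hzero : twRem r u 0 σ = 0 := Complex.ext hσ0 (him σ)
  rcases le_or_gt σ 1 with h1 | h1
  · exact hz σ hσ.1 h1 hzero
  · have := hm.LSeries_eq_exp hb hu.norm_le (s := (σ : ℂ)) (by simpa using h1)
    rw [hL σ h1, hzero] at this
    exact Complex.exp_ne_zero _ this.symm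

theorem exists_rpow_le {A x ε : ℝ} {E : ℕ} (hA : 1 ≤ A) (hε : x * E ≤ ε) :
    ∀ q : ℝ, 1 ≤ q → A ^ (-x) * q ^ (-ε) ≤ (A * q ^ E) ^ (-x) := by
  intro q hq
  rw [Real.mul_rpow (by linarith) (by positivity), ← Real.rpow_natCast, ← Real.rpow_mul (by linarith)]
  gcongr
  linarith

/-- **Siegel's theorem.** -/
theorem CharFamily.siegel (h : CharFamily r b κ δ A₀ A E c) {ε : ℝ} (hε : 0 < ε) :
    ∃ c₀ : ℝ, 0 < c₀ ∧ ∀ (q : ℕ) (χ : DirichletCharacter ℂ q), 1 ≤ q → χ.IsPrimitive → c q χ = 0 →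
      c q (χ ^ 2) ≠ 0 → c₀ * (q : ℝ) ^ (-ε) ≤ ‖twRem r (charHom χ) 0 1‖ := by
  have hb := h.base
  have hm := h.mangoldt
  have hA := h.one_le_A
  have hκ := hb.κ_pos
  have hδ := hb.δ_pos
  have hδ1 := hb.δ_le
  obtain ⟨η₂, c₂, C₂, hη₂, hη₂δ, hc₂, hC₂, est2⟩ := hm.exists_quadratic_ge hb
  obtain ⟨η₄, c₄, C₄, hη₄, hη₄δ, hc₄, hC₄, est4⟩ := hm.exists_quadratic_mul_ge hb
  set ε₁ := ε / (2 * (E + 1)) with hε₁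
  have hε₁0 : 0 < ε₁ := by positivity
  have hε₁E : ε₁ * E ≤ ε / 2 := by
    rw [hε₁, div_mul_eq_mul_div, div_le_div_iff₀ (by positivity) (by norm_num)]
    nlinarith
  set ε₀ := min (min η₂ η₄) (min (ε₁ / C₂) (ε₁ / C₄)) with hε₀
  have hε₀0 : 0 < ε₀ := by positivity
  have hl1 : ε₀ ≤ η₂ := (min_le_left _ _).trans (min_le_left _ _)
  have hl2 : ε₀ ≤ η₄ := (min_le_left _ _).trans (min_le_right _ _)
  have hl3 : C₂ * ε₀ ≤ ε₁ := by
    have : ε₀ ≤ ε₁ / C₂ := (min_le_right _ _).trans (min_le_left _ _)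
    rw [le_div_iff₀ hC₂] at this; linarith
  have hl4 : C₄ * ε₀ ≤ ε₁ := by
    have : ε₀ ≤ ε₁ / C₄ := (min_le_right _ _).trans (min_le_right _ _)
    rw [le_div_iff₀ hC₄] at this; linarith
  by_cases hcase : ∃ (q₁ : ℕ) (χ₁ : DirichletCharacter ℂ q₁) (β : ℝ), 1 ≤ q₁ ∧ c q₁ χ₁ = 0 ∧
      c q₁ (χ₁ ^ 2) ≠ 0 ∧ 1 - ε₀ ≤ β ∧ β < 1 ∧ twRem r (charHom χ₁) 0 β = 0
  · obtain ⟨q₁, χ₁, β, hq₁, hcχ₁, hcχ₁2, hβ, hβ1, hzero⟩ := hcase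
    obtain ⟨η, D, hη, hηδ, hD, hH⟩ := hb.exists_norm_twRem_le hε₁0
    have hfin := h.finite q₁ χ₁ hq₁
    -- exceptional characters
    obtain ⟨m, hm0, hmin⟩ : ∃ m : ℝ, 0 < m ∧ ∀ (q : ℕ) (χ : DirichletCharacter ℂ q), 1 ≤ q →
        χ.IsPrimitive → c q χ = 0 →
        c (q₁ * q) (DirichletCharacter.changeLevel (Nat.dvd_mul_right q₁ q) χ₁ *
          DirichletCharacter.changeLevel (Nat.dvd_mul_left q q₁) χ) ≠ 0 →
        m ≤ ‖twRem r (charHom χ) 0 1‖ := by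
      set S := hfin.toFinset.filter (fun p => c p.1 p.2 = 0) with hS
      rcases S.eq_empty_or_nonempty with hemp | hne
      · refine ⟨1, one_pos, fun q χ hq hp hc hne => ?_⟩
        have : (⟨q, χ⟩ : Σ q : ℕ, DirichletCharacter ℂ q) ∈ S := by
          rw [hS, Finset.mem_filter, Set.Finite.mem_toFinset]
          exact ⟨⟨hq, hp, hne⟩, hc⟩
        rw [hemp] at this
        exact absurd this (Finset.notMem_empty _)
      · obtain ⟨p, hp, hpmin⟩ := S.exists_min_image (fun p => ‖twRem r (charHom p.2) 0 1‖) hne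
        have hp' := hp
        rw [hS, Finset.mem_filter, Set.Finite.mem_toFinset] at hp'
        refine ⟨_, norm_pos_iff.mpr (h.ne_zero p.1 p.2 hp'.1.1 hp'.2), fun q χ hq hpr hc hne => ?_⟩
        refine hpmin ⟨q, χ⟩ ?_
        rw [hS, Finset.mem_filter, Set.Finite.mem_toFinset]
        exact ⟨⟨hq, hpr, hne⟩, hc⟩
    set A' := A * (q₁ : ℝ) ^ E with hA'
    have hq₁' : (1 : ℝ) ≤ q₁ := by exact_mod_cast hq₁
    have hA'1 : 1 ≤ A' := one_le_mul_of_one_le_of_one_le hA (one_le_pow₀ hq₁')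
    set ℓ := ‖twRem r (charHom χ₁) 0 1‖ with hℓ
    have hℓ0 : 0 < ℓ := norm_pos_iff.mpr (h.ne_zero q₁ χ₁ hq₁ hcχ₁)
    have h1β : 0 < 1 - β := by linarith
    set c₅ := c₄ * (1 - β) * A' ^ (-ε₁) / (ℓ * (D * (A' * 2) ^ ε₁)) with hc₅
    have hc₅0 : 0 < c₅ := by positivity
    refine ⟨min m c₅, by positivity, fun q χ hq hp hcχ hcχ2 => ?_⟩
    have hq' : (1 : ℝ) ≤ q := by exact_mod_cast hq
    by_cases hex : c (q₁ * q) (DirichletCharacter.changeLevel (Nat.dvd_mul_right q₁ q) χ₁ *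
          DirichletCharacter.changeLevel (Nat.dvd_mul_left q q₁) χ) = 0
    swap
    · have h1 : (q : ℝ) ^ (-ε) ≤ 1 := Real.rpow_le_one_of_one_le_of_nonpos hq' (by linarith)
      calc min m c₅ * (q : ℝ) ^ (-ε) ≤ m * 1 := by
            gcongr
            exact min_le_left _ _
        _ ≤ _ := by rw [mul_one]; exact hmin q χ hq hp hcχ hex
    have h12 := h.twist (q₁ * q) (DirichletCharacter.changeLevel (Nat.dvd_mul_right q₁ q) χ₁ *
          DirichletCharacter.changeLevel (Nat.dvd_mul_left q q₁) χ) (Nat.mul_pos hq₁ hq)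
    rw [hex, charHom_changeLevel_mul] at h12
    have hB : A * ((q₁ * q : ℕ) : ℝ) ^ E = A' * (q : ℝ) ^ E := by
      rw [hA', Nat.cast_mul, mul_pow]; ring
    rw [hB] at h12
    have hqE : 1 ≤ (q : ℝ) ^ E := one_le_pow₀ hq'
    have t1 := h.twist q₁ χ₁ hq₁
    rw [hcχ₁] at t1
    have t2 := h.twist q χ hq
    rw [hcχ] at t2
    have key := est4 (charHom χ₁) (charHom χ) (A' * (q : ℝ) ^ E) β
      (t1.mono (le_mul_of_one_le_right (by linarith) hqE)) (h.quadratic hq₁ hcχ₁2)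
      (t2.mono (by
        rw [hA']
        gcongr
        exact le_mul_of_one_le_right (by linarith) (one_le_pow₀ hq₁')))
      (h.quadratic hq hcχ2) h12 (by linarith) hβ1 hzero
    have hH12 := hH _ _ _ h12 1 (by simp; linarith)
    simp only [Complex.one_im, abs_zero, add_zero] at hH12
    have hbase : 1 ≤ A' * (q : ℝ) ^ E := h12.one_le
    have e1 : (A' * (q : ℝ) ^ E) ^ (-ε₁) ≤ (A' * (q : ℝ) ^ E) ^ (-(C₄ * (1 - β))) := by
      refine Real.rpow_le_rpow_of_exponent_le hbase ?_
      have : C₄ * (1 - β) ≤ C₄ * ε₀ := by gcongr; linarith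
      linarith
    have e2 := exists_rpow_le hA'1 hε₁E q hq'
    have e3 : (A' * (q : ℝ) ^ E * 2) ^ ε₁ ≤ (A' * 2) ^ ε₁ * (q : ℝ) ^ (ε / 2) := by
      have : A' * (q : ℝ) ^ E * 2 = (A' * 2) * (q : ℝ) ^ E := by ring
      rw [this, Real.mul_rpow (by positivity) (by positivity)]
      gcongr
      rw [← Real.rpow_natCast, ← Real.rpow_mul (by linarith)]
      exact Real.rpow_le_rpow_of_exponent_le hq' (by linarith)
    have e4 : c₄ * (1 - β) * (A' ^ (-ε₁) * (q : ℝ) ^ (-(ε / 2))) ≤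
        ℓ * ‖twRem r (charHom χ) 0 1‖ * (D * ((A' * 2) ^ ε₁ * (q : ℝ) ^ (ε / 2))) := by
      calc _ ≤ c₄ * (1 - β) * (A' * (q : ℝ) ^ E) ^ (-(C₄ * (1 - β))) := by
            gcongr; exact e2.trans e1
        _ ≤ _ := key
        _ ≤ _ := by
            gcongr
            exact hH12.trans (by gcongr)
    have e5 : (q : ℝ) ^ (-ε) * (q : ℝ) ^ (ε / 2) = (q : ℝ) ^ (-(ε / 2)) := by
      rw [← Real.rpow_add (by linarith)]; congr 1; ring
    have hqp : 0 < (q : ℝ) ^ (ε / 2) := by positivity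
    calc min m c₅ * (q : ℝ) ^ (-ε) ≤ c₅ * (q : ℝ) ^ (-ε) := by
          gcongr; exact min_le_right _ _
      _ ≤ _ := by
        rw [← e5] at e4
        rw [hc₅, div_mul_eq_mul_div, div_le_iff₀ (by positivity)]
        refine le_of_mul_le_mul_right ?_ hqp
        linarith
  · push Not at hcase
    -- a point close to `1` where the base series is negative
    set D := 3 * (A₀ / (δ / 2)) with hD
    have hA₀ : 0 < A₀ := one_pos.trans_le hb.twist.one_le
    have hD0 : 0 < D := by positivity
    set ε₂ := min ε₀ (κ / (2 * D)) with hε₂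
    have hε₂0 : 0 < ε₂ := by positivity
    have hε₂l : ε₂ ≤ ε₀ := min_le_left _ _
    have hε₂D : ε₂ * D ≤ κ / 2 := by
      have : ε₂ ≤ κ / (2 * D) := min_le_right _ _
      rw [le_div_iff₀ (by positivity)] at this; linarith
    set β := 1 - ε₂ with hβ
    have hε₂h : ε₂ ≤ δ / 2 := by linarith
    have hre : ((κ : ℂ) * ((β : ℂ) / (β - 1)) + twRem r 1 κ β).re ≤ 0 := by
      have h1 : ‖twRem r 1 κ (β : ℂ)‖ ≤ D := by
        refine (norm_remFun_le hb.twist.bound' (s := (β : ℂ)) (by simp; linarith)).trans ?_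
        rw [hD]
        have : A₀ / ((β : ℂ).re - 1 + δ) ≤ A₀ / (δ / 2) := by
          gcongr; rw [Complex.ofReal_re]; linarith
        refine mul_le_mul ?_ this (div_nonneg hA₀.le (by rw [Complex.ofReal_re]; linarith)) (by norm_num)
        rw [Complex.norm_real, Real.norm_of_nonneg (by linarith)]
        linarith
      have h2 : ((κ : ℂ) * ((β : ℂ) / (β - 1))).re = κ * (β / (β - 1)) := by
        rw [← Complex.ofReal_one, ← Complex.ofReal_sub, ← Complex.ofReal_div, ← Complex.ofReal_mul,
          Complex.ofReal_re]
      rw [Complex.add_re, h2]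
      have h3 := (Complex.re_le_norm (twRem r 1 κ (β : ℂ))).trans h1
      have h4 : β - 1 = -ε₂ := by rw [hβ]; ring
      have h5 : κ * (β / (β - 1)) ≤ -D := by
        rw [h4, div_neg, mul_neg, neg_le_neg_iff, ← mul_div_assoc, le_div_iff₀ hε₂0]
        nlinarith
      linarith
    refine ⟨c₂ * ε₂ * A ^ (-ε₁), by positivity, fun q χ hq hp hcχ hcχ2 => ?_⟩
    have hq' : (1 : ℝ) ≤ q := by exact_mod_cast hq
    have t2 := h.twist q χ hq
    rw [hcχ] at t2
    have hnz : ∀ σ : ℝ, β ≤ σ → σ ≤ 1 → twRem r (charHom χ) 0 σ ≠ 0 := by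
      intro σ h1 h2
      rcases h2.lt_or_eq with h2 | rfl
      · exact hcase q χ σ hq hcχ hcχ2 (by linarith) h2
      · simpa using h.ne_zero q χ hq hcχ
    have hpos := hm.twRem_nonneg hb t2 (h.quadratic hq hcχ2) (by linarith) hnz (by linarith)
    have key := est2 (charHom χ) _ β t2 (h.quadratic hq hcχ2) (by linarith) (by linarith) (by
      rw [Complex.mul_re, hpos.2, mul_zero, sub_zero]
      exact mul_nonpos_of_nonpos_of_nonneg hre hpos.1)
    have hβ' : 1 - β = ε₂ := by rw [hβ]; ring
    rw [hβ'] at key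
    refine le_trans ?_ (key.trans (Complex.re_le_norm _))
    have e1 : (A * (q : ℝ) ^ E) ^ (-ε₁) ≤ (A * (q : ℝ) ^ E) ^ (-(C₂ * ε₂)) := by
      refine Real.rpow_le_rpow_of_exponent_le t2.one_le ?_
      have : C₂ * ε₂ ≤ C₂ * ε₀ := by gcongr
      linarith
    have e2 := exists_rpow_le hA (hε₁E.trans (by linarith : ε / 2 ≤ ε)) q hq'
    calc c₂ * ε₂ * A ^ (-ε₁) * (q : ℝ) ^ (-ε) = c₂ * ε₂ * (A ^ (-ε₁) * (q : ℝ) ^ (-ε)) := by ring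
      _ ≤ _ := by gcongr; exact e2.trans e1

end

/-! ### Lower bounds to the right of the line `Re s = 1` -/

section
variable {r b : ℕ → ℝ} {κ δ A₀ A : ℝ} {E : ℕ} {c : ∀ q : ℕ, DirichletCharacter ℂ q → ℂ}

theorem IsMangoldt.norm_LSeries_ge_of_lt (hm : IsMangoldt r b) (hb : TwistBase r κ δ A₀)
    {u : ℕ →* ℂ} (hu : ∀ n, ‖u n‖ ≤ 1) {C τ σ t : ℝ} (hC : 1 ≤ C) (hτ : 0 < τ)
    (hZ : ‖LSeries (twCoeff r 1) σ‖ ≤ C / (σ - 1)) (hσ : τ ≤ σ - 1) :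
    τ / C ≤ ‖LSeries (twCoeff r u) (σ + t * Complex.I)‖ := by
  have h1 := hm.one_le_mul_norm hb hu (σ := σ) (by linarith) t
  have h2 : 1 ≤ C / (σ - 1) * ‖LSeries (twCoeff r u) (σ + t * Complex.I)‖ :=
    h1.trans (by gcongr)
  rw [div_mul_eq_mul_div, le_div_iff₀ (by linarith)] at h2
  rw [div_le_iff₀ (by linarith)]
  linarith

theorem convex_strip : Convex ℝ {z : ℂ | 1 ≤ z.re ∧ |z.im| ≤ 1} := by
  have : {z : ℂ | 1 ≤ z.re ∧ |z.im| ≤ 1} = ({z : ℂ | 1 ≤ z.re} ∩ {z : ℂ | -1 ≤ z.im}) ∩ {z : ℂ | z.im ≤ 1} := by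
    ext z
    simp only [Set.mem_ofPred_eq, Set.mem_inter_iff, abs_le]
    tauto
  rw [this]
  exact ((convex_halfSpace_re_ge 1).inter (convex_halfSpace_im_ge _)).inter (convex_halfSpace_im_le 1)

theorem norm_sub_one_le (σ t : ℝ) (hσ : 1 ≤ σ) : ‖(σ + t * Complex.I : ℂ) - 1‖ ≤ (σ - 1) + |t| := by
  have : (σ + t * Complex.I : ℂ) - 1 = ((σ - 1 : ℝ) : ℂ) + t * Complex.I := by push_cast; ring
  rw [this]
  refine (norm_add_le _ _).trans ?_
  rw [norm_mul, Complex.norm_I, mul_one, Complex.norm_real, Complex.norm_real, Real.norm_eq_abs,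
    Real.norm_eq_abs, abs_of_nonneg (by linarith)]

theorem CharFamily.exists_norm_ge (h : CharFamily r b κ δ A₀ A E c) (hE : 1 ≤ E) {ε : ℝ}
    (hε : 0 < ε) :
    ∃ c₀ : ℝ, 0 < c₀ ∧ ∀ (q : ℕ) (χ : DirichletCharacter ℂ q), 1 ≤ q → χ.IsPrimitive → c q χ = 0 →
      ∀ σ t : ℝ, 1 < σ → σ ≤ 2 → c₀ / (A * (q : ℝ) ^ E * (2 + |t|)) ^ ε ≤
        ‖twRem r (charHom χ) 0 (σ + t * Complex.I)‖ := by
  have hb := h.base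
  have hm := h.mangoldt
  have hA := h.one_le_A
  set e := ε / 21 with he
  have he0 : 0 < e := by positivity
  obtain ⟨c₁, hc₁, hS⟩ := h.siegel he0
  obtain ⟨c₂, hc₂, hG⟩ := hm.exists_norm_LSeries_ge hb he0
  obtain ⟨C, hC, hZ⟩ := hb.exists_norm_LSeries_one_le
  obtain ⟨η, D, hη, hηδ, hD, hH⟩ := hb.exists_norm_deriv_twRem_le he0
  set D' := D * 2 ^ e with hD'
  have hD'0 : 0 < D' := by positivity
  set a := min 1 (c₁ / (4 * D')) with ha
  have ha0 : 0 < a := by positivity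
  have ha1 : a ≤ 1 := min_le_left _ _
  have haD : a * (4 * D') ≤ c₁ := by
    have : a ≤ c₁ / (4 * D') := min_le_right _ _
    rwa [le_div_iff₀ (by positivity)] at this
  set c₃ := min (min (c₁ / 2) (a / C)) (c₂ * a ^ 7) with hc₃
  refine ⟨c₃, by positivity, ?_⟩
  intro q χ hq hp hcχ σ t hσ hσ2
  have hq' : (1 : ℝ) ≤ q := by exact_mod_cast hq
  have tw := h.twist q χ hq
  rw [hcχ] at tw
  have tw2 := h.twist q (χ ^ 2) hq
  rw [charHom_pow χ 2 two_ne_zero] at tw2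
  set B := A * (q : ℝ) ^ E with hB
  have hB1 : 1 ≤ B := tw.one_le
  set X := B * (2 + |t|) with hX
  have hX1 : 1 ≤ X := one_le_cond hB1 t
  have hBX : 2 * B ≤ X := by
    have := abs_nonneg t
    rw [hX]; nlinarith
  have hqX : (q : ℝ) ≤ X := by
    have h1 : (q : ℝ) ≤ (q : ℝ) ^ E := le_self_pow₀ hq' (by omega)
    have h2 : (q : ℝ) ^ E ≤ B := by rw [hB]; nlinarith
    linarith
  set P := X ^ e with hP
  have hP1 : 1 ≤ P := Real.one_le_rpow hX1 he0.le
  have hP0 : 0 < P := by linarith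
  have hXε : X ^ ε = P ^ 21 := by
    rw [hP, ← Real.rpow_natCast, ← Real.rpow_mul (by linarith)]
    congr 1; rw [he]; push_cast; ring
  rw [hXε]
  have hL : LSeries (twCoeff r (charHom χ)) (σ + t * Complex.I)
      = twRem r (charHom χ) 0 (σ + t * Complex.I) := by
    rw [tw.LSeries_eq hb (by simpa using hσ), zero_mul, zero_add]
  set τ := a / P ^ 2 with hτ
  have hτ0 : 0 < τ := by positivity
  have hτ1 : τ ≤ 1 := by
    rw [hτ, div_le_one (by positivity)]
    exact ha1.trans (one_le_pow₀ hP1)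
  have hpow : ∀ (k : ℕ) (y : ℝ), k ≤ 21 → 0 ≤ y → y / P ^ 21 ≤ y / P ^ k := by
    intro k y hk hy
    gcongr
  have hcase3 : (c q (χ ^ 2) = 0 ∨ τ ≤ |t|) →
      c₃ / P ^ 21 ≤ ‖twRem r (charHom χ) 0 (σ + t * Complex.I)‖ := by
    intro hor
    have h1 := hG (charHom χ) 0 (c q (χ ^ 2)) B tw tw2 σ t τ hσ hσ2 hτ0 hτ1 (Or.inl rfl) hor
    rw [hL] at h1
    refine le_trans ?_ h1
    rw [← hX, ← hP, hτ]
    have : c₂ / (P / (a / P ^ 2)) ^ 7 = (c₂ * a ^ 7) / P ^ 21 := by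
      field_simp
    rw [this]
    gcongr
    exact min_le_right _ _
  by_cases hχ2 : c q (χ ^ 2) = 0
  · exact hcase3 (Or.inl hχ2)
  rcases le_or_gt τ |t| with ht | ht
  · exact hcase3 (Or.inr ht)
  rcases le_or_gt τ (σ - 1) with hs | hs
  · have h1 := hm.norm_LSeries_ge_of_lt hb tw.norm_le (t := t) hC hτ0 (hZ σ hσ hσ2) hs
    rw [hL] at h1
    refine le_trans ?_ h1
    have : τ / C = (a / C) / P ^ 2 := by rw [hτ]; field_simp
    rw [this]
    refine le_trans ?_ (hpow 2 (a / C) (by norm_num) (by positivity))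
    gcongr
    exact (min_le_left _ _).trans (min_le_right _ _)
  · have h1 : c₁ / P ≤ ‖twRem r (charHom χ) 0 1‖ := by
      refine le_trans ?_ (hS q χ hq hp hcχ hχ2)
      rw [div_eq_mul_inv, hP, ← Real.rpow_neg (by linarith)]
      gcongr ?_ * ?_
      exact Real.rpow_le_rpow_of_nonpos (by linarith) hqX (by linarith)
    have h2 : ‖twRem r (charHom χ) 0 (σ + t * Complex.I) - twRem r (charHom χ) 0 1‖
        ≤ D' * P * ‖(σ + t * Complex.I : ℂ) - 1‖ := by
      refine convex_strip.norm_image_sub_le_of_norm_deriv_le (𝕜 := ℂ)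
        (fun z hz => tw.differentiableAt (by linarith [hz.1])) (fun z hz => ?_)
        ⟨by simp, by simp⟩ ⟨by simpa using hσ.le, by simpa using ht.le.trans hτ1⟩
      refine (hH _ _ _ tw z (by linarith [hz.1])).2.trans ?_
      have h3 : B * (2 + |z.im|) ≤ 2 * X := by nlinarith [hz.2]
      have h4 : (B * (2 + |z.im|)) ^ e ≤ 2 ^ e * P := by
        rw [hP, ← Real.mul_rpow (by norm_num) (by linarith)]
        exact Real.rpow_le_rpow (by positivity) h3 he0.le
      calc D * (B * (2 + |z.im|)) ^ e ≤ D * (2 ^ e * P) := by gcongr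
        _ = D' * P := by rw [hD']; ring
    have h3 : ‖(σ + t * Complex.I : ℂ) - 1‖ ≤ 2 * τ :=
      (norm_sub_one_le σ t hσ.le).trans (by linarith)
    have h4 : D' * P * (2 * τ) ≤ c₁ / 2 / P := by
      rw [hτ, le_div_iff₀ hP0]
      have : D' * P * (2 * (a / P ^ 2)) * P = a * (4 * D') / 2 := by field_simp; ring
      rw [this]; linarith
    have h5 : ‖twRem r (charHom χ) 0 1‖ - ‖twRem r (charHom χ) 0 (σ + t * Complex.I)
        - twRem r (charHom χ) 0 1‖ ≤ ‖twRem r (charHom χ) 0 (σ + t * Complex.I)‖ := by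
      have := norm_sub_norm_le (twRem r (charHom χ) 0 1) (twRem r (charHom χ) 0 1
        - twRem r (charHom χ) 0 (σ + t * Complex.I))
      rw [sub_sub_cancel, norm_sub_rev (twRem r (charHom χ) 0 1)] at this
      exact this
    have h6 : D' * P * ‖(σ + t * Complex.I : ℂ) - 1‖ ≤ D' * P * (2 * τ) := by gcongr
    have h7 : c₁ / P = c₁ / 2 / P + c₁ / 2 / P := by ring
    have h8 : c₃ / P ^ 21 ≤ c₁ / 2 / P ^ 1 := by
      refine le_trans ?_ (hpow 1 (c₁ / 2) (by norm_num) (by positivity))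
      gcongr
      exact (min_le_left _ _).trans (min_le_left _ _)
    rw [pow_one] at h8
    linarith

/-- The base Dirichlet series multiplied by `(s - 1) / s`. -/
noncomputable def zetaReg (r : ℕ → ℝ) (κ : ℝ) (s : ℂ) : ℂ := κ + (s - 1) / s * twRem r 1 κ s

theorem TwistBase.LSeries_eq_zetaReg (hb : TwistBase r κ δ A₀) {s : ℂ} (hs : 1 < s.re) :
    LSeries (twCoeff r 1) s = s / (s - 1) * zetaReg r κ s := by
  have h1 : s - 1 ≠ 0 := sub_ne_zero.mpr (by rintro rfl; simp at hs)
  have h0 : s ≠ 0 := by rintro rfl; simp at hs; linarith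
  rw [hb.twist.LSeries_eq hb hs, zetaReg]
  field_simp

theorem IsMangoldt.exists_norm_zetaReg_ge (hm : IsMangoldt r b) (hb : TwistBase r κ δ A₀) {ε : ℝ}
    (hε : 0 < ε) :
    ∃ c₀ : ℝ, 0 < c₀ ∧ ∀ σ t : ℝ, 1 < σ → σ ≤ 2 → c₀ / (A₀ * (2 + |t|)) ^ ε ≤
        ‖zetaReg r κ (σ + t * Complex.I)‖ := by
  have hκ := hb.κ_pos
  have hA := hb.twist.one_le
  set e := ε / 7 with he
  have he0 : 0 < e := by positivity
  obtain ⟨c₂, hc₂, hG⟩ := hm.exists_norm_LSeries_ge hb he0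
  obtain ⟨C, hC, hZ⟩ := hb.exists_norm_LSeries_one_le
  obtain ⟨η, D, hη, hηδ, hD, hH⟩ := hb.exists_norm_twRem_le he0
  set D' := D * (A₀ * 3) ^ e with hD'
  have hD'0 : 0 < D' := by positivity
  set τ := min 1 (κ / (4 * D')) with hτ
  have hτ0 : 0 < τ := by positivity
  have hτ1 : τ ≤ 1 := min_le_left _ _
  have hτD : τ * (4 * D') ≤ κ := by
    have : τ ≤ κ / (4 * D') := min_le_right _ _
    rwa [le_div_iff₀ (by positivity)] at this
  set c₃ := min (min (κ / 2) (τ / C * (τ / 3))) (c₂ * τ ^ 7 * (τ / 3)) with hc₃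
  have hc₃0 : 0 < c₃ := by positivity
  refine ⟨c₃, hc₃0, fun σ t hσ hσ2 => ?_⟩
  set X := A₀ * (2 + |t|) with hX
  have hX1 : 1 ≤ X := one_le_cond hA t
  have hXe : 1 ≤ X ^ ε := Real.one_le_rpow hX1 hε.le
  set s : ℂ := σ + t * Complex.I with hs
  have hsre : s.re = σ := by simp [hs]
  have hs1 : 1 < s.re := by rw [hsre]; exact hσ
  have hσn : σ ≤ ‖s‖ := hsre ▸ Complex.re_le_norm s
  have hs0 : s ≠ 0 := by rw [← norm_pos_iff]; linarith
  have hs10 : s - 1 ≠ 0 := sub_ne_zero.mpr (by rintro h; rw [h] at hs1; simp at hs1)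
  have hsim : s.im = t := by simp [hs]
  have hZeq : zetaReg r κ s = (s - 1) / s * LSeries (twCoeff r 1) s := by
    rw [hb.LSeries_eq_zetaReg hs1]; field_simp
  have hsn : ‖s‖ ≤ 2 + |t| := by
    rw [hs]
    refine (norm_add_le _ _).trans ?_
    rw [norm_mul, Complex.norm_I, mul_one, Complex.norm_real, Complex.norm_real, Real.norm_eq_abs,
      Real.norm_eq_abs, abs_of_nonneg (by linarith)]
    linarith
  have hone : ∀ n, ‖(1 : ℕ →* ℂ) n‖ ≤ 1 := by simp
  have hweak : c₃ / X ^ ε ≤ c₃ := div_le_self hc₃0.le hXe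
  rcases le_or_gt τ |t| with ht | ht
  · have h1 := hG 1 κ κ A₀ hb.twist (by rw [one_pow]; exact hb.twist) σ t τ hσ hσ2 hτ0 hτ1
      (Or.inr ht) (Or.inr ht)
    rw [← hs, ← hX] at h1
    have h2 : τ / 3 ≤ ‖(s - 1) / s‖ := by
      rw [norm_div, div_le_div_iff₀ (by norm_num) (by linarith)]
      have h3 : |t| ≤ ‖s - 1‖ := by
        have := Complex.abs_im_le_norm (s - 1)
        rwa [Complex.sub_im, hsim, Complex.one_im, sub_zero] at this
      have := abs_nonneg t
      nlinarith
    have h3 : (X ^ e / τ) ^ 7 = X ^ ε / τ ^ 7 := by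
      rw [div_pow, ← Real.rpow_natCast, ← Real.rpow_mul (by linarith)]
      congr 2; rw [he]; push_cast; ring
    rw [h3] at h1
    rw [hZeq, norm_mul]
    calc c₃ / X ^ ε ≤ (c₂ * τ ^ 7 * (τ / 3)) / X ^ ε := by gcongr; exact min_le_right _ _
      _ = (τ / 3) * (c₂ / (X ^ ε / τ ^ 7)) := by field_simp
      _ ≤ _ := by gcongr
  rcases le_or_gt τ (σ - 1) with hs' | hs'
  · have h1 := hm.norm_LSeries_ge_of_lt hb hone (t := t) hC hτ0 (hZ σ hσ hσ2) hs'
    rw [← hs] at h1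
    have h2 : τ / 3 ≤ ‖(s - 1) / s‖ := by
      rw [norm_div, div_le_div_iff₀ (by norm_num) (by linarith)]
      have h3 : σ - 1 ≤ ‖s - 1‖ := by
        have := Complex.re_le_norm (s - 1)
        rwa [Complex.sub_re, hsre, Complex.one_re] at this
      nlinarith
    rw [hZeq, norm_mul]
    refine hweak.trans ?_
    calc c₃ ≤ τ / C * (τ / 3) := (min_le_left _ _).trans (min_le_right _ _)
      _ = τ / 3 * (τ / C) := by ring
      _ ≤ _ := by gcongr
  · have h1 : ‖twRem r 1 κ s‖ ≤ D' := by
      refine (hH _ _ _ hb.twist s (by rw [hsre]; linarith)).trans ?_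
      rw [hD', hsim]
      gcongr
      linarith
    have h2 : ‖(s - 1) / s‖ ≤ 2 * τ := by
      rw [norm_div, div_le_iff₀ (by linarith)]
      have := norm_sub_one_le σ t hσ.le
      rw [← hs] at this
      nlinarith
    have h3 : ‖(s - 1) / s * twRem r 1 κ s‖ ≤ κ / 2 := by
      rw [norm_mul]
      calc _ ≤ 2 * τ * D' := by gcongr
        _ ≤ κ / 2 := by linarith
    refine hweak.trans ?_
    have h4 : κ - ‖(s - 1) / s * twRem r 1 κ s‖ ≤ ‖zetaReg r κ s‖ := by
      rw [zetaReg]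
      have := norm_sub_norm_le (κ : ℂ) (-((s - 1) / s * twRem r 1 κ s))
      rw [sub_neg_eq_add, norm_neg, Complex.norm_real, Real.norm_of_nonneg hκ.le] at this
      exact this
    have h5 : c₃ ≤ κ / 2 := (min_le_left _ _).trans (min_le_left _ _)
    linarith

end

/-! ### Derivatives of logarithmic derivatives near the line `Re s = 1` -/

theorem re_im_of_mem_closedBall {σ t ρ : ℝ} {z : ℂ}
    (hz : z ∈ Metric.closedBall (σ + t * Complex.I : ℂ) ρ) : σ - ρ ≤ z.re ∧ |z.im - t| ≤ ρ := by
  rw [Metric.mem_closedBall, dist_eq_norm] at hz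
  have h1 := (Complex.abs_re_le_norm _).trans hz
  have h2 := (Complex.abs_im_le_norm _).trans hz
  simp at h1 h2
  exact ⟨by linarith [(abs_le.mp h1).1], h2⟩

theorem logDeriv_bound_closedBall {L : ℂ → ℂ} {η D c₀ ε B : ℝ} (hη : 0 < η) (hD : 1 ≤ D) (hc₀ : 0 < c₀)
    (hε : 0 < ε) (hε1 : ε ≤ 1) (hB : 1 ≤ B)
    (hL : ∀ z : ℂ, 1 - 2 * η < z.re → DifferentiableAt ℂ L z)
    (hL' : ∀ z : ℂ, 1 - η ≤ z.re → ‖deriv L z‖ ≤ D * (B * (2 + |z.im|)) ^ ε)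
    (hlow : ∀ σ t : ℝ, 1 < σ → σ ≤ 2 → c₀ / (B * (2 + |t|)) ^ ε ≤ ‖L (σ + t * Complex.I)‖)
    {σ t : ℝ} (hσ : 1 < σ) (hσ2 : σ ≤ 2) (z : ℂ)
    (hz : z ∈ Metric.closedBall (σ + t * Complex.I : ℂ)
      (min (min η (1 / 2)) (c₀ / (4 * D)) / ((B * (2 + |t|)) ^ ε) ^ 2)) :
    DifferentiableAt ℂ (fun z => deriv L z / L z) z ∧
      ‖deriv L z / L z‖ ≤ 4 * D / c₀ * ((B * (2 + |t|)) ^ ε) ^ 2 := by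
  set X := B * (2 + |t|) with hX
  have hX1 : 1 ≤ X := one_le_cond hB t
  set P := X ^ ε with hP
  have hP1 : 1 ≤ P := Real.one_le_rpow hX1 hε.le
  set a := min (min η (1 / 2)) (c₀ / (4 * D)) with ha
  have ha0 : 0 < a := by positivity
  have haη : a ≤ η := (min_le_left _ _).trans (min_le_left _ _)
  have ha2 : a ≤ 1 / 2 := (min_le_left _ _).trans (min_le_right _ _)
  have hac : a * (4 * D) ≤ c₀ := by
    have : a ≤ c₀ / (4 * D) := min_le_right _ _
    rwa [le_div_iff₀ (by positivity)] at this
  have hρa : a / P ^ 2 ≤ a := div_le_self ha0.le (one_le_pow₀ hP1)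
  have hbd : ∀ w ∈ Metric.closedBall (σ + t * Complex.I : ℂ) (a / P ^ 2),
      1 - η ≤ w.re ∧ ‖deriv L w‖ ≤ 2 * D * P := by
    intro w hw
    obtain ⟨h1, h2⟩ := re_im_of_mem_closedBall hw
    refine ⟨by linarith, (hL' w (by linarith)).trans ?_⟩
    have h3 : |w.im| ≤ |t| + 1 / 2 := by
      have := abs_sub_abs_le_abs_sub w.im t
      linarith
    have h4 : B * (2 + |w.im|) ≤ 2 * X := by
      rw [hX]
      have := abs_nonneg t
      nlinarith
    have h5 : (B * (2 + |w.im|)) ^ ε ≤ 2 * P := by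
      calc (B * (2 + |w.im|)) ^ ε ≤ (2 * X) ^ ε := Real.rpow_le_rpow (by positivity) h4 hε.le
        _ = 2 ^ ε * P := by rw [Real.mul_rpow (by norm_num) (by linarith)]
        _ ≤ 2 ^ (1 : ℝ) * P := by
            gcongr
            norm_num
        _ = 2 * P := by rw [Real.rpow_one]
    calc D * (B * (2 + |w.im|)) ^ ε ≤ D * (2 * P) := by gcongr
      _ = 2 * D * P := by ring
  have hρ0 : 0 < a / P ^ 2 := by positivity
  have hdist : ‖L z - L (σ + t * Complex.I)‖ ≤ 2 * D * P * ‖z - (σ + t * Complex.I)‖ :=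
    (convex_closedBall (σ + t * Complex.I : ℂ) (a / P ^ 2)).norm_image_sub_le_of_norm_deriv_le
      (fun w hw => hL w (by linarith [(hbd w hw).1])) (fun w hw => (hbd w hw).2)
      (Metric.mem_closedBall_self hρ0.le) hz
  have hz' : ‖z - (σ + t * Complex.I)‖ ≤ a / P ^ 2 := by
    rwa [Metric.mem_closedBall, dist_eq_norm] at hz
  have h1 : ‖L z - L (σ + t * Complex.I)‖ ≤ c₀ / (2 * P) := by
    refine hdist.trans ?_
    calc 2 * D * P * ‖z - (σ + t * Complex.I)‖ ≤ 2 * D * P * (a / P ^ 2) := by gcongr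
      _ = a * (4 * D) / (2 * P) := by field_simp; ring
      _ ≤ _ := by gcongr
  have h2 := hlow σ t hσ hσ2
  have h3 : c₀ / (2 * P) ≤ ‖L z‖ := by
    have h4 := norm_sub_norm_le (L (σ + t * Complex.I)) (L (σ + t * Complex.I) - L z)
    rw [sub_sub_cancel, norm_sub_rev] at h4
    have h5 : c₀ / P = c₀ / (2 * P) + c₀ / (2 * P) := by field_simp; ring
    rw [← hX, ← hP] at h2
    linarith
  have hpos : 0 < c₀ / (2 * P) := by positivity
  have hne : L z ≠ 0 := norm_pos_iff.mp (hpos.trans_le h3)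
  have hzre := (hbd z hz).1
  constructor
  · have hopen : IsOpen {s : ℂ | 1 - 2 * η < s.re} := isOpen_lt continuous_const Complex.continuous_re
    have hmem : z ∈ {s : ℂ | 1 - 2 * η < s.re} := by
      change 1 - 2 * η < z.re
      linarith
    have han : AnalyticAt ℂ L z := DifferentiableOn.analyticAt
      (fun w hw => (hL w hw).differentiableWithinAt) (hopen.mem_nhds hmem)
    exact han.deriv.differentiableAt.div (hL z hmem) hne
  · rw [norm_div, div_le_iff₀ (by linarith)]
    calc ‖deriv L z‖ ≤ 2 * D * P := (hbd z hz).2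
      _ = 4 * D / c₀ * P ^ 2 * (c₀ / (2 * P)) := by field_simp; ring
      _ ≤ _ := by gcongr

theorem norm_iteratedDeriv_LSeries_div_le {d : ℕ → ℂ} {F : ℂ → ℂ}
    (hF : ∀ s : ℂ, 1 < s.re → LSeries d s = F s) {a W B ε : ℝ} (ha : 0 < a) (ha2 : a ≤ 1 / 2)
    (hW : 0 ≤ W) (hε : 0 < ε) (hB : 1 ≤ B) {σ t : ℝ} (hσ : 1 < σ)
    (hbd : ∀ z ∈ Metric.closedBall (σ + t * Complex.I : ℂ) (a / ((B * (2 + |t|)) ^ ε) ^ 2),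
      DifferentiableAt ℂ F z ∧ ‖F z‖ ≤ W * ((B * (2 + |t|)) ^ ε) ^ 2) {j k : ℕ} (hj : j ≤ k)
    (hk : ε * (4 * (k + 1)) = 1) :
    ‖iteratedDeriv j (fun s => LSeries d s / (s * (s + 1))) (σ + t * Complex.I)‖ ≤
      6 * W * k.factorial / a ^ k * ((B * (2 + |t|)) ^ (1 / 2 : ℝ) / (1 + t ^ 2)) := by
  set X := B * (2 + |t|) with hX
  have hX1 : 1 ≤ X := one_le_cond hB t
  set P := X ^ ε with hP
  have hP1 : 1 ≤ P := Real.one_le_rpow hX1 hε.le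
  set s₀ : ℂ := σ + t * Complex.I with hs₀
  have hs₀re : s₀.re = σ := by simp [hs₀]
  set ρ := a / P ^ 2 with hρ
  have hρ0 : 0 < ρ := by positivity
  have hρa : ρ ≤ a := div_le_self ha.le (one_le_pow₀ hP1)
  have hev : (fun s => LSeries d s / (s * (s + 1))) =ᶠ[nhds s₀] fun s => F s / (s * (s + 1)) := by
    filter_upwards [(isOpen_lt continuous_const Complex.continuous_re).mem_nhds
        (show (1 : ℝ) < s₀.re by rw [hs₀re]; exact hσ)] with w hw
    rw [hF w hw]
  rw [hev.iteratedDeriv_eq j]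
  have hlow : ∀ z ∈ Metric.closedBall s₀ ρ, (1 + t ^ 2) / 6 ≤ ‖z * (z + 1)‖ := by
    intro z hz
    obtain ⟨h1, h2⟩ := re_im_of_mem_closedBall hz
    have h3 : 1 / 2 ≤ z.re := by linarith
    have h4 : ‖z‖ ≤ ‖z + 1‖ := by
      rw [← sq_le_sq₀ (norm_nonneg _) (norm_nonneg _), Complex.sq_norm, Complex.sq_norm,
        Complex.normSq_apply, Complex.normSq_apply]
      simp only [Complex.add_re, Complex.add_im, Complex.one_re, Complex.one_im]
      nlinarith
    have h5 : (1 + t ^ 2) / 6 ≤ ‖z‖ ^ 2 := by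
      rw [Complex.sq_norm, Complex.normSq_apply]
      have h6 : |z.im - t| ≤ 1 / 2 := by linarith
      have h7 : (z.im - t) ^ 2 ≤ (1 / 2) ^ 2 := by
        rw [← sq_abs]
        exact pow_le_pow_left₀ (abs_nonneg _) h6 2
      have h8 : 1 / 2 * (1 / 2) ≤ z.re * z.re := by gcongr
      nlinarith [sq_nonneg (z.im + (z.im - t))]
    rw [norm_mul]
    nlinarith [norm_nonneg z]
  have ht2 : 0 < 1 + t ^ 2 := by positivity
  have hne : ∀ z ∈ Metric.closedBall s₀ ρ, z * (z + 1) ≠ 0 := fun z hz =>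
    norm_pos_iff.mp (lt_of_lt_of_le (by positivity) (hlow z hz))
  have hdc : DiffContOnCl ℂ (fun s => F s / (s * (s + 1))) (Metric.ball s₀ ρ) := by
    refine DifferentiableOn.diffContOnCl fun z hz => ?_
    have hz' := Metric.closure_ball_subset_closedBall hz
    refine (DifferentiableAt.div (hbd z hz').1 ?_ (hne z hz')).differentiableWithinAt
    fun_prop
  have h1 := Complex.norm_iteratedDeriv_le_of_forall_mem_sphere_norm_le j hρ0 hdc
    (C := W * P ^ 2 * (6 / (1 + t ^ 2))) (fun z hz => by
      have hz' := Metric.sphere_subset_closedBall hz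
      rw [norm_div, div_le_iff₀ (norm_pos_iff.mpr (hne z hz'))]
      calc ‖F z‖ ≤ W * P ^ 2 := (hbd z hz').2
        _ = W * P ^ 2 * (6 / (1 + t ^ 2)) * ((1 + t ^ 2) / 6) := by field_simp
        _ ≤ _ := by gcongr; exact hlow z hz')
  refine h1.trans ?_
  have hjk : (j.factorial : ℝ) ≤ k.factorial := by exact_mod_cast Nat.factorial_le hj
  have hak : 1 / ρ ^ j ≤ (P ^ 2) ^ k / a ^ k := by
    have h2 : 1 / ρ ^ j = (P ^ 2 / a) ^ j := by rw [hρ, one_div, ← inv_pow, inv_div]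
    rw [h2, ← div_pow]
    refine pow_le_pow_right₀ ?_ hj
    rw [one_le_div ha]
    have : 1 ≤ P ^ 2 := one_le_pow₀ hP1
    linarith
  have hPX : P ^ 2 * (P ^ 2) ^ k = X ^ (1 / 2 : ℝ) := by
    rw [← pow_mul, ← pow_add, hP, ← Real.rpow_natCast, ← Real.rpow_mul (by linarith)]
    congr 1
    push_cast
    linarith
  calc (j.factorial : ℝ) * (W * P ^ 2 * (6 / (1 + t ^ 2))) / ρ ^ j
      = j.factorial * (W * P ^ 2 * (6 / (1 + t ^ 2))) * (1 / ρ ^ j) := by ring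
    _ ≤ k.factorial * (W * P ^ 2 * (6 / (1 + t ^ 2))) * ((P ^ 2) ^ k / a ^ k) := by gcongr
    _ = 6 * W * k.factorial / a ^ k * ((P ^ 2 * (P ^ 2) ^ k) / (1 + t ^ 2)) := by ring
    _ = _ := by rw [hPX]

section
variable {r b : ℕ → ℝ} {κ δ A₀ A : ℝ} {E : ℕ} {c : ∀ q : ℕ, DirichletCharacter ℂ q → ℂ}

theorem CharFamily.exists_norm_iteratedDeriv_le (h : CharFamily r b κ δ A₀ A E c) (hE : 1 ≤ E)
    (k : ℕ) :
    ∃ C : ℝ, 0 < C ∧ ∀ (q : ℕ) (χ : DirichletCharacter ℂ q), 1 ≤ q → χ.IsPrimitive → c q χ = 0 →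
      ∀ j ≤ k, ∀ σ t : ℝ, 1 < σ → σ ≤ 2 →
        ‖iteratedDeriv j (fun s => LSeries (twCoeff b (charHom χ)) s / (s * (s + 1)))
          (σ + t * Complex.I)‖ ≤
          C * ((A * (q : ℝ) ^ E * (2 + |t|)) ^ (1 / 2 : ℝ) / (1 + t ^ 2)) := by
  have hb := h.base
  have hm := h.mangoldt
  set ε : ℝ := 1 / (4 * (k + 1)) with hε
  have hε0 : 0 < ε := by positivity
  have hεk : ε * (4 * (k + 1)) = 1 := by rw [hε]; field_simp
  have hε1 : ε ≤ 1 := by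
    have : (0 : ℝ) ≤ k := Nat.cast_nonneg k
    nlinarith
  obtain ⟨c₀, hc₀, hlow⟩ := h.exists_norm_ge hE hε0
  obtain ⟨η, D, hη, hηδ, hD, hH⟩ := hb.exists_norm_deriv_twRem_le hε0
  set a := min (min η (1 / 2)) (c₀ / (4 * D)) with ha
  have ha0 : 0 < a := by positivity
  have ha2 : a ≤ 1 / 2 := (min_le_left _ _).trans (min_le_right _ _)
  refine ⟨6 * (4 * D / c₀) * k.factorial / a ^ k, by positivity, ?_⟩
  intro q χ hq hp hcχ j hj σ t hσ hσ2
  have tw := h.twist q χ hq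
  rw [hcχ] at tw
  have hL : ∀ s : ℂ, 1 < s.re → LSeries (twCoeff r (charHom χ)) s = twRem r (charHom χ) 0 s := by
    intro s hs
    rw [tw.LSeries_eq hb hs, zero_mul, zero_add]
  have hF : ∀ s : ℂ, 1 < s.re → LSeries (twCoeff b (charHom χ)) s
      = -(deriv (twRem r (charHom χ) 0) s / twRem r (charHom χ) 0 s) := by
    intro s hs
    have hev : LSeries (twCoeff r (charHom χ)) =ᶠ[nhds s] twRem r (charHom χ) 0 := by
      filter_upwards [(isOpen_lt continuous_const Complex.continuous_re).mem_nhds hs] with w hw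
      exact hL w hw
    rw [hm.log_deriv hb tw.norm_le hs, hev.deriv_eq, hL s hs]
  refine norm_iteratedDeriv_LSeries_div_le (W := 4 * D / c₀) hF ha0 ha2 (by positivity) hε0 tw.one_le hσ
    (fun z hz => ?_) hj hεk
  have := logDeriv_bound_closedBall hη hD hc₀ hε0 hε1 tw.one_le
    (fun z hz => tw.differentiableAt (by linarith)) (fun z hz => (hH _ _ _ tw z hz).2)
    (fun σ t h1 h2 => hlow q χ hq hp hcχ σ t h1 h2) hσ hσ2 z hz
  exact ⟨this.1.neg, by rw [norm_neg]; exact this.2⟩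

theorem TwistBase.hasDerivAt_zetaReg (hb : TwistBase r κ δ A₀) {s : ℂ} (hs : 1 - δ < s.re) :
    HasDerivAt (zetaReg r κ) (1 / s ^ 2 * twRem r 1 κ s + (s - 1) / s * deriv (twRem r 1 κ) s) s := by
  have hs0 : s ≠ 0 := by
    rintro rfl
    have := hb.δ_le
    simp at hs; linarith
  have h1 := (hb.twist.differentiableAt hs).hasDerivAt
  have h2 : HasDerivAt (fun s : ℂ => (s - 1) / s) (1 / s ^ 2) s := by
    refine (((hasDerivAt_id s).sub_const 1).div (hasDerivAt_id s) hs0).congr_deriv ?_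
    simp only [id]
    ring
  exact (h2.mul h1).const_add (κ : ℂ)

theorem IsMangoldt.LSeries_sub_eq (hm : IsMangoldt r b) (hb : TwistBase r κ δ A₀) {s : ℂ}
    (hs : 1 < s.re) :
    LSeries (fun n => (b n : ℂ) - r n / κ) s = -(deriv (zetaReg r κ) s / zetaReg r κ s) - 1 / s - 1
      - twRem r 1 κ s / κ := by
  have hκ : (κ : ℂ) ≠ 0 := by exact_mod_cast hb.κ_pos.ne'
  have hδ := hb.δ_pos
  have h1 : s - 1 ≠ 0 := sub_ne_zero.mpr (by rintro rfl; simp at hs)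
  have h0 : s ≠ 0 := by rintro rfl; simp at hs; linarith
  have hone : ∀ n, ‖(1 : ℕ →* ℂ) n‖ ≤ 1 := by simp
  have hev : LSeries (twCoeff r 1) =ᶠ[nhds s] fun w => w / (w - 1) * zetaReg r κ w := by
    filter_upwards [(isOpen_lt continuous_const Complex.continuous_re).mem_nhds hs] with w hw
    exact hb.LSeries_eq_zetaReg hw
  have hZd := hb.hasDerivAt_zetaReg (s := s) (by linarith)
  have hq : HasDerivAt (fun w : ℂ => w / (w - 1)) (-1 / (s - 1) ^ 2) s := by
    refine ((hasDerivAt_id s).div ((hasDerivAt_id s).sub_const 1) h1).congr_deriv ?_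
    simp only [id]
    ring
  have hder : deriv (LSeries (twCoeff r 1)) s
      = -1 / (s - 1) ^ 2 * zetaReg r κ s + s / (s - 1) * deriv (zetaReg r κ) s := by
    rw [hev.deriv_eq]
    rw [hZd.deriv]
    exact (hq.mul hZd).deriv
  have hLne : LSeries (twCoeff r 1) s ≠ 0 := by
    rw [hm.LSeries_eq_exp hb hone hs]; exact Complex.exp_ne_zero _
  have hZne : zetaReg r κ s ≠ 0 := by
    intro h
    rw [hb.LSeries_eq_zetaReg hs, h, mul_zero] at hLne
    exact hLne rfl
  have hsum : LSeries (fun n => (b n : ℂ) - r n / κ) s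
      = LSeries (twCoeff b 1) s - (κ : ℂ)⁻¹ * LSeries (twCoeff r 1) s := by
    have e1 : (fun n => (b n : ℂ) - r n / κ) = twCoeff b 1 - (κ : ℂ)⁻¹ • twCoeff r 1 := by
      funext n
      simp [twCoeff, div_eq_inv_mul]
    rw [e1, LSeries_sub (hm.summable hb hone hs) ((hb.summable_twCoeff hone hs).smul _), LSeries_smul]
  rw [hsum, hm.log_deriv hb hone hs, hder]
  have e2 : (κ : ℂ)⁻¹ * LSeries (twCoeff r 1) s = s / (s - 1) + twRem r 1 κ s / κ := by
    rw [hb.twist.LSeries_eq hb hs]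
    field_simp
  rw [e2, hb.LSeries_eq_zetaReg hs]
  field_simp
  ring

theorem IsMangoldt.exists_norm_iteratedDeriv_le (hm : IsMangoldt r b) (hb : TwistBase r κ δ A₀)
    (k : ℕ) :
    ∃ C : ℝ, 0 < C ∧ ∀ j ≤ k, ∀ σ t : ℝ, 1 < σ → σ ≤ 2 →
        ‖iteratedDeriv j (fun s => LSeries (fun n => (b n : ℂ) - r n / κ) s / (s * (s + 1)))
          (σ + t * Complex.I)‖ ≤
          C * ((A₀ * (2 + |t|)) ^ (1 / 2 : ℝ) / (1 + t ^ 2)) := by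
  have hκ := hb.κ_pos
  have hA := hb.twist.one_le
  have hδ1 := hb.δ_le
  set ε : ℝ := 1 / (4 * (k + 1)) with hε
  have hε0 : 0 < ε := by positivity
  have hεk : ε * (4 * (k + 1)) = 1 := by rw [hε]; field_simp
  have hε1 : ε ≤ 1 := by
    have : (0 : ℝ) ≤ k := Nat.cast_nonneg k
    nlinarith
  obtain ⟨c₀, hc₀, hlow⟩ := hm.exists_norm_zetaReg_ge hb hε0
  obtain ⟨η, D, hη, hηδ, hD, hH⟩ := hb.exists_norm_deriv_twRem_le hε0
  have hD7 : 1 ≤ 7 * D := by linarith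
  set a := min (min η (1 / 2)) (c₀ / (4 * (7 * D))) with ha
  have ha0 : 0 < a := by positivity
  have ha2 : a ≤ 1 / 2 := (min_le_left _ _).trans (min_le_right _ _)
  have haη : a ≤ η := (min_le_left _ _).trans (min_le_left _ _)
  have hinv : ∀ z : ℂ, 1 - η ≤ z.re → 1 / 2 ≤ ‖z‖ := fun z hz => by
    have := Complex.re_le_norm z
    linarith
  set W := 4 * (7 * D) / c₀ + 2 + 1 + 2 * D / κ with hW
  refine ⟨6 * W * k.factorial / a ^ k, by positivity, ?_⟩
  intro j hj σ t hσ hσ2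
  refine norm_iteratedDeriv_LSeries_div_le (W := W) (fun s hs => hm.LSeries_sub_eq hb hs) ha0 ha2
    (by positivity) hε0 hA hσ (fun z hz => ?_) hj hεk
  have hmain := logDeriv_bound_closedBall hη hD7 hc₀ hε0 hε1 hA
    (fun z hz => (hb.hasDerivAt_zetaReg (by linarith)).differentiableAt) (fun z hz => ?_)
    hlow hσ hσ2 z hz
  · set X := A₀ * (2 + |t|) with hX
    have hX1 : 1 ≤ X := one_le_cond hA t
    set P := X ^ ε with hP
    have hP1 : 1 ≤ P := Real.one_le_rpow hX1 hε0.le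
    have hPP : P ≤ P ^ 2 := by nlinarith
    obtain ⟨h1, h2⟩ := re_im_of_mem_closedBall hz
    have hρa : a / P ^ 2 ≤ a := div_le_self ha0.le (one_le_pow₀ hP1)
    have hzre : 1 - η ≤ z.re := by linarith
    have hzn := hinv z hzre
    have hz0 : z ≠ 0 := by rw [← norm_pos_iff]; linarith
    have hzd := hb.twist.differentiableAt (s := z) (by linarith)
    have h3 : |z.im| ≤ |t| + 1 / 2 := by
      have := abs_sub_abs_le_abs_sub z.im t
      linarith
    have h4 : A₀ * (2 + |z.im|) ≤ 2 * X := by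
      rw [hX]
      have := abs_nonneg t
      nlinarith
    have h5 : (A₀ * (2 + |z.im|)) ^ ε ≤ 2 * P := by
      calc (A₀ * (2 + |z.im|)) ^ ε ≤ (2 * X) ^ ε := Real.rpow_le_rpow (by positivity) h4 hε0.le
        _ = 2 ^ ε * P := by rw [Real.mul_rpow (by norm_num) (by linarith)]
        _ ≤ 2 ^ (1 : ℝ) * P := by
            gcongr
            norm_num
        _ = 2 * P := by rw [Real.rpow_one]
    constructor
    · exact ((hmain.1.neg.sub ((differentiableAt_const _).div differentiableAt_id hz0)).sub
        (differentiableAt_const _)).sub (hzd.div_const _)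
    · have e1 : ‖1 / z‖ ≤ 2 * P ^ 2 := by
        rw [norm_div, norm_one, div_le_iff₀ (by linarith)]
        nlinarith
      have e2 : ‖(1 : ℂ)‖ ≤ 1 * P ^ 2 := by rw [norm_one]; nlinarith
      have e3 : ‖twRem r 1 κ z / κ‖ ≤ 2 * D / κ * P ^ 2 := by
        rw [norm_div, Complex.norm_real, Real.norm_of_nonneg hκ.le, div_mul_eq_mul_div]
        gcongr
        refine (hH _ _ _ hb.twist z hzre).1.trans ?_
        calc D * (A₀ * (2 + |z.im|)) ^ ε ≤ D * (2 * P ^ 2) := by gcongr; linarith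
          _ = _ := by ring
      have e0 := hmain.2
      calc _ ≤ ‖-(deriv (zetaReg r κ) z / zetaReg r κ z)‖ + ‖1 / z‖ + ‖(1 : ℂ)‖ + ‖twRem r 1 κ z / κ‖ := by
            refine (norm_sub_le _ _).trans ?_
            gcongr
            refine (norm_sub_le _ _).trans ?_
            gcongr
            exact norm_sub_le _ _
        _ ≤ 4 * (7 * D) / c₀ * P ^ 2 + 2 * P ^ 2 + 1 * P ^ 2 + 2 * D / κ * P ^ 2 := by
            rw [norm_neg]; gcongr
        _ = _ := by rw [hW]; ring
  · rw [(hb.hasDerivAt_zetaReg (by linarith)).deriv]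
    obtain ⟨g1, g2⟩ := hH _ _ _ hb.twist z hz
    have hzn := hinv z hz
    have hz0 : z ≠ 0 := by rw [← norm_pos_iff]; linarith
    set Y := (A₀ * (2 + |z.im|)) ^ ε with hY
    have e1 : ‖1 / z ^ 2‖ ≤ 4 := by
      rw [norm_div, norm_one, norm_pow, div_le_iff₀ (by positivity)]
      nlinarith
    have e2 : ‖(z - 1) / z‖ ≤ 3 := by
      rw [norm_div, div_le_iff₀ (by linarith)]
      have := norm_sub_le z 1
      rw [norm_one] at this
      linarith
    calc _ ≤ ‖1 / z ^ 2‖ * ‖twRem r 1 κ z‖ + ‖(z - 1) / z‖ * ‖deriv (twRem r 1 κ) z‖ := by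
          rw [← norm_mul, ← norm_mul]; exact norm_add_le _ _
      _ ≤ 4 * (D * Y) + 3 * (D * Y) := by gcongr
      _ = 7 * D * Y := by ring

end

/-! ### A smoothed Perron formula -/

section
open MeasureTheory FourierTransform

/-- The Mellin kernel of the Riesz mean of order one, in logarithmic coordinates. -/
noncomputable def rieszKernel (n : ℕ) (s : ℂ) (u : ℝ) : ℂ :=
  Complex.exp (-(s + 1) * u) * ((max (Real.exp u - n) 0 : ℝ) : ℂ)

theorem rieszKernel_eq_indicator {n : ℕ} (hn : 1 ≤ n) (s : ℂ) :
    rieszKernel n s = (Set.Ioi (Real.log n)).indicator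
      fun u => Complex.exp (-s * u) - n * Complex.exp (-(s + 1) * u) := by
  have hn0 : (0 : ℝ) < n := by exact_mod_cast hn
  funext u
  rw [rieszKernel]
  by_cases hu : Real.log n < u
  · rw [Set.indicator_of_mem (by exact hu)]
    have : (n : ℝ) < Real.exp u := (Real.log_lt_iff_lt_exp hn0).mp hu
    rw [max_eq_left (by linarith)]
    push_cast
    rw [mul_sub, ← Complex.exp_add]
    ring_nf
  · rw [Set.indicator_of_notMem (by exact hu)]
    have : Real.exp u ≤ n := by
      rw [← Real.exp_log hn0]
      exact Real.exp_le_exp.mpr (not_lt.mp hu)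
    rw [max_eq_right (by linarith)]
    simp

theorem integrable_rieszKernel {n : ℕ} (hn : 1 ≤ n) {s : ℂ} (hs : 0 < s.re) :
    Integrable (rieszKernel n s) := by
  rw [rieszKernel_eq_indicator hn, integrable_indicator_iff measurableSet_Ioi]
  exact (integrableOn_exp_mul_complex_Ioi (by simpa using hs) _).sub
    ((integrableOn_exp_mul_complex_Ioi (by simp; linarith) _).const_mul _)

theorem integral_rieszKernel {n : ℕ} (hn : 1 ≤ n) {s : ℂ} (hs : 0 < s.re) :
    ∫ u, rieszKernel n s u = (n : ℂ) ^ (-s) / (s * (s + 1)) := by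
  have hn0 : (n : ℂ) ≠ 0 := by exact_mod_cast (by omega : n ≠ 0)
  have hs0 : s ≠ 0 := by rintro rfl; simp at hs
  have hs1 : s + 1 ≠ 0 := by
    intro h
    have := congrArg Complex.re h
    simp at this; linarith
  have h1 : (-s).re < 0 := by simpa using hs
  have h2 : (-(s + 1)).re < 0 := by simp; linarith
  rw [rieszKernel_eq_indicator hn, integral_indicator measurableSet_Ioi,
    integral_sub (integrableOn_exp_mul_complex_Ioi h1 _)
      ((integrableOn_exp_mul_complex_Ioi h2 _).const_mul _), integral_const_mul,
    integral_exp_mul_complex_Ioi h1, integral_exp_mul_complex_Ioi h2, Complex.natCast_log]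
  have e1 : Complex.exp (-s * Complex.log n) = (n : ℂ) ^ (-s) := by
    rw [Complex.cpow_def_of_ne_zero hn0, mul_comm]
  have e2 : Complex.exp (-(s + 1) * Complex.log n) = (n : ℂ) ^ (-s) / n := by
    rw [neg_add, add_mul, Complex.exp_add, e1, neg_one_mul, Complex.exp_neg, Complex.exp_log hn0,
      div_eq_mul_inv]
  rw [e1, e2]
  field_simp
  ring

theorem norm_rieszKernel (n : ℕ) (s : ℂ) (u : ℝ) :
    (‖rieszKernel n s u‖ : ℂ) = rieszKernel n (s.re : ℂ) u := by
  rw [rieszKernel, rieszKernel, norm_mul, Complex.norm_exp, Complex.norm_real,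
    Real.norm_of_nonneg (le_max_right _ _)]
  push_cast
  congr 2
  simp

theorem integral_norm_rieszKernel {n : ℕ} (hn : 1 ≤ n) {s : ℂ} (hs : 0 < s.re) :
    ∫ u, ‖rieszKernel n s u‖ = ‖(n : ℂ) ^ (-s)‖ / (s.re * (s.re + 1)) := by
  have h : ((∫ u, ‖rieszKernel n s u‖ : ℝ) : ℂ) = (n : ℂ) ^ (-(s.re : ℂ)) / (s.re * (s.re + 1)) := by
    rw [← integral_rieszKernel hn (s := (s.re : ℂ)) (by simpa using hs), ← integral_complex_ofReal]
    simp_rw [norm_rieszKernel]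
  have h2 : (n : ℂ) ^ (-(s.re : ℂ)) = ((‖(n : ℂ) ^ (-s)‖ : ℝ) : ℂ) := by
    rw [Complex.norm_natCast_cpow_of_pos hn, Complex.neg_re]
    rw [Complex.ofReal_cpow (by positivity)]
    push_cast
    rfl
  rw [h2] at h
  exact_mod_cast h

/-- The Riesz mean of order one of the coefficients `d`. -/
noncomputable def rieszSum (d : ℕ → ℂ) (x : ℝ) : ℂ := ∑ n ∈ Finset.Icc 1 ⌊x⌋₊, d n * (x - n)

theorem rieszSum_eq {d : ℕ → ℂ} {x : ℝ} {N : ℕ} (hN : x ≤ N) :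
    rieszSum d x = ∑ n ∈ Finset.Icc 1 N, d n * ((max (x - n) 0 : ℝ) : ℂ) := by
  have hsub : Finset.Icc 1 ⌊x⌋₊ ⊆ Finset.Icc 1 N :=
    Finset.Icc_subset_Icc_right (Nat.floor_le_of_le hN)
  rw [rieszSum, ← Finset.sum_subset hsub]
  · refine Finset.sum_congr rfl fun n hn => ?_
    rw [Finset.mem_Icc] at hn
    have : (n : ℝ) ≤ x := (Nat.le_floor_iff' (by omega)).mp hn.2
    rw [max_eq_left (by linarith)]
    push_cast; rfl
  · intro n hn hn'
    rw [Finset.mem_Icc] at hn hn'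
    have : x < n := by
      by_contra hcon
      exact hn' ⟨hn.1, (Nat.le_floor_iff' (by omega)).mpr (not_lt.mp hcon)⟩
    rw [max_eq_right (by linarith)]
    simp

theorem continuous_rieszSum (d : ℕ → ℂ) : Continuous (rieszSum d) := by
  rw [continuous_iff_continuousAt]
  intro x
  obtain ⟨N, hN⟩ := exists_nat_gt x
  have : rieszSum d =ᶠ[nhds x] fun y => ∑ n ∈ Finset.Icc 1 N, d n * ((max (y - n) 0 : ℝ) : ℂ) := by
    filter_upwards [Iio_mem_nhds hN] with y hy
    exact rieszSum_eq (le_of_lt hy)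
  refine ContinuousAt.congr ?_ this.symm
  fun_prop

theorem hasSum_rieszKernel (d : ℕ → ℂ) (s : ℂ) (u : ℝ) :
    HasSum (fun n : ℕ => (if n = 0 then 0 else d n) * rieszKernel n s u)
      (Complex.exp (-(s + 1) * u) * rieszSum d (Real.exp u)) := by
  obtain ⟨N, hN⟩ := exists_nat_gt (Real.exp u)
  rw [rieszSum_eq hN.le, Finset.mul_sum]
  have : ∑ n ∈ Finset.Icc 1 N, Complex.exp (-(s + 1) * u) * (d n * ((max (Real.exp u - n) 0 : ℝ) : ℂ))
      = ∑ n ∈ Finset.Icc 1 N, (if n = 0 then 0 else d n) * rieszKernel n s u := by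
    refine Finset.sum_congr rfl fun n hn => ?_
    rw [Finset.mem_Icc] at hn
    rw [if_neg (by omega), rieszKernel]
    ring
  rw [this]
  refine hasSum_sum_of_ne_finset_zero fun n hn => ?_
  rw [Finset.mem_Icc] at hn
  by_cases h0 : n = 0
  · simp [h0]
  · have : (N : ℝ) < n := by exact_mod_cast (by omega : N < n)
    rw [rieszKernel, max_eq_right (by linarith)]
    simp

theorem integral_rieszSum {d : ℕ → ℂ} {s : ℂ} (hs : 0 < s.re) (hd : LSeriesSummable d s) :
    ∫ u : ℝ, Complex.exp (-(s + 1) * u) * rieszSum d (Real.exp u) = LSeries d s / (s * (s + 1)) := by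
  have hterm : ∀ n : ℕ, ∫ u, (if n = 0 then 0 else d n) * rieszKernel n s u
      = LSeries.term d s n / (s * (s + 1)) := by
    intro n
    by_cases h0 : n = 0
    · simp [h0]
    · rw [integral_const_mul, integral_rieszKernel (by omega) hs, if_neg h0,
        LSeries.term_of_ne_zero h0, Complex.cpow_neg]
      ring
  have hint : ∀ n : ℕ, Integrable (fun u => (if n = 0 then 0 else d n) * rieszKernel n s u) := by
    intro n
    by_cases h0 : n = 0
    · simp [h0]
    · exact (integrable_rieszKernel (by omega) hs).const_mul _
  have hnorm : ∀ n : ℕ, ∫ u, ‖(if n = 0 then 0 else d n) * rieszKernel n s u‖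
      = ‖LSeries.term d s n‖ / (s.re * (s.re + 1)) := by
    intro n
    by_cases h0 : n = 0
    · simp [h0]
    · simp_rw [norm_mul, integral_const_mul, integral_norm_rieszKernel (Nat.pos_of_ne_zero h0) hs,
        if_neg h0, LSeries.term_of_ne_zero h0, Complex.cpow_neg, norm_div, norm_inv]
      ring
  have h1 := hasSum_integral_of_summable_integral_norm hint (by
    simp_rw [hnorm]
    exact hd.norm.div_const _)
  simp_rw [hterm, (hasSum_rieszKernel d s _).tsum_eq] at h1
  exact h1.unique (hd.hasSum.div_const _)

theorem norm_rieszSum_le {d : ℕ → ℂ} {σ : ℝ} (hσ : 0 < σ) (hd : LSeriesSummable d σ) {x : ℝ}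
    (hx : 0 < x) : ‖rieszSum d x‖ ≤ (∑' n, ‖LSeries.term d σ n‖) * x ^ (σ + 1) := by
  have h1 : ∑ n ∈ Finset.Icc 1 ⌊x⌋₊, ‖LSeries.term d σ n‖ ≤ ∑' n, ‖LSeries.term d σ n‖ :=
    hd.norm.sum_le_tsum _ fun _ _ => norm_nonneg _
  refine le_trans ?_ (mul_le_mul_of_nonneg_right h1 (by positivity))
  rw [rieszSum, Finset.sum_mul]
  refine norm_sum_le_of_le _ fun n hn => ?_
  rw [Finset.mem_Icc] at hn
  have hnx : (n : ℝ) ≤ x := (Nat.le_floor_iff' (by omega)).mp hn.2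
  have hn0 : (0 : ℝ) < n := by exact_mod_cast hn.1
  rw [LSeries.norm_term_eq, if_neg (by omega), Complex.ofReal_re, norm_mul, div_mul_eq_mul_div,
    le_div_iff₀ (by positivity), mul_assoc]
  refine mul_le_mul_of_nonneg_left ?_ (norm_nonneg _)
  have h2 : ‖(x : ℂ) - n‖ = x - n := by
    rw [← Complex.ofReal_natCast, ← Complex.ofReal_sub, Complex.norm_real,
      Real.norm_of_nonneg (by linarith)]
  rw [h2, Real.rpow_add hx, Real.rpow_one, mul_comm]
  have := Real.rpow_le_rpow hn0.le hnx hσ.le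
  have h3 : x - n ≤ x := by linarith
  have h4 : 0 ≤ x - n := by linarith
  gcongr

theorem integrable_rieszSum {d : ℕ → ℂ} (hd : ∀ s : ℂ, 1 < s.re → LSeriesSummable d s) {σ : ℝ}
    (hσ : 1 < σ) :
    Integrable fun u : ℝ => Complex.exp (-((σ : ℂ) + 1) * u) * rieszSum d (Real.exp u) := by
  set τ := (σ + 1) / 2 with hτ
  have hτ1 : 1 < τ := by rw [hτ]; linarith
  have hmeas : AEStronglyMeasurable
      (fun u : ℝ => Complex.exp (-((σ : ℂ) + 1) * u) * rieszSum d (Real.exp u)) := by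
    refine Continuous.aestronglyMeasurable ?_
    have := continuous_rieszSum d
    fun_prop
  have hz : ∀ u : ℝ, u ≤ 0 →
      Complex.exp (-((σ : ℂ) + 1) * u) * rieszSum d (Real.exp u) = 0 := by
    intro u hu
    have h1 : Real.exp u ≤ (1 : ℕ) := by simpa using Real.exp_le_one_iff.mpr hu
    rw [rieszSum_eq h1]
    simp only [Finset.Icc_self, Finset.sum_singleton]
    rw [max_eq_right (by linarith)]
    simp
  have hI : IntegrableOn (fun u : ℝ =>
      Complex.exp (-((σ : ℂ) + 1) * u) * rieszSum d (Real.exp u)) (Set.Ioi 0) := by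
    refine Integrable.mono' (g := fun u => (∑' n, ‖LSeries.term d τ n‖) * Real.exp (-(σ - τ) * u))
      ((exp_neg_integrableOn_Ioi 0 (by rw [hτ]; linarith)).const_mul _) hmeas.restrict ?_
    refine Filter.Eventually.of_forall fun u => ?_
    rw [norm_mul, Complex.norm_exp]
    have := norm_rieszSum_le (by linarith) (hd τ (by simpa using hτ1)) (Real.exp_pos u)
    rw [← Real.exp_mul] at this
    calc _ ≤ Real.exp (-((σ : ℂ) + 1) * u).re * ((∑' n, ‖LSeries.term d τ n‖) * Real.exp (u * (τ + 1))) := by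
          gcongr
      _ = (∑' n, ‖LSeries.term d τ n‖) * (Real.exp (-((σ : ℂ) + 1) * u).re * Real.exp (u * (τ + 1))) := by
          ring
      _ = _ := by
          rw [← Real.exp_add]
          congr 2
          simp
          ring
  rw [← integrable_indicator_iff measurableSet_Ioi] at hI
  refine hI.congr (Filter.Eventually.of_forall fun u => ?_)
  by_cases hu : 0 < u
  · exact Set.indicator_of_mem (by exact hu) _
  · rw [Set.indicator_of_notMem (by exact hu)]
    exact (hz u (not_lt.mp hu)).symm

theorem fourier_rieszSum {d : ℕ → ℂ} (hd : ∀ s : ℂ, 1 < s.re → LSeriesSummable d s) {σ : ℝ}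
    (hσ : 1 < σ) :
    𝓕 (fun u : ℝ => Complex.exp (-((σ : ℂ) + 1) * u) * rieszSum d (Real.exp u)) =
      fun w : ℝ => (fun s => LSeries d s / (s * (s + 1))) (σ + (2 * Real.pi * w : ℝ) * Complex.I) := by
  funext w
  rw [Real.fourier_real_eq_integral_exp_smul]
  have hre : ((σ : ℂ) + (2 * Real.pi * w : ℝ) * Complex.I).re = σ := by simp
  have := integral_rieszSum (d := d) (s := σ + (2 * Real.pi * w : ℝ) * Complex.I)
    (by rw [hre]; linarith) (hd _ (by rw [hre]; exact hσ))
  refine Eq.trans ?_ this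
  congr 1
  funext u
  rw [smul_eq_mul, ← mul_assoc, ← Complex.exp_add]
  congr 2
  push_cast
  ring

theorem iteratedDeriv_comp_line {F : ℂ → ℂ} {σ : ℝ}
    (hF : ∀ z : ℂ, z.re = σ → AnalyticAt ℂ F z) (n : ℕ) :
    iteratedDeriv n (fun w : ℝ => F (σ + (2 * Real.pi * w : ℝ) * Complex.I)) =
      (fun w : ℝ => (2 * Real.pi * Complex.I) ^ n *
        iteratedDeriv n F (σ + (2 * Real.pi * w : ℝ) * Complex.I)) ∧
    Differentiable ℝ (fun w : ℝ => (2 * Real.pi * Complex.I) ^ n *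
        iteratedDeriv n F (σ + (2 * Real.pi * w : ℝ) * Complex.I)) := by
  have key : ∀ n : ℕ, ∀ w : ℝ, HasDerivAt (fun w : ℝ => (2 * Real.pi * Complex.I) ^ n *
        iteratedDeriv n F (σ + (2 * Real.pi * w : ℝ) * Complex.I))
      ((2 * Real.pi * Complex.I) ^ (n + 1) *
        iteratedDeriv (n + 1) F (σ + (2 * Real.pi * w : ℝ) * Complex.I)) w := by
    intro n w
    have han : AnalyticAt ℂ (iteratedDeriv n F) (σ + (2 * Real.pi * w : ℝ) * Complex.I) := by
      rw [iteratedDeriv_eq_iterate]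
      exact (hF _ (by simp)).iterated_deriv n
    have h1 := han.differentiableAt.hasDerivAt
    have h2 : HasDerivAt (fun w : ℝ => (σ : ℂ) + (2 * Real.pi * w : ℝ) * Complex.I)
        (2 * Real.pi * Complex.I) w := by
      have h3 : HasDerivAt (fun w : ℂ => (σ : ℂ) + (2 * Real.pi * w) * Complex.I)
          (2 * Real.pi * Complex.I) (w : ℂ) := by
        have := (((hasDerivAt_id (w : ℂ)).const_mul (2 * Real.pi : ℂ)).mul_const Complex.I).const_add (σ : ℂ)
        simpa using this
      simpa using h3.comp_ofReal
    have h4 := (h1.comp w h2).const_mul ((2 * Real.pi * Complex.I) ^ n)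
    refine h4.congr_deriv ?_
    rw [iteratedDeriv_succ, pow_succ]
    ring
  refine ⟨?_, fun w => (key n w).differentiableAt⟩
  induction n with
  | zero => simp
  | succ n ih =>
    rw [iteratedDeriv_succ, ih]
    funext w
    exact (key n w).deriv

theorem integrable_decay :
    Integrable fun w : ℝ => (2 + |2 * Real.pi * w|) ^ (1 / 2 : ℝ) / (1 + (2 * Real.pi * w) ^ 2) := by
  have h0 : Integrable fun t : ℝ => (2 + |t|) ^ (1 / 2 : ℝ) / (1 + t ^ 2) := by
    have h1 : Integrable fun t : ℝ => 4 * (1 + ‖t‖) ^ (-(3 / 2 : ℝ)) :=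
      (integrable_one_add_norm (by norm_num)).const_mul 4
    refine h1.mono' (Continuous.aestronglyMeasurable ?_) (Filter.Eventually.of_forall fun t => ?_)
    · refine Continuous.div ?_ (by fun_prop) fun t => by positivity
      exact Continuous.rpow_const (by fun_prop) fun t => Or.inr (by norm_num)
    · have ht := abs_nonneg t
      rw [Real.norm_of_nonneg (by positivity), Real.norm_eq_abs, div_le_iff₀ (by positivity)]
      have e1 : (2 + |t|) ^ (1 / 2 : ℝ) ≤ 2 * (1 + |t|) ^ (1 / 2 : ℝ) := by
        calc (2 + |t|) ^ (1 / 2 : ℝ) ≤ (4 * (1 + |t|)) ^ (1 / 2 : ℝ) := by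
              gcongr; linarith
          _ = _ := by
            rw [Real.mul_rpow (by norm_num) (by linarith)]
            congr 1
            rw [← Real.sqrt_eq_rpow, show (4 : ℝ) = 2 ^ 2 by norm_num]
            simp
      have e2 : (1 + |t|) ^ (1 / 2 : ℝ) = (1 + |t|) ^ (-(3 / 2 : ℝ)) * (1 + |t|) ^ 2 := by
        rw [← Real.rpow_natCast, ← Real.rpow_add (by linarith)]
        norm_num
      have e3 : (1 + |t|) ^ 2 ≤ 2 * (1 + t ^ 2) := by
        rw [← sq_abs t]
        nlinarith [sq_nonneg (|t| - 1)]
      have e4 : 0 ≤ (1 + |t|) ^ (-(3 / 2 : ℝ)) := by positivity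
      rw [e2] at e1
      nlinarith [mul_le_mul_of_nonneg_left e3 e4]
  exact h0.comp_mul_left' (g := fun t : ℝ => (2 + |t|) ^ (1 / 2 : ℝ) / (1 + t ^ 2)) (by positivity)

theorem norm_rieszSum_le_of_iteratedDeriv {d : ℕ → ℂ}
    (hd : ∀ s : ℂ, 1 < s.re → LSeriesSummable d s) {k : ℕ} {V : ℝ}
    (hV : ∀ j ≤ k, ∀ σ t : ℝ, 1 < σ → σ ≤ 2 →
      ‖iteratedDeriv j (fun s => LSeries d s / (s * (s + 1))) (σ + t * Complex.I)‖ ≤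
        V * ((2 + |t|) ^ (1 / 2 : ℝ) / (1 + t ^ 2))) {x : ℝ} (hx : Real.exp 1 ≤ x) :
    ‖rieszSum d x‖ ≤ (Real.exp 1 * ∫ w : ℝ, (2 + |2 * Real.pi * w|) ^ (1 / 2 : ℝ) /
      (1 + (2 * Real.pi * w) ^ 2)) * V * x ^ 2 / Real.log x ^ k := by
  have hx0 : 0 < x := (Real.exp_pos 1).trans_le hx
  set L := Real.log x with hL
  have hL1 : 1 ≤ L := (Real.le_log_iff_exp_le hx0).mpr hx
  have hxL : Real.exp L = x := Real.exp_log hx0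
  set σ : ℝ := 1 + 1 / L with hσ
  have hσ1 : 1 < σ := by rw [hσ]; linarith [show 0 < 1 / L by positivity]
  have hσ2 : σ ≤ 2 := by
    have : 1 / L ≤ 1 := by rw [div_le_one (by linarith)]; exact hL1
    linarith
  set g : ℝ → ℂ := fun u => Complex.exp (-((σ : ℂ) + 1) * u) * rieszSum d (Real.exp u) with hg
  set F : ℂ → ℂ := fun s => LSeries d s / (s * (s + 1)) with hF
  set H : ℝ → ℂ := fun w => F (σ + (2 * Real.pi * w : ℝ) * Complex.I) with hH
  have hFg : 𝓕 g = H := fourier_rieszSum hd hσ1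
  have han : ∀ z : ℂ, z.re = σ → AnalyticAt ℂ F z := by
    intro z hz
    have hzm : LSeries.abscissaOfAbsConv d < z.re := by
      rw [hz]; exact abscissa_lt_of_forall hd hσ1
    refine (LSeries_analyticOnNhd d z hzm).div (by fun_prop) ?_
    refine mul_ne_zero ?_ ?_
    · rintro rfl; simp at hz; linarith
    · intro h
      have := congrArg Complex.re h
      simp at this; linarith
  set J : ℝ → ℝ := fun w => (2 + |2 * Real.pi * w|) ^ (1 / 2 : ℝ) / (1 + (2 * Real.pi * w) ^ 2) with hJ
  have hJi : Integrable J := integrable_decay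
  have hbd : ∀ j ≤ k, ∀ w : ℝ, ‖iteratedDeriv j H w‖ ≤ (2 * Real.pi) ^ j * (V * J w) := by
    intro j hj w
    rw [hH, (iteratedDeriv_comp_line han j).1]
    simp only [norm_mul, norm_pow, Complex.norm_I, mul_one, Complex.norm_real, Complex.norm_ofNat,
      Real.norm_of_nonneg Real.pi_pos.le]
    gcongr
    exact hV j hj σ _ hσ1 hσ2
  have hdiff : ∀ j : ℕ, Differentiable ℝ (iteratedDeriv j H) := by
    intro j
    rw [hH, (iteratedDeriv_comp_line han j).1]
    exact (iteratedDeriv_comp_line han j).2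
  have hint : ∀ j ≤ k, Integrable (iteratedDeriv j H) := fun j hj =>
    ((hJi.const_mul V).const_mul _).mono' (hdiff j).continuous.aestronglyMeasurable
      (Filter.Eventually.of_forall (hbd j hj))
  have hHi : Integrable H := by simpa using hint 0 (Nat.zero_le k)
  have hinv : 𝓕⁻ (𝓕 g) L = g L := by
    refine (integrable_rieszSum hd hσ1).fourierInv_fourier_eq (by rw [hFg]; exact hHi) ?_
    have := continuous_rieszSum d
    have : Continuous g := by rw [hg]; fun_prop
    exact this.continuousAt
  rw [hFg, Real.fourierInv_eq_fourier_neg] at hinv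
  have hder := Real.fourier_iteratedDeriv (f := H) (N := k) (n := k)
    (contDiff_of_differentiable_iteratedDeriv fun m _ => hdiff m)
    (fun n hn => hint n (by exact_mod_cast hn)) le_rfl
  have hk := congrFun hder (-L)
  have hle : ‖𝓕 (iteratedDeriv k H) (-L)‖ ≤ (2 * Real.pi) ^ k * (V * ∫ w, J w) := by
    calc ‖𝓕 (iteratedDeriv k H) (-L)‖ ≤ ∫ w, ‖iteratedDeriv k H w‖ := by
          rw [Real.fourier_real_eq_integral_exp_smul]
          refine (norm_integral_le_integral_norm _).trans (le_of_eq ?_)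
          congr 1
          funext w
          rw [norm_smul, Complex.norm_exp_ofReal_mul_I, one_mul]
      _ ≤ ∫ w, (2 * Real.pi) ^ k * (V * J w) :=
          integral_mono (hint k le_rfl).norm ((hJi.const_mul V).const_mul _) (hbd k le_rfl)
      _ = _ := by rw [integral_const_mul, integral_const_mul]
  rw [hk, hinv, norm_smul, norm_pow] at hle
  have hn1 : ‖(2 * Real.pi * Complex.I * ((-L : ℝ) : ℂ) : ℂ)‖ = 2 * Real.pi * L := by
    simp only [norm_mul, Complex.norm_I, mul_one, Complex.norm_real, Complex.norm_ofNat,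
      Real.norm_of_nonneg Real.pi_pos.le, norm_neg]
    rw [Real.norm_of_nonneg (by linarith)]
  rw [hn1, mul_pow, mul_assoc] at hle
  have hle2 : L ^ k * ‖g L‖ ≤ V * ∫ w, J w := le_of_mul_le_mul_left hle (by positivity)
  have hgL : ‖g L‖ = (Real.exp 1 * x ^ 2)⁻¹ * ‖rieszSum d x‖ := by
    rw [hg]
    simp only [norm_mul, hxL]
    congr 1
    rw [Complex.norm_exp, ← hxL, ← Real.exp_nat_mul, ← Real.exp_add, ← Real.exp_neg]
    congr 1
    simp [hσ]
    field_simp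
    ring
  rw [hgL] at hle2
  rw [le_div_iff₀ (by positivity)]
  calc ‖rieszSum d x‖ * L ^ k
      = (Real.exp 1 * x ^ 2) * (L ^ k * ((Real.exp 1 * x ^ 2)⁻¹ * ‖rieszSum d x‖)) := by field_simp
    _ ≤ (Real.exp 1 * x ^ 2) * (V * ∫ w, J w) := by gcongr
    _ = _ := by ring

end

/-! ### From Riesz means to sharp cutoffs -/

theorem rieszSum_add_sub (d : ℕ → ℂ) {x h : ℝ} (hh : 0 ≤ h) :
    rieszSum d (x + h) - rieszSum d x = h * ∑ n ∈ Finset.Icc 1 ⌊x⌋₊, d n +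
      ∑ n ∈ Finset.Ioc ⌊x⌋₊ ⌊x + h⌋₊, d n * ((x + h : ℝ) - n) := by
  have hle : ⌊x⌋₊ ≤ ⌊x + h⌋₊ := Nat.floor_le_floor (by linarith)
  have hsplit : ∀ f : ℕ → ℂ, ∑ n ∈ Finset.Icc 1 ⌊x + h⌋₊, f n
      = ∑ n ∈ Finset.Icc 1 ⌊x⌋₊, f n + ∑ n ∈ Finset.Ioc ⌊x⌋₊ ⌊x + h⌋₊, f n := by
    intro f
    rw [← Finset.sum_union]
    · congr 1
      ext n
      simp only [Finset.mem_Icc, Finset.mem_union, Finset.mem_Ioc]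
      omega
    · rw [Finset.disjoint_left]
      intro n
      simp only [Finset.mem_Icc, Finset.mem_Ioc]
      omega
  rw [rieszSum, hsplit, rieszSum, Finset.mul_sum, add_sub_right_comm, ← Finset.sum_sub_distrib]
  congr 1
  refine Finset.sum_congr rfl fun n _ => ?_
  push_cast
  ring

theorem sum_Icc_floor_add (f : ℕ → ℝ) {x h : ℝ} (hh : 0 ≤ h) :
    ∑ n ∈ Finset.Icc 1 ⌊x + h⌋₊, f n
      = ∑ n ∈ Finset.Icc 1 ⌊x⌋₊, f n + ∑ n ∈ Finset.Ioc ⌊x⌋₊ ⌊x + h⌋₊, f n := by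
  have hle : ⌊x⌋₊ ≤ ⌊x + h⌋₊ := Nat.floor_le_floor (by linarith)
  rw [← Finset.sum_union]
  · congr 1
    ext n
    simp only [Finset.mem_Icc, Finset.mem_union, Finset.mem_Ioc]
    omega
  · rw [Finset.disjoint_left]
    intro n
    simp only [Finset.mem_Icc, Finset.mem_Ioc]
    omega

theorem cast_mem_Ioc_floor {x y : ℝ} (hx : 0 ≤ x) {n : ℕ} (hn : n ∈ Finset.Ioc ⌊x⌋₊ ⌊y⌋₊) :
    x < n ∧ (n : ℝ) ≤ y := by
  rw [Finset.mem_Ioc] at hn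
  exact ⟨(Nat.floor_lt hx).mp hn.1, (Nat.le_floor_iff' (by omega)).mp hn.2⟩

/-- The Riesz mean of order one of real coefficients. -/
noncomputable def rieszSumReal (f : ℕ → ℝ) (x : ℝ) : ℝ := ∑ n ∈ Finset.Icc 1 ⌊x⌋₊, f n * (x - n)

theorem rieszSumReal_diff (f : ℕ → ℝ) (hf : ∀ n, 0 ≤ f n) {x h : ℝ} (hx : 0 ≤ x) (hh : 0 ≤ h) :
    h * ∑ n ∈ Finset.Icc 1 ⌊x⌋₊, f n ≤ rieszSumReal f (x + h) - rieszSumReal f x ∧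
      rieszSumReal f (x + h) - rieszSumReal f x ≤ h * ∑ n ∈ Finset.Icc 1 ⌊x + h⌋₊, f n := by
  have key : rieszSumReal f (x + h) - rieszSumReal f x = h * ∑ n ∈ Finset.Icc 1 ⌊x⌋₊, f n +
      ∑ n ∈ Finset.Ioc ⌊x⌋₊ ⌊x + h⌋₊, f n * (x + h - n) := by
    have := rieszSum_add_sub (fun n => (f n : ℂ)) (x := x) hh
    simp only [rieszSum] at this
    rw [rieszSumReal, rieszSumReal]
    exact_mod_cast this
  rw [key, sum_Icc_floor_add f hh, mul_add]
  constructor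
  · have : 0 ≤ ∑ n ∈ Finset.Ioc ⌊x⌋₊ ⌊x + h⌋₊, f n * (x + h - n) :=
      Finset.sum_nonneg fun n hn => mul_nonneg (hf n) (by linarith [(cast_mem_Ioc_floor hx hn).2])
    linarith
  · rw [Finset.mul_sum (s := Finset.Ioc _ _)]
    refine add_le_add_right (Finset.sum_le_sum fun n hn => ?_) _
    rw [mul_comm]
    exact mul_le_mul_of_nonneg_right (by linarith [(cast_mem_Ioc_floor hx hn).1]) (hf n)

theorem log_pow_le_rpow {δ : ℝ} (hδ : 0 < δ) (m : ℕ) :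
    ∃ C : ℝ, 0 < C ∧ ∀ x : ℝ, Real.exp 1 ≤ x → Real.log x ^ m ≤ C * x ^ δ := by
  refine ⟨((m + 1) / δ) ^ (m + 1), by positivity, fun x hx => ?_⟩
  have hx0 : 0 < x := (Real.exp_pos 1).trans_le hx
  have hL1 : 1 ≤ Real.log x := (Real.le_log_iff_exp_le hx0).mpr hx
  have h1 := Real.log_le_rpow_div hx0.le (show 0 < δ / (m + 1) by positivity)
  calc Real.log x ^ m ≤ Real.log x ^ (m + 1) := pow_le_pow_right₀ hL1 (Nat.le_succ m)
    _ ≤ (x ^ (δ / (m + 1)) / (δ / (m + 1))) ^ (m + 1) := by gcongr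
    _ = ((m + 1) / δ) ^ (m + 1) * (x ^ (δ / (m + 1))) ^ (m + 1) := by
        rw [← mul_pow]; congr 1; field_simp
    _ = ((m + 1) / δ) ^ (m + 1) * x ^ δ := by
        rw [← Real.rpow_natCast (x ^ _), ← Real.rpow_mul hx0.le]
        congr 2
        push_cast
        field_simp

section
variable {r b : ℕ → ℝ} {κ δ A₀ A : ℝ} {E : ℕ} {c : ∀ q : ℕ, DirichletCharacter ℂ q → ℂ}

theorem TwistBase.abs_sum_sub_le (hb : TwistBase r κ δ A₀) {t : ℝ} (ht : 1 ≤ t) :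
    |∑ k ∈ Finset.Icc 1 ⌊t⌋₊, r k - κ * t| ≤ A₀ * t ^ (1 - δ) := by
  have h1 := hb.twist.bound t ht
  have h2 : sumRem (fun n => (1 : ℕ →* ℂ) n * r n) κ t
      = ((∑ k ∈ Finset.Icc 1 ⌊t⌋₊, r k - κ * t : ℝ) : ℂ) := by
    simp [sumRem]
  rwa [h2, Complex.norm_real] at h1

theorem IsMangoldt.exists_rieszSumReal_le (hm : IsMangoldt r b) (hb : TwistBase r κ δ A₀) (k : ℕ) :
    ∃ D : ℝ, 0 < D ∧ ∀ x : ℝ, Real.exp 1 ≤ x →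
      |rieszSumReal b x - rieszSumReal r x / κ| ≤ D * x ^ 2 / Real.log x ^ k := by
  obtain ⟨C, hC, hbd⟩ := hm.exists_norm_iteratedDeriv_le hb k
  have hA := hb.twist.one_le
  have hone : ∀ n, ‖(1 : ℕ →* ℂ) n‖ ≤ 1 := by simp
  set T := Real.exp 1 * ∫ w : ℝ, (2 + |2 * Real.pi * w|) ^ (1 / 2 : ℝ) /
      (1 + (2 * Real.pi * w) ^ 2) with hT
  have hT0 : 0 ≤ T := mul_nonneg (Real.exp_pos 1).le
    (MeasureTheory.integral_nonneg fun w => by positivity)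
  refine ⟨T * (C * A₀ ^ (1 / 2 : ℝ)) + 1, by positivity, fun x hx => ?_⟩
  have hx0 : 0 < x := (Real.exp_pos 1).trans_le hx
  have hL1 : 1 ≤ Real.log x := (Real.le_log_iff_exp_le hx0).mpr hx
  have hsum : ∀ s : ℂ, 1 < s.re → LSeriesSummable (fun n => (b n : ℂ) - r n / κ) s := by
    intro s hs
    have e1 : (fun n => (b n : ℂ) - r n / κ) = twCoeff b 1 - (κ : ℂ)⁻¹ • twCoeff r 1 := by
      funext n
      simp [twCoeff, div_eq_inv_mul]
    rw [e1]
    exact (hm.summable hb hone hs).sub ((hb.summable_twCoeff hone hs).smul _)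
  have h1 := norm_rieszSum_le_of_iteratedDeriv hsum (k := k) (V := C * A₀ ^ (1 / 2 : ℝ))
    (fun j hj σ t hσ hσ2 => by
      refine (hbd j hj σ t hσ hσ2).trans (le_of_eq ?_)
      rw [Real.mul_rpow (by linarith) (by positivity)]
      ring) hx
  have h2 : rieszSum (fun n => (b n : ℂ) - r n / κ) x
      = ((rieszSumReal b x - rieszSumReal r x / κ : ℝ) : ℂ) := by
    rw [rieszSum, rieszSumReal, rieszSumReal, Finset.sum_div, ← Finset.sum_sub_distrib]
    push_cast
    refine Finset.sum_congr rfl fun n _ => ?_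
    ring
  rw [h2, Complex.norm_real, Real.norm_eq_abs] at h1
  refine h1.trans ?_
  gcongr
  linarith

set_option maxHeartbeats 400000 in
theorem IsMangoldt.exists_abs_sum_sub_le (hm : IsMangoldt r b) (hb : TwistBase r κ δ A₀) (m : ℕ) :
    ∃ C : ℝ, 0 < C ∧ ∀ x : ℝ, Real.exp 1 ≤ x →
      |∑ n ∈ Finset.Icc 1 ⌊x⌋₊, b n - x| ≤ C * (x / Real.log x ^ m) := by
  obtain ⟨D, hD, hR⟩ := hm.exists_rieszSumReal_le hb (2 * m)
  obtain ⟨C₂, hC₂, hlog⟩ := log_pow_le_rpow hb.δ_pos m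
  have hκ := hb.κ_pos
  have hA := hb.twist.one_le
  have hδ := hb.δ_pos
  have hδ1 := hb.δ_le
  set G : ℝ := 1 + 2 * A₀ * C₂ / κ + 10 * D * 4 ^ m + 2 ^ m with hG
  refine ⟨G, by positivity, fun x hx => ?_⟩
  have hx0 : 0 < x := (Real.exp_pos 1).trans_le hx
  have hx2 : 2 ≤ x := by
    have := Real.add_one_le_exp 1
    linarith
  set L := Real.log x with hL
  have hL1 : 1 ≤ L := (Real.le_log_iff_exp_le hx0).mpr hx
  set h := x / (2 * L ^ m) with hh
  have hLm : 1 ≤ L ^ m := one_le_pow₀ hL1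
  have hh0 : 0 < h := by positivity
  have hhx : h ≤ x / 2 := by
    rw [hh]
    gcongr
    linarith
  have hhL : h = (x / L ^ m) / 2 := by rw [hh]; field_simp
  set Y := x / L ^ m with hY
  have hY0 : 0 < Y := by positivity
  have hrp : ∀ y : ℝ, 1 ≤ y → y ≤ 2 * x → A₀ * y ^ (1 - δ) ≤ κ * (2 * A₀ * C₂ / κ * Y) := by
    intro y hy hyx
    have e1 : y ^ (1 - δ) ≤ 2 * x ^ (1 - δ) := by
      calc y ^ (1 - δ) ≤ (2 * x) ^ (1 - δ) := by gcongr
        _ = 2 ^ (1 - δ) * x ^ (1 - δ) := Real.mul_rpow (by norm_num) hx0.le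
        _ ≤ 2 ^ (1 : ℝ) * x ^ (1 - δ) := by gcongr <;> linarith
        _ = _ := by rw [Real.rpow_one]
    have e2 : x ^ (1 - δ) ≤ C₂ * Y := by
      rw [hY, mul_div_assoc', le_div_iff₀ (by positivity), Real.rpow_sub hx0, Real.rpow_one,
        div_mul_eq_mul_div, div_le_iff₀ (by positivity)]
      calc x * L ^ m ≤ x * (C₂ * x ^ δ) := by gcongr; exact hlog x hx
        _ = _ := by ring
    calc A₀ * y ^ (1 - δ) ≤ A₀ * (2 * (C₂ * Y)) := by gcongr; linarith
      _ = _ := by field_simp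
  have hS : ∀ y : ℝ, 1 ≤ y → y ≤ 2 * x →
      |(∑ n ∈ Finset.Icc 1 ⌊y⌋₊, r n) / κ - y| ≤ 2 * A₀ * C₂ / κ * Y := by
    intro y hy hyx
    have e1 := (hb.abs_sum_sub_le hy).trans (hrp y hy hyx)
    have e2 : (∑ n ∈ Finset.Icc 1 ⌊y⌋₊, r n) / κ - y
        = (∑ n ∈ Finset.Icc 1 ⌊y⌋₊, r n - κ * y) / κ := by field_simp
    rw [e2, abs_div, abs_of_pos hκ, div_le_iff₀ hκ]
    linarith
  have hx2L : x ^ 2 / L ^ (2 * m) = h * (2 * Y) := by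
    rw [hhL, hY, pow_mul']; field_simp
  rw [abs_le]
  constructor
  · by_cases hxe : Real.exp 2 ≤ x
    · have hexp : Real.exp 2 = Real.exp 1 * Real.exp 1 := by rw [← Real.exp_add]; norm_num
      have hex2 : 2 ≤ Real.exp 1 := by
        have := Real.add_one_le_exp 1
        linarith
      have hy1 : Real.exp 1 ≤ x - h := by
        nlinarith
      have hL2 : 2 ≤ L := (Real.le_log_iff_exp_le hx0).mpr hxe
      have hlogy : L / 2 ≤ Real.log (x - h) := by
        have h3 : Real.log (x / 2) ≤ Real.log (x - h) := Real.log_le_log (by positivity) (by linarith)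
        rw [Real.log_div hx0.ne' (by norm_num)] at h3
        have := Real.log_two_lt_d9
        linarith
      have hd := rieszSumReal_diff b hm.nonneg (x := x - h) (h := h) (by linarith) hh0.le
      have hdr := rieszSumReal_diff r hb.nonneg (x := x - h) (h := h) (by linarith) hh0.le
      rw [sub_add_cancel] at hd hdr
      have hR1 := hR x hx
      have hR2 := hR (x - h) hy1
      have hR2' : D * (x - h) ^ 2 / Real.log (x - h) ^ (2 * m) ≤ D * 4 ^ m * (h * (2 * Y)) := by
        rw [← hx2L]
        have e1 : (x - h) ^ 2 ≤ x ^ 2 := pow_le_pow_left₀ (by linarith [Real.exp_pos 1]) (by linarith) 2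
        calc D * (x - h) ^ 2 / Real.log (x - h) ^ (2 * m) ≤ D * x ^ 2 / (L / 2) ^ (2 * m) := by
              gcongr
          _ = _ := by
              rw [div_pow, pow_mul 2, show (2 : ℝ) ^ 2 = 4 by norm_num]; field_simp
      have h4 : (1 : ℝ) ≤ 4 ^ m := one_le_pow₀ (by norm_num)
      have hR1' : D * x ^ 2 / L ^ (2 * m) ≤ D * 4 ^ m * (h * (2 * Y)) := by
        rw [mul_div_assoc, hx2L]
        nlinarith [show 0 ≤ D * (h * (2 * Y)) by positivity]
      have hS1 := hS (x - h) (by linarith) (by linarith)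
      rw [abs_le] at hR1 hR2 hS1
      have h5 : h * ((∑ n ∈ Finset.Icc 1 ⌊x - h⌋₊, r n) / κ)
          ≤ rieszSumReal r x / κ - rieszSumReal r (x - h) / κ := by
        rw [← sub_div, ← mul_div_assoc]
        exact div_le_div_of_nonneg_right hdr.1 hκ.le
      have h6 : h * (x - h - 2 * A₀ * C₂ / κ * Y - 4 * D * 4 ^ m * Y)
          ≤ h * ∑ n ∈ Finset.Icc 1 ⌊x⌋₊, b n := by
        have h7 : h * (x - h - 2 * A₀ * C₂ / κ * Y) ≤ h * ((∑ n ∈ Finset.Icc 1 ⌊x - h⌋₊, r n) / κ) := by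
          gcongr; linarith
        linarith [hd.2]
      have h8 := le_of_mul_le_mul_left h6 hh0
      have h9 : 0 ≤ D * 4 ^ m * Y := by positivity
      have h10 : 0 ≤ 2 ^ m * Y := by positivity
      rw [hG]
      linarith
    · have hL2 : L ≤ 2 := by
        rw [hL, ← Real.log_exp 2]
        exact Real.log_le_log hx0 (not_le.mp hxe).le
      have h1 : 0 ≤ ∑ n ∈ Finset.Icc 1 ⌊x⌋₊, b n := Finset.sum_nonneg fun n _ => hm.nonneg n
      have h2 : x ≤ 2 ^ m * Y := by
        rw [hY, mul_div_assoc', le_div_iff₀ (by positivity), mul_comm]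
        gcongr
      have h3 : 2 ^ m * Y ≤ G * Y := by
        rw [hG]
        have : 0 ≤ 1 + 2 * A₀ * C₂ / κ + 10 * D * 4 ^ m := by positivity
        gcongr
        linarith
      linarith
  · have hd := rieszSumReal_diff b hm.nonneg (x := x) (h := h) hx0.le hh0.le
    have hdr := rieszSumReal_diff r hb.nonneg (x := x) (h := h) hx0.le hh0.le
    have hR1 := hR x hx
    have hR2 := hR (x + h) (by linarith)
    have h4 : (1 : ℝ) ≤ 4 ^ m := one_le_pow₀ (by norm_num)
    have hR1' : D * x ^ 2 / L ^ (2 * m) = D * (h * (2 * Y)) := by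
      rw [mul_div_assoc, hx2L]
    have hR2' : D * (x + h) ^ 2 / Real.log (x + h) ^ (2 * m) ≤ D * 4 * (h * (2 * Y)) := by
      rw [← hx2L]
      have e1 : (x + h) ^ 2 ≤ (2 * x) ^ 2 := pow_le_pow_left₀ (by linarith) (by linarith) 2
      have e2 : L ≤ Real.log (x + h) := Real.log_le_log hx0 (by linarith)
      calc D * (x + h) ^ 2 / Real.log (x + h) ^ (2 * m) ≤ D * (2 * x) ^ 2 / L ^ (2 * m) := by
            gcongr
        _ = _ := by ring
    have hS1 := hS (x + h) (by linarith) (by linarith)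
    rw [abs_le] at hR1 hR2 hS1
    have h5 : rieszSumReal r (x + h) / κ - rieszSumReal r x / κ
        ≤ h * ((∑ n ∈ Finset.Icc 1 ⌊x + h⌋₊, r n) / κ) := by
      rw [← sub_div, ← mul_div_assoc]
      exact div_le_div_of_nonneg_right hdr.2 hκ.le
    have h6 : h * ∑ n ∈ Finset.Icc 1 ⌊x⌋₊, b n
        ≤ h * (x + h + 2 * A₀ * C₂ / κ * Y + 10 * D * Y) := by
      have h7 : h * ((∑ n ∈ Finset.Icc 1 ⌊x + h⌋₊, r n) / κ) ≤ h * (x + h + 2 * A₀ * C₂ / κ * Y) := by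
        gcongr; linarith
      linarith [hd.1]
    have h8 := le_of_mul_le_mul_left h6 hh0
    have h9 : D * Y ≤ D * 4 ^ m * Y := by
      refine mul_le_mul_of_nonneg_right ?_ hY0.le
      exact le_mul_of_one_le_right hD.le h4
    have h10 : 0 ≤ 2 ^ m * Y := by positivity
    rw [hG]
    linarith

theorem CharFamily.siegelWalfisz (h : CharFamily r b κ δ A₀ A E c) (hE : 1 ≤ E) (m : ℕ) :
    ∃ C : ℝ, 0 < C ∧ ∀ x : ℝ, Real.exp 1 ≤ x → ∀ (q : ℕ) (χ : DirichletCharacter ℂ q), 1 ≤ q →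
      (q : ℝ) ≤ Real.log x ^ m → χ.IsPrimitive → c q χ = 0 →
      ‖∑ n ∈ Finset.Icc 1 ⌊x⌋₊, χ (n : ZMod q) * b n‖ ≤ C * (x / Real.log x ^ m) := by
  have hb := h.base
  have hm := h.mangoldt
  have hA := h.one_le_A
  obtain ⟨C₁, hC₁, hbd⟩ := h.exists_norm_iteratedDeriv_le hE (2 * m + m * E)
  obtain ⟨C₂, hC₂, hpsi⟩ := hm.exists_abs_sum_sub_le hb m
  set T := Real.exp 1 * ∫ w : ℝ, (2 + |2 * Real.pi * w|) ^ (1 / 2 : ℝ) /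
      (1 + (2 * Real.pi * w) ^ 2) with hT
  have hT0 : 0 ≤ T := mul_nonneg (Real.exp_pos 1).le
    (MeasureTheory.integral_nonneg fun w => by positivity)
  refine ⟨5 * (T * (C₁ * A)) + 1 + 3 * C₂, by positivity, fun x hx q χ hq hqL hp hcχ => ?_⟩
  have hx0 : 0 < x := (Real.exp_pos 1).trans_le hx
  set L := Real.log x with hL
  have hL1 : 1 ≤ L := (Real.le_log_iff_exp_le hx0).mpr hx
  set Y := x / L ^ m with hY
  have hLm : 1 ≤ L ^ m := one_le_pow₀ hL1
  have hY0 : 0 < Y := by positivity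
  have hYx : Y ≤ x := div_le_self hx0.le hLm
  have hq1 : (1 : ℝ) ≤ q := by exact_mod_cast hq
  have tw := h.twist q χ hq
  have hV : C₁ * (A * (q : ℝ) ^ E) ^ (1 / 2 : ℝ) ≤ C₁ * A * L ^ (m * E) := by
    rw [mul_assoc]
    gcongr
    calc (A * (q : ℝ) ^ E) ^ (1 / 2 : ℝ) ≤ (A * (q : ℝ) ^ E) ^ (1 : ℝ) :=
          Real.rpow_le_rpow_of_exponent_le tw.one_le (by norm_num)
      _ = A * (q : ℝ) ^ E := Real.rpow_one _
      _ ≤ A * (L ^ m) ^ E := by gcongr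
      _ = _ := by rw [pow_mul]
  have hR : ∀ y : ℝ, x ≤ y → ‖rieszSum (twCoeff b (charHom χ)) y‖ ≤
      T * (C₁ * A) * y ^ 2 / L ^ (2 * m) := by
    intro y hy
    have h1 := norm_rieszSum_le_of_iteratedDeriv (fun s hs => hm.summable hb tw.norm_le hs)
      (k := 2 * m + m * E) (V := C₁ * (A * (q : ℝ) ^ E) ^ (1 / 2 : ℝ))
      (fun j hj σ t hσ hσ2 => by
        refine (hbd q χ hq hp hcχ j hj σ t hσ hσ2).trans (le_of_eq ?_)
        rw [Real.mul_rpow (by positivity) (by positivity)]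
        ring) (hx.trans hy)
    have e2 : L ≤ Real.log y := Real.log_le_log hx0 hy
    refine h1.trans ?_
    calc T * (C₁ * (A * (q : ℝ) ^ E) ^ (1 / 2 : ℝ)) * y ^ 2 / Real.log y ^ (2 * m + m * E)
        ≤ T * (C₁ * A * L ^ (m * E)) * y ^ 2 / L ^ (2 * m + m * E) := by gcongr
      _ = _ := by rw [pow_add]; field_simp
  have hkey := rieszSum_add_sub (twCoeff b (charHom χ)) (x := x) hY0.le
  have hsplit := sum_Icc_floor_add b (x := x) hY0.le
  have hp1 := hpsi x hx
  have hp2 := hpsi (x + Y) (by linarith)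
  have hp2' : (x + Y) / Real.log (x + Y) ^ m ≤ 2 * Y := by
    have e2 : L ≤ Real.log (x + Y) := Real.log_le_log hx0 (by linarith)
    calc (x + Y) / Real.log (x + Y) ^ m ≤ (2 * x) / L ^ m := by
          gcongr; linarith
      _ = _ := by rw [hY]; ring
  have hshort : ∑ n ∈ Finset.Ioc ⌊x⌋₊ ⌊x + Y⌋₊, b n ≤ Y + 3 * C₂ * Y := by
    rw [abs_le] at hp1 hp2
    have := mul_le_mul_of_nonneg_left hp2' hC₂.le
    linarith [hp1.1, hp2.2]
  have herr : ‖∑ n ∈ Finset.Ioc ⌊x⌋₊ ⌊x + Y⌋₊, twCoeff b (charHom χ) n * ((x + Y : ℝ) - n)‖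
      ≤ Y * (Y + 3 * C₂ * Y) := by
    refine le_trans ?_ (mul_le_mul_of_nonneg_left hshort hY0.le)
    rw [Finset.mul_sum]
    refine norm_sum_le_of_le _ fun n hn => ?_
    obtain ⟨h1, h2⟩ := cast_mem_Ioc_floor hx0.le hn
    rw [norm_mul, mul_comm]
    have e1 : ‖(((x + Y : ℝ) : ℂ) - n)‖ ≤ Y := by
      rw [← Complex.ofReal_natCast, ← Complex.ofReal_sub, Complex.norm_real,
        Real.norm_of_nonneg (by linarith)]
      linarith
    have e2 : ‖twCoeff b (charHom χ) n‖ ≤ b n := by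
      rw [twCoeff, norm_mul, Complex.norm_real, Real.norm_of_nonneg (hm.nonneg n)]
      exact mul_le_of_le_one_left (hm.nonneg n) (tw.norm_le n)
    gcongr
  have hx2L : x ^ 2 / L ^ (2 * m) = Y * Y := by
    rw [hY, pow_mul']; field_simp
  have hR1 := hR x le_rfl
  have hR2 := hR (x + Y) (by linarith)
  have hR2' : T * (C₁ * A) * (x + Y) ^ 2 / L ^ (2 * m) ≤ 4 * (T * (C₁ * A)) * (Y * Y) := by
    rw [← hx2L]
    have e1 : (x + Y) ^ 2 ≤ (2 * x) ^ 2 := pow_le_pow_left₀ (by linarith) (by linarith) 2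
    calc T * (C₁ * A) * (x + Y) ^ 2 / L ^ (2 * m) ≤ T * (C₁ * A) * (2 * x) ^ 2 / L ^ (2 * m) := by
          gcongr
      _ = _ := by ring
  rw [mul_div_assoc, hx2L] at hR1
  have hfin : Y * ‖∑ n ∈ Finset.Icc 1 ⌊x⌋₊, twCoeff b (charHom χ) n‖
      ≤ Y * ((5 * (T * (C₁ * A)) + 1 + 3 * C₂) * Y) := by
    have e1 : Y * ‖∑ n ∈ Finset.Icc 1 ⌊x⌋₊, twCoeff b (charHom χ) n‖
        = ‖(Y : ℂ) * ∑ n ∈ Finset.Icc 1 ⌊x⌋₊, twCoeff b (charHom χ) n‖ := by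
      rw [norm_mul, Complex.norm_real, Real.norm_of_nonneg hY0.le]
    have e2 : (Y : ℂ) * ∑ n ∈ Finset.Icc 1 ⌊x⌋₊, twCoeff b (charHom χ) n
        = rieszSum (twCoeff b (charHom χ)) (x + Y) - rieszSum (twCoeff b (charHom χ)) x -
          ∑ n ∈ Finset.Ioc ⌊x⌋₊ ⌊x + Y⌋₊, twCoeff b (charHom χ) n * ((x + Y : ℝ) - n) := by
      rw [hkey]; ring
    rw [e1, e2]
    refine (norm_sub_le _ _).trans ?_
    have := norm_sub_le (rieszSum (twCoeff b (charHom χ)) (x + Y)) (rieszSum (twCoeff b (charHom χ)) x)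
    linarith
  exact le_of_mul_le_mul_left hfin hY0

end

/-! ### Lattice points in sets with a Lipschitz-like boundary -/

section LatticeCount
open MeasureTheory Module
open scoped Pointwise

theorem IsPreconnected.subset_or_disjoint_of_disjoint_frontier {α : Type*} [TopologicalSpace α]
    {s t : Set α} (hs : IsPreconnected s) (h : Disjoint s (frontier t)) : s ⊆ t ∨ Disjoint s t := by
  have hcov : s ⊆ interior t ∪ interior tᶜ := by
    intro x hx
    have hx' : x ∉ frontier t := Set.disjoint_left.mp h hx
    rw [interior_compl]
    by_cases h1 : x ∈ closure t
    · exact Or.inl (by by_contra h2; exact hx' ⟨h1, h2⟩)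
    · exact Or.inr h1
  rcases IsPreconnected.subset_or_subset isOpen_interior isOpen_interior
    (disjoint_compl_right.mono interior_subset interior_subset) hcov hs with h1 | h1
  · exact Or.inl (h1.trans interior_subset)
  · exact Or.inr (Set.disjoint_left.mpr fun x hx => interior_subset (h1 hx))

variable {E ι : Type*} [NormedAddCommGroup E] [NormedSpace ℝ E] [FiniteDimensional ℝ E]
  [Fintype ι] (b : Basis ι ℝ E)

theorem ZSpan.finite_add_mem {Y : Set E} (hY : Bornology.IsBounded Y) (c : E) :
    {v : E | v ∈ Submodule.span ℤ (Set.range b) ∧ v + c ∈ Y}.Finite := by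
  have : ProperSpace E := FiniteDimensional.proper ℝ E
  have h1 : Bornology.IsBounded ((fun v => v + c) ⁻¹' Y) := by
    obtain ⟨R, hR⟩ := isBounded_iff_forall_norm_le.mp hY
    refine isBounded_iff_forall_norm_le.mpr ⟨R + ‖c‖, fun v hv => ?_⟩
    calc ‖v‖ = ‖(v + c) - c‖ := by simp
      _ ≤ ‖v + c‖ + ‖c‖ := norm_sub_le _ _
      _ ≤ R + ‖c‖ := by gcongr; exact hR _ hv
  refine (ZSpan.setFinite_inter b h1).subset ?_
  rintro v ⟨h2, h3⟩
  exact ⟨h3, h2⟩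

/-- The number of lattice points in a ball, uniformly in the centre. -/
theorem ZSpan.ncard_dist_le (ρ : ℝ) (z : E) :
    {v : E | v ∈ Submodule.span ℤ (Set.range b) ∧ dist v z ≤ ρ}.ncard ≤
      {v : E | v ∈ Submodule.span ℤ (Set.range b) ∧ v + 0 ∈ Metric.closedBall (0 : E) (2 * ρ)}.ncard := by
  set A := {v : E | v ∈ Submodule.span ℤ (Set.range b) ∧ dist v z ≤ ρ} with hA
  rcases A.eq_empty_or_nonempty with h | ⟨v₀, hv₀⟩
  · rw [h]; simp
  · refine Set.ncard_le_ncard_of_injOn (fun v => v - v₀) ?_ (fun x _ y _ h => sub_left_injective h)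
      (ZSpan.finite_add_mem b Metric.isBounded_closedBall 0)
    rintro v ⟨h1, h2⟩
    refine ⟨Submodule.sub_mem _ h1 hv₀.1, ?_⟩
    rw [add_zero, mem_closedBall_zero_iff, ← dist_eq_norm]
    calc dist v v₀ ≤ dist v z + dist v₀ z := dist_triangle_right _ _ _
      _ ≤ 2 * ρ := by linarith [hv₀.2]

variable [MeasurableSpace E] [BorelSpace E]

theorem ZSpan.abs_ncard_mul_sub_le (μ : Measure E) [μ.IsAddHaarMeasure] {d : ℝ}
    (hd : ∀ x ∈ ZSpan.fundamentalDomain b, ‖x‖ ≤ d) {Y : Set E} (hY : Bornology.IsBounded Y)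
    (hYm : MeasurableSet Y) {L : ℝ} (S : Finset E)
    (hS : frontier Y ⊆ ⋃ p ∈ S, Metric.closedBall p L) (c : E) :
    |({v : E | v ∈ Submodule.span ℤ (Set.range b) ∧ v + c ∈ Y}.ncard : ℝ) *
        μ.real (ZSpan.fundamentalDomain b) - μ.real Y| ≤
      μ.real (ZSpan.fundamentalDomain b) * (S.card *
        {v : E | v ∈ Submodule.span ℤ (Set.range b) ∧
          v + 0 ∈ Metric.closedBall (0 : E) (2 * (d + L))}.ncard) := by
  have hYμ : μ Y ≠ ⊤ := hY.measure_lt_top.ne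
  set F := ZSpan.fundamentalDomain b with hF
  have hFm : MeasurableSet F := ZSpan.fundamentalDomain_measurableSet b
  have hFμ : μ F ≠ ⊤ := (ZSpan.fundamentalDomain_isBounded b).measure_lt_top.ne
  have hd0 : 0 ≤ d := by
    have := hd _ (ZSpan.fract_mem_fundamentalDomain b 0)
    exact (norm_nonneg _).trans this
  set Y' := Metric.cthickening d Y with hY'
  have hY'b : Bornology.IsBounded Y' := hY.cthickening
  set I : Finset E := (ZSpan.finite_add_mem b hY'b c).toFinset with hI
  have hImem : ∀ v, v ∈ I ↔ v ∈ Submodule.span ℤ (Set.range b) ∧ v + c ∈ Y' := by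
    intro v; rw [hI, Set.Finite.mem_toFinset]; rfl
  -- the cells
  set cell : E → Set E := fun v => (fun x => x - (v + c)) ⁻¹' F with hcell
  have hcellm : ∀ v, MeasurableSet (cell v) := fun v => hFm.preimage (by fun_prop)
  have hcellμ : ∀ v, μ.real (cell v) = μ.real F := by
    intro v
    simp only [measureReal_def, hcell, sub_eq_add_neg]
    rw [measure_preimage_add_right]
  have hdist : ∀ v, ∀ x ∈ cell v, dist x (v + c) ≤ d := by
    intro v x hx
    rw [dist_eq_norm]; exact hd _ hx
  have hex : ∀ x ∈ Y, ∃ v ∈ I, x ∈ cell v := by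
    intro x hx
    refine ⟨ZSpan.floor b (x - c), ?_, ?_⟩
    · rw [hImem]
      refine ⟨(ZSpan.floor b (x - c)).2, ?_⟩
      refine Metric.mem_cthickening_of_dist_le _ x d Y hx ?_
      rw [dist_comm, dist_eq_norm]
      refine le_trans (le_of_eq ?_) (hd _ (ZSpan.fract_mem_fundamentalDomain b (x - c)))
      rw [ZSpan.fract_apply]; congr 1; abel
    · have := ZSpan.fract_mem_fundamentalDomain b (x - c)
      rw [ZSpan.fract_apply] at this
      simp only [hcell, Set.mem_preimage]
      convert this using 1; abel
  have hdisj : (I : Set E).PairwiseDisjoint (fun v => cell v ∩ Y) := by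
    intro v hv w hw hvw
    refine Set.disjoint_left.mpr fun x hx hx' => hvw ?_
    have hv' := ((hImem v).mp hv).1
    have hw' := ((hImem w).mp hw).1
    obtain ⟨u, _, hu⟩ := ZSpan.exist_unique_vadd_mem_fundamentalDomain b (x - c)
    have h1 := hu ⟨-v, Submodule.neg_mem _ hv'⟩ (by
      have := hx.1
      simp only [hcell, Set.mem_preimage] at this
      show -v + (x - c) ∈ F
      convert this using 1; abel)
    have h2 := hu ⟨-w, Submodule.neg_mem _ hw'⟩ (by
      have := hx'.1
      simp only [hcell, Set.mem_preimage] at this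
      show -w + (x - c) ∈ F
      convert this using 1; abel)
    have h3 := congrArg Subtype.val (h1.trans h2.symm)
    simpa using h3
  have hYsum : μ.real Y = ∑ v ∈ I, μ.real (cell v ∩ Y) := by
    rw [← measureReal_biUnion_finset hdisj (fun v _ => (hcellm v).inter hYm)
      (fun v _ => ne_top_of_le_ne_top hYμ (measure_mono Set.inter_subset_right))]
    congr 1
    ext x
    simp only [Set.mem_iUnion, exists_prop, Set.mem_inter_iff]
    constructor
    · intro hx
      obtain ⟨v, hv, hxv⟩ := hex x hx
      exact ⟨v, hv, hxv, hx⟩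
    · rintro ⟨v, _, _, hx⟩; exact hx
  have hcount : ({v : E | v ∈ Submodule.span ℤ (Set.range b) ∧ v + c ∈ Y}.ncard : ℝ) * μ.real F =
      ∑ v ∈ I, if v + c ∈ Y then μ.real F else 0 := by
    rw [← Finset.sum_filter, Finset.sum_const, nsmul_eq_mul]
    congr 2
    rw [← Set.ncard_coe_finset]
    congr 1
    ext v
    simp only [Set.mem_ofPred_eq, Finset.coe_filter, hImem]
    constructor
    · rintro ⟨h1, h2⟩; exact ⟨⟨h1, Metric.self_subset_cthickening Y h2⟩, h2⟩
    · rintro ⟨⟨h1, _⟩, h2⟩; exact ⟨h1, h2⟩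
  set bad : Finset E := I.filter (fun v => ¬ Disjoint (Metric.closedBall (v + c) d) (frontier Y))
    with hbad
  have hterm : ∀ v ∈ I, |(if v + c ∈ Y then μ.real F else 0) - μ.real (cell v ∩ Y)| ≤
      if ¬ Disjoint (Metric.closedBall (v + c) d) (frontier Y) then μ.real F else 0 := by
    intro v hv
    have hle : μ.real (cell v ∩ Y) ≤ μ.real F := by
      rw [← hcellμ v]
      refine measureReal_mono Set.inter_subset_left ?_
      have : μ (cell v) = μ F := by
        simp only [hcell, sub_eq_add_neg]
        rw [measure_preimage_add_right]
      rw [this]; exact hFμ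
    have hnn : 0 ≤ μ.real (cell v ∩ Y) := measureReal_nonneg
    by_cases hdj : Disjoint (Metric.closedBall (v + c) d) (frontier Y)
    · rw [if_neg (not_not.mpr hdj)]
      have hself : v + c ∈ Metric.closedBall (v + c) d := Metric.mem_closedBall_self hd0
      have hsub : cell v ⊆ Metric.closedBall (v + c) d := fun x hx => hdist v x hx
      rcases (convex_closedBall (v + c) d).isPreconnected.subset_or_disjoint_of_disjoint_frontier hdj
        with h1 | h1
      · rw [if_pos (h1 hself), Set.inter_eq_left.mpr (hsub.trans h1), hcellμ, sub_self, abs_zero]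
      · rw [if_neg (Set.disjoint_left.mp h1 hself), (h1.mono_left hsub).inter_eq]
        simp
    · rw [if_pos hdj, abs_le]
      split_ifs <;> constructor <;> linarith [measureReal_nonneg (μ := μ) (s := F)]
  have hbadcard : bad.card ≤ S.card * {v : E | v ∈ Submodule.span ℤ (Set.range b) ∧
          v + 0 ∈ Metric.closedBall (0 : E) (2 * (d + L))}.ncard := by
    have hsub : (bad : Set E) ⊆ ⋃ p ∈ S, {v : E | v ∈ Submodule.span ℤ (Set.range b) ∧
        dist v (p - c) ≤ d + L} := by
      intro v hv
      rw [hbad, Finset.coe_filter] at hv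
      obtain ⟨hvI, hv2⟩ := hv
      obtain ⟨x, hx1, hx2⟩ := Set.not_disjoint_iff.mp hv2
      obtain ⟨p, hp, hxp⟩ := by simpa only [Set.mem_iUnion, exists_prop] using hS hx2
      simp only [Set.mem_iUnion, exists_prop]
      refine ⟨p, hp, ((hImem v).mp hvI).1, ?_⟩
      have : dist v (p - c) = dist (v + c) p := by
        rw [dist_eq_norm, dist_eq_norm]; congr 1; abel
      rw [this]
      calc dist (v + c) p ≤ dist x (v + c) + dist x p := dist_triangle_left _ _ _
        _ ≤ d + L := add_le_add hx1 hxp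
    rw [← Set.ncard_coe_finset]
    have hfin : ∀ p : E, {v : E | v ∈ Submodule.span ℤ (Set.range b) ∧
        dist v (p - c) ≤ d + L}.Finite := by
      intro p
      refine (ZSpan.finite_add_mem b (Metric.isBounded_closedBall (x := p - c) (r := d + L)) 0).subset ?_
      rintro v ⟨h1, h2⟩
      exact ⟨h1, by simpa using h2⟩
    calc (bad : Set E).ncard ≤ (⋃ p ∈ S, {v : E | v ∈ Submodule.span ℤ (Set.range b) ∧
        dist v (p - c) ≤ d + L}).ncard :=
          Set.ncard_le_ncard hsub (Set.Finite.biUnion S.finite_toSet fun p _ => hfin p)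
      _ ≤ ∑ p ∈ S, {v : E | v ∈ Submodule.span ℤ (Set.range b) ∧
        dist v (p - c) ≤ d + L}.ncard := Finset.set_ncard_biUnion_le _ _
      _ ≤ ∑ p ∈ S, _ := Finset.sum_le_sum fun p _ => ZSpan.ncard_dist_le b (d + L) (p - c)
      _ = _ := by rw [Finset.sum_const, smul_eq_mul]
  rw [hcount, hYsum, ← Finset.sum_sub_distrib]
  calc |∑ v ∈ I, ((if v + c ∈ Y then μ.real F else 0) - μ.real (cell v ∩ Y))|
      ≤ ∑ v ∈ I, |(if v + c ∈ Y then μ.real F else 0) - μ.real (cell v ∩ Y)| :=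
        Finset.abs_sum_le_sum_abs _ _
    _ ≤ ∑ v ∈ I, if ¬ Disjoint (Metric.closedBall (v + c) d) (frontier Y) then μ.real F else 0 :=
        Finset.sum_le_sum hterm
    _ = μ.real F * bad.card := by
        rw [← Finset.sum_filter, Finset.sum_const, nsmul_eq_mul, mul_comm]
    _ ≤ _ := by
        gcongr
        exact_mod_cast hbadcard

/-- The boundary of `X` is covered by `O(N ^ k)` balls of radius `O(1 / N)`. -/
def HasSmallFrontier (X : Set E) (k : ℕ) : Prop :=
  ∃ C L : ℝ, 0 ≤ C ∧ 0 ≤ L ∧ ∀ N : ℕ, 1 ≤ N → ∃ S : Finset E, (S.card : ℝ) ≤ C * (N : ℝ) ^ k ∧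
    frontier X ⊆ ⋃ p ∈ S, Metric.closedBall p (L / N)

/-- The number of points of a translated lattice in a dilated set. -/
theorem ZSpan.exists_abs_ncard_sub_le {X : Set E} (hX : Bornology.IsBounded X)
    (hXm : MeasurableSet X) {k : ℕ} (hk : HasSmallFrontier X k) :
    ∃ V C : ℝ, 0 ≤ C ∧ ∀ T : ℝ, 0 < T → ∀ c : E,
      |({v : E | v ∈ Submodule.span ℤ (Set.range b) ∧ v + c ∈ T • X}.ncard : ℝ) -
        T ^ (finrank ℝ E) * V| ≤ C * (1 + T) ^ k := by
  obtain ⟨C, L, hC, hL, hcov⟩ := hk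
  obtain ⟨d, hd⟩ := isBounded_iff_forall_norm_le.mp (ZSpan.fundamentalDomain_isBounded b)
  let μ : Measure E := Measure.addHaar
  set F := ZSpan.fundamentalDomain b with hF
  have hFμ : μ F ≠ ⊤ := (ZSpan.fundamentalDomain_isBounded b).measure_lt_top.ne
  have hF0 : 0 < μ.real F :=
    ENNReal.toReal_pos (ZSpan.measure_fundamentalDomain_ne_zero b) hFμ
  set B := {v : E | v ∈ Submodule.span ℤ (Set.range b) ∧
          v + 0 ∈ Metric.closedBall (0 : E) (2 * (d + L))}.ncard with hB
  refine ⟨μ.real X / μ.real F, C * B, by positivity, fun T hT c => ?_⟩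
  obtain ⟨S, hScard, hS⟩ := hcov ⌈T⌉₊ (Nat.one_le_ceil_iff.mpr hT)
  have hfr : frontier (T • X) = T • frontier X :=
    ((Homeomorph.smulOfNeZero T hT.ne').image_frontier X).symm
  have hS' : frontier (T • X) ⊆ ⋃ p ∈ S.image (fun p => T • p), Metric.closedBall p L := by
    rw [hfr]
    rintro _ ⟨x, hx, rfl⟩
    obtain ⟨p, hp, hxp⟩ := by simpa only [Set.mem_iUnion, exists_prop] using hS hx
    simp only [Set.mem_iUnion, exists_prop]
    refine ⟨T • p, Finset.mem_image_of_mem _ hp, ?_⟩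
    show dist (T • x) (T • p) ≤ L
    rw [dist_smul₀, Real.norm_of_nonneg hT.le]
    have h0 : (0 : ℝ) < ⌈T⌉₊ := hT.trans_le (Nat.le_ceil T)
    calc T * dist x p ≤ T * (L / ⌈T⌉₊) := by gcongr; exact hxp
      _ = (T / ⌈T⌉₊) * L := by ring
      _ ≤ 1 * L := by gcongr; exact (div_le_one h0).mpr (Nat.le_ceil T)
      _ = L := one_mul L
  have h1 := ZSpan.abs_ncard_mul_sub_le b μ hd (hX.smul₀ T) (hXm.const_smul₀ T) _ hS' c
  have hμT : μ.real (T • X) = T ^ finrank ℝ E * μ.real X := by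
    rw [measureReal_def, Measure.addHaar_smul, ENNReal.toReal_mul, ENNReal.toReal_ofReal (abs_nonneg _),
      abs_of_nonneg (by positivity)]
    rfl
  rw [hμT] at h1
  set n := ({v : E | v ∈ Submodule.span ℤ (Set.range b) ∧ v + c ∈ T • X}.ncard : ℝ)
  have h2 : n - T ^ finrank ℝ E * (μ.real X / μ.real F) =
      (n * μ.real F - T ^ finrank ℝ E * μ.real X) / μ.real F := by
    field_simp
  rw [h2, abs_div, abs_of_pos hF0, div_le_iff₀ hF0]
  refine h1.trans ?_
  have h3 : ((S.image (fun p => T • p)).card : ℝ) ≤ C * (1 + T) ^ k := by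
    calc ((S.image (fun p => T • p)).card : ℝ) ≤ S.card := by exact_mod_cast Finset.card_image_le
      _ ≤ C * (⌈T⌉₊ : ℝ) ^ k := hScard
      _ ≤ C * (1 + T) ^ k := by
        gcongr
        linarith [Nat.ceil_lt_add_one hT.le]
  calc μ.real F * (((S.image (fun p => T • p)).card : ℝ) * B)
      ≤ μ.real F * ((C * (1 + T) ^ k) * B) := by gcongr
    _ = C * B * (1 + T) ^ k * μ.real F := by ring

end LatticeCount

theorem hasSmallFrontier_of_lipschitzOn {E ι : Type*} [NormedAddCommGroup E] [Fintype ι]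
    {X : Set E} {L : NNReal} {Φ : (ι → ℝ) → E} (hΦ : LipschitzOnWith L Φ (Set.Icc 0 1))
    (hX : ∀ x ∈ frontier X, ∃ p ∈ Set.Icc (0 : ι → ℝ) 1, (∃ i, p i = 0 ∨ p i = 1) ∧ Φ p = x) :
    HasSmallFrontier X (Fintype.card ι - 1) := by
  refine ⟨Fintype.card ι * (2 * 2 ^ (Fintype.card ι - 1)), L, by positivity, L.2, fun N hN => ?_⟩
  have hN0 : (0 : ℝ) < N := by exact_mod_cast hN
  let g : (Σ i : ι, Bool × ({j // j ≠ i} → Fin (N + 1))) → (ι → ℝ) := fun t j =>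
    if h : j = t.1 then (if t.2.1 then 1 else 0) else ((t.2.2 ⟨j, h⟩ : ℕ) : ℝ) / N
  have hg : ∀ t, g t ∈ Set.Icc (0 : ι → ℝ) 1 := by
    intro t
    constructor
    · intro j
      simp only [g, Pi.zero_apply]
      split_ifs <;> positivity
    · intro j
      simp only [g, Pi.one_apply]
      split_ifs
      · norm_num
      · norm_num
      · rw [div_le_one hN0]
        exact_mod_cast Nat.lt_succ_iff.mp (Fin.is_lt _)
  refine ⟨Finset.univ.image fun t => Φ (g t), ?_, ?_⟩
  · have hcard : Fintype.card (Σ i : ι, Bool × ({j // j ≠ i} → Fin (N + 1))) =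
        Fintype.card ι * (2 * (N + 1) ^ (Fintype.card ι - 1)) := by
      simp [Fintype.card_sigma, Fintype.card_subtype_compl]
    calc ((Finset.univ.image fun t => Φ (g t)).card : ℝ)
        ≤ (Fintype.card ι * (2 * (N + 1) ^ (Fintype.card ι - 1)) : ℕ) := by
          rw [← hcard]; exact_mod_cast Finset.card_image_le
      _ = Fintype.card ι * (2 * ((N : ℝ) + 1) ^ (Fintype.card ι - 1)) := by push_cast; ring
      _ ≤ Fintype.card ι * (2 * (2 * (N : ℝ)) ^ (Fintype.card ι - 1)) := by
          have : (1 : ℝ) ≤ N := by exact_mod_cast hN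
          gcongr
          linarith
      _ = _ := by rw [mul_pow]; ring
  · intro x hx
    obtain ⟨p, hp, ⟨i, hi⟩, rfl⟩ := hX x hx
    have hfl : ∀ j, ⌊N * p j⌋₊ < N + 1 := by
      intro j
      refine Nat.lt_succ_of_le (Nat.floor_le_of_le ?_)
      have := hp.2 j
      simp only [Pi.one_apply] at this
      nlinarith
    let t : (Σ i : ι, Bool × ({j // j ≠ i} → Fin (N + 1))) :=
      ⟨i, decide (p i = 1), fun j => ⟨⌊N * p j⌋₊, hfl j⟩⟩
    simp only [Set.mem_iUnion, exists_prop]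
    refine ⟨Φ (g t), Finset.mem_image_of_mem _ (Finset.mem_univ t), ?_⟩
    rw [Metric.mem_closedBall]
    refine (hΦ.dist_le_mul p hp (g t) (hg t)).trans ?_
    rw [div_eq_mul_one_div]
    gcongr
    refine (dist_pi_le_iff (by positivity)).mpr fun j => ?_
    simp only [g, t]
    split_ifs with h1 h2
    · rw [h1, of_decide_eq_true h2]; simp
    · rw [h1]
      rcases hi with hi | hi
      · rw [hi]; simp
      · exact absurd (decide_eq_true hi) h2
    · have h0 : 0 ≤ p j := hp.1 j
      have h3 := Nat.floor_le (by positivity : (0 : ℝ) ≤ N * p j)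
      have h4 := Nat.lt_floor_add_one (N * p j)
      rw [Real.dist_eq, abs_le]
      constructor
      · have h6 : (⌊N * p j⌋₊ : ℝ) / N ≤ p j := by rw [div_le_iff₀ hN0]; linarith
        have h7 : (0 : ℝ) ≤ 1 / N := by positivity
        linarith
      · have h6 : p j ≤ ((⌊N * p j⌋₊ : ℝ) + 1) / N := by rw [le_div_iff₀ hN0]; linarith
        rw [add_div] at h6
        linarith

/-! ### Sign components of the fundamental cone -/

section SignedCone
open NumberField.mixedEmbedding NumberField.mixedEmbedding.fundamentalCone NumberField.InfinitePlace
open NumberField.Units.dirichletUnitTheorem (w₀)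

variable (K : Type*) [Field K] [NumberField K]

/-- The points of norm at most one of the fundamental cone with prescribed signs at the real
places. -/
def signedNormLeOne (ε : {w : InfinitePlace K // IsReal w} → ℤˣ) : Set (mixedSpace K) :=
  {x | x ∈ normLeOne K ∧ ∀ w, 0 < ((ε w : ℤ) : ℝ) * x.1 w}

variable {K}
variable (ε : {w : InfinitePlace K // IsReal w} → ℤˣ)

theorem isBounded_signedNormLeOne : Bornology.IsBounded (signedNormLeOne K ε) :=
  (isBounded_normLeOne K).subset fun _ h => h.1

theorem isOpen_signs : IsOpen {x : mixedSpace K | ∀ w, 0 < ((ε w : ℤ) : ℝ) * x.1 w} := by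
  have : {x : mixedSpace K | ∀ w, 0 < ((ε w : ℤ) : ℝ) * x.1 w} =
      ⋂ w, {x : mixedSpace K | 0 < ((ε w : ℤ) : ℝ) * x.1 w} := by ext; simp
  rw [this]
  exact isOpen_iInter_of_finite fun w => isOpen_lt continuous_const (by fun_prop)

theorem measurableSet_signedNormLeOne : MeasurableSet (signedNormLeOne K ε) :=
  (measurableSet_normLeOne K).inter (isOpen_signs ε).measurableSet

theorem units_int_cast_mul_self (u : ℤˣ) : ((u : ℤ) : ℝ) * ((u : ℤ) : ℝ) = 1 := by
  rcases Int.units_eq_one_or u with rfl | rfl <;> simp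

theorem abs_units_int_cast (u : ℤˣ) : |((u : ℤ) : ℝ)| = 1 := by
  rcases Int.units_eq_one_or u with rfl | rfl <;> simp

/-- Absolute values of the parametrization of the sign components. -/
noncomputable def coneRadius (p : InfinitePlace K ⊕ {w : InfinitePlace K // IsComplex w} → ℝ) :
    realSpace K :=
  p (Sum.inl w₀) • expMapBasis (fun i => if i = w₀ then 0 else p (Sum.inl i))

/-- A smooth parametrization of the sign components. -/
noncomputable def coneParam (p : InfinitePlace K ⊕ {w : InfinitePlace K // IsComplex w} → ℝ) :
    mixedSpace K :=
  (fun w => ((ε w : ℤ) : ℝ) * coneRadius p w.1,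
    fun w => (coneRadius p w.1 : ℂ) *
      Complex.exp (((2 * Real.pi * p (Sum.inr w) - Real.pi : ℝ) : ℂ) * Complex.I))

theorem contDiff_expMapBasis_apply (w : InfinitePlace K) :
    ContDiff ℝ 1 fun y : realSpace K => expMapBasis y w := by
  simp only [expMapBasis_apply, expMap_apply]
  refine Real.contDiff_exp.comp (contDiff_const.mul ?_)
  let f : realSpace K →ₗ[ℝ] ℝ := (LinearMap.proj w).comp
    ((completeBasis K).equivFun.symm : (InfinitePlace K → ℝ) →ₗ[ℝ] realSpace K)
  exact (LinearMap.toContinuousLinearMap f).contDiff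

theorem contDiff_coneRadius (w : InfinitePlace K) :
    ContDiff ℝ 1 fun p : InfinitePlace K ⊕ {w : InfinitePlace K // IsComplex w} → ℝ =>
      coneRadius p w := by
  simp only [coneRadius, Pi.smul_apply, smul_eq_mul]
  refine (contDiff_apply ℝ ℝ _).mul ((contDiff_expMapBasis_apply w).comp ?_)
  refine contDiff_pi.mpr fun i => ?_
  split_ifs
  · exact contDiff_const
  · exact contDiff_apply ℝ ℝ _

theorem contDiff_coneParam : ContDiff ℝ 1 (coneParam ε) := by
  refine ContDiff.prodMk (contDiff_pi.mpr fun w => ?_) (contDiff_pi.mpr fun w => ?_)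
  · exact contDiff_const.mul (contDiff_coneRadius _)
  · refine (Complex.ofRealCLM.contDiff.comp (contDiff_coneRadius _)).mul ?_
    refine ContDiff.cexp ?_
    refine ContDiff.mul (Complex.ofRealCLM.contDiff.comp ?_) contDiff_const
    exact (contDiff_const.mul (contDiff_apply ℝ ℝ _)).sub contDiff_const

theorem exists_lipschitzOnWith_coneParam : ∃ L, LipschitzOnWith L (coneParam ε) (Set.Icc 0 1) :=
  (contDiff_coneParam ε).contDiffOn.exists_lipschitzOnWith one_ne_zero (convex_Icc _ _) isCompact_Icc

theorem sign_nonneg_of_mem_closure {x : mixedSpace K} (hx : x ∈ closure (signedNormLeOne K ε)) (w) :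
    0 ≤ ((ε w : ℤ) : ℝ) * x.1 w := by
  have hc : IsClosed {x : mixedSpace K | 0 ≤ ((ε w : ℤ) : ℝ) * x.1 w} :=
    isClosed_le continuous_const (by fun_prop)
  exact closure_minimal (fun y hy => (hy.2 w).le) hc hx

/-- The boundary of a sign component lies on the faces of the parametrization. -/
theorem exists_coneParam_eq {x : mixedSpace K} (hx : x ∈ frontier (signedNormLeOne K ε)) :
    ∃ p ∈ Set.Icc (0 : InfinitePlace K ⊕ {w : InfinitePlace K // IsComplex w} → ℝ) 1,
      (∃ i, p i = 0 ∨ p i = 1) ∧ coneParam ε p = x := by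
  have hsgn := sign_nonneg_of_mem_closure ε hx.1
  have hcl : x ∈ closure (normLeOne K) := closure_mono (fun _ h => h.1) hx.1
  obtain ⟨c, hc, _, ⟨y, hy, rfl⟩, hcy⟩ := closure_normLeOne_subset K hcl
  let p : InfinitePlace K ⊕ {w : InfinitePlace K // IsComplex w} → ℝ :=
    Sum.elim (fun w => if w = w₀ then c else y w)
      (fun w => ((x.2 w).arg + Real.pi) / (2 * Real.pi))
  have hy' : ∀ w, w ≠ w₀ → y w ∈ Set.Icc (0 : ℝ) 1 := fun w hw => by
    simpa [hw] using hy w (Set.mem_univ _)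
  have hy0 : y w₀ = 0 := by simpa using hy w₀ (Set.mem_univ _)
  have hrad : coneRadius p = normAtAllPlaces x := by
    rw [← hcy]
    simp only [coneRadius, p, Sum.elim_inl, if_true]
    congr 2
    funext w
    split_ifs with h
    · rw [h, hy0]
    · rfl
  have hp01 : p ∈ Set.Icc (0 : InfinitePlace K ⊕ {w : InfinitePlace K // IsComplex w} → ℝ) 1 := by
    have h : ∀ i, p i ∈ Set.Icc (0 : ℝ) 1 := by
      rintro (w | w)
      · simp only [p, Sum.elim_inl]
        split_ifs with h
        · exact hc
        · exact hy' w h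
      · simp only [p, Sum.elim_inr]
        have h1 := Complex.neg_pi_lt_arg (x.2 w)
        have h2 := Complex.arg_le_pi (x.2 w)
        have h3 := Real.pi_pos
        constructor
        · exact div_nonneg (by linarith) (by linarith)
        · rw [div_le_one (by linarith)]; linarith
    exact ⟨fun i => (h i).1, fun i => (h i).2⟩
  refine ⟨p, hp01, ?_, ?_⟩
  · by_contra hne
    push Not at hne
    have hne' := fun w => hne (Sum.inl w)
    have hc0 : c ≠ 0 := by simpa [p] using (hne' w₀).1
    have hc1 : c ≠ 1 := by simpa [p] using (hne' w₀).2
    have hcpos : 0 < c := lt_of_le_of_ne hc.1 hc0.symm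
    have hint : x ∈ interior (normLeOne K) := by
      refine subset_interior_normLeOne K ?_
      refine ⟨fun w => if w = w₀ then Real.log c else y w, ?_, ?_⟩
      · rw [interior_paramSet]
        intro w _
        by_cases h : w = w₀
        · simp only [h, if_true]
          exact Real.log_neg hcpos (lt_of_le_of_ne hc.2 hc1)
        · simp only [h, if_false]
          have h0 := (hne' w).1
          have h1 := (hne' w).2
          simp only [p, Sum.elim_inl, h, if_false] at h0 h1
          exact ⟨lt_of_le_of_ne (hy' w h).1 (Ne.symm h0), lt_of_le_of_ne (hy' w h).2 h1⟩
      · rw [expMapBasis_apply'', if_pos rfl, Real.exp_log hcpos, ← hcy]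
        simp only
        congr 2
        funext w
        split_ifs with h
        · rw [h, hy0]
        · rfl
    have hpos : ∀ w, 0 < normAtPlace w x := by
      intro w
      have := congrFun hcy w
      simp only [Pi.smul_apply, smul_eq_mul] at this
      rw [← normAtAllPlaces_apply, ← this]
      exact mul_pos hcpos (expMapBasis_pos _ _)
    refine hx.2 ?_
    refine interior_maximal (s := signedNormLeOne K ε) (t := interior (normLeOne K) ∩
      {x : mixedSpace K | ∀ w, 0 < ((ε w : ℤ) : ℝ) * x.1 w}) ?_
      (isOpen_interior.inter (isOpen_signs ε)) ⟨hint, fun w => ?_⟩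
    · rintro z ⟨h1, h2⟩
      exact ⟨interior_subset h1, h2⟩
    · refine lt_of_le_of_ne (hsgn w) (Ne.symm ?_)
      have h1 := hpos w.1
      rw [normAtPlace_apply_of_isReal w.2] at h1
      refine mul_ne_zero ?_ (norm_pos_iff.mp h1)
      rcases Int.units_eq_one_or (ε w) with h | h <;> rw [h] <;> norm_num
  · refine Prod.ext ?_ ?_
    · funext w
      simp only [coneParam]
      rw [hrad, normAtAllPlaces_apply, normAtPlace_apply_of_isReal w.2, Real.norm_eq_abs]
      have h1 : |x.1 w| = ((ε w : ℤ) : ℝ) * x.1 w := by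
        rw [← abs_of_nonneg (hsgn w), abs_mul, abs_units_int_cast, one_mul]
      show ((ε w : ℤ) : ℝ) * |x.1 w| = _
      rw [h1, ← mul_assoc, units_int_cast_mul_self, one_mul]
    · funext w
      simp only [coneParam]
      rw [hrad, normAtAllPlaces_apply, normAtPlace_apply_of_isComplex w.2]
      have h1 : 2 * Real.pi * p (Sum.inr w) - Real.pi = (x.2 w).arg := by
        simp only [p, Sum.elim_inr]
        field_simp
        ring
      rw [h1]
      exact Complex.norm_mul_exp_arg_mul_I _

theorem hasSmallFrontier_signedNormLeOne :
    HasSmallFrontier (signedNormLeOne K ε) (Module.finrank ℚ K - 1) := by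
  obtain ⟨L, hL⟩ := exists_lipschitzOnWith_coneParam ε
  have h := hasSmallFrontier_of_lipschitzOn hL fun x hx => exists_coneParam_eq ε hx
  have hcard : Fintype.card (InfinitePlace K ⊕ {w : InfinitePlace K // IsComplex w}) =
      Module.finrank ℚ K := by
    rw [Fintype.card_sum, card_eq_nrRealPlaces_add_nrComplexPlaces,
      ← card_add_two_mul_card_eq_rank, nrComplexPlaces]
    ring
  rwa [hcard] at h

end SignedCone

/-! ### Norms, signs and congruences -/

section NormSign
open NumberField.mixedEmbedding NumberField.mixedEmbedding.fundamentalCone NumberField.InfinitePlace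

variable {K : Type*} [Field K] [NumberField K]

theorem prod_filter_mk_eq_of_isReal (x : K) {w : InfinitePlace K} (hw : IsReal w) :
    ∏ φ ∈ Finset.univ.filter (fun φ : K →+* ℂ => InfinitePlace.mk φ = w), φ x =
      (embedding_of_isReal hw x : ℂ) := by
  have : Finset.univ.filter (fun φ : K →+* ℂ => InfinitePlace.mk φ = w) = {embedding w} := by
    ext φ
    simp only [Finset.mem_filter, Finset.mem_univ, true_and, Finset.mem_singleton]
    constructor
    · rintro rfl
      have h := ComplexEmbedding.isReal_iff.mp (isReal_iff.mp hw)
      have h2 : mk (embedding (mk φ)) = mk φ := mk_embedding _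
      rw [mk_eq_iff, h, or_self] at h2
      exact h2.symm
    · rintro rfl; exact mk_embedding w
  rw [this, Finset.prod_singleton, embedding_of_isReal_apply]

theorem prod_filter_mk_eq_of_not_isReal (x : K) {w : InfinitePlace K} (hw : ¬ IsReal w) :
    ∏ φ ∈ Finset.univ.filter (fun φ : K →+* ℂ => InfinitePlace.mk φ = w), φ x =
      ((w x : ℝ) : ℂ) ^ 2 := by
  have h0 : ComplexEmbedding.conjugate (embedding w) ≠ embedding w := by
    intro h
    exact hw (isReal_iff.mpr (ComplexEmbedding.isReal_iff.mpr h))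
  have : Finset.univ.filter (fun φ : K →+* ℂ => InfinitePlace.mk φ = w) =
      {embedding w, ComplexEmbedding.conjugate (embedding w)} := by
    ext φ
    simp only [Finset.mem_filter, Finset.mem_univ, true_and, Finset.mem_singleton,
      Finset.mem_insert]
    nth_rewrite 1 [← mk_embedding w]
    rw [mk_eq_iff]
    refine or_congr Iff.rfl ?_
    constructor
    · rintro h
      rw [← h]; simp
    · rintro rfl; simp
  rw [this, Finset.prod_pair h0.symm, ComplexEmbedding.conjugate_coe_eq, Complex.mul_conj,
    Complex.normSq_eq_norm_sq, norm_embedding_eq]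
  push_cast; rfl

/-- The norm of an element with prescribed signs at the real places. -/
theorem norm_eq_prod_mul_abs_norm (ε : {w : InfinitePlace K // IsReal w} → ℤˣ) (x : K)
    (h : ∀ w, 0 < ((ε w : ℤ) : ℝ) * (mixedEmbedding K x).1 w) :
    Algebra.norm ℚ x = ((∏ w, ε w : ℤˣ) : ℤ) * |Algebra.norm ℚ x| := by
  have h1 : ((Algebra.norm ℚ x : ℚ) : ℂ) =
      ∏ w : InfinitePlace K, ((if hw : IsReal w then ((ε ⟨w, hw⟩ : ℤ) : ℂ) else 1) *
        ((w x ^ mult w : ℝ) : ℂ)) := by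
    have := Algebra.norm_eq_prod_embeddings ℚ ℂ x
    rw [eq_ratCast] at this
    rw [this, ← Fintype.prod_equiv (RingHom.equivRatAlgHom K ℂ) (fun f => f x)
      (fun φ => φ x) fun _ => by simp [RingHom.equivRatAlgHom_apply],
      ← Finset.prod_fiberwise Finset.univ InfinitePlace.mk]
    refine Finset.prod_congr rfl fun w _ => ?_
    by_cases hw : IsReal w
    · rw [prod_filter_mk_eq_of_isReal x hw, dif_pos hw]
      have h2 := h ⟨w, hw⟩
      rw [mixedEmbedding_apply_isReal] at h2
      have h3 : w x = |embedding_of_isReal hw x| := by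
        rw [← Real.norm_eq_abs, norm_embedding_of_isReal]
      have h4 : ((ε ⟨w, hw⟩ : ℤ) : ℝ) * w x = embedding_of_isReal hw x := by
        rw [h3]
        rcases Int.units_eq_one_or (ε ⟨w, hw⟩) with he | he
        · rw [he] at h2 ⊢
          simp only [Units.val_one, Int.cast_one, one_mul] at h2 ⊢
          exact abs_of_pos h2
        · rw [he] at h2 ⊢
          simp only [Units.val_neg, Units.val_one, Int.cast_neg, Int.cast_one, neg_mul,
            one_mul] at h2 ⊢
          rw [abs_of_neg (by linarith), neg_neg]
      rw [← h4]
      simp [mult, hw]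
    · rw [prod_filter_mk_eq_of_not_isReal x hw, dif_neg hw]
      simp [mult, hw]
  rw [Finset.prod_mul_distrib, ← Complex.ofReal_prod, prod_eq_abs_norm] at h1
  have h5 : (∏ w : InfinitePlace K, (if hw : IsReal w then ((ε ⟨w, hw⟩ : ℤ) : ℂ) else 1)) =
      (((∏ w, ε w : ℤˣ) : ℤ) : ℂ) := by
    rw [prod_eq_prod_mul_prod]
    have : ∀ w : {w : InfinitePlace K // IsComplex w}, ¬ IsReal w.1 := fun w =>
      not_isReal_iff_isComplex.mpr w.2
    simp [this]
    have : ∀ w : {w : InfinitePlace K // IsReal w}, IsReal w.1 := fun w => w.2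
    simp [this]
  rw [h5] at h1
  exact_mod_cast h1

theorem intNorm_eq_prod_mul_natAbs (ε : {w : InfinitePlace K // IsReal w} → ℤˣ) (x : 𝓞 K)
    (h : ∀ w, 0 < ((ε w : ℤ) : ℝ) * (mixedEmbedding K x).1 w) :
    ((Algebra.norm ℤ x).natAbs : ℤ) = ((∏ w, ε w : ℤˣ) : ℤ) * Algebra.norm ℤ x := by
  have h1 := norm_eq_prod_mul_abs_norm ε (x : K) h
  rw [← Algebra.coe_norm_int] at h1
  have h2 : (Algebra.norm ℤ x) = ((∏ w, ε w : ℤˣ) : ℤ) * |Algebra.norm ℤ x| := by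
    exact_mod_cast h1
  rw [Int.natCast_natAbs]
  conv_rhs => rw [h2]
  rw [← mul_assoc, ← Units.val_mul]
  rw [← sq, Int.units_sq]; simp

/-- Norms of integers congruent modulo `m` are congruent modulo `m`. -/
theorem intNorm_add_natCast_mul_modEq (m : ℕ) (x y : 𝓞 K) :
    ((Algebra.norm ℤ (x + m * y) : ℤ) : ZMod m) = ((Algebra.norm ℤ x : ℤ) : ZMod m) := by
  rw [Algebra.norm_eq_matrix_det (RingOfIntegers.basis K),
    Algebra.norm_eq_matrix_det (RingOfIntegers.basis K)]
  rw [← eq_intCast (Int.castRingHom (ZMod m)), ← eq_intCast (Int.castRingHom (ZMod m)),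
    RingHom.map_det, RingHom.map_det]
  congr 1
  have : (m : 𝓞 K) * y = m • y := by simp
  rw [map_add, this, map_nsmul, map_add]
  ext i j
  simp [-nsmul_eq_mul]
end NormSign

/-! ### Counting integers of the fundamental cone in residue classes -/

section ConeCount
open NumberField.mixedEmbedding NumberField.mixedEmbedding.fundamentalCone NumberField.InfinitePlace
open Module
open scoped Pointwise

variable (K : Type*) [Field K] [NumberField K]

/-- The algebraic integers of the fundamental cone with norm at most `y`. -/
def coneIntegers (y : ℝ) : Set (𝓞 K) :=
  {α | mixedEmbedding K α ∈ fundamentalCone K ∧ mixedEmbedding.norm (mixedEmbedding K α) ≤ y}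

variable {K}

theorem mem_smul_normLeOne {s : ℝ} (hs : 0 < s) (x : mixedSpace K) :
    x ∈ s • normLeOne K ↔
      x ∈ fundamentalCone K ∧ mixedEmbedding.norm x ≤ s ^ finrank ℚ K := by
  rw [Set.mem_smul_set_iff_inv_smul_mem₀ hs.ne', mem_normLeOne,
    smul_mem_iff_mem (inv_ne_zero hs.ne'), mixedEmbedding.norm_smul, abs_of_pos (inv_pos.mpr hs),
    inv_pow, inv_mul_le_iff₀ (pow_pos hs _), mul_one]

theorem mem_smul_signedNormLeOne (ε : {w : InfinitePlace K // IsReal w} → ℤˣ) {s : ℝ}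
    (hs : 0 < s) (x : mixedSpace K) :
    x ∈ s • signedNormLeOne K ε ↔
      (x ∈ fundamentalCone K ∧ mixedEmbedding.norm x ≤ s ^ finrank ℚ K) ∧
        ∀ w, 0 < ((ε w : ℤ) : ℝ) * x.1 w := by
  rw [← mem_smul_normLeOne hs, Set.mem_smul_set_iff_inv_smul_mem₀ hs.ne',
    Set.mem_smul_set_iff_inv_smul_mem₀ hs.ne', signedNormLeOne, Set.mem_ofPred_eq]
  refine and_congr Iff.rfl (forall_congr' fun w => ?_)
  rw [Prod.smul_fst, Pi.smul_apply, smul_eq_mul, mul_left_comm]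
  exact mul_pos_iff_of_pos_left (inv_pos.mpr hs)

theorem mem_span_latticeBasis_iff (v : mixedSpace K) :
    v ∈ Submodule.span ℤ (Set.range (latticeBasis K)) ↔
      ∃ β : 𝓞 K, mixedEmbedding K β = v := by
  rw [mem_span_latticeBasis]
  simp only [LinearMap.mem_range, AlgHom.toLinearMap_apply, RingHom.toIntAlgHom_coe,
    RingHom.coe_comp, Function.comp_apply]

theorem mixedEmbedding_coe_injective :
    Function.Injective (fun α : 𝓞 K => mixedEmbedding K (α : K)) :=
  (mixedEmbedding_injective K).comp RingOfIntegers.coe_injective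

theorem finite_coneIntegers (y : ℝ) : (coneIntegers K y).Finite := by
  have h : (coneIntegers K (max y 1)).Finite := by
    have hy : 0 < max y 1 := lt_max_of_lt_right one_pos
    set s : ℝ := (max y 1) ^ (1 / (finrank ℚ K : ℝ)) with hs
    have hs0 : 0 < s := Real.rpow_pos_of_pos hy _
    have hsn : s ^ finrank ℚ K = max y 1 := by
      rw [hs, ← Real.rpow_natCast, ← Real.rpow_mul hy.le, one_div_mul_cancel, Real.rpow_one]
      exact Nat.cast_ne_zero.mpr finrank_pos.ne'
    have hb : Bornology.IsBounded (s • normLeOne K) := (isBounded_normLeOne K).smul₀ s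
    have := ZSpan.finite_add_mem (latticeBasis K) hb 0
    refine Set.Finite.of_finite_image (f := fun α : 𝓞 K => mixedEmbedding K (α : K))
      (this.subset ?_) mixedEmbedding_coe_injective.injOn
    rintro _ ⟨α, hα, rfl⟩
    refine ⟨(mem_span_latticeBasis_iff _).mpr ⟨α, rfl⟩, ?_⟩
    rw [add_zero, mem_smul_normLeOne hs0, hsn]
    exact hα
  exact h.subset fun α hα => ⟨hα.1, hα.2.trans (le_max_left _ _)⟩

/-- The number of integers of a residue class in a dilated sign component of the cone. -/
theorem exists_abs_ncard_coset_sub_le (ε : {w : InfinitePlace K // IsReal w} → ℤˣ) :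
    ∃ V C : ℝ, 0 ≤ C ∧ ∀ m : ℕ, 1 ≤ m → ∀ κ : 𝓞 K ⧸ Ideal.span {(m : 𝓞 K)}, ∀ s : ℝ, 0 < s →
      |({α : 𝓞 K | Ideal.Quotient.mk _ α = κ ∧
        mixedEmbedding K (α : K) ∈ s • signedNormLeOne K ε}.ncard : ℝ) -
          (s / m) ^ finrank ℚ K * V| ≤ C * (1 + s / m) ^ (finrank ℚ K - 1) := by
  obtain ⟨V, C, hC, h⟩ := ZSpan.exists_abs_ncard_sub_le (latticeBasis K)
    (isBounded_signedNormLeOne ε) (measurableSet_signedNormLeOne ε)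
    (hasSmallFrontier_signedNormLeOne ε)
  refine ⟨V, C, hC, fun m hm κ s hs => ?_⟩
  obtain ⟨α₀, rfl⟩ := Ideal.Quotient.mk_surjective κ
  have hm0 : (0 : ℝ) < m := by exact_mod_cast hm
  have hmK : (m : 𝓞 K) ≠ 0 := Nat.cast_ne_zero.mpr (by omega)
  have h1 := h (s / m) (by positivity) ((m : ℝ)⁻¹ • mixedEmbedding K (α₀ : K))
  rw [mixedEmbedding.finrank] at h1
  set B : Set (𝓞 K) := {β | mixedEmbedding K ((α₀ + m * β : 𝓞 K) : K) ∈ s • signedNormLeOne K ε}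
    with hB
  have e1 : {v : mixedSpace K | v ∈ Submodule.span ℤ (Set.range (latticeBasis K)) ∧
      v + (m : ℝ)⁻¹ • mixedEmbedding K (α₀ : K) ∈ (s / m) • signedNormLeOne K ε} =
      (fun α : 𝓞 K => mixedEmbedding K (α : K)) '' B := by
    have key : ∀ β : 𝓞 K, mixedEmbedding K (β : K) + (m : ℝ)⁻¹ • mixedEmbedding K (α₀ : K) ∈
        (s / m) • signedNormLeOne K ε ↔ β ∈ B := by
      intro β
      rw [hB, Set.mem_ofPred_eq, div_eq_inv_mul, mul_smul,
        Set.mem_smul_set_iff_inv_smul_mem₀ (inv_ne_zero hm0.ne'), inv_inv, smul_add, smul_smul,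
        mul_inv_cancel₀ hm0.ne', one_smul]
      have : (m : ℝ) • mixedEmbedding K (β : K) + mixedEmbedding K (α₀ : K) =
          mixedEmbedding K ((α₀ + m * β : 𝓞 K) : K) := by
        push_cast
        rw [map_add, map_mul, map_natCast, add_comm]
        rw [Nat.cast_smul_eq_nsmul, nsmul_eq_mul]
      rw [this]
    ext v
    constructor
    · rintro ⟨hv, hv'⟩
      obtain ⟨β, rfl⟩ := (mem_span_latticeBasis_iff v).mp hv
      exact ⟨β, (key β).mp hv', rfl⟩
    · rintro ⟨β, hβ, rfl⟩
      exact ⟨(mem_span_latticeBasis_iff _).mpr ⟨β, rfl⟩, (key β).mpr hβ⟩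
  have e2 : {α : 𝓞 K | Ideal.Quotient.mk (Ideal.span {(m : 𝓞 K)}) α =
      Ideal.Quotient.mk _ α₀ ∧ mixedEmbedding K (α : K) ∈ s • signedNormLeOne K ε} =
      (fun β : 𝓞 K => α₀ + m * β) '' B := by
    ext α
    constructor
    · rintro ⟨h1, h2⟩
      rw [Ideal.Quotient.eq, Ideal.mem_span_singleton] at h1
      obtain ⟨β, hβ⟩ := h1
      have : α = α₀ + m * β := by rw [← hβ]; ring
      exact ⟨β, by rw [hB, Set.mem_ofPred_eq, ← this]; exact h2, this.symm⟩
    · rintro ⟨β, hβ, rfl⟩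
      refine ⟨?_, hβ⟩
      rw [Ideal.Quotient.eq, Ideal.mem_span_singleton]
      exact ⟨β, by ring⟩
  rw [e1, Set.ncard_image_of_injective _ mixedEmbedding_coe_injective] at h1
  rw [e2, Set.ncard_image_of_injective]
  · exact h1
  · intro a b hab
    exact mul_left_cancel₀ hmK (add_left_cancel hab)

/-- The signs of the real coordinates of a point of the mixed space. -/
noncomputable def mixedSign (x : mixedSpace K) (w : {w : InfinitePlace K // IsReal w}) : ℤˣ :=
  if 0 < x.1 w then 1 else -1

theorem mixedSign_mul_pos {x : mixedSpace K} (hx : x ∈ fundamentalCone K)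
    (w : {w : InfinitePlace K // IsReal w}) : 0 < ((mixedSign x w : ℤ) : ℝ) * x.1 w := by
  have hx0 : x.1 w ≠ 0 := by
    intro h
    refine hx.2 ?_
    rw [Set.mem_ofPred_eq, mixedEmbedding.norm_eq_zero_iff]
    exact ⟨w.1, by rw [normAtPlace_apply_of_isReal w.2, h, norm_zero]⟩
  unfold mixedSign
  split_ifs with h
  · simpa using h
  · have : x.1 w < 0 := lt_of_le_of_ne (not_lt.mp h) hx0
    simpa using this

theorem eq_mixedSign {x : mixedSpace K} {ε : {w : InfinitePlace K // IsReal w} → ℤˣ}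
    (h : ∀ w, 0 < ((ε w : ℤ) : ℝ) * x.1 w) : mixedSign x = ε := by
  funext w
  have h1 := h w
  unfold mixedSign
  rcases Int.units_eq_one_or (ε w) with he | he
  · rw [he] at h1 ⊢
    simp only [Units.val_one, Int.cast_one, one_mul] at h1
    rw [if_pos h1]
  · rw [he] at h1 ⊢
    simp only [Units.val_neg, Units.val_one, Int.cast_neg, Int.cast_one, neg_mul, one_mul] at h1
    rw [if_neg (by linarith)]

theorem card_quotient_span_natCast (m : ℕ) :
    Nat.card (𝓞 K ⧸ Ideal.span {(m : 𝓞 K)}) = m ^ finrank ℚ K := by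
  have : absNorm (Ideal.span {(m : 𝓞 K)}) = m ^ finrank ℚ K := by
    rw [Ideal.absNorm_span_singleton]
    have := Algebra.norm_algebraMap (R := ℤ) (S := 𝓞 K) (m : ℤ)
    rw [map_natCast] at this
    rw [this, RingOfIntegers.rank, Int.natAbs_pow, Int.natAbs_natCast]
  rw [← this, absNorm_apply, Submodule.cardQuot_apply]

/-- Sums over the integers of the cone of a function depending only on the signs and on a residue
class. -/
theorem exists_norm_sum_coneIntegers_sub_le (K : Type*) [Field K] [NumberField K] :
    ∃ C : ℝ, 0 ≤ C ∧ ∀ m : ℕ, 1 ≤ m → ∀ h : 𝓞 K → ℂ, (∀ α, ‖h α‖ ≤ 1) →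
      (∀ α β γ : 𝓞 K, α = β + m * γ → mixedEmbedding K (α : K) ∈ fundamentalCone K →
        mixedEmbedding K (β : K) ∈ fundamentalCone K →
        mixedSign (mixedEmbedding K (α : K)) = mixedSign (mixedEmbedding K (β : K)) → h α = h β) →
      ∃ c : ℂ, ∀ s : ℝ, 1 ≤ s →
        ‖∑ α ∈ (finite_coneIntegers (K := K) (s ^ finrank ℚ K)).toFinset, h α -
          c * (s : ℂ) ^ finrank ℚ K‖ ≤ C * (m : ℝ) ^ finrank ℚ K * s ^ (finrank ℚ K - 1) := by
  choose V C hC hVC using exists_abs_ncard_coset_sub_le (K := K)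
  set n := finrank ℚ K with hn
  refine ⟨(∑ ε, C ε) * 2 ^ (n - 1), by have := Finset.sum_nonneg fun ε (_ : ε ∈ Finset.univ) => hC ε; positivity, fun m hm h h1 hconst => ?_⟩
  have hm0 : (0 : ℝ) < m := by exact_mod_cast hm
  have hcard := card_quotient_span_natCast (K := K) m
  have : Finite (𝓞 K ⧸ Ideal.span {(m : 𝓞 K)}) := by
    refine Nat.finite_of_card_ne_zero ?_
    rw [hcard]; positivity
  have : Fintype (𝓞 K ⧸ Ideal.span {(m : 𝓞 K)}) := Fintype.ofFinite _
  let P : ({w : InfinitePlace K // IsReal w} → ℤˣ) × (𝓞 K ⧸ Ideal.span {(m : 𝓞 K)}) → 𝓞 K → Prop :=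
    fun p α => mixedEmbedding K (α : K) ∈ fundamentalCone K ∧
      mixedSign (mixedEmbedding K (α : K)) = p.1 ∧ Ideal.Quotient.mk _ α = p.2
  let H : ({w : InfinitePlace K // IsReal w} → ℤˣ) × (𝓞 K ⧸ Ideal.span {(m : 𝓞 K)}) → ℂ :=
    fun p => if hp : ∃ α, P p α then h hp.choose else 0
  have hH1 : ∀ p, ‖H p‖ ≤ 1 := by
    intro p
    simp only [H]
    split_ifs
    · exact h1 _
    · simp
  have hH : ∀ p α, P p α → h α = H p := by
    intro p α hα
    have hp : ∃ α, P p α := ⟨α, hα⟩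
    simp only [H]
    rw [dif_pos hp]
    have h2 := hp.choose_spec
    have h3 : Ideal.Quotient.mk (Ideal.span {(m : 𝓞 K)}) α = Ideal.Quotient.mk _ hp.choose :=
      hα.2.2.trans h2.2.2.symm
    rw [Ideal.Quotient.eq, Ideal.mem_span_singleton] at h3
    obtain ⟨γ, hγ⟩ := h3
    exact hconst α hp.choose γ (by rw [← hγ]; ring) hα.1 h2.1 (hα.2.1.trans h2.2.1.symm)
  refine ⟨∑ p, H p * ((V p.1 / (m : ℝ) ^ n : ℝ) : ℂ), fun s hs => ?_⟩
  have hs0 : 0 < s := by linarith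
  set T := (finite_coneIntegers (K := K) (s ^ n)).toFinset with hT
  have hfib : ∑ α ∈ T, h α = ∑ p, H p *
      (({α : 𝓞 K | Ideal.Quotient.mk _ α = p.2 ∧
        mixedEmbedding K (α : K) ∈ s • signedNormLeOne K p.1}.ncard : ℝ) : ℂ) := by
    rw [← Finset.sum_fiberwise T (fun α : 𝓞 K => (mixedSign (mixedEmbedding K (α : K)),
      Ideal.Quotient.mk (Ideal.span {(m : 𝓞 K)}) α))]
    refine Finset.sum_congr rfl fun p _ => ?_
    have e : {α : 𝓞 K | Ideal.Quotient.mk _ α = p.2 ∧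
        mixedEmbedding K (α : K) ∈ s • signedNormLeOne K p.1} =
        ↑(T.filter fun α : 𝓞 K => (mixedSign (mixedEmbedding K (α : K)),
      Ideal.Quotient.mk (Ideal.span {(m : 𝓞 K)}) α) = p) := by
      ext α
      rw [Set.mem_ofPred_eq, mem_smul_signedNormLeOne _ hs0, Finset.mem_coe, Finset.mem_filter, hT,
        Set.Finite.mem_toFinset, coneIntegers, Set.mem_ofPred_eq, Prod.ext_iff]
      constructor
      · rintro ⟨a, b, c⟩
        exact ⟨b, eq_mixedSign c, a⟩
      · rintro ⟨b, c, a⟩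
        exact ⟨a, b, by rw [← c]; exact mixedSign_mul_pos b.1⟩
    rw [e, Set.ncard_coe_finset]
    rw [Finset.sum_congr rfl (g := fun _ => H p)]
    · rw [Finset.sum_const, nsmul_eq_mul, mul_comm]; push_cast; rfl
    · intro α hα
      rw [Finset.mem_filter, Prod.ext_iff, hT, Set.Finite.mem_toFinset] at hα
      exact hH p α ⟨hα.1.1, hα.2.1, hα.2.2⟩
  rw [hfib, Finset.sum_mul, ← Finset.sum_sub_distrib]
  refine (norm_sum_le _ _).trans ?_
  have hterm : ∀ p : ({w : InfinitePlace K // IsReal w} → ℤˣ) × (𝓞 K ⧸ Ideal.span {(m : 𝓞 K)}),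
      ‖H p * (({α : 𝓞 K | Ideal.Quotient.mk _ α = p.2 ∧
        mixedEmbedding K (α : K) ∈ s • signedNormLeOne K p.1}.ncard : ℝ) : ℂ) -
        H p * ((V p.1 / (m : ℝ) ^ n : ℝ) : ℂ) * (s : ℂ) ^ n‖ ≤
        C p.1 * (2 ^ (n - 1) * s ^ (n - 1)) := by
    intro p
    have e : H p * (({α : 𝓞 K | Ideal.Quotient.mk _ α = p.2 ∧
        mixedEmbedding K (α : K) ∈ s • signedNormLeOne K p.1}.ncard : ℝ) : ℂ) -
        H p * ((V p.1 / (m : ℝ) ^ n : ℝ) : ℂ) * (s : ℂ) ^ n =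
        H p * (((({α : 𝓞 K | Ideal.Quotient.mk _ α = p.2 ∧
        mixedEmbedding K (α : K) ∈ s • signedNormLeOne K p.1}.ncard : ℝ) -
          (s / m) ^ n * V p.1 : ℝ)) : ℂ) := by
      push_cast
      rw [div_pow]
      ring
    rw [e, norm_mul, Complex.norm_real, Real.norm_eq_abs]
    refine (mul_le_of_le_one_left (abs_nonneg _) (hH1 p)).trans
      ((hVC p.1 m hm p.2 s hs0).trans ?_)
    refine mul_le_mul_of_nonneg_left ?_ (hC _)
    rw [← mul_pow]
    have : s / m ≤ s := div_le_self hs0.le (by exact_mod_cast hm)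
    exact pow_le_pow_left₀ (by positivity) (by linarith) _
  refine (Finset.sum_le_sum fun p _ => hterm p).trans (le_of_eq ?_)
  rw [Fintype.sum_prod_type]
  simp only [Finset.sum_const, Finset.card_univ, nsmul_eq_mul]
  rw [← Nat.card_eq_fintype_card, hcard, ← Finset.mul_sum, ← Finset.sum_mul]
  push_cast
  ring
end ConeCount

/-! ### The mean values of Dirichlet characters over ideals -/

section IdealCount
open NumberField.mixedEmbedding NumberField.mixedEmbedding.fundamentalCone NumberField.InfinitePlace
open Module NumberField.Units
open scoped nonZeroDivisors

variable (K : Type*) [Field K] [NumberField K]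

/-- The number of ideals of norm `n`. -/
noncomputable def idealCount (n : ℕ) : ℝ := Nat.card {I : Ideal (𝓞 K) // absNorm I = n}

variable {K}

theorem natCard_class_norm_eq {C : ClassGroup (𝓞 K)} {J : (Ideal (𝓞 K))⁰}
    (hJ : ClassGroup.mk0 J = C⁻¹) (n : ℕ) :
    Nat.card {I : (Ideal (𝓞 K))⁰ // absNorm (I : Ideal (𝓞 K)) = n ∧ ClassGroup.mk0 I = C} =
      Nat.card {I : (Ideal (𝓞 K))⁰ // (J : Ideal (𝓞 K)) ∣ I ∧
        Submodule.IsPrincipal (I : Ideal (𝓞 K)) ∧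
        absNorm (I : Ideal (𝓞 K)) = absNorm (J : Ideal (𝓞 K)) * n} := by
  simp_rw [← nonZeroDivisors_dvd_iff_dvd_coe]
  refine Nat.card_congr ?_
  refine ((Equiv.dvd J).subtypeEquiv fun I ↦ ?_).trans
    (Equiv.subtypeSubtypeEquivSubtypeInter (fun I : (Ideal (𝓞 K))⁰ ↦ J ∣ I) _)
  rw [← ClassGroup.mk0_eq_one_iff (SetLike.coe_mem _)]
  simp_rw [Equiv.dvd_apply, Submonoid.coe_mul, ← Submonoid.mul_def, _root_.map_mul, hJ,
    inv_mul_eq_one, eq_comm (a := C), and_comm, and_congr_left_iff]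
  exact fun _ ↦ (Nat.mul_right_inj (absNorm_ne_zero_of_nonZeroDivisors J)).symm

theorem natAbs_norm_eq_iff (α : 𝓞 K) (m : ℕ) :
    mixedEmbedding.norm (mixedEmbedding K (α : K)) = m ↔ (Algebra.norm ℤ α).natAbs = m := by
  rw [norm_eq_norm, ← Algebra.coe_norm_int, ← Nat.cast_inj (R := ℝ), Nat.cast_natAbs]
  push_cast
  rfl

theorem mixedEmbedding_norm_eq_natAbs (α : 𝓞 K) :
    mixedEmbedding.norm (mixedEmbedding K (α : K)) = (Algebra.norm ℤ α).natAbs :=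
  (natAbs_norm_eq_iff α _).mpr rfl

theorem natCard_cone_norm_eq {C : ClassGroup (𝓞 K)} {J : (Ideal (𝓞 K))⁰}
    (hJ : ClassGroup.mk0 J = C⁻¹) (n : ℕ) :
    Nat.card {α : 𝓞 K // mixedEmbedding K (α : K) ∈ fundamentalCone K ∧ α ∈ (J : Ideal (𝓞 K)) ∧
        (Algebra.norm ℤ α).natAbs = absNorm (J : Ideal (𝓞 K)) * n} =
      Nat.card {I : (Ideal (𝓞 K))⁰ // absNorm (I : Ideal (𝓞 K)) = n ∧ ClassGroup.mk0 I = C} *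
        torsionOrder K := by
  rw [natCard_class_norm_eq hJ, torsionOrder, ← Nat.card_prod,
    ← Nat.card_congr (idealSetEquivNorm K J _)]
  refine Nat.card_congr (Equiv.ofBijective (fun α => ⟨⟨mixedEmbedding K (α.1 : K),
    mem_idealSet.mpr ⟨α.2.1, α.1, α.2.2.1, rfl⟩⟩, (natAbs_norm_eq_iff _ _).mpr α.2.2.2⟩) ⟨?_, ?_⟩)
  · intro α β h
    simp only [Subtype.mk.injEq] at h
    exact Subtype.ext (mixedEmbedding_coe_injective h)
  · rintro ⟨⟨x, hx⟩, hn⟩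
    obtain ⟨h1, α, h2, rfl⟩ := mem_idealSet.mp hx
    exact ⟨⟨α, h1, h2, (natAbs_norm_eq_iff _ _).mp hn⟩, rfl⟩

theorem finite_absNorm_eq (n : ℕ) :
    Finite {I : Ideal (𝓞 K) // absNorm I = n} :=
  (Ideal.finite_setOfPred_absNorm_eq (S := 𝓞 K) n).to_subtype

theorem idealCount_eq_sum_class (n : ℕ) (hn : n ≠ 0) :
    idealCount K n = ∑ C : ClassGroup (𝓞 K),
      (Nat.card {I : (Ideal (𝓞 K))⁰ // absNorm (I : Ideal (𝓞 K)) = n ∧ ClassGroup.mk0 I = C} :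
        ℝ) := by
  have hfin := finite_absNorm_eq (K := K) n
  have e : {I : Ideal (𝓞 K) // absNorm I = n} ≃
      (Σ C : ClassGroup (𝓞 K), {I : (Ideal (𝓞 K))⁰ // absNorm (I : Ideal (𝓞 K)) = n ∧
        ClassGroup.mk0 I = C}) :=
    { toFun := fun I => ⟨ClassGroup.mk0 ⟨I.1, mem_nonZeroDivisors_of_ne_zero (by
        intro h; apply hn; rw [← I.2, h]; simp)⟩, ⟨⟨I.1, _⟩, I.2, rfl⟩⟩
      invFun := fun p => ⟨p.2.1, p.2.2.1⟩
      left_inv := fun I => rfl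
      right_inv := by
        rintro ⟨C, ⟨I, h1, rfl⟩⟩
        rfl }
  have hfin2 := Finite.of_equiv _ e
  have (C : ClassGroup (𝓞 K)) : Finite {I : (Ideal (𝓞 K))⁰ // absNorm (I : Ideal (𝓞 K)) = n ∧
        ClassGroup.mk0 I = C} :=
    Finite.of_injective (fun x => (⟨C, x⟩ : Σ C : ClassGroup (𝓞 K),
      {I : (Ideal (𝓞 K))⁰ // absNorm (I : Ideal (𝓞 K)) = n ∧ ClassGroup.mk0 I = C}))
      (fun _ _ h => by simpa using h)
  rw [idealCount, Nat.card_congr e, Nat.card_sigma]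
  push_cast
  rfl

/-- The weight on integers of the cone attached to a Dirichlet character and an ideal. -/
noncomputable def coneWeight {q : ℕ} (χ : DirichletCharacter ℂ q) (J : Ideal (𝓞 K)) (α : 𝓞 K) : ℂ :=
  if α ∈ J then χ (((Algebra.norm ℤ α).natAbs / absNorm J : ℕ) : ZMod q) else 0

theorem coneWeight_congr {q : ℕ} (χ : DirichletCharacter ℂ q) (J : (Ideal (𝓞 K))⁰)
    {α β γ : 𝓞 K} (h : α = β + ((absNorm (J : Ideal (𝓞 K)) * q : ℕ) : 𝓞 K) * γ)
    (hα : mixedEmbedding K (α : K) ∈ fundamentalCone K)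
    (hβ : mixedEmbedding K (β : K) ∈ fundamentalCone K)
    (hs : mixedSign (mixedEmbedding K (α : K)) = mixedSign (mixedEmbedding K (β : K))) :
    coneWeight χ (J : Ideal (𝓞 K)) α = coneWeight χ (J : Ideal (𝓞 K)) β := by
  have hJ0 := absNorm_ne_zero_of_nonZeroDivisors J
  have hm : ((absNorm (J : Ideal (𝓞 K)) * q : ℕ) : 𝓞 K) * γ ∈ (J : Ideal (𝓞 K)) := by
    push_cast
    rw [mul_assoc]
    exact Ideal.mul_mem_right _ _ (Ideal.absNorm_mem _)
  have hmem : α ∈ (J : Ideal (𝓞 K)) ↔ β ∈ (J : Ideal (𝓞 K)) := by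
    rw [h]; exact Ideal.add_mem_iff_left _ hm
  unfold coneWeight
  by_cases hβJ : β ∈ (J : Ideal (𝓞 K))
  · rw [if_pos hβJ, if_pos (hmem.mpr hβJ)]
    congr 1
    have h1 := intNorm_eq_prod_mul_natAbs _ α (mixedSign_mul_pos hα)
    have h2 := intNorm_eq_prod_mul_natAbs _ β (mixedSign_mul_pos hβ)
    rw [hs] at h1
    have h3 : (((Algebra.norm ℤ α).natAbs : ℕ) : ZMod (absNorm (J : Ideal (𝓞 K)) * q)) =
        (((Algebra.norm ℤ β).natAbs : ℕ) : ZMod (absNorm (J : Ideal (𝓞 K)) * q)) := by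
      rw [← Int.cast_natCast, h1, ← Int.cast_natCast (R := ZMod _) (Algebra.norm ℤ β).natAbs, h2]
      rw [Int.cast_mul, Int.cast_mul, h, intNorm_add_natCast_mul_modEq]
    rw [ZMod.natCast_eq_natCast_iff] at h3 ⊢
    have d1 : absNorm (J : Ideal (𝓞 K)) ∣ (Algebra.norm ℤ α).natAbs := by
      rw [← Int.natCast_dvd]
      exact absNorm_dvd_norm_of_mem (hmem.mpr hβJ)
    have d2 : absNorm (J : Ideal (𝓞 K)) ∣ (Algebra.norm ℤ β).natAbs := by
      rw [← Int.natCast_dvd]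
      exact absNorm_dvd_norm_of_mem hβJ
    obtain ⟨a, ha⟩ := d1
    obtain ⟨b, hb⟩ := d2
    rw [ha, hb] at h3 ⊢
    rw [Nat.mul_div_cancel_left _ (Nat.pos_of_ne_zero hJ0),
      Nat.mul_div_cancel_left _ (Nat.pos_of_ne_zero hJ0)]
    exact Nat.ModEq.mul_left_cancel' hJ0 h3
  · rw [if_neg hβJ, if_neg (mt hmem.mp hβJ)]

theorem norm_coneWeight_le {q : ℕ} (χ : DirichletCharacter ℂ q) (J : Ideal (𝓞 K)) (α : 𝓞 K) :
    ‖coneWeight χ J α‖ ≤ 1 := by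
  unfold coneWeight
  split_ifs
  · exact DirichletCharacter.norm_le_one _ _
  · simp

theorem sum_coneIntegers_coneWeight {C : ClassGroup (𝓞 K)} {J : (Ideal (𝓞 K))⁰}
    (hJ : ClassGroup.mk0 J = C⁻¹) {q : ℕ} (χ : DirichletCharacter ℂ q) (y : ℝ) (hy : 0 ≤ y) :
    ∑ α ∈ (finite_coneIntegers (K := K) (absNorm (J : Ideal (𝓞 K)) * y)).toFinset,
      coneWeight χ (J : Ideal (𝓞 K)) α =
    ∑ n ∈ Finset.Icc 1 ⌊y⌋₊, χ (n : ZMod q) *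
      ((Nat.card {I : (Ideal (𝓞 K))⁰ // absNorm (I : Ideal (𝓞 K)) = n ∧ ClassGroup.mk0 I = C} : ℂ) *
        torsionOrder K) := by
  have hJ0 : 0 < absNorm (J : Ideal (𝓞 K)) := absNorm_pos_of_nonZeroDivisors J
  have hJ0' : (0 : ℝ) < absNorm (J : Ideal (𝓞 K)) := by exact_mod_cast hJ0
  simp only [coneWeight]
  rw [← Finset.sum_filter]
  have hdvd : ∀ α ∈ (J : Ideal (𝓞 K)), absNorm (J : Ideal (𝓞 K)) *
      ((Algebra.norm ℤ α).natAbs / absNorm (J : Ideal (𝓞 K))) = (Algebra.norm ℤ α).natAbs := by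
    intro α hα
    refine Nat.mul_div_cancel' ?_
    rw [← Int.natCast_dvd]
    exact absNorm_dvd_norm_of_mem hα
  rw [← Finset.sum_fiberwise_of_maps_to (t := Finset.Icc 1 ⌊y⌋₊)
    (g := fun α => (Algebra.norm ℤ α).natAbs / absNorm (J : Ideal (𝓞 K)))]
  · refine Finset.sum_congr rfl fun n hn => ?_
    rw [Finset.sum_congr rfl (g := fun _ => χ (n : ZMod q))]
    · rw [Finset.sum_const, nsmul_eq_mul, mul_comm]
      congr 1
      have h1 := natCard_cone_norm_eq hJ n
      rw [← Nat.cast_mul, ← h1]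
      congr 1
      refine (Nat.subtype_card _ fun α => ?_).symm
      rw [Finset.mem_filter, Finset.mem_filter, Set.Finite.mem_toFinset, coneIntegers,
        Set.mem_ofPred_eq, mixedEmbedding_norm_eq_natAbs]
      have hn2 : (n : ℝ) ≤ y := (Nat.le_floor_iff hy).mp (Finset.mem_Icc.mp hn).2
      constructor
      · rintro ⟨⟨⟨a, -⟩, b⟩, c⟩
        exact ⟨a, b, by rw [← c, hdvd α b]⟩
      · rintro ⟨a, b, c⟩
        refine ⟨⟨⟨a, ?_⟩, b⟩, ?_⟩
        · rw [c, Nat.cast_mul]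
          exact mul_le_mul_of_nonneg_left hn2 hJ0'.le
        · rw [c, Nat.mul_div_cancel_left _ hJ0]
    · intro α hα
      rw [Finset.mem_filter] at hα
      rw [hα.2]
  · intro α hα
    rw [Finset.mem_filter, Set.Finite.mem_toFinset, coneIntegers,
      Set.mem_ofPred_eq, mixedEmbedding_norm_eq_natAbs] at hα
    obtain ⟨⟨h1, h2⟩, h3⟩ := hα
    have h4 := hdvd α h3
    rw [Finset.mem_Icc]
    constructor
    · rw [Nat.one_le_iff_ne_zero]
      intro h0
      rw [h0, mul_zero] at h4
      refine h1.2 ?_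
      rw [Set.mem_ofPred_eq, mixedEmbedding_norm_eq_natAbs, ← h4, Nat.cast_zero]
    · rw [Nat.le_floor_iff hy]
      rw [← h4, Nat.cast_mul] at h2
      exact le_of_mul_le_mul_left h2 hJ0'

theorem exists_norm_sum_class_sub_le (C : ClassGroup (𝓞 K)) :
    ∃ A : ℝ, 0 ≤ A ∧ ∀ (q : ℕ) (χ : DirichletCharacter ℂ q), 1 ≤ q → ∃ c : ℂ, ∀ y : ℝ, 1 ≤ y →
      ‖∑ n ∈ Finset.Icc 1 ⌊y⌋₊, χ (n : ZMod q) *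
        (Nat.card {I : (Ideal (𝓞 K))⁰ // absNorm (I : Ideal (𝓞 K)) = n ∧ ClassGroup.mk0 I = C} : ℂ) -
          c * y‖ ≤ A * (q : ℝ) ^ finrank ℚ K * y ^ (1 - 1 / (finrank ℚ K : ℝ)) := by
  obtain ⟨J, hJ⟩ := ClassGroup.mk0_surjective C⁻¹
  obtain ⟨A, hA, h⟩ := exists_norm_sum_coneIntegers_sub_le K
  have hJ0 : 0 < absNorm (J : Ideal (𝓞 K)) := absNorm_pos_of_nonZeroDivisors J
  set N := absNorm (J : Ideal (𝓞 K)) with hN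
  have hN1 : (1 : ℝ) ≤ N := by exact_mod_cast hJ0
  set d := finrank ℚ K with hd
  have hd0 : 0 < d := finrank_pos
  have hw : (0 : ℝ) < torsionOrder K := by exact_mod_cast torsionOrder_pos K
  refine ⟨A * (N : ℝ) ^ d * (N : ℝ) ^ (1 - 1 / (d : ℝ)) / torsionOrder K, by positivity,
    fun q χ hq => ?_⟩
  obtain ⟨c, hc⟩ := h (N * q) (Nat.mul_pos hJ0 hq) (coneWeight χ (J : Ideal (𝓞 K)))
    (norm_coneWeight_le χ _) (fun α β γ h1 h2 h3 h4 => coneWeight_congr χ J h1 h2 h3 h4)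
  refine ⟨c * N / torsionOrder K, fun y hy => ?_⟩
  have hNy : 1 ≤ (N : ℝ) * y := one_le_mul_of_one_le_of_one_le hN1 hy
  have hs1 : 1 ≤ ((N : ℝ) * y) ^ (1 / (d : ℝ)) := Real.one_le_rpow hNy (by positivity)
  have hsd : (((N : ℝ) * y) ^ (1 / (d : ℝ))) ^ d = N * y := by
    rw [← Real.rpow_natCast, ← Real.rpow_mul (by linarith), one_div_mul_cancel, Real.rpow_one]
    exact Nat.cast_ne_zero.mpr hd0.ne'
  have hsd1 : (((N : ℝ) * y) ^ (1 / (d : ℝ))) ^ (d - 1) = (N * y) ^ (1 - 1 / (d : ℝ)) := by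
    rw [← Real.rpow_natCast, ← Real.rpow_mul (by linarith), Nat.cast_sub hd0]
    congr 1
    field_simp
    simp
  have h2 := hc _ hs1
  rw [← Complex.ofReal_pow, hsd, hsd1, sum_coneIntegers_coneWeight hJ χ y (by linarith)] at h2
  have e : ∑ n ∈ Finset.Icc 1 ⌊y⌋₊, χ (n : ZMod q) *
        (Nat.card {I : (Ideal (𝓞 K))⁰ // absNorm (I : Ideal (𝓞 K)) = n ∧ ClassGroup.mk0 I = C} : ℂ) -
          c * N / torsionOrder K * y = (∑ n ∈ Finset.Icc 1 ⌊y⌋₊, χ (n : ZMod q) *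
      ((Nat.card {I : (Ideal (𝓞 K))⁰ // absNorm (I : Ideal (𝓞 K)) = n ∧ ClassGroup.mk0 I = C} : ℂ) *
        torsionOrder K) - c * ((N * y : ℝ) : ℂ)) / torsionOrder K := by
    have hw' : (torsionOrder K : ℂ) ≠ 0 := by exact_mod_cast torsionOrder_ne_zero K
    simp_rw [← mul_assoc]
    rw [← Finset.sum_mul, eq_div_iff hw', sub_mul]
    push_cast
    field_simp
  rw [e, norm_div, Complex.norm_natCast, div_le_iff₀ hw]
  refine h2.trans (le_of_eq ?_)
  rw [Real.mul_rpow (by positivity) (by linarith)]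
  push_cast
  field_simp
  ring

variable (K) in
/-- The twists of the ideal counting function by Dirichlet characters have mean values, with a
power saving that is polynomial in the modulus. -/
theorem exists_isTwist_idealCount :
    ∃ (A : ℝ) (c : ∀ q : ℕ, DirichletCharacter ℂ q → ℂ), ∀ (q : ℕ) (χ : DirichletCharacter ℂ q),
      1 ≤ q → IsTwist (idealCount K) (1 / (finrank ℚ K : ℝ)) (charHom χ) (c q χ)
        (A * (q : ℝ) ^ finrank ℚ K) := by
  choose A hA h using exists_norm_sum_class_sub_le (K := K)
  choose! c hc using h
  refine ⟨1 + ∑ C, A C, fun q χ => ∑ C, c C q χ, fun q χ hq => ⟨fun n => ?_, ?_, fun t ht => ?_⟩⟩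
  · exact DirichletCharacter.norm_le_one _ _
  · have h1 : 0 ≤ ∑ C, A C := Finset.sum_nonneg fun C _ => hA C
    exact one_le_mul_of_one_le_of_one_le (by linarith) (one_le_pow₀ (by exact_mod_cast hq))
  · have e : sumRem (fun n => charHom χ n * idealCount K n) (∑ C, c C q χ) t =
        ∑ C : ClassGroup (𝓞 K), (∑ n ∈ Finset.Icc 1 ⌊t⌋₊, χ (n : ZMod q) *
        (Nat.card {I : (Ideal (𝓞 K))⁰ // absNorm (I : Ideal (𝓞 K)) = n ∧ ClassGroup.mk0 I = C} : ℂ) -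
          c C q χ * t) := by
      rw [sumRem, Finset.sum_sub_distrib, Finset.sum_comm, Finset.sum_mul]
      congr 1
      refine Finset.sum_congr rfl fun n hn => ?_
      rw [idealCount_eq_sum_class n (by have := (Finset.mem_Icc.mp hn).1; omega), charHom_apply,
        Complex.ofReal_sum, Finset.mul_sum]
      simp
    rw [e]
    refine (norm_sum_le _ _).trans ((Finset.sum_le_sum fun C _ => hc C q χ hq t ht).trans ?_)
    rw [← Finset.sum_mul, ← Finset.sum_mul]
    have : 0 ≤ t ^ (1 - 1 / (finrank ℚ K : ℝ)) := by positivity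
    gcongr
    linarith

theorem charHom_one_level_one : charHom (1 : DirichletCharacter ℂ 1) = 1 := by
  ext n
  rw [charHom_apply, Subsingleton.elim (n : ZMod 1) 1, map_one, MonoidHom.one_apply]

theorem sum_idealCount (t : ℝ) (ht : 0 ≤ t) :
    ∑ n ∈ Finset.Icc 1 ⌊t⌋₊, idealCount K n =
      (Nat.card {I : (Ideal (𝓞 K))⁰ // absNorm (I : Ideal (𝓞 K)) ≤ t} : ℝ) := by
  have hfin : {I : (Ideal (𝓞 K))⁰ | absNorm (I : Ideal (𝓞 K)) ≤ ⌊t⌋₊}.Finite :=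
    Ideal.finite_setOfPred_absNorm_le₀ ⌊t⌋₊
  have e1 : Nat.card {I : (Ideal (𝓞 K))⁰ // absNorm (I : Ideal (𝓞 K)) ≤ t} = hfin.toFinset.card := by
    refine Nat.subtype_card _ fun I => ?_
    rw [Set.Finite.mem_toFinset, Set.mem_ofPred_eq, Nat.le_floor_iff ht]
  rw [e1, Finset.card_eq_sum_card_fiberwise (t := Finset.Icc 1 ⌊t⌋₊)
    (f := fun I : (Ideal (𝓞 K))⁰ => absNorm (I : Ideal (𝓞 K)))]
  · push_cast
    refine Finset.sum_congr rfl fun n hn => ?_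
    rw [idealCount]
    congr 1
    rw [← Nat.subtype_card (p := fun I : (Ideal (𝓞 K))⁰ => absNorm (I : Ideal (𝓞 K)) = n)]
    · refine Nat.card_congr ⟨fun I => ⟨⟨I.1, mem_nonZeroDivisors_of_ne_zero ?_⟩, I.2⟩,
        fun I => ⟨I.1.1, I.2⟩, fun I => rfl, fun I => rfl⟩
      intro h
      have := I.2
      rw [h] at this
      have h2 := (Finset.mem_Icc.mp hn).1
      simp at this
      omega
    · intro I
      rw [Finset.mem_filter, Set.Finite.mem_toFinset, Set.mem_ofPred_eq]
      constructor
      · exact fun h => h.2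
      · intro h
        exact ⟨h.le.trans (Finset.mem_Icc.mp hn).2, h⟩
  · intro I hI
    rw [Finset.mem_coe, Set.Finite.mem_toFinset, Set.mem_ofPred_eq] at hI
    rw [Finset.coe_Icc, Set.mem_Icc]
    exact ⟨absNorm_pos_of_nonZeroDivisors I, hI⟩

theorem idealCount_one : idealCount K 1 = 1 := by
  rw [idealCount]
  simp only [Ideal.absNorm_eq_one_iff]
  simp

variable (K) in
/-- The mean value of the ideal counting function is positive. -/
theorem exists_pos_of_isTwist_idealCount {δ : ℝ} (hδ : 0 < δ) {c : ℂ} {A : ℝ}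
    (h : IsTwist (idealCount K) δ 1 c A) : ∃ κ : ℝ, 0 < κ ∧ c = κ := by
  have h1 := NumberField.Ideal.tendsto_norm_le_div_atTop₀ K
  set κ : ℝ := (2 ^ nrRealPlaces K * (2 * Real.pi) ^ nrComplexPlaces K * regulator K *
    classNumber K) / (torsionOrder K * Real.sqrt |discr K|) with hκ
  have hκ0 : 0 < κ := by
    have a1 := regulator_pos K
    have a2 : (0 : ℝ) < torsionOrder K := by exact_mod_cast torsionOrder_pos K
    have a3 : (0 : ℝ) < classNumber K := by exact_mod_cast classNumber_pos K
    have a4 : (0 : ℝ) < |(discr K : ℝ)| := abs_pos.mpr (by exact_mod_cast discr_ne_zero K)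
    have a5 := Real.pi_pos
    have a6 : 0 < Real.sqrt |(discr K : ℝ)| := Real.sqrt_pos.mpr a4
    rw [hκ]
    positivity
  refine ⟨κ, hκ0, ?_⟩
  have h2 : Filter.Tendsto (fun s : ℝ => (((Nat.card {I : (Ideal (𝓞 K))⁰ //
      absNorm (I : Ideal (𝓞 K)) ≤ s} : ℝ) / s : ℝ) : ℂ)) Filter.atTop (nhds (κ : ℂ)) :=
    (Complex.continuous_ofReal.tendsto _).comp h1
  refine tendsto_nhds_unique (tendsto_iff_norm_sub_tendsto_zero.mpr ?_) h2
  have h3 : Filter.Tendsto (fun t : ℝ => A * t ^ (-δ)) Filter.atTop (nhds 0) := by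
    simpa using (tendsto_rpow_neg_atTop hδ).const_mul A
  refine squeeze_zero' (Filter.Eventually.of_forall fun _ => norm_nonneg _) ?_ h3
  filter_upwards [Filter.eventually_ge_atTop 1] with t ht
  have ht0 : 0 < t := by linarith
  have h4 := h.bound t ht
  rw [← sum_idealCount t ht0.le]
  have e : (((∑ n ∈ Finset.Icc 1 ⌊t⌋₊, idealCount K n) / t : ℝ) : ℂ) - c =
      sumRem (fun n => (1 : ℕ →* ℂ) n * idealCount K n) c t / t := by
    rw [sumRem, sub_div, mul_div_cancel_right₀ _ (by exact_mod_cast ht0.ne')]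
    push_cast
    simp
  rw [e, norm_div, Complex.norm_real, Real.norm_of_nonneg ht0.le, div_le_iff₀ ht0, mul_assoc,
    ← Real.rpow_add_one ht0.ne']
  rw [show -δ + 1 = 1 - δ by ring]
  exact h4

variable (K) in
/-- The data attached to a number field by the lattice point count. -/
theorem exists_twistBase_idealCount :
    ∃ (κ A : ℝ) (c : ∀ q : ℕ, DirichletCharacter ℂ q → ℂ),
      TwistBase (idealCount K) κ (1 / (finrank ℚ K : ℝ)) A ∧
      ∀ (q : ℕ) (χ : DirichletCharacter ℂ q), 1 ≤ q →
        IsTwist (idealCount K) (1 / (finrank ℚ K : ℝ)) (charHom χ) (c q χ)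
          (A * (q : ℝ) ^ finrank ℚ K) := by
  obtain ⟨A, c, h⟩ := exists_isTwist_idealCount K
  have hd : (1 : ℝ) ≤ finrank ℚ K := by exact_mod_cast (finrank_pos (R := ℚ) (M := K))
  have h1 := h 1 1 le_rfl
  rw [charHom_one_level_one] at h1
  obtain ⟨κ, hκ, e⟩ := exists_pos_of_isTwist_idealCount K (by positivity) h1
  rw [e] at h1
  refine ⟨κ, A, c, ⟨fun n => by unfold idealCount; positivity, idealCount_one, by positivity,
    div_le_one_of_le₀ hd (by positivity), hκ, by simpa using h1⟩, h⟩

end IdealCount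

/-! ### The von Mangoldt function of a number field -/

section Mangoldt
variable (K : Type*) [Field K] [NumberField K]

/-- The ideals of norm `n`. -/
noncomputable def idealsOfNorm (n : ℕ) : Finset (Ideal (𝓞 K)) :=
  (Ideal.finite_setOfPred_absNorm_eq (S := 𝓞 K) n).toFinset

/-- The sum of the von Mangoldt function over the ideals of norm `n`. -/
noncomputable def mangoldtCoeff (n : ℕ) : ℝ := ∑ I ∈ idealsOfNorm K n, LambdaK K I

variable {K}

theorem mem_idealsOfNorm {n : ℕ} {I : Ideal (𝓞 K)} : I ∈ idealsOfNorm K n ↔ absNorm I = n := by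
  rw [idealsOfNorm, Set.Finite.mem_toFinset, Set.mem_ofPred_eq]

theorem idealCount_eq_card (n : ℕ) : idealCount K n = (idealsOfNorm K n).card := by
  rw [idealCount, Nat.subtype_card _ fun I => mem_idealsOfNorm]

theorem LambdaK_nonneg (I : Ideal (𝓞 K)) : 0 ≤ LambdaK K I := by
  unfold LambdaK
  split_ifs
  · exact Real.log_natCast_nonneg _
  · exact le_rfl

theorem mangoldtCoeff_nonneg (n : ℕ) : 0 ≤ mangoldtCoeff K n :=
  Finset.sum_nonneg fun I _ => LambdaK_nonneg I

theorem radical_prime_pow {p : Ideal (𝓞 K)} (hp : p.IsPrime) {m : ℕ} (hm : 1 ≤ m) :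
    (p ^ m).radical = p := by
  rw [Ideal.radical_pow _ (by omega), hp.radical]

theorem LambdaK_prime_pow {p : Ideal (𝓞 K)} (hp : p.IsPrime) (hp0 : p ≠ ⊥) {m : ℕ} (hm : 1 ≤ m) :
    LambdaK K (p ^ m) = Real.log (absNorm p) := by
  rw [LambdaK, if_pos ⟨p, m, hp, hp0, hm, rfl⟩, radical_prime_pow hp hm]

theorem one_lt_absNorm_of_isPrime {p : Ideal (𝓞 K)} (hp : p.IsPrime) (hp0 : p ≠ ⊥) :
    1 < absNorm p := by
  have h1 : absNorm p ≠ 0 := by rwa [Ne, Ideal.absNorm_eq_zero_iff]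
  have h2 : absNorm p ≠ 1 := by rw [Ne, Ideal.absNorm_eq_one_iff]; exact hp.ne_top
  omega

theorem prime_pow_inj {p p' : Ideal (𝓞 K)} (hp : p.IsPrime) (hp' : p'.IsPrime) (hp0 : p ≠ ⊥)
    {m m' : ℕ} (hm : 1 ≤ m) (hm' : 1 ≤ m') (h : p ^ m = p' ^ m') : p = p' ∧ m = m' := by
  have h1 : p = p' := by rw [← radical_prime_pow hp hm, h, radical_prime_pow hp' hm']
  subst h1
  refine ⟨rfl, ?_⟩
  have h2 := congrArg absNorm h
  rw [map_pow, map_pow] at h2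
  exact Nat.pow_right_injective (one_lt_absNorm_of_isPrime hp hp0) h2

open UniqueFactorizationMonoid in
/-- `log N I` is the sum of the von Mangoldt function over the divisors of `I`. -/
theorem sum_LambdaK_dvd {I : Ideal (𝓞 K)} (hI : I ≠ ⊥) (F : Finset (Ideal (𝓞 K)))
    (hF : ∀ J, J ∣ I → J ∈ F) :
    ∑ J ∈ F.filter (fun J => J ∣ I), LambdaK K J = Real.log (absNorm I) := by
  have hpr : ∀ p ∈ normalizedFactors I, p.IsPrime ∧ p ≠ ⊥ := fun p hp =>
    ⟨Ideal.isPrime_of_prime (prime_of_normalized_factor p hp), (prime_of_normalized_factor p hp).ne_zero⟩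
  have h1 : Real.log (absNorm I) = ∑ x ∈ (normalizedFactors I).toFinset.sigma
      (fun p => Finset.Icc 1 ((normalizedFactors I).count p)), Real.log (absNorm x.1) := by
    rw [Finset.sum_sigma]
    simp only [Finset.sum_const, Nat.card_Icc, Nat.add_sub_cancel, nsmul_eq_mul]
    have h2 : (normalizedFactors I).prod = I :=
      Ideal.prod_normalizedFactors_eq_self hI
    nth_rewrite 1 [← h2]
    rw [Finset.prod_multiset_count, map_prod, Nat.cast_prod, Real.log_prod]
    · refine Finset.sum_congr rfl fun p _ => ?_
      rw [map_pow, Nat.cast_pow, Real.log_pow]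
    · intro p hp
      rw [Multiset.mem_toFinset] at hp
      have := one_lt_absNorm_of_isPrime (hpr p hp).1 (hpr p hp).2
      rw [map_pow]
      exact_mod_cast (pow_pos (by omega) _).ne'
  rw [h1]
  symm
  refine Finset.sum_of_injOn (fun x => x.1 ^ x.2) ?_ ?_ ?_ ?_
  · rintro ⟨p, m⟩ hx ⟨p', m'⟩ hy h
    simp only [Finset.coe_sigma, Set.mem_sigma_iff, Finset.mem_coe, Multiset.mem_toFinset,
      Finset.mem_Icc] at hx hy
    obtain ⟨rfl, rfl⟩ := prime_pow_inj (hpr p hx.1).1 (hpr p' hy.1).1 (hpr p hx.1).2 hx.2.1 hy.2.1 h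
    rfl
  · rintro ⟨p, m⟩ hx
    simp only [Finset.coe_sigma, Set.mem_sigma_iff, Finset.mem_coe, Multiset.mem_toFinset,
      Finset.mem_Icc] at hx
    rw [Finset.mem_coe, Finset.mem_filter]
    have : p ^ m ∣ I := by
      rw [pow_dvd_iff_le_emultiplicity, emultiplicity_eq_count_normalizedFactors
        (irreducible_of_normalized_factor p hx.1) hI, normalize_eq]
      exact_mod_cast hx.2.2
    exact ⟨hF _ this, this⟩
  · intro J hJ hJ'
    rw [LambdaK, if_neg]
    rintro ⟨p, m, hp, hp0, hm, rfl⟩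
    refine hJ' ⟨⟨p, m⟩, ?_, rfl⟩
    have hpi : Irreducible p := ((Ideal.prime_iff_isPrime hp0).mpr hp).irreducible
    rw [Finset.mem_filter, pow_dvd_iff_le_emultiplicity,
      emultiplicity_eq_count_normalizedFactors hpi hI, normalize_eq] at hJ
    have h3 : m ≤ (normalizedFactors I).count p := by exact_mod_cast hJ.2
    simp only [Finset.coe_sigma, Set.mem_sigma_iff, Finset.mem_coe, Multiset.mem_toFinset,
      Finset.mem_Icc]
    exact ⟨Multiset.count_pos.mp (by omega), hm, h3⟩
  · rintro ⟨p, m⟩ hx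
    rw [Finset.mem_sigma, Multiset.mem_toFinset, Finset.mem_Icc] at hx
    exact (LambdaK_prime_pow (hpr p hx.1).1 (hpr p hx.1).2 hx.2.1).symm

variable (K) in
theorem isMangoldt_mangoldtCoeff : IsMangoldt (idealCount K) (mangoldtCoeff K) where
  nonneg := mangoldtCoeff_nonneg
  conv n hn := by
    have h0 : ∀ {I : Ideal (𝓞 K)}, absNorm I = n → I ≠ ⊥ := by
      rintro I h rfl
      exact hn (by rw [← h]; simp)
    set F : Finset (Ideal (𝓞 K)) :=
      (Ideal.finite_setOfPred_absNorm_le (S := 𝓞 K) n).toFinset with hF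
    have hFm : ∀ I : Ideal (𝓞 K), absNorm I = n → ∀ J, J ∣ I → J ∈ F := by
      intro I hI J hJ
      rw [hF, Set.Finite.mem_toFinset, Set.mem_ofPred_eq, ← hI]
      refine Nat.le_of_dvd (by omega) (absNorm_dvd_absNorm_of_le (Ideal.le_of_dvd hJ))
    have h1 : idealCount K n * Real.log n =
        ∑ I ∈ idealsOfNorm K n, ∑ J ∈ F.filter (fun J => J ∣ I), LambdaK K J := by
      rw [idealCount_eq_card, ← nsmul_eq_mul, ← Finset.sum_const]
      refine Finset.sum_congr rfl fun I hI => ?_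
      rw [mem_idealsOfNorm] at hI
      rw [sum_LambdaK_dvd (h0 hI) F (hFm I hI), hI]
    rw [h1, Finset.sum_sigma']
    have h2 : ∀ p : ℕ × ℕ, mangoldtCoeff K p.1 * idealCount K p.2 =
        ∑ x ∈ idealsOfNorm K p.1 ×ˢ idealsOfNorm K p.2, LambdaK K x.1 := by
      intro p
      rw [idealCount_eq_card, mangoldtCoeff, Finset.sum_product, Finset.sum_mul]
      refine Finset.sum_congr rfl fun I _ => ?_
      dsimp only
      rw [Finset.sum_const, nsmul_eq_mul, mul_comm]
    simp_rw [h2]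
    rw [Finset.sum_sigma']
    refine Finset.sum_bij (fun x _ => ⟨x.2.1 * x.2.2, x.2.1⟩) ?_ ?_ ?_ ?_
    · rintro ⟨p, J, L⟩ hx
      simp only [Finset.mem_sigma, Nat.mem_divisorsAntidiagonal, Finset.mem_product,
        mem_idealsOfNorm, Finset.mem_filter] at hx ⊢
      have : absNorm (J * L) = n := by rw [map_mul, hx.2.1, hx.2.2, hx.1.1]
      exact ⟨this, hFm _ this _ (dvd_mul_right _ _), dvd_mul_right _ _⟩
    · rintro ⟨p, J, L⟩ hx ⟨p', J', L'⟩ hy h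
      simp only [Finset.mem_sigma, Nat.mem_divisorsAntidiagonal, Finset.mem_product,
        mem_idealsOfNorm, Sigma.mk.injEq] at hx hy h
      obtain ⟨h3, h4⟩ := h
      rw [heq_eq_eq] at h4
      subst h4
      have hJ : J ≠ 0 := by
        rintro rfl
        have : absNorm (0 * L) = n := by rw [map_mul, hx.2.1, hx.2.2, hx.1.1]
        exact h0 this (by simp)
      have := mul_left_cancel₀ hJ h3
      subst this
      have : p = p' := Prod.ext (hx.2.1.symm.trans hy.2.1) (hx.2.2.symm.trans hy.2.2)
      subst this
      rfl
    · rintro ⟨I, J⟩ hx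
      simp only [Finset.mem_sigma, mem_idealsOfNorm, Finset.mem_filter] at hx
      obtain ⟨hI, -, L, rfl⟩ := hx
      refine ⟨⟨(absNorm J, absNorm L), J, L⟩, ?_, rfl⟩
      simp only [Finset.mem_sigma, Nat.mem_divisorsAntidiagonal, Finset.mem_product,
        mem_idealsOfNorm]
      exact ⟨⟨by rw [← map_mul, hI], hn⟩, trivial, trivial⟩
    · rintro ⟨p, J, L⟩ hx
      rfl
end Mangoldt

/-! ### Growth of logarithms of Dirichlet series at `1` -/

section LogGrowth
open Filter Topology
variable {r b : ℕ → ℝ} {κ δ A₀ : ℝ}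

/-- The real part of the logarithm of the twisted Dirichlet series at a real point. -/
noncomputable def logSum (b : ℕ → ℝ) (u : ℕ → ℂ) (σ : ℝ) : ℝ :=
  ∑' n : ℕ, logCoeff b n * (n : ℝ) ^ (-σ) * (u n).re

/-- `log (1 / (σ - 1))`, the growth of the logarithm of a simple pole at `1`. -/
noncomputable def poleLog (σ : ℝ) : ℝ := -Real.log (σ - 1)

theorem tendsto_poleLog : Tendsto poleLog (𝓝[>] 1) atTop := by
  have h1 : Tendsto (fun σ : ℝ => σ - 1) (𝓝[>] 1) (𝓝[>] 0) := by
    refine tendsto_nhdsWithin_iff.mpr ⟨?_, ?_⟩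
    · exact ((continuous_id.sub continuous_const).tendsto' 1 0 (by simp)).mono_left
        nhdsWithin_le_nhds
    · filter_upwards [self_mem_nhdsWithin] with σ hσ
      simpa using hσ
  exact tendsto_neg_atBot_atTop.comp (Real.tendsto_log_nhdsGT_zero.comp h1)

theorem not_eventually_poleLog_le {k C : ℝ} (hk : 0 < k) :
    ¬ ∀ᶠ σ in 𝓝[>] (1 : ℝ), k * poleLog σ ≤ C := by
  intro h
  obtain ⟨σ, h1, h2⟩ := (h.and (tendsto_poleLog.eventually_gt_atTop (C / k))).exists
  rw [div_lt_iff₀ hk] at h2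
  linarith

theorem IsMangoldt.logCoeff_zero (b : ℕ → ℝ) : logCoeff b 0 = 0 := by simp [logCoeff]

theorem IsMangoldt.summable_logSum_base (hm : IsMangoldt r b) (hb : TwistBase r κ δ A₀) {σ : ℝ}
    (hσ : 1 < σ) : Summable fun n : ℕ => logCoeff b n * (n : ℝ) ^ (-σ) := by
  have h1 := (hm.summable_logCoeff hb (u := 1) (fun n => by simp) (s := (σ : ℂ) + (0 : ℝ) * Complex.I)
    (by simpa using hσ)).norm
  refine h1.congr fun n => ?_
  rcases eq_or_ne n 0 with rfl | hn
  · simp [IsMangoldt.logCoeff_zero]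
  · rw [re_term_eq _ _ _ _ _ hn]
    simp only [Complex.ofReal_zero, zero_mul, neg_zero, Complex.cpow_zero, mul_one,
      MonoidHom.one_apply]
    rw [Complex.norm_real, Real.norm_of_nonneg]
    exact mul_nonneg (hm.logCoeff_nonneg n) (Real.rpow_nonneg (Nat.cast_nonneg n) _)

theorem IsMangoldt.logTerm_nonneg (hm : IsMangoldt r b) (n : ℕ) (σ : ℝ) :
    0 ≤ logCoeff b n * (n : ℝ) ^ (-σ) :=
  mul_nonneg (hm.logCoeff_nonneg n) (Real.rpow_nonneg (Nat.cast_nonneg n) _)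

theorem IsMangoldt.summable_logSum (hm : IsMangoldt r b) (hb : TwistBase r κ δ A₀) {σ : ℝ}
    (hσ : 1 < σ) {u : ℕ → ℝ} (hu : ∀ n, |u n| ≤ 1) :
    Summable fun n : ℕ => logCoeff b n * (n : ℝ) ^ (-σ) * u n := by
  refine (hm.summable_logSum_base hb hσ).of_norm_bounded fun n => ?_
  rw [Real.norm_eq_abs, abs_mul, abs_of_nonneg (hm.logTerm_nonneg n σ)]
  exact mul_le_of_le_one_right (hm.logTerm_nonneg n σ) (hu n)

theorem IsMangoldt.norm_LSeries_eq (hm : IsMangoldt r b) (hb : TwistBase r κ δ A₀) {u : ℕ →* ℂ}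
    (hu : ∀ n, ‖u n‖ ≤ 1) {σ : ℝ} (hσ : 1 < σ) :
    ‖LSeries (twCoeff r u) σ‖ = Real.exp (logSum b u σ) := by
  have e : (1 : ℝ) < ((σ : ℂ) + (0 : ℝ) * Complex.I).re := by simpa using hσ
  have h1 := hm.LSeries_eq_exp hb hu e
  have h2 := Complex.hasSum_re (hm.summable_logCoeff hb hu e).hasSum
  have h3 : (LSeries (twCoeff (logCoeff b) u) ((σ : ℂ) + (0 : ℝ) * Complex.I)).re =
      logSum b u σ := by
    rw [LSeries, logSum, ← h2.tsum_eq]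
    refine tsum_congr fun n => ?_
    rcases eq_or_ne n 0 with rfl | hn
    · simp [IsMangoldt.logCoeff_zero]
    · rw [re_term_eq _ _ _ _ _ hn]
      simp only [Complex.ofReal_zero, zero_mul, neg_zero, Complex.cpow_zero, mul_one]
      rw [Complex.re_ofReal_mul]
  rw [← h3, ← Complex.norm_exp, ← h1]
  simp

theorem tendsto_ofReal_nhdsGT_one : Tendsto (fun σ : ℝ => (σ : ℂ)) (𝓝[>] 1) (𝓝 1) :=
  (Complex.continuous_ofReal.tendsto' 1 1 (by simp)).mono_left nhdsWithin_le_nhds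

theorem IsTwist.tendsto_twRem (hb : TwistBase r κ δ A₀) {u : ℕ →* ℂ} {c : ℂ} {B : ℝ}
    (h : IsTwist r δ u c B) :
    Tendsto (fun σ : ℝ => twRem r u c σ) (𝓝[>] 1) (𝓝 (twRem r u c 1)) :=
  ((h.differentiableAt (s := 1) (by simpa using hb.δ_pos)).continuousAt.tendsto).comp
    tendsto_ofReal_nhdsGT_one

theorem IsTwist.tendsto_mul_LSeries (hb : TwistBase r κ δ A₀) {u : ℕ →* ℂ} {c : ℂ} {B : ℝ}
    (h : IsTwist r δ u c B) :
    Tendsto (fun σ : ℝ => (σ - 1) * ‖LSeries (twCoeff r u) σ‖) (𝓝[>] 1) (𝓝 ‖c‖) := by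
  have h1 : Tendsto (fun σ : ℝ => ‖c * σ + ((σ : ℂ) - 1) * twRem r u c σ‖) (𝓝[>] 1)
      (𝓝 ‖c * 1 + (1 - 1) * twRem r u c 1‖) :=
    ((tendsto_const_nhds.mul tendsto_ofReal_nhdsGT_one).add
      ((tendsto_ofReal_nhdsGT_one.sub tendsto_const_nhds).mul (h.tendsto_twRem hb))).norm
  rw [mul_one, sub_self, zero_mul, add_zero] at h1
  refine h1.congr' ?_
  filter_upwards [self_mem_nhdsWithin] with σ hσ
  have hσ' : (1 : ℝ) < σ := hσ
  have hne : (σ : ℂ) - 1 ≠ 0 := by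
    rw [sub_ne_zero]; exact_mod_cast hσ'.ne'
  have e : ((σ - 1 : ℝ)) = ‖(σ : ℂ) - 1‖ := by
    rw [← Complex.ofReal_one, ← Complex.ofReal_sub, Complex.norm_real,
      Real.norm_of_nonneg (by linarith)]
  rw [h.LSeries_eq hb (by simpa using hσ'), e, ← norm_mul]
  congr 1
  field_simp

/-- If `(σ - 1) ^ k e ^ {f σ}` stays bounded then `f` is at most `k log (1 / (σ - 1)) + O(1)`. -/
theorem eventually_le_of_exp_bound {f : ℝ → ℝ} {D : ℝ} (k : ℤ)
    (h : ∀ᶠ σ in 𝓝[>] (1 : ℝ), (σ - 1) ^ k * Real.exp (f σ) ≤ D) :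
    ∃ C, ∀ᶠ σ in 𝓝[>] (1 : ℝ), f σ ≤ k * poleLog σ + C := by
  refine ⟨Real.log D, ?_⟩
  filter_upwards [h, self_mem_nhdsWithin] with σ h1 h2
  have h3 : (0 : ℝ) < σ - 1 := by simpa using h2
  have h4 : 0 < (σ - 1) ^ k := zpow_pos h3 k
  have h5 := Real.log_le_log (by positivity) h1
  rw [Real.log_mul h4.ne' (Real.exp_pos _).ne', Real.log_exp, Real.log_zpow] at h5
  rw [poleLog]
  linarith

theorem eventually_ge_of_exp_bound {f : ℝ → ℝ} {D : ℝ} (hD : 0 < D) (k : ℤ)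
    (h : ∀ᶠ σ in 𝓝[>] (1 : ℝ), D ≤ (σ - 1) ^ k * Real.exp (f σ)) :
    ∃ C, ∀ᶠ σ in 𝓝[>] (1 : ℝ), k * poleLog σ - C ≤ f σ := by
  refine ⟨-Real.log D, ?_⟩
  filter_upwards [h, self_mem_nhdsWithin] with σ h1 h2
  have h3 : (0 : ℝ) < σ - 1 := by simpa using h2
  have h4 : 0 < (σ - 1) ^ k := zpow_pos h3 k
  have h5 := Real.log_le_log hD h1
  rw [Real.log_mul h4.ne' (Real.exp_pos _).ne', Real.log_exp, Real.log_zpow] at h5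
  rw [poleLog]
  linarith

theorem IsTwist.exists_logSum_le (hm : IsMangoldt r b) (hb : TwistBase r κ δ A₀) {u : ℕ →* ℂ}
    {c : ℂ} {B : ℝ} (h : IsTwist r δ u c B) :
    ∃ C, ∀ᶠ σ in 𝓝[>] (1 : ℝ), logSum b u σ ≤ poleLog σ + C := by
  obtain ⟨C, hC⟩ := eventually_le_of_exp_bound (f := logSum b u) (D := ‖c‖ + 1) 1 (by
    filter_upwards [(h.tendsto_mul_LSeries hb).eventually_le_const (lt_add_one _),
      self_mem_nhdsWithin] with σ h1 h2
    rwa [hm.norm_LSeries_eq hb h.norm_le h2, ← zpow_one (σ - 1)] at h1)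
  exact ⟨C, by simpa using hC⟩

theorem IsTwist.exists_le_logSum (hm : IsMangoldt r b) (hb : TwistBase r κ δ A₀) {u : ℕ →* ℂ}
    {c : ℂ} {B : ℝ} (h : IsTwist r δ u c B) (hc : c ≠ 0) :
    ∃ C, ∀ᶠ σ in 𝓝[>] (1 : ℝ), poleLog σ - C ≤ logSum b u σ := by
  have hc' : 0 < ‖c‖ := norm_pos_iff.mpr hc
  obtain ⟨C, hC⟩ := eventually_ge_of_exp_bound (f := logSum b u) (D := ‖c‖ / 2) (by positivity) 1 (by
    filter_upwards [(h.tendsto_mul_LSeries hb).eventually_const_le (half_lt_self hc'),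
      self_mem_nhdsWithin] with σ h1 h2
    rwa [hm.norm_LSeries_eq hb h.norm_le h2, ← zpow_one (σ - 1)] at h1)
  exact ⟨C, by simpa using hC⟩

theorem IsTwist.norm_LSeries_of_zero (hb : TwistBase r κ δ A₀) {u : ℕ →* ℂ} {B : ℝ}
    (h : IsTwist r δ u 0 B) {σ : ℝ} (hσ : 1 < σ) : LSeries (twCoeff r u) σ = twRem r u 0 σ := by
  rw [h.LSeries_eq hb (by simpa using hσ), zero_mul, zero_add]

theorem IsTwist.exists_logSum_le_of_zero (hm : IsMangoldt r b) (hb : TwistBase r κ δ A₀)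
    {u : ℕ →* ℂ} {B : ℝ} (h : IsTwist r δ u 0 B) :
    ∃ C, ∀ᶠ σ in 𝓝[>] (1 : ℝ), logSum b u σ ≤ C := by
  obtain ⟨C, hC⟩ := eventually_le_of_exp_bound (f := logSum b u) (D := ‖twRem r u 0 1‖ + 1) 0 (by
    filter_upwards [(h.tendsto_twRem hb).norm.eventually_le_const (lt_add_one _),
      self_mem_nhdsWithin] with σ h1 h2
    rwa [← h.norm_LSeries_of_zero hb h2, hm.norm_LSeries_eq hb h.norm_le h2, ← one_mul (Real.exp _),
      ← zpow_zero (σ - 1)] at h1)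
  exact ⟨C, by simpa using hC⟩

theorem IsTwist.exists_le_logSum_of_ne_zero (hm : IsMangoldt r b) (hb : TwistBase r κ δ A₀)
    {u : ℕ →* ℂ} {B : ℝ} (h : IsTwist r δ u 0 B) (h1 : twRem r u 0 1 ≠ 0) :
    ∃ C, ∀ᶠ σ in 𝓝[>] (1 : ℝ), -C ≤ logSum b u σ := by
  have hc' : 0 < ‖twRem r u 0 1‖ := norm_pos_iff.mpr h1
  obtain ⟨C, hC⟩ := eventually_ge_of_exp_bound (f := logSum b u) (D := ‖twRem r u 0 1‖ / 2)
    (by positivity) 0 (by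
    filter_upwards [(h.tendsto_twRem hb).norm.eventually_const_le (half_lt_self hc'),
      self_mem_nhdsWithin] with σ h1 h2
    rwa [← h.norm_LSeries_of_zero hb h2, hm.norm_LSeries_eq hb h.norm_le h2, ← one_mul (Real.exp _),
      ← zpow_zero (σ - 1)] at h1)
  exact ⟨C, by simpa using hC⟩

theorem IsTwist.exists_logSum_le_neg (hm : IsMangoldt r b) (hb : TwistBase r κ δ A₀)
    {u : ℕ →* ℂ} {B : ℝ} (h : IsTwist r δ u 0 B) (h1 : twRem r u 0 1 = 0) :
    ∃ C, ∀ᶠ σ in 𝓝[>] (1 : ℝ), logSum b u σ ≤ -poleLog σ + C := by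
  have hd := (h.differentiableAt (s := 1) (by simpa using hb.δ_pos)).isBigO_sub
  obtain ⟨D, hD⟩ := hd.bound
  obtain ⟨C, hC⟩ := eventually_le_of_exp_bound (f := logSum b u) (D := D) (-1) (by
    filter_upwards [tendsto_ofReal_nhdsGT_one.eventually hD, self_mem_nhdsWithin] with σ h2 h3
    have h3' : 1 < σ := h3
    have e : ‖(σ : ℂ) - 1‖ = σ - 1 := by
      rw [← Complex.ofReal_one, ← Complex.ofReal_sub, Complex.norm_real,
        Real.norm_of_nonneg (by linarith)]
    rw [h1, sub_zero, ← h.norm_LSeries_of_zero hb h3', hm.norm_LSeries_eq hb h.norm_le h3', e] at h2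
    rw [zpow_neg_one, inv_mul_le_iff₀ (by linarith)]
    linarith)
  exact ⟨C, by simpa using hC⟩

theorem TwistBase.exists_logSum_bounds (hm : IsMangoldt r b) (hb : TwistBase r κ δ A₀) :
    ∃ C, ∀ᶠ σ in 𝓝[>] (1 : ℝ),
      poleLog σ - C ≤ logSum b (1 : ℕ →* ℂ) σ ∧ logSum b (1 : ℕ →* ℂ) σ ≤ poleLog σ + C := by
  obtain ⟨C₁, h₁⟩ := hb.twist.exists_logSum_le hm hb
  obtain ⟨C₂, h₂⟩ := hb.twist.exists_le_logSum hm hb (by exact_mod_cast hb.κ_pos.ne')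
  refine ⟨max C₁ C₂, ?_⟩
  filter_upwards [h₁, h₂] with σ h3 h4
  exact ⟨by linarith [le_max_right C₁ C₂], by linarith [le_max_left C₁ C₂]⟩

end LogGrowth

/-! ### Counting the characters whose Dirichlet series has a pole -/

section PoleCount
open Filter Topology
variable {r b : ℕ → ℝ} {κ δ A₀ : ℝ} {q : ℕ}

/-- The part of the logarithm supported on `n ≡ 1 (mod q)`. -/
noncomputable def logSumOne (b : ℕ → ℝ) (q : ℕ) (σ : ℝ) : ℝ :=
  ∑' n : ℕ, logCoeff b n * (n : ℝ) ^ (-σ) * (if (n : ZMod q) = 1 then 1 else 0)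

theorem abs_charHom_re_le (χ : DirichletCharacter ℂ q) (n : ℕ) : |(charHom χ n).re| ≤ 1 :=
  (Complex.abs_re_le_norm _).trans (by rw [charHom_apply]; exact χ.norm_le_one _)

theorem IsMangoldt.sum_logSum (hm : IsMangoldt r b) (hb : TwistBase r κ δ A₀) [NeZero q] {σ : ℝ}
    (hσ : 1 < σ) :
    ∑ χ : DirichletCharacter ℂ q, logSum b (charHom χ) σ = q.totient * logSumOne b q σ := by
  unfold logSum logSumOne
  rw [← Summable.tsum_finsetSum fun χ _ => hm.summable_logSum hb hσ (abs_charHom_re_le χ),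
    ← tsum_mul_left]
  refine tsum_congr fun n => ?_
  rw [← Finset.mul_sum]
  have h1 := congrArg Complex.re (DirichletCharacter.sum_characters_eq ℂ (n : ZMod q))
  rw [Complex.re_sum] at h1
  simp only [charHom_apply]
  rw [h1]
  split_ifs <;> simp [mul_comm]

/-- A character value is controlled by its deviation from `1` in real part. -/
theorem exists_norm_sub_le (χ : DirichletCharacter ℂ q) [NeZero q] :
    ∃ A : ℝ, 0 ≤ A ∧ ∀ (ψ : DirichletCharacter ℂ q) (n : ℕ),
      ‖charHom (ψ * χ) n - charHom ψ n‖ ≤ A * (1 - (charHom χ n).re) := by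
  have h1 : ∀ a : ZMod q, IsUnit a → χ a ≠ 1 → 0 < 1 - (χ a).re := by
    intro a ha hne
    have h2 : ‖χ a‖ ≤ 1 := χ.norm_le_one a
    have h3 : (χ a).re ≤ ‖χ a‖ := Complex.re_le_norm _
    rcases (h3.trans h2).lt_or_eq with h | h
    · linarith
    · exfalso
      apply hne
      have h4 : ‖χ a‖ = 1 := le_antisymm h2 (h ▸ h3)
      have h5 := Complex.sq_norm (χ a)
      rw [Complex.normSq_apply, h4, h] at h5
      apply Complex.ext
      · simp [h]
      · have : (χ a).im * (χ a).im = 0 := by linarith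
        simpa using this
  refine ⟨∑ a : ZMod q, 2 / (1 - (χ a).re), ?_, fun ψ n => ?_⟩
  · refine Finset.sum_nonneg fun a _ => div_nonneg (by norm_num) ?_
    linarith [Complex.re_le_norm (χ a), χ.norm_le_one a]
  rw [charHom_apply, charHom_apply, charHom_apply, MulChar.mul_apply]
  have hre : ∀ a : ZMod q, 0 ≤ 1 - (χ a).re := fun a => by
    linarith [Complex.re_le_norm (χ a), χ.norm_le_one a]
  have hA : 0 ≤ ∑ a : ZMod q, 2 / (1 - (χ a).re) :=
    Finset.sum_nonneg fun a _ => div_nonneg (by norm_num) (hre a)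
  by_cases hu : IsUnit (n : ZMod q)
  · by_cases h2 : χ (n : ZMod q) = 1
    · simp [h2]
    · have h3 := h1 _ hu h2
      have h4 : 2 / (1 - (χ (n : ZMod q)).re) ≤ ∑ a : ZMod q, 2 / (1 - (χ a).re) :=
        Finset.single_le_sum (f := fun a : ZMod q => 2 / (1 - (χ a).re))
          (fun a _ => div_nonneg (by norm_num) (hre a)) (Finset.mem_univ _)
      rw [div_le_iff₀ h3] at h4
      refine le_trans ?_ h4
      refine (norm_sub_le _ _).trans ?_
      rw [norm_mul]
      have := ψ.norm_le_one (n : ZMod q)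
      have := χ.norm_le_one (n : ZMod q)
      nlinarith [norm_nonneg (ψ (n : ZMod q)), norm_nonneg (χ (n : ZMod q))]
  · rw [ψ.map_nonunit hu, zero_mul, sub_zero, norm_zero]
    exact mul_nonneg hA (hre _)

/-- Multiplying by a character with a pole changes the logarithm by a bounded amount. -/
theorem IsTwist.exists_logSum_mul_le (hm : IsMangoldt r b) (hb : TwistBase r κ δ A₀) [NeZero q]
    {χ : DirichletCharacter ℂ q} {c : ℂ} {B : ℝ} (h : IsTwist r δ (charHom χ) c B) (hc : c ≠ 0)
    (ψ : DirichletCharacter ℂ q) :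
    ∃ C, ∀ᶠ σ in 𝓝[>] (1 : ℝ), logSum b (charHom (ψ * χ)) σ ≤ logSum b (charHom ψ) σ + C := by
  obtain ⟨A, hA, hA'⟩ := exists_norm_sub_le χ
  obtain ⟨C₁, h₁⟩ := h.exists_le_logSum hm hb hc
  obtain ⟨C₂, h₂⟩ := hb.exists_logSum_bounds hm
  refine ⟨A * (C₁ + C₂), ?_⟩
  filter_upwards [h₁, h₂, self_mem_nhdsWithin] with σ h3 h4 hσ
  have key : logSum b (charHom (ψ * χ)) σ - logSum b (charHom ψ) σ ≤
      A * (logSum b (1 : ℕ →* ℂ) σ - logSum b (charHom χ) σ) := by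
    unfold logSum
    have s1 := hm.summable_logSum hb hσ (abs_charHom_re_le (ψ * χ))
    have s2 := hm.summable_logSum hb hσ (abs_charHom_re_le ψ)
    have s3 := hm.summable_logSum hb hσ (abs_charHom_re_le χ)
    have s4 := hm.summable_logSum hb hσ (u := fun n => ((1 : ℕ →* ℂ) n).re) (fun n => by simp)
    rw [← s1.tsum_sub s2, ← s4.tsum_sub s3, ← tsum_mul_left]
    refine Summable.tsum_le_tsum (fun n => ?_) (s1.sub s2) ((s4.sub s3).mul_left A)
    have h5 := (Complex.re_le_norm _).trans (hA' ψ n)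
    rw [Complex.sub_re] at h5
    have h6 := mul_le_mul_of_nonneg_left h5 (hm.logTerm_nonneg n σ)
    simp only [MonoidHom.one_apply, Complex.one_re]
    linarith
  have := mul_le_mul_of_nonneg_left (show logSum b (1 : ℕ →* ℂ) σ - logSum b (charHom χ) σ ≤ C₁ + C₂
    by linarith [h4.2]) hA
  linarith

variable {c : DirichletCharacter ℂ q → ℂ} {B : ℝ}

/-- If the primes `≡ 1 (mod q)` have a positive density, no series without a pole vanishes
at `1`. -/
theorem twRem_one_ne_zero (hm : IsMangoldt r b) (hb : TwistBase r κ δ A₀) [NeZero q]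
    (h : ∀ χ : DirichletCharacter ℂ q, IsTwist r δ (charHom χ) (c χ) B) {g : ℕ} {D : ℝ}
    (hT : ∀ᶠ σ in 𝓝[>] (1 : ℝ), poleLog σ - D ≤ g * logSumOne b q σ)
    (χ : DirichletCharacter ℂ q) (hχ : c χ = 0) : twRem r (charHom χ) 0 1 ≠ 0 := by
  intro hz
  set P := Finset.univ.filter fun ψ : DirichletCharacter ℂ q => c ψ ≠ 0 with hP
  set Z := P.map ⟨fun ψ => χ * ψ, mul_right_injective χ⟩ with hZ
  have h0 : IsTwist r δ (charHom χ) 0 B := hχ ▸ h χ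
  obtain ⟨C₀, hC₀⟩ := h0.exists_logSum_le_neg hm hb hz
  have hZle : ∀ ψ ∈ Z, ∃ C, ∀ᶠ σ in 𝓝[>] (1 : ℝ), logSum b (charHom ψ) σ ≤ -poleLog σ + C := by
    intro ψ hψ
    obtain ⟨ψ', hψ', rfl⟩ := Finset.mem_map.mp hψ
    rw [hP, Finset.mem_filter] at hψ'
    obtain ⟨C₁, hC₁⟩ := (h ψ').exists_logSum_mul_le hm hb hψ'.2 χ
    refine ⟨C₀ + C₁, ?_⟩
    filter_upwards [hC₀, hC₁] with σ h3 h4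
    simp only [Function.Embedding.coeFn_mk]
    linarith
  have hbd : ∀ ψ : DirichletCharacter ℂ q, ∃ C, ∀ᶠ σ in 𝓝[>] (1 : ℝ), logSum b (charHom ψ) σ ≤
      (if ψ ∈ P then poleLog σ else 0) - (if ψ ∈ Z then poleLog σ else 0) + C := by
    intro ψ
    by_cases hψ : ψ ∈ P
    · have hψZ : ψ ∉ Z := by
        intro hmem
        obtain ⟨C₁, hC₁⟩ := hZle ψ hmem
        rw [hP, Finset.mem_filter] at hψ
        obtain ⟨C₂, hC₂⟩ := (h ψ).exists_le_logSum hm hb hψ.2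
        refine not_eventually_poleLog_le (k := 2) (C := C₁ + C₂) (by norm_num) ?_
        filter_upwards [hC₁, hC₂] with σ h3 h4
        linarith
      obtain ⟨C, hC⟩ := (h ψ).exists_logSum_le hm hb
      refine ⟨C, ?_⟩
      filter_upwards [hC] with σ h3
      rw [if_pos hψ, if_neg hψZ]
      linarith
    · have hc0 : c ψ = 0 := by simpa [hP] using hψ
      by_cases hψZ : ψ ∈ Z
      · obtain ⟨C, hC⟩ := hZle ψ hψZ
        refine ⟨C, ?_⟩
        filter_upwards [hC] with σ h3
        rw [if_neg hψ, if_pos hψZ]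
        linarith
      · obtain ⟨C, hC⟩ := IsTwist.exists_logSum_le_of_zero hm hb (hc0 ▸ h ψ)
        refine ⟨C, ?_⟩
        filter_upwards [hC] with σ h3
        rw [if_neg hψ, if_neg hψZ]
        linarith
  choose C hC using hbd
  refine not_eventually_poleLog_le (k := 1) (C := D + g * ((∑ ψ, C ψ) / q.totient)) one_pos ?_
  have hall := Filter.eventually_all.mpr hC
  have hφ : (0 : ℝ) < q.totient := by exact_mod_cast Nat.totient_pos.mpr (NeZero.pos q)
  filter_upwards [hall, hT, self_mem_nhdsWithin] with σ h3 h4 hσ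
  have h5 := Finset.sum_le_sum fun ψ (_ : ψ ∈ Finset.univ) => h3 ψ
  rw [hm.sum_logSum hb hσ, Finset.sum_add_distrib, Finset.sum_sub_distrib, Finset.sum_ite_mem,
    Finset.sum_ite_mem, Finset.univ_inter, Finset.univ_inter, Finset.sum_const, Finset.sum_const,
    hZ, Finset.card_map, sub_self, zero_add] at h5
  have h6 : logSumOne b q σ ≤ (∑ ψ, C ψ) / q.totient := by
    rw [le_div_iff₀ hφ]; linarith
  have := mul_le_mul_of_nonneg_left h6 (Nat.cast_nonneg (α := ℝ) g)
  linarith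

/-- The number of characters with a pole. -/
theorem card_pole_mul_le (hm : IsMangoldt r b) (hb : TwistBase r κ δ A₀) [NeZero q]
    (h : ∀ χ : DirichletCharacter ℂ q, IsTwist r δ (charHom χ) (c χ) B) {g : ℕ} {D : ℝ}
    (hT : ∀ᶠ σ in 𝓝[>] (1 : ℝ), poleLog σ - D ≤ g * logSumOne b q σ ∧
      g * logSumOne b q σ ≤ poleLog σ + D) :
    (Finset.univ.filter fun χ : DirichletCharacter ℂ q => c χ ≠ 0).card * g ≤ q.totient := by
  set P := Finset.univ.filter fun ψ : DirichletCharacter ℂ q => c ψ ≠ 0 with hP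
  have hbd : ∀ ψ : DirichletCharacter ℂ q, ∃ C, ∀ᶠ σ in 𝓝[>] (1 : ℝ),
      (if ψ ∈ P then poleLog σ else 0) - C ≤ logSum b (charHom ψ) σ := by
    intro ψ
    by_cases hψ : ψ ∈ P
    · rw [hP, Finset.mem_filter] at hψ
      obtain ⟨C, hC⟩ := (h ψ).exists_le_logSum hm hb hψ.2
      refine ⟨C, ?_⟩
      filter_upwards [hC] with σ h3
      rwa [if_pos (by simpa [hP] using hψ)]
    · have hc0 : c ψ = 0 := by simpa [hP] using hψ
      obtain ⟨C, hC⟩ := IsTwist.exists_le_logSum_of_ne_zero hm hb (hc0 ▸ h ψ)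
        (twRem_one_ne_zero hm hb h (hT.mono fun σ h => h.1) ψ hc0)
      refine ⟨C, ?_⟩
      filter_upwards [hC] with σ h3
      rw [if_neg hψ]
      linarith
  choose C hC using hbd
  by_contra! hlt
  have hlt' : (q.totient : ℝ) < P.card * g := by exact_mod_cast hlt
  refine not_eventually_poleLog_le (k := P.card * g - q.totient)
    (C := q.totient * D + g * ∑ ψ, C ψ) (by linarith) ?_
  have hall := Filter.eventually_all.mpr hC
  filter_upwards [hall, hT, self_mem_nhdsWithin] with σ h3 h4 hσ
  have h5 := Finset.sum_le_sum fun ψ (_ : ψ ∈ Finset.univ) => h3 ψ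
  rw [hm.sum_logSum hb hσ, Finset.sum_sub_distrib, Finset.sum_ite_mem,
    Finset.univ_inter, Finset.sum_const, nsmul_eq_mul] at h5
  have h6 := mul_le_mul_of_nonneg_left h5 (Nat.cast_nonneg (α := ℝ) g)
  have h7 := mul_le_mul_of_nonneg_left h4.2 (Nat.cast_nonneg (α := ℝ) q.totient)
  nlinarith

/-- A character that is trivial on the support of `r` has a pole. -/
theorem pole_of_eq_one (hm : IsMangoldt r b) (hb : TwistBase r κ δ A₀) [NeZero q]
    (h : ∀ χ : DirichletCharacter ℂ q, IsTwist r δ (charHom χ) (c χ) B) {g : ℕ} {D : ℝ}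
    (hT : ∀ᶠ σ in 𝓝[>] (1 : ℝ), poleLog σ - D ≤ g * logSumOne b q σ)
    (χ : DirichletCharacter ℂ q)
    (hχ : ∀ n : ℕ, n.Coprime q → b n ≠ 0 → χ (n : ZMod q) = 1) : c χ ≠ 0 := by
  intro hc0
  obtain ⟨C, hC⟩ := IsTwist.exists_logSum_le_of_zero hm hb (hc0 ▸ h χ)
  refine not_eventually_poleLog_le (k := 1) (C := D + g * C) one_pos ?_
  filter_upwards [hC, hT, self_mem_nhdsWithin] with σ h3 h4 hσ
  have h5 : logSumOne b q σ ≤ logSum b (charHom χ) σ := by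
    unfold logSumOne logSum
    refine Summable.tsum_le_tsum (fun n => ?_) (hm.summable_logSum hb hσ fun n => ?_)
      (hm.summable_logSum hb hσ (abs_charHom_re_le χ))
    · by_cases hbn : b n = 0
      · simp [logCoeff, hbn]
      · refine mul_le_mul_of_nonneg_left ?_ (hm.logTerm_nonneg n σ)
        rw [charHom_apply]
        by_cases hn : n.Coprime q
        · rw [hχ n hn hbn]
          split_ifs <;> simp
        · have hnu : ¬ IsUnit (n : ZMod q) := by rwa [ZMod.isUnit_iff_coprime]
          rw [χ.map_nonunit hnu, if_neg]
          · simp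
          · intro h1; exact hnu (h1 ▸ isUnit_one)
    · split_ifs <;> simp
  have := mul_le_mul_of_nonneg_left (h5.trans h3) (Nat.cast_nonneg (α := ℝ) g)
  linarith

end PoleCount

/-! ### Primes in cyclotomic extensions -/

section CyclotomicPrimes
open scoped Pointwise
variable {K L : Type*} [Field K] [NumberField K] [Field L] [NumberField L] [Algebra K L]

theorem card_quotient_eq_absNorm (P : Ideal (𝓞 K)) : Nat.card (𝓞 K ⧸ P) = absNorm P := by
  rw [absNorm_apply, Submodule.cardQuot_apply]

theorem finite_quotient_of_ne_bot {P : Ideal (𝓞 K)} (hP : P ≠ ⊥) : Finite (𝓞 K ⧸ P) :=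
  Ideal.finiteQuotientOfFreeOfNeBot P hP

theorem under_ne_bot {Q : Ideal (𝓞 L)} (hQ : Q ≠ ⊥) : Q.under (𝓞 K) ≠ ⊥ :=
  Ideal.IsIntegral.comap_ne_bot (R := 𝓞 K) hQ

theorem pow_absNorm_sub_mem {Q : Ideal (𝓞 L)} (hQ : Q.IsPrime) (hQ0 : Q ≠ ⊥) (x : 𝓞 L) :
    x ^ absNorm Q - x ∈ Q := by
  have := finite_quotient_of_ne_bot hQ0
  have := Fintype.ofFinite (𝓞 L ⧸ Q)
  have hmax : Q.IsMaximal := hQ.isMaximal hQ0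
  let _ := Ideal.Quotient.field Q
  rw [← Ideal.Quotient.eq, map_pow, ← card_quotient_eq_absNorm, Nat.card_eq_fintype_card,
    FiniteField.pow_card]

theorem absNorm_under_le {Q : Ideal (𝓞 L)} (hQ0 : Q ≠ ⊥) :
    absNorm (Q.under (𝓞 K)) ≤ absNorm Q := by
  have := finite_quotient_of_ne_bot hQ0
  rw [← card_quotient_eq_absNorm, ← card_quotient_eq_absNorm]
  exact Nat.card_le_card_of_injective _
    (Ideal.algebraMap_quotient_injective (R := 𝓞 K) (I := Q))

theorem absNorm_eq_or_sq_le {Q : Ideal (𝓞 L)} (hQ : Q.IsPrime) (hQ0 : Q ≠ ⊥) :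
    absNorm Q = absNorm (Q.under (𝓞 K)) ∨ absNorm (Q.under (𝓞 K)) ^ 2 ≤ absNorm Q := by
  have hP0 := under_ne_bot (K := K) hQ0
  have hmax : (Q.under (𝓞 K)).IsMaximal := (inferInstance : (Q.under (𝓞 K)).IsPrime).isMaximal hP0
  have h1 := absNorm_eq_pow_inertiaDeg'_of_liesOver Q (Q.under (𝓞 K)) inferInstance hP0
  have h2 : 1 < absNorm (Q.under (𝓞 K)) := one_lt_absNorm_of_isPrime inferInstance hP0
  rcases Nat.lt_or_ge ((Q.under (𝓞 K)).inertiaDeg' Q) 2 with h | h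
  · left
    refine le_antisymm ?_ (absNorm_under_le hQ0)
    rw [h1]
    calc _ ≤ absNorm (Q.under (𝓞 K)) ^ 1 := Nat.pow_le_pow_right (by omega) (by omega)
      _ = _ := pow_one _
  · right
    rw [h1]
    exact Nat.pow_le_pow_right (by omega) h

variable [IsGalois K L]

theorem under_smul (σ : Gal(L/K)) (Q : Ideal (𝓞 L)) : (σ • Q).under (𝓞 K) = Q.under (𝓞 K) := by
  ext x
  rw [Ideal.mem_under, Ideal.mem_under, Ideal.mem_pointwise_smul_iff_inv_smul_mem, smul_algebraMap]

theorem absNorm_smul (σ : Gal(L/K)) (Q : Ideal (𝓞 L)) : absNorm (σ • Q) = absNorm Q := by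
  rw [← card_quotient_eq_absNorm, ← card_quotient_eq_absNorm]
  exact Nat.card_congr (Ideal.quotientEquiv Q (σ • Q) (MulSemiringAction.toRingEquiv _ _ σ)
    rfl).symm.toEquiv

variable {q : ℕ} [NeZero q] {ζ : L}

theorem autToPow_of_isArithFrobAt (hζ : IsPrimitiveRoot ζ q) {Q : Ideal (𝓞 L)}
    (hq : (q : 𝓞 L) ∉ Q) {σ : Gal(L/K)} (hσ : IsArithFrobAt (𝓞 K) σ Q) :
    ((hζ.autToPow K σ : (ZMod q)ˣ) : ZMod q) = (absNorm (Q.under (𝓞 K)) : ZMod q) := by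
  have hint : IsIntegral ℤ ζ := hζ.isIntegral (NeZero.pos q)
  have h1 := hσ.apply_of_pow_eq_one (ζ := hζ.toInteger) (m := q) hζ.toInteger_isPrimitiveRoot.pow_eq_one hq
  have h2 := congrArg (algebraMap (𝓞 L) L) h1
  rw [map_pow, card_quotient_eq_absNorm] at h2
  have h3 : σ ζ = ζ ^ absNorm (Q.under (𝓞 K)) := h2
  rw [← hζ.autToPow_spec K σ] at h3
  have h4 : ζ ^ absNorm (Q.under (𝓞 K)) = ζ ^ (absNorm (Q.under (𝓞 K)) % q) :=
    pow_eq_pow_mod _ hζ.pow_eq_one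
  rw [h4] at h3
  have h5 := hζ.pow_inj (ZMod.val_lt _) (Nat.mod_lt _ (NeZero.pos q)) h3
  rw [← ZMod.natCast_zmod_val ((hζ.autToPow K σ : (ZMod q)ˣ) : ZMod q), h5, ZMod.natCast_mod]

theorem exists_isArithFrobAt (hζ : IsPrimitiveRoot ζ q) {Q : Ideal (𝓞 L)} (hQ : Q.IsPrime)
    (hQ0 : Q ≠ ⊥) (hq : (q : 𝓞 L) ∉ Q) :
    ∃ σ : Gal(L/K), IsArithFrobAt (𝓞 K) σ Q ∧
      ((hζ.autToPow K σ : (ZMod q)ˣ) : ZMod q) = (absNorm (Q.under (𝓞 K)) : ZMod q) := by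
  have := finite_quotient_of_ne_bot hQ0
  obtain ⟨σ, hσ⟩ := IsArithFrobAt.exists_of_isInvariant (𝓞 K) Gal(L/K) Q
  exact ⟨σ, hσ, autToPow_of_isArithFrobAt hζ hq hσ⟩

theorem absNorm_eq_one_of_eq (hζ : IsPrimitiveRoot ζ q) {Q : Ideal (𝓞 L)} (hQ : Q.IsPrime)
    (hQ0 : Q ≠ ⊥) (hq : (q : 𝓞 L) ∉ Q) (h : absNorm Q = absNorm (Q.under (𝓞 K))) :
    (absNorm (Q.under (𝓞 K)) : ZMod q) = 1 := by
  have h1 : IsArithFrobAt (𝓞 K) (1 : Gal(L/K)) Q := by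
    intro x
    rw [card_quotient_eq_absNorm, ← h, ← neg_mem_iff, neg_sub]
    simpa using pow_absNorm_sub_mem hQ hQ0 x
  rw [← autToPow_of_isArithFrobAt hζ hq h1, map_one, Units.val_one]

variable [IsCyclotomicExtension {q} K L]

theorem absNorm_eq_of_eq_one (hζ : IsPrimitiveRoot ζ q) {Q : Ideal (𝓞 L)} (hQ : Q.IsPrime)
    (hQ0 : Q ≠ ⊥) (hq : (q : 𝓞 L) ∉ Q) (h : (absNorm (Q.under (𝓞 K)) : ZMod q) = 1) :
    absNorm Q = absNorm (Q.under (𝓞 K)) := by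
  obtain ⟨σ, hσ, h1⟩ := exists_isArithFrobAt (K := K) hζ hQ hQ0 hq
  have h2 : σ = 1 := by
    apply hζ.autToPow_injective K
    rw [map_one]
    exact Units.ext (h1.trans h)
  subst h2
  refine le_antisymm ?_ (absNorm_under_le hQ0)
  have := finite_quotient_of_ne_bot hQ0
  have := Fintype.ofFinite (𝓞 L ⧸ Q)
  have hmax : Q.IsMaximal := hQ.isMaximal hQ0
  let _ := Ideal.Quotient.field Q
  have h3 : 1 < absNorm (Q.under (𝓞 K)) :=
    one_lt_absNorm_of_isPrime inferInstance (under_ne_bot hQ0)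
  have h4 : (Polynomial.X ^ absNorm (Q.under (𝓞 K)) - Polynomial.X :
      Polynomial (𝓞 L ⧸ Q)) ≠ 0 := FiniteField.X_pow_card_sub_X_ne_zero _ h3
  have h5 : (Finset.univ : Finset (𝓞 L ⧸ Q)) ⊆ (Polynomial.X ^ absNorm (Q.under (𝓞 K)) -
      Polynomial.X : Polynomial (𝓞 L ⧸ Q)).roots.toFinset := by
    intro y _
    obtain ⟨x, rfl⟩ := Ideal.Quotient.mk_surjective y
    rw [Multiset.mem_toFinset, Polynomial.mem_roots h4, Polynomial.IsRoot.def, Polynomial.eval_sub,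
      Polynomial.eval_pow, Polynomial.eval_X, ← card_quotient_eq_absNorm, ← hσ.mk_apply x]
    simp
  have h6 := (Finset.card_le_card h5).trans (Multiset.toFinset_card_le _)
  have h7 := h6.trans (Polynomial.card_roots' _)
  rw [FiniteField.X_pow_card_sub_X_natDegree_eq _ h3, Finset.card_univ, ← Nat.card_eq_fintype_card,
    card_quotient_eq_absNorm] at h7
  exact h7

theorem smul_injective_of_eq_one (hζ : IsPrimitiveRoot ζ q) {Q : Ideal (𝓞 L)} (hQ : Q.IsPrime)
    (hQ0 : Q ≠ ⊥) (hq : (q : 𝓞 L) ∉ Q) (h : (absNorm (Q.under (𝓞 K)) : ZMod q) = 1) :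
    Function.Injective fun σ : Gal(L/K) => σ • Q := by
  have hN := absNorm_eq_of_eq_one hζ hQ hQ0 hq h
  have := finite_quotient_of_ne_bot hQ0
  have := finite_quotient_of_ne_bot (under_ne_bot (K := K) hQ0)
  have hbij : Function.Bijective (algebraMap (𝓞 K ⧸ Q.under (𝓞 K)) (𝓞 L ⧸ Q)) := by
    refine (Nat.bijective_iff_injective_and_card _).mpr
      ⟨Ideal.algebraMap_quotient_injective, ?_⟩
    rw [card_quotient_eq_absNorm, card_quotient_eq_absNorm, hN]
  have key : ∀ τ : Gal(L/K), τ • Q = Q → τ = 1 := by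
    intro τ hτ
    have h1 : IsArithFrobAt (𝓞 K) τ Q := by
      intro x
      rw [card_quotient_eq_absNorm, ← hN]
      obtain ⟨y, hy⟩ := hbij.2 (Ideal.Quotient.mk Q x)
      obtain ⟨y, rfl⟩ := Ideal.Quotient.mk_surjective y
      have h2 : algebraMap (𝓞 K) (𝓞 L) y - x ∈ Q := Ideal.Quotient.eq.mp hy
      have h3 : τ • (algebraMap (𝓞 K) (𝓞 L) y - x) ∈ Q := by
        rw [← hτ]
        exact Ideal.smul_mem_pointwise_smul _ _ _ h2
      rw [smul_sub, smul_algebraMap] at h3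
      have h4 := pow_absNorm_sub_mem hQ hQ0 x
      have h5 := sub_mem (sub_mem h2 h3) h4
      have h6 : algebraMap (𝓞 K) (𝓞 L) y - x - (algebraMap (𝓞 K) (𝓞 L) y - τ • x) -
          (x ^ absNorm Q - x) = τ • x - x ^ absNorm Q := by ring
      rw [h6] at h5
      exact h5
    apply hζ.autToPow_injective K
    rw [map_one]
    exact Units.ext ((autToPow_of_isArithFrobAt hζ hq h1).trans h)
  intro σ σ' hσ
  have h1 : (σ'⁻¹ * σ) • Q = Q := by
    have : σ • Q = σ' • Q := hσ
    rw [mul_smul, this, inv_smul_smul]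
  have := key _ h1
  rw [inv_mul_eq_one] at this
  exact this.symm

end CyclotomicPrimes

/-! ### Sums over prime ideals -/

section PrimeSums
open scoped ENNReal
variable {K : Type*} [Field K] [NumberField K]

/-- `N I ^ (-σ)` as an extended nonnegative real. -/
noncomputable def normWeight (σ : ℝ) (I : Ideal (𝓞 K)) : ℝ≥0∞ :=
  ENNReal.ofReal ((absNorm I : ℝ) ^ (-σ))

/-- The terms of the logarithm of the Dedekind zeta function. -/
noncomputable def logWeight (σ : ℝ) (I : Ideal (𝓞 K)) : ℝ≥0∞ :=
  ENNReal.ofReal (LambdaK K I / Real.log (absNorm I) * (absNorm I : ℝ) ^ (-σ))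

theorem tsum_ideal_eq (f : Ideal (𝓞 K) → ℝ≥0∞) :
    ∑' I, f I = ∑' n : ℕ, ∑ I ∈ idealsOfNorm K n, f I := by
  rw [← ENNReal.tsum_fiberwise f (fun I => absNorm I)]
  refine tsum_congr fun n => ?_
  rw [← Finset.tsum_subtype]
  have : ((fun I : Ideal (𝓞 K) => absNorm I) ⁻¹' {n}) = {I | I ∈ idealsOfNorm K n} := by
    ext I
    simp [mem_idealsOfNorm]
  rw [this]
  rfl

theorem tsum_logWeight {κ δ A₀ : ℝ} (hb : TwistBase (idealCount K) κ δ A₀) {σ : ℝ} (hσ : 1 < σ)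
    (S : ℕ → Prop) :
    ∑' I : Ideal (𝓞 K), (if S (absNorm I) then logWeight σ I else 0) = ENNReal.ofReal
      (∑' n : ℕ, logCoeff (mangoldtCoeff K) n * (n : ℝ) ^ (-σ) * (if S n then 1 else 0)) := by
  have hm := isMangoldt_mangoldtCoeff K
  rw [ENNReal.ofReal_tsum_of_nonneg
    (fun n => mul_nonneg (hm.logTerm_nonneg n σ) (by split_ifs <;> norm_num))
    (hm.summable_logSum hb hσ fun n => by split_ifs <;> norm_num), tsum_ideal_eq]
  refine tsum_congr fun n => ?_
  by_cases hS : S n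
  · rw [if_pos hS, mul_one, logCoeff, mangoldtCoeff, Finset.sum_div, Finset.sum_mul,
      ENNReal.ofReal_sum_of_nonneg]
    · refine Finset.sum_congr rfl fun I hI => ?_
      rw [mem_idealsOfNorm] at hI
      rw [hI, if_pos hS, logWeight, hI]
    · intro I _
      exact mul_nonneg (div_nonneg (LambdaK_nonneg I) (Real.log_natCast_nonneg n))
        (Real.rpow_nonneg (Nat.cast_nonneg n) _)
  · rw [if_neg hS, mul_zero, ENNReal.ofReal_zero]
    refine Finset.sum_eq_zero fun I hI => ?_
    rw [mem_idealsOfNorm] at hI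
    rw [hI, if_neg hS]

theorem tsum_normWeight_two_ne_top : ∑' I : Ideal (𝓞 K), normWeight 2 I ≠ ∞ := by
  obtain ⟨κ, A, c, hb, -⟩ := exists_twistBase_idealCount K
  have h1 := (hb.summable (s := 2) (by norm_num)).norm
  rw [tsum_ideal_eq]
  have h2 : ∀ n : ℕ, ∑ I ∈ idealsOfNorm K n, normWeight 2 I =
      ENNReal.ofReal (idealCount K n * (n : ℝ) ^ (-2 : ℝ)) := by
    intro n
    rw [idealCount_eq_card, ENNReal.ofReal_mul (Nat.cast_nonneg _), ENNReal.ofReal_natCast,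
      ← nsmul_eq_mul]
    refine Finset.sum_eq_card_nsmul fun I hI => ?_
    rw [mem_idealsOfNorm] at hI
    rw [normWeight, hI]
  simp_rw [h2]
  have h3 : Summable fun n : ℕ => idealCount K n * (n : ℝ) ^ (-2 : ℝ) := by
    refine h1.congr fun n => ?_
    rcases eq_or_ne n 0 with rfl | hn
    · simp
    · rw [LSeries.norm_term_eq, if_neg hn, Complex.norm_real, Real.norm_of_nonneg (hb.nonneg n),
        Real.rpow_neg (Nat.cast_nonneg n), div_eq_mul_inv]
      simp
  exact h3.tsum_ofReal_ne_top

theorem normWeight_anti {σ τ : ℝ} (h : τ ≤ σ) {I : Ideal (𝓞 K)} (hI : I ≠ ⊥) :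
    normWeight σ I ≤ normWeight τ I :=
  ENNReal.ofReal_le_ofReal (Real.rpow_le_rpow_of_exponent_le
    (by exact_mod_cast Nat.one_le_iff_ne_zero.mpr (by rwa [Ne, Ideal.absNorm_eq_zero_iff]))
    (by linarith))

/-- The weight `normWeight`, restricted to the nonzero prime ideals. -/
noncomputable def primeWeight (σ : ℝ) (I : Ideal (𝓞 K)) : ℝ≥0∞ :=
  if I.IsPrime ∧ I ≠ ⊥ then normWeight σ I else 0

/-- The weight `normWeight 1`, restricted to the proper powers of nonzero prime ideals. -/
noncomputable def properPowerWeight (I : Ideal (𝓞 K)) : ℝ≥0∞ :=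
  if ∃ p : Ideal (𝓞 K) × ℕ, (p.1.IsPrime ∧ p.1 ≠ ⊥) ∧ p.1 ^ (p.2 + 2) = I then normWeight 1 I else 0

theorem primeWeight_le_logWeight (σ : ℝ) (I : Ideal (𝓞 K)) :
    primeWeight σ I ≤ logWeight σ I := by
  unfold primeWeight
  split_ifs with h
  · have h1 := LambdaK_prime_pow h.1 h.2 le_rfl
    rw [pow_one] at h1
    have h2 : (1 : ℝ) < absNorm I := by exact_mod_cast one_lt_absNorm_of_isPrime h.1 h.2
    rw [logWeight, h1, div_self (Real.log_pos h2).ne', one_mul, normWeight]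
  · exact zero_le

theorem logWeight_le {σ : ℝ} (hσ : 1 ≤ σ) (I : Ideal (𝓞 K)) :
    logWeight σ I ≤ primeWeight σ I + properPowerWeight I := by
  by_cases hI : IsPrimeIdealPower I
  · obtain ⟨p, m, hp, hp0, hm, rfl⟩ := hI
    have h2 : (1 : ℝ) < absNorm p := by exact_mod_cast one_lt_absNorm_of_isPrime hp hp0
    have h3 : logWeight σ (p ^ m) ≤ normWeight σ (p ^ m) := by
      refine ENNReal.ofReal_le_ofReal ?_
      rw [LambdaK_prime_pow hp hp0 hm]
      refine mul_le_of_le_one_left (Real.rpow_nonneg (Nat.cast_nonneg _) _) ?_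
      refine div_le_one_of_le₀ ?_ (Real.log_natCast_nonneg _)
      refine Real.log_le_log (by linarith) ?_
      rw [map_pow, Nat.cast_pow]
      exact le_self_pow₀ h2.le (by omega)
    rcases Nat.lt_or_ge m 2 with h | h
    · have : m = 1 := by omega
      subst this
      rw [pow_one] at h3 ⊢
      refine h3.trans (le_add_right ?_)
      rw [primeWeight, if_pos ⟨hp, hp0⟩]
    · refine h3.trans (le_add_left ?_)
      rw [properPowerWeight, if_pos ⟨(p, m - 2), ⟨hp, hp0⟩, by rw [Nat.sub_add_cancel h]⟩]
      exact normWeight_anti hσ (pow_ne_zero m hp0)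
  · rw [logWeight, LambdaK, if_neg hI]
    simp

theorem normWeight_one_pow_le {p : Ideal (𝓞 K)} (hp : p.IsPrime) (hp0 : p ≠ ⊥) (m : ℕ) :
    normWeight 1 (p ^ (m + 2)) ≤ normWeight 2 p * (2⁻¹ : ℝ≥0∞) ^ m := by
  have h2 : (2 : ℝ) ≤ absNorm p := by exact_mod_cast one_lt_absNorm_of_isPrime hp hp0
  have h3 : (2⁻¹ : ℝ≥0∞) ^ m = ENNReal.ofReal ((2⁻¹ : ℝ) ^ m) := by
    rw [ENNReal.ofReal_pow (by norm_num), ENNReal.ofReal_inv_of_pos (by norm_num)]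
    norm_num
  rw [h3, normWeight, normWeight, ← ENNReal.ofReal_mul (Real.rpow_nonneg (Nat.cast_nonneg _) _)]
  refine ENNReal.ofReal_le_ofReal ?_
  rw [Real.rpow_neg_one, map_pow, Nat.cast_pow, Real.rpow_neg (Nat.cast_nonneg _), pow_add,
    mul_inv, mul_comm, inv_pow]
  have h4 : ((absNorm p : ℝ) ^ (2 : ℝ)) = (absNorm p : ℝ) ^ 2 := Real.rpow_two _
  rw [h4]
  gcongr

theorem tsum_properPowerWeight_ne_top : ∑' I : Ideal (𝓞 K), properPowerWeight I ≠ ∞ := by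
  have h1 : ∀ I : Ideal (𝓞 K), properPowerWeight I ≤ ∑' p : Ideal (𝓞 K) × ℕ,
      if p.1 ^ (p.2 + 2) = I then (if p.1.IsPrime ∧ p.1 ≠ ⊥ then normWeight 1 I else 0) else 0 := by
    intro I
    unfold properPowerWeight
    split_ifs with h
    · obtain ⟨p, hp, h⟩ := h
      refine le_trans ?_ (ENNReal.le_tsum p)
      rw [if_pos h, if_pos hp]
    · exact zero_le
  refine ne_top_of_le_ne_top ?_ (ENNReal.tsum_le_tsum h1)
  rw [ENNReal.tsum_comm]
  have h2 : ∀ p : Ideal (𝓞 K) × ℕ, (∑' I : Ideal (𝓞 K),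
      if p.1 ^ (p.2 + 2) = I then (if p.1.IsPrime ∧ p.1 ≠ ⊥ then normWeight 1 I else 0) else 0) ≤
      normWeight 2 p.1 * (2⁻¹ : ℝ≥0∞) ^ p.2 := by
    intro p
    rw [tsum_eq_single (p.1 ^ (p.2 + 2)) (fun I hI => if_neg hI.symm), if_pos rfl]
    split_ifs with h
    · exact normWeight_one_pow_le h.1 h.2 p.2
    · exact zero_le
  refine ne_top_of_le_ne_top ?_ (ENNReal.tsum_le_tsum h2)
  rw [ENNReal.tsum_prod']
  simp_rw [ENNReal.tsum_mul_left, ENNReal.tsum_mul_right, ENNReal.tsum_geometric]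
  refine ENNReal.mul_ne_top tsum_normWeight_two_ne_top ?_
  simp

end PrimeSums

section CyclotomicSums
open scoped ENNReal Pointwise
variable {K L : Type*} [Field K] [NumberField K] [Field L] [NumberField L] [Algebra K L]
  [IsGalois K L]

theorem tsum_isPrime_under_eq_le (P : Ideal (𝓞 K)) (a : ℝ≥0∞) :
    (∑' Q : Ideal (𝓞 L), if (Q.IsPrime ∧ Q ≠ ⊥) ∧ Q.under (𝓞 K) = P then a else 0) ≤
      Nat.card Gal(L/K) * a := by
  by_cases h : ∃ Q : Ideal (𝓞 L), Q.IsPrime ∧ Q.under (𝓞 K) = P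
  · obtain ⟨Q₀, hQ₀, rfl⟩ := h
    have h1 : ∀ Q : Ideal (𝓞 L), (if (Q.IsPrime ∧ Q ≠ ⊥) ∧ Q.under (𝓞 K) = Q₀.under (𝓞 K) then a
        else 0) ≤ ∑ σ : Gal(L/K), if Q = σ • Q₀ then a else 0 := by
      intro Q
      split_ifs with h
      · have := h.1.1
        obtain ⟨σ, hσ⟩ := Algebra.IsInvariant.exists_smul_of_under_eq (𝓞 K) (𝓞 L) Gal(L/K)
          Q₀ Q h.2.symm
        refine le_trans ?_ (Finset.single_le_sum (f := fun σ : Gal(L/K) => if Q = σ • Q₀ then a else 0)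
          (fun _ _ => zero_le) (Finset.mem_univ σ))
        simp only [hσ, if_true, le_refl]
      · exact zero_le
    refine (ENNReal.tsum_le_tsum h1).trans ?_
    rw [Summable.tsum_finsetSum (fun _ _ => ENNReal.summable)]
    simp [tsum_ite_eq]
  · refine le_of_eq_of_le ?_ zero_le
    rw [ENNReal.tsum_eq_zero]
    exact fun Q => if_neg fun hQ => h ⟨Q, hQ.1.1, hQ.2⟩

theorem tsum_eq_tsum_under (f : Ideal (𝓞 L) → ℝ≥0∞) :
    (∑' Q : Ideal (𝓞 L), if Q.IsPrime ∧ Q ≠ ⊥ then f Q else 0) =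
      ∑' P : Ideal (𝓞 K), ∑' Q : Ideal (𝓞 L),
        if (Q.IsPrime ∧ Q ≠ ⊥) ∧ Q.under (𝓞 K) = P then f Q else 0 := by
  rw [ENNReal.tsum_comm]
  refine tsum_congr fun Q => ?_
  rw [tsum_eq_single (Q.under (𝓞 K)) fun P hP => if_neg fun h => hP h.2.symm]
  simp

variable {q : ℕ} [NeZero q] {ζ : L}

theorem primeWeight_le (hζ : IsPrimitiveRoot ζ q) {σ : ℝ} (hσ : 1 ≤ σ) (Q : Ideal (𝓞 L)) :
    primeWeight σ Q ≤ ((absNorm (span {(q : 𝓞 L)}) ^ 2 : ℕ) : ℝ≥0∞) * normWeight 2 Q +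
      if Q.IsPrime ∧ Q ≠ ⊥ then ((if (absNorm (Q.under (𝓞 K)) : ZMod q) = 1 then
        primeWeight σ (Q.under (𝓞 K)) else 0) + normWeight 2 (Q.under (𝓞 K))) else 0 := by
  by_cases hQ : Q.IsPrime ∧ Q ≠ ⊥
  · rw [primeWeight, if_pos hQ, if_pos hQ]
    have hN : (1 : ℝ) < absNorm Q := by exact_mod_cast one_lt_absNorm_of_isPrime hQ.1 hQ.2
    by_cases hq : (q : 𝓞 L) ∈ Q
    · refine le_add_right ?_
      rw [normWeight, normWeight, ← ENNReal.ofReal_natCast, ← ENNReal.ofReal_mul (Nat.cast_nonneg _)]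
      refine ENNReal.ofReal_le_ofReal ?_
      have h1 : absNorm Q ≤ absNorm (span {(q : 𝓞 L)}) := by
        refine Nat.le_of_dvd (Nat.pos_of_ne_zero ?_) (absNorm_dvd_absNorm_of_le ?_)
        · rw [Ne, Ideal.absNorm_eq_zero_iff, Ideal.span_singleton_eq_bot]
          exact_mod_cast NeZero.ne q
        · rwa [Ideal.span_singleton_le_iff_mem]
      have h2 : (absNorm Q : ℝ) ^ (-σ) ≤ 1 :=
        Real.rpow_le_one_of_one_le_of_nonpos hN.le (by linarith)
      refine h2.trans ?_
      have h4 : ((absNorm Q : ℝ) ^ (2 : ℝ)) = (absNorm Q : ℝ) ^ 2 := Real.rpow_two _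
      rw [Real.rpow_neg (Nat.cast_nonneg _), h4, ← div_eq_mul_inv, Nat.cast_pow,
        one_le_div (by positivity)]
      gcongr
    · refine le_add_left ?_
      have hP0 := under_ne_bot (K := K) hQ.2
      have := hQ.1
      rcases absNorm_eq_or_sq_le (K := K) hQ.1 hQ.2 with h | h
      · refine le_add_right ?_
        rw [if_pos (absNorm_eq_one_of_eq hζ hQ.1 hQ.2 hq h), primeWeight, if_pos ⟨inferInstance, hP0⟩,
          normWeight, normWeight, h]
      · refine le_add_left ((normWeight_anti hσ hQ.2).trans (ENNReal.ofReal_le_ofReal ?_))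
        have h3 : (0 : ℝ) < absNorm (Q.under (𝓞 K)) := by
          exact_mod_cast (one_lt_absNorm_of_isPrime inferInstance hP0).le
        have h4 : ((absNorm (Q.under (𝓞 K)) : ℝ) ^ (2 : ℝ)) = (absNorm (Q.under (𝓞 K)) : ℝ) ^ 2 := Real.rpow_two _
        rw [Real.rpow_neg (Nat.cast_nonneg _) 2, h4, Real.rpow_neg_one]
        gcongr
        exact_mod_cast h
  · rw [primeWeight, if_neg hQ]
    exact zero_le

theorem natCast_notMem_of_absNorm_eq_one {P : Ideal (𝓞 K)} (hP : P.IsPrime)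
    (h : (absNorm P : ZMod q) = 1) : (q : 𝓞 K) ∉ P := by
  intro hq
  have h1 : ((absNorm P - 1 : ℤ) : ZMod q) = 0 := by
    push_cast
    rw [h, sub_self]
  rw [ZMod.intCast_zmod_eq_zero_iff_dvd] at h1
  obtain ⟨k, hk⟩ := h1
  have h2 : (absNorm P : 𝓞 K) - 1 = q * k := by exact_mod_cast congrArg (fun z : ℤ => (z : 𝓞 K)) hk
  have h3 : (1 : 𝓞 K) ∈ P := by
    have h4 : (1 : 𝓞 K) = absNorm P - q * k := by rw [← h2]; ring
    rw [h4]
    exact sub_mem (Ideal.absNorm_mem P) (P.mul_mem_right _ hq)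
  exact hP.ne_top ((Ideal.eq_top_iff_one P).mpr h3)

variable [IsCyclotomicExtension {q} K L]

theorem card_mul_primeWeight_le (hζ : IsPrimitiveRoot ζ q) (σ : ℝ) {P : Ideal (𝓞 K)}
    (h : (absNorm P : ZMod q) = 1) :
    Nat.card Gal(L/K) * primeWeight σ P ≤
      ∑' Q : Ideal (𝓞 L), if (Q.IsPrime ∧ Q ≠ ⊥) ∧ Q.under (𝓞 K) = P then normWeight σ Q else 0 := by
  by_cases hP : P.IsPrime ∧ P ≠ ⊥
  · have := hP.1
    obtain ⟨Q₀, hQ₀, hQP⟩ := Ideal.exists_ideal_over_prime_of_isIntegral_of_isDomain (S := 𝓞 L) P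
      (by rw [(RingHom.injective_iff_ker_eq_bot _).mp
            (FaithfulSMul.algebraMap_injective (𝓞 K) (𝓞 L))]; exact bot_le)
    replace hQP : Q₀.under (𝓞 K) = P := hQP
    have hQ0 : Q₀ ≠ ⊥ := by
      rintro rfl
      exact hP.2 (hQP ▸ Ideal.under_bot (𝓞 K) (𝓞 L))
    have hq : (q : 𝓞 L) ∉ Q₀ := by
      intro hq
      refine natCast_notMem_of_absNorm_eq_one hP.1 h ?_
      rw [← hQP, Ideal.mem_under]
      simpa using hq
    subst hQP
    have hinj := smul_injective_of_eq_one hζ hQ₀ hQ0 hq h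
    have hN := absNorm_eq_of_eq_one hζ hQ₀ hQ0 hq h
    refine le_trans ?_ (ENNReal.tsum_comp_le_tsum_of_injective hinj _)
    rw [tsum_fintype]
    refine le_of_eq ?_
    rw [Nat.card_eq_fintype_card, ← nsmul_eq_mul, Fintype.card]
    refine (Finset.sum_eq_card_nsmul fun τ _ => ?_).symm
    have h1 : (τ • Q₀).IsPrime := inferInstance
    have h2 : τ • Q₀ ≠ ⊥ := by
      intro h2
      have := absNorm_smul τ Q₀
      rw [h2, Ideal.absNorm_bot, eq_comm, Ideal.absNorm_eq_zero_iff] at this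
      exact hQ0 this
    rw [if_pos ⟨⟨h1, h2⟩, under_smul τ Q₀⟩, primeWeight, if_pos hP, normWeight, normWeight,
      absNorm_smul, hN]
  · rw [primeWeight, if_neg hP, mul_zero]
    exact zero_le

theorem tsum_logWeight_le_of_cyclotomic (hζ : IsPrimitiveRoot ζ q) :
    ∃ D : ℝ≥0∞, D ≠ ∞ ∧ ∀ σ : ℝ, 1 ≤ σ → ∑' Q : Ideal (𝓞 L), logWeight σ Q ≤ Nat.card Gal(L/K) *
      (∑' P : Ideal (𝓞 K), if (absNorm P : ZMod q) = 1 then logWeight σ P else 0) + D := by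
  refine ⟨((absNorm (span {(q : 𝓞 L)}) ^ 2 : ℕ) : ℝ≥0∞) * ∑' Q : Ideal (𝓞 L), normWeight 2 Q +
    Nat.card Gal(L/K) * (∑' P : Ideal (𝓞 K), normWeight 2 P) +
    ∑' Q : Ideal (𝓞 L), properPowerWeight Q, ?_, fun σ hσ => ?_⟩
  · exact ENNReal.add_ne_top.mpr ⟨ENNReal.add_ne_top.mpr
      ⟨ENNReal.mul_ne_top (ENNReal.natCast_ne_top _) tsum_normWeight_two_ne_top,
        ENNReal.mul_ne_top (ENNReal.natCast_ne_top _) tsum_normWeight_two_ne_top⟩,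
      tsum_properPowerWeight_ne_top⟩
  · refine (ENNReal.tsum_le_tsum fun Q => logWeight_le hσ Q).trans ?_
    rw [ENNReal.tsum_add, ← add_assoc, ← add_assoc]
    refine add_le_add ?_ le_rfl
    refine (ENNReal.tsum_le_tsum fun Q => primeWeight_le (K := K) hζ hσ Q).trans ?_
    rw [ENNReal.tsum_add, ENNReal.tsum_mul_left, tsum_eq_tsum_under (K := K) (fun Q : Ideal (𝓞 L) =>
      (if (absNorm (Q.under (𝓞 K)) : ZMod q) = 1 then
        primeWeight σ (Q.under (𝓞 K)) else 0) + normWeight 2 (Q.under (𝓞 K)))]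
    have h1 : ∀ P : Ideal (𝓞 K), (∑' Q : Ideal (𝓞 L), if (Q.IsPrime ∧ Q ≠ ⊥) ∧ Q.under (𝓞 K) = P then
        (if (absNorm (Q.under (𝓞 K)) : ZMod q) = 1 then
        primeWeight σ (Q.under (𝓞 K)) else 0) + normWeight 2 (Q.under (𝓞 K)) else 0) ≤
        Nat.card Gal(L/K) * ((if (absNorm P : ZMod q) = 1 then logWeight σ P else 0) +
          normWeight 2 P) := by
      intro P
      refine le_trans (ENNReal.tsum_le_tsum fun Q => ?_) (tsum_isPrime_under_eq_le (L := L) P _)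
      by_cases h : (Q.IsPrime ∧ Q ≠ ⊥) ∧ Q.under (𝓞 K) = P
      · rw [if_pos h, if_pos h, h.2]
        refine add_le_add ?_ le_rfl
        split_ifs
        · exact primeWeight_le_logWeight σ P
        · exact le_rfl
      · rw [if_neg h, if_neg h]
    have h2 := ENNReal.tsum_le_tsum h1
    rw [ENNReal.tsum_mul_left, ENNReal.tsum_add, mul_add] at h2
    refine (add_le_add le_rfl h2).trans (le_of_eq ?_)
    ring

theorem card_mul_tsum_logWeight_le (hζ : IsPrimitiveRoot ζ q) :
    ∃ D : ℝ≥0∞, D ≠ ∞ ∧ ∀ σ : ℝ, 1 ≤ σ → Nat.card Gal(L/K) *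
      (∑' P : Ideal (𝓞 K), if (absNorm P : ZMod q) = 1 then logWeight σ P else 0) ≤
        ∑' Q : Ideal (𝓞 L), logWeight σ Q + D := by
  refine ⟨Nat.card Gal(L/K) * ∑' P : Ideal (𝓞 K), properPowerWeight P,
    ENNReal.mul_ne_top (ENNReal.natCast_ne_top _) tsum_properPowerWeight_ne_top, fun σ hσ => ?_⟩
  have h1 : ∀ P : Ideal (𝓞 K), Nat.card Gal(L/K) *
      (if (absNorm P : ZMod q) = 1 then logWeight σ P else 0) ≤
      (∑' Q : Ideal (𝓞 L), if (Q.IsPrime ∧ Q ≠ ⊥) ∧ Q.under (𝓞 K) = P then normWeight σ Q else 0) +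
      Nat.card Gal(L/K) * properPowerWeight P := by
    intro P
    split_ifs with h
    · refine (mul_le_mul_right (logWeight_le hσ P) _).trans ?_
      rw [mul_add]
      exact add_le_add (card_mul_primeWeight_le hζ σ h) le_rfl
    · rw [mul_zero]
      exact zero_le
  have h2 := ENNReal.tsum_le_tsum h1
  rw [ENNReal.tsum_mul_left, ENNReal.tsum_add, ← tsum_eq_tsum_under, ENNReal.tsum_mul_left] at h2
  exact h2.trans (add_le_add (ENNReal.tsum_le_tsum fun Q => primeWeight_le_logWeight σ Q) le_rfl)

theorem exists_card_mul_logSumOne_bounds (hζ : IsPrimitiveRoot ζ q) :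
    ∃ D : ℝ, ∀ᶠ σ : ℝ in nhdsWithin 1 (Set.Ioi 1),
      poleLog σ - D ≤ Nat.card Gal(L/K) * logSumOne (mangoldtCoeff K) q σ ∧
      Nat.card Gal(L/K) * logSumOne (mangoldtCoeff K) q σ ≤ poleLog σ + D := by
  obtain ⟨_, _, _, hbK, -⟩ := exists_twistBase_idealCount K
  obtain ⟨_, _, _, hbL, -⟩ := exists_twistBase_idealCount L
  obtain ⟨C, hC⟩ := hbL.exists_logSum_bounds (isMangoldt_mangoldtCoeff L)
  obtain ⟨D₁, hD₁, h₁⟩ := tsum_logWeight_le_of_cyclotomic (K := K) hζ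
  obtain ⟨D₂, hD₂, h₂⟩ := card_mul_tsum_logWeight_le (K := K) hζ
  refine ⟨C + D₁.toReal + D₂.toReal, ?_⟩
  filter_upwards [hC, self_mem_nhdsWithin] with σ hσ h1σ
  replace h1σ : 1 < σ := h1σ
  have hL : ∑' Q : Ideal (𝓞 L), logWeight σ Q =
      ENNReal.ofReal (logSum (mangoldtCoeff L) (1 : ℕ →* ℂ) σ) := by
    have := tsum_logWeight hbL h1σ fun _ => True
    simpa [logSum] using this
  have hK := tsum_logWeight hbK h1σ fun n => (n : ZMod q) = 1
  have hL0 : 0 ≤ logSum (mangoldtCoeff L) (1 : ℕ →* ℂ) σ := by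
    refine tsum_nonneg fun n => ?_
    simpa using (isMangoldt_mangoldtCoeff L).logTerm_nonneg n σ
  have hK0 : 0 ≤ logSumOne (mangoldtCoeff K) q σ :=
    tsum_nonneg fun n => mul_nonneg ((isMangoldt_mangoldtCoeff K).logTerm_nonneg n σ)
      (by split_ifs <;> norm_num)
  have e₁ := h₁ σ h1σ.le
  have e₂ := h₂ σ h1σ.le
  replace hK : (∑' P : Ideal (𝓞 K), if (absNorm P : ZMod q) = 1 then logWeight σ P else 0) =
    ENNReal.ofReal (logSumOne (mangoldtCoeff K) q σ) := by
    rw [logSumOne]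
    convert hK
  rw [hL, hK, ← ENNReal.ofReal_natCast, ← ENNReal.ofReal_mul (Nat.cast_nonneg _)] at e₁ e₂
  rw [← ENNReal.ofReal_toReal hD₁, ← ENNReal.ofReal_add (by positivity) ENNReal.toReal_nonneg,
    ENNReal.ofReal_le_ofReal_iff (by positivity)] at e₁
  rw [← ENNReal.ofReal_toReal hD₂, ← ENNReal.ofReal_add hL0 ENNReal.toReal_nonneg,
    ENNReal.ofReal_le_ofReal_iff (by positivity)] at e₂
  have := ENNReal.toReal_nonneg (a := D₁)
  have := ENNReal.toReal_nonneg (a := D₂)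
  constructor <;> linarith [hσ.1, hσ.2]

end CyclotomicSums

/-! ### The characters with a pole -/

section PoleCharacters
variable {K : Type*} [Field K] [NumberField K] {q : ℕ} [NeZero q]

theorem Gq_eq_range : Gq K q =
    ((IsCyclotomicExtension.zeta_spec q K (CyclotomicField q K)).autToPow K).range := by
  unfold Gq
  rw [dif_pos (NeZero.pos q)]

theorem isGalois_cyclotomicField : IsGalois K (CyclotomicField q K) :=
  IsCyclotomicExtension.isGalois {q} K (CyclotomicField q K)

theorem natCard_Gq : Nat.card (Gq K q) = Nat.card Gal(CyclotomicField q K/K) := by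
  rw [Gq_eq_range]
  exact Nat.card_congr (MonoidHom.ofInjective
    ((IsCyclotomicExtension.zeta_spec q K (CyclotomicField q K)).autToPow_injective K)).symm.toEquiv

theorem totient_le_natCard_Gq_mul : q.totient ≤ Nat.card (Gq K q) * Module.finrank ℚ K := by
  have := isGalois_cyclotomicField (K := K) (q := q)
  have hζ := IsCyclotomicExtension.zeta_spec q K (CyclotomicField q K)
  rw [natCard_Gq, IsGalois.card_aut_eq_finrank, mul_comm,
    Module.finrank_mul_finrank ℚ K (CyclotomicField q K), ← Polynomial.natDegree_cyclotomic q ℚ,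
    Polynomial.cyclotomic_eq_minpoly_rat hζ (NeZero.pos q)]
  exact minpoly.natDegree_le _

theorem natCast_notMem_of_coprime {P : Ideal (𝓞 K)} (hP : P.IsPrime)
    (h : (absNorm P).Coprime q) : (q : 𝓞 K) ∉ P := by
  intro hq
  obtain ⟨a, b, hab⟩ := Nat.isCoprime_iff_coprime.mpr h
  have h1 : (a : 𝓞 K) * (absNorm P : 𝓞 K) + b * (q : 𝓞 K) = 1 := by
    exact_mod_cast congrArg (fun z : ℤ => (z : 𝓞 K)) hab
  refine hP.ne_top ((Ideal.eq_top_iff_one P).mpr ?_)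
  rw [← h1]
  exact add_mem (P.mul_mem_left _ (Ideal.absNorm_mem P)) (P.mul_mem_left _ hq)

/-- The norm of a prime ideal coprime to `q` is the image of a Frobenius element. -/
theorem exists_mem_Gq {P : Ideal (𝓞 K)} (hP : P.IsPrime) (hP0 : P ≠ ⊥)
    (h : (absNorm P).Coprime q) : ∃ a ∈ Gq K q, ((a : (ZMod q)ˣ) : ZMod q) = absNorm P := by
  have := isGalois_cyclotomicField (K := K) (q := q)
  have hζ := IsCyclotomicExtension.zeta_spec q K (CyclotomicField q K)
  obtain ⟨Q, hQ, hQP⟩ := Ideal.exists_ideal_over_prime_of_isIntegral_of_isDomain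
    (S := 𝓞 (CyclotomicField q K)) P
    (by rw [(RingHom.injective_iff_ker_eq_bot _).mp
          (FaithfulSMul.algebraMap_injective (𝓞 K) (𝓞 (CyclotomicField q K)))]; exact bot_le)
  replace hQP : Q.under (𝓞 K) = P := hQP
  have hQ0 : Q ≠ ⊥ := by
    rintro rfl
    exact hP0 (hQP ▸ Ideal.under_bot (𝓞 K) (𝓞 (CyclotomicField q K)))
  have hq : (q : 𝓞 (CyclotomicField q K)) ∉ Q := by
    intro hq
    refine natCast_notMem_of_coprime hP h ?_
    rw [← hQP, Ideal.mem_under]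
    simpa using hq
  obtain ⟨σ, -, hσ⟩ := exists_isArithFrobAt (K := K) hζ hQ hQ0 hq
  refine ⟨hζ.autToPow K σ, ?_, by rw [hσ, hQP]⟩
  rw [Gq_eq_range]
  exact ⟨σ, rfl⟩

theorem apply_absNorm_eq_one {χ : DirichletCharacter ℂ q} (hχ : ∀ a ∈ Gq K q, χ (a : ZMod q) = 1)
    (I : Ideal (𝓞 K)) (h : (absNorm I).Coprime q) : χ (absNorm I : ZMod q) = 1 := by
  induction I using UniqueFactorizationMonoid.induction_on_prime with
  | h₁ =>
    have h1 : absNorm (0 : Ideal (𝓞 K)) = 0 := Ideal.absNorm_bot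
    rw [h1, Nat.coprime_zero_left] at h
    subst h
    rw [DirichletCharacter.level_one χ]
    exact MulChar.one_apply (isUnit_of_subsingleton _)
  | h₂ I hI =>
    rw [Ideal.isUnit_iff.mp hI, Ideal.absNorm_top, Nat.cast_one, map_one]
  | h₃ I P hI hP ih =>
    rw [map_mul] at h ⊢
    rw [Nat.cast_mul, map_mul, ih h.coprime_mul_left, mul_one]
    obtain ⟨a, ha, ha'⟩ := exists_mem_Gq (Ideal.isPrime_of_prime hP) hP.ne_zero
      h.coprime_mul_right
    rw [← ha', hχ a ha]

theorem apply_eq_one_of_idealCount {χ : DirichletCharacter ℂ q}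
    (hχ : ∀ a ∈ Gq K q, χ (a : ZMod q) = 1) {n : ℕ} (hn : n.Coprime q) (h : idealCount K n ≠ 0) :
    χ (n : ZMod q) = 1 := by
  rw [idealCount_eq_card, Nat.cast_ne_zero, Finset.card_ne_zero] at h
  obtain ⟨I, hI⟩ := h
  rw [mem_idealsOfNorm] at hI
  subst hI
  exact apply_absNorm_eq_one hχ I hn

theorem idealCount_ne_zero_of_mangoldtCoeff {n : ℕ} (h : mangoldtCoeff K n ≠ 0) :
    idealCount K n ≠ 0 := by
  rw [idealCount_eq_card, Nat.cast_ne_zero, Finset.card_ne_zero]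
  by_contra h1
  rw [Finset.not_nonempty_iff_eq_empty] at h1
  exact h (by rw [mangoldtCoeff, h1, Finset.sum_empty])

theorem card_trivial_mul_natCard (G : Subgroup (ZMod q)ˣ) :
    (Finset.univ.filter fun χ : DirichletCharacter ℂ q =>
      ∀ a ∈ G, χ (a : ZMod q) = 1).card * Nat.card G = q.totient := by
  have h1 : ∀ χ : DirichletCharacter ℂ q, ∑ a : G, χ ((a : (ZMod q)ˣ) : ZMod q) =
      if ∀ a ∈ G, χ (a : ZMod q) = 1 then (Nat.card G : ℂ) else 0 := by
    intro χ
    have h2 := sum_hom_units ((χ.toMonoidHom.comp (Units.coeHom (ZMod q))).comp G.subtype)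
    have h3 : (χ.toMonoidHom.comp (Units.coeHom (ZMod q))).comp G.subtype = 1 ↔
        ∀ a ∈ G, χ (a : ZMod q) = 1 := by
      rw [MonoidHom.ext_iff]
      simp
    rw [Nat.card_eq_fintype_card]
    simp only [h3] at h2
    push_cast at h2
    exact h2
  have h2 : ∑ χ : DirichletCharacter ℂ q, ∑ a : G, χ ((a : (ZMod q)ˣ) : ZMod q) = q.totient := by
    rw [Finset.sum_comm]
    simp_rw [DirichletCharacter.sum_characters_eq ℂ]
    rw [Finset.sum_eq_single (1 : G)]
    · simp
    · intro a _ ha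
      rw [if_neg]
      intro h
      exact ha (Subtype.ext (Units.ext h))
    · simp
  simp_rw [h1] at h2
  rw [← Finset.sum_filter, Finset.sum_const, nsmul_eq_mul] at h2
  exact_mod_cast h2

section
variable {c : DirichletCharacter ℂ q → ℂ} {δ B : ℝ}

theorem pole_of_mangoldtCoeff_eq_one
    (h : ∀ χ : DirichletCharacter ℂ q, IsTwist (idealCount K) δ (charHom χ) (c χ) B)
    {κ A : ℝ} (hb : TwistBase (idealCount K) κ δ A) (χ : DirichletCharacter ℂ q)
    (hχ : ∀ n : ℕ, n.Coprime q → idealCount K n ≠ 0 → χ (n : ZMod q) = 1) : c χ ≠ 0 := by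
  have := isGalois_cyclotomicField (K := K) (q := q)
  have hζ := IsCyclotomicExtension.zeta_spec q K (CyclotomicField q K)
  obtain ⟨D, hD⟩ := exists_card_mul_logSumOne_bounds (K := K) hζ
  exact pole_of_eq_one (isMangoldt_mangoldtCoeff K) hb h (hD.mono fun _ h => h.1) χ
    fun n hn hbn => hχ n hn (idealCount_ne_zero_of_mangoldtCoeff hbn)

theorem twRem_idealCount_ne_zero
    (h : ∀ χ : DirichletCharacter ℂ q, IsTwist (idealCount K) δ (charHom χ) (c χ) B)
    {κ A : ℝ} (hb : TwistBase (idealCount K) κ δ A) (χ : DirichletCharacter ℂ q)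
    (hχ : c χ = 0) : twRem (idealCount K) (charHom χ) 0 1 ≠ 0 := by
  have := isGalois_cyclotomicField (K := K) (q := q)
  have hζ := IsCyclotomicExtension.zeta_spec q K (CyclotomicField q K)
  obtain ⟨D, hD⟩ := exists_card_mul_logSumOne_bounds (K := K) hζ
  exact twRem_one_ne_zero (isMangoldt_mangoldtCoeff K) hb h (hD.mono fun _ h => h.1) χ hχ

theorem card_pole_mul_natCard_Gq_le
    (h : ∀ χ : DirichletCharacter ℂ q, IsTwist (idealCount K) δ (charHom χ) (c χ) B)
    {κ A : ℝ} (hb : TwistBase (idealCount K) κ δ A) :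
    (Finset.univ.filter fun χ : DirichletCharacter ℂ q => c χ ≠ 0).card * Nat.card (Gq K q) ≤
      q.totient := by
  have := isGalois_cyclotomicField (K := K) (q := q)
  have hζ := IsCyclotomicExtension.zeta_spec q K (CyclotomicField q K)
  obtain ⟨D, hD⟩ := exists_card_mul_logSumOne_bounds (K := K) hζ
  rw [natCard_Gq]
  exact card_pole_mul_le (isMangoldt_mangoldtCoeff K) hb h hD

theorem pole_iff_trivial
    (h : ∀ χ : DirichletCharacter ℂ q, IsTwist (idealCount K) δ (charHom χ) (c χ) B)
    {κ A : ℝ} (hb : TwistBase (idealCount K) κ δ A) (χ : DirichletCharacter ℂ q) :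
    c χ ≠ 0 ↔ ∀ a ∈ Gq K q, χ (a : ZMod q) = 1 := by
  have h1 := card_pole_mul_natCard_Gq_le h hb
  rw [← card_trivial_mul_natCard (Gq K q)] at h1
  have h2 := Nat.le_of_mul_le_mul_right h1 Nat.card_pos
  have h3 := Finset.eq_of_subset_of_card_le (fun χ hχ => by
    rw [Finset.mem_filter] at hχ ⊢
    exact ⟨Finset.mem_univ _, pole_of_mangoldtCoeff_eq_one h hb χ
      fun n hn hr => apply_eq_one_of_idealCount hχ.2 hn hr⟩) h2
  have h4 := Finset.ext_iff.mp h3 χ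
  simpa using h4.symm

theorem card_pole_le
    (h : ∀ χ : DirichletCharacter ℂ q, IsTwist (idealCount K) δ (charHom χ) (c χ) B)
    {κ A : ℝ} (hb : TwistBase (idealCount K) κ δ A) :
    (Finset.univ.filter fun χ : DirichletCharacter ℂ q => c χ ≠ 0).card ≤ Module.finrank ℚ K := by
  have h1 := (card_pole_mul_natCard_Gq_le h hb).trans (totient_le_natCard_Gq_mul (K := K))
  rw [mul_comm] at h1
  exact Nat.le_of_mul_le_mul_left h1 Nat.card_pos

end

/-- A primitive character is determined by any character it induces. -/
theorem sigma_eq_of_changeLevel_eq {p p' : Σ q : ℕ, DirichletCharacter ℂ q} {N : ℕ} [NeZero N]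
    (hp : p.2.IsPrimitive) (hp' : p'.2.IsPrimitive) (hd : p.1 ∣ N) (hd' : p'.1 ∣ N)
    (h : DirichletCharacter.changeLevel hd p.2 = DirichletCharacter.changeLevel hd' p'.2) :
    p = p' := by
  have h1 := congrArg DirichletCharacter.conductor h
  rw [DirichletCharacter.conductor_changeLevel, DirichletCharacter.conductor_changeLevel, hp, hp'] at h1
  obtain ⟨q, χ⟩ := p
  obtain ⟨q', χ'⟩ := p'
  simp only at h1
  subst h1
  have h2 : χ = χ' := DirichletCharacter.changeLevel_injective hd h
  rw [h2]

end PoleCharacters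

section Family
variable (K : Type*) [Field K] [NumberField K]

/-- The analytic data of the characters `χ ∘ N` of a number field. -/
theorem exists_charFamily : ∃ (κ A : ℝ) (c : ∀ q : ℕ, DirichletCharacter ℂ q → ℂ),
    CharFamily (idealCount K) (mangoldtCoeff K) κ (1 / (Module.finrank ℚ K : ℝ)) A A
      (Module.finrank ℚ K) c ∧
    ∀ (q : ℕ) (χ : DirichletCharacter ℂ q), 1 ≤ q →
      (c q χ ≠ 0 ↔ ∀ a ∈ Gq K q, χ (a : ZMod q) = 1) := by
  obtain ⟨κ, A, c, hb, hc⟩ := exists_twistBase_idealCount K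
  have hpole : ∀ (q : ℕ) (χ : DirichletCharacter ℂ q), 1 ≤ q →
      (c q χ ≠ 0 ↔ ∀ a ∈ Gq K q, χ (a : ZMod q) = 1) := by
    intro q χ hq
    have : NeZero q := ⟨by omega⟩
    exact pole_iff_trivial (fun χ => hc q χ hq) hb χ
  have heq : ∀ (q : ℕ) (χ : DirichletCharacter ℂ q), 1 ≤ q → c q χ ≠ 0 →
      ∀ n : ℕ, n.Coprime q → idealCount K n ≠ 0 → χ (n : ZMod q) = 1 := by
    intro q χ hq h n hn hr
    have : NeZero q := ⟨by omega⟩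
    exact apply_eq_one_of_idealCount ((hpole q χ hq).mp h) hn hr
  refine ⟨κ, A, c, ⟨hb, isMangoldt_mangoldtCoeff K, hc, heq, ?_, ?_⟩, hpole⟩
  · intro q χ hq h
    have : NeZero q := ⟨by omega⟩
    exact twRem_idealCount_ne_zero (fun χ => hc q χ hq) hb χ h
  · intro q₁ χ₁ hq₁
    by_contra hinf
    obtain ⟨F, hF, hcard⟩ := Set.Infinite.exists_subset_card_eq hinf (Module.finrank ℚ K + 1)
    set N := q₁ * ∏ p ∈ F, p.1 with hN
    have hpos : ∀ p ∈ F, 1 ≤ p.1 := fun p hp => (hF hp).1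
    have hN1 : 1 ≤ N := Nat.mul_pos hq₁ (Finset.prod_pos hpos)
    have : NeZero N := ⟨by omega⟩
    have hdvd : ∀ p ∈ F, q₁ * p.1 ∣ N := fun p hp => mul_dvd_mul_left q₁ (Finset.dvd_prod_of_mem _ hp)
    have key := card_pole_le (fun χ => hc N χ hN1) hb
    set f : {p // p ∈ F} → DirichletCharacter ℂ N := fun p =>
      DirichletCharacter.changeLevel (hdvd p p.2)
        (DirichletCharacter.changeLevel (Nat.dvd_mul_right q₁ p.1.1) χ₁ *
        DirichletCharacter.changeLevel (Nat.dvd_mul_left p.1.1 q₁) p.1.2) with hf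
    have hinj : Function.Injective f := by
      intro p p' hpp
      simp only [hf, map_mul] at hpp
      rw [← DirichletCharacter.changeLevel_trans, ← DirichletCharacter.changeLevel_trans,
        ← DirichletCharacter.changeLevel_trans, ← DirichletCharacter.changeLevel_trans] at hpp
      exact Subtype.ext (sigma_eq_of_changeLevel_eq (hF p.2).2.1 (hF p'.2).2.1 _ _
        (mul_left_cancel hpp))
    have hmem : ∀ p, f p ∈ Finset.univ.filter fun χ : DirichletCharacter ℂ N => c N χ ≠ 0 := by
      intro p
      rw [Finset.mem_filter]
      refine ⟨Finset.mem_univ _, pole_of_mangoldtCoeff_eq_one (fun χ => hc N χ hN1) hb _ ?_⟩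
      intro n hn hr
      have hp := hF p.2
      have h1 : n.Coprime (q₁ * p.1.1) := Nat.Coprime.coprime_dvd_right (hdvd p p.2) hn
      have h2 := heq _ _ (Nat.mul_pos hq₁ hp.1) hp.2.2 n h1 hr
      have h3 := DirichletCharacter.changeLevel_eq_cast_of_dvd'
        (DirichletCharacter.changeLevel (Nat.dvd_mul_right q₁ p.1.1) χ₁ *
        DirichletCharacter.changeLevel (Nat.dvd_mul_left p.1.1 q₁) p.1.2) (hdvd p p.2) (a := n)
        (Nat.isCoprime_iff_coprime.mpr hn)
      rw [← h2]
      simpa only [Int.cast_natCast] using h3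
    have h4 := Finset.card_le_card_of_injOn f (s := Finset.univ) (fun p _ => hmem p) hinj.injOn
    rw [Finset.card_univ, Fintype.card_coe, hcard] at h4
    omega

end Family

/-! ### The bound for the twisted sums of the von Mangoldt function -/

section CoeffBound
variable {r b : ℕ → ℝ} {κ δ A₀ : ℝ}

theorem TwistBase.le_rpow (hb : TwistBase r κ δ A₀) {n : ℕ} (hn : 1 ≤ n) :
    r n ≤ (κ + 2 * A₀) * (n : ℝ) ^ (1 - δ) := by
  have hκ := hb.κ_pos
  have hA := hb.twist.one_le
  have hδ : 0 ≤ 1 - δ := by linarith [hb.δ_le]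
  have hn1 : (1 : ℝ) ≤ n := by exact_mod_cast hn
  have hp : 1 ≤ (n : ℝ) ^ (1 - δ) := Real.one_le_rpow hn1 hδ
  rcases Nat.lt_or_ge n 2 with h | h
  · have : n = 1 := by omega
    subst this
    rw [hb.map_one]
    nlinarith
  · obtain ⟨k, rfl⟩ : ∃ k, n = k + 1 := ⟨n - 1, by omega⟩
    have hk : 1 ≤ k := by omega
    have hk1 : (1 : ℝ) ≤ k := by exact_mod_cast hk
    have h1 := hb.twist.bound _ hn1
    have h2 := hb.twist.bound _ hk1
    have h3 : sumRem (fun n => (1 : ℕ →* ℂ) n * (r n : ℂ)) κ ((k + 1 : ℕ) : ℝ) -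
        sumRem (fun n => (1 : ℕ →* ℂ) n * (r n : ℂ)) κ (k : ℝ) = ((r (k + 1) - κ : ℝ) : ℂ) := by
      unfold sumRem
      rw [Nat.floor_natCast, Nat.floor_natCast, Finset.sum_Icc_succ_top (by omega)]
      push_cast
      rw [MonoidHom.one_apply]
      ring
    have h4 := norm_sub_le (sumRem (fun n => (1 : ℕ →* ℂ) n * (r n : ℂ)) κ ((k + 1 : ℕ) : ℝ))
      (sumRem (fun n => (1 : ℕ →* ℂ) n * (r n : ℂ)) κ (k : ℝ))
    rw [h3, Complex.norm_real] at h4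
    have h5 : (k : ℝ) ^ (1 - δ) ≤ ((k + 1 : ℕ) : ℝ) ^ (1 - δ) := by
      gcongr
      omega
    have h6 := (le_abs_self _).trans h4
    nlinarith [mul_le_mul_of_nonneg_left h5 (by linarith : (0 : ℝ) ≤ A₀)]

end CoeffBound

section Psi
variable {K : Type*} [Field K] [NumberField K]

theorem LambdaK_bot : LambdaK K ⊥ = 0 := by
  rw [LambdaK, if_neg]
  rintro ⟨p, m, -, hp, -, h⟩
  exact pow_ne_zero m hp h.symm

theorem psiKChi_eq {q : ℕ} (χ : DirichletCharacter ℂ q) (x : ℝ) (hx : 0 ≤ x) :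
    psiKChi K x χ = ∑ n ∈ Finset.Icc 1 ⌊x⌋₊, χ (n : ZMod q) * (mangoldtCoeff K n : ℂ) := by
  have h1 : ∀ n ∈ Finset.Icc 1 ⌊x⌋₊, χ (n : ZMod q) * (mangoldtCoeff K n : ℂ) =
      ∑ I ∈ idealsOfNorm K n,
        if (absNorm I : ℝ) ≤ x then χ (absNorm I : ZMod q) * (LambdaK K I : ℂ) else 0 := by
    intro n hn
    rw [mangoldtCoeff, Complex.ofReal_sum, Finset.mul_sum]
    refine Finset.sum_congr rfl fun I hI => ?_
    rw [mem_idealsOfNorm] at hI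
    rw [hI, if_pos ((Nat.le_floor_iff hx).mp (Finset.mem_Icc.mp hn).2)]
  rw [Finset.sum_congr rfl h1, ← Finset.sum_biUnion, psiKChi]
  · refine tsum_eq_sum fun I hI => ?_
    split_ifs with h
    · rcases eq_or_ne I ⊥ with rfl | hI0
      · rw [LambdaK_bot, Complex.ofReal_zero, mul_zero]
      · refine absurd (Finset.mem_biUnion.mpr ⟨absNorm I, Finset.mem_Icc.mpr
          ⟨Nat.pos_of_ne_zero ?_, Nat.le_floor h⟩, mem_idealsOfNorm.mpr rfl⟩) hI
        rwa [Ne, Ideal.absNorm_eq_zero_iff]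
    · rfl
  · intro n _ n' _ hne
    rw [Function.onFun, Finset.disjoint_left]
    intro I hI hI'
    rw [mem_idealsOfNorm] at hI hI'
    exact hne (hI.symm.trans hI')

theorem isPrimePow_of_mangoldtCoeff {n : ℕ} (h : mangoldtCoeff K n ≠ 0) : IsPrimePow n := by
  obtain ⟨I, hI, hΛ⟩ := Finset.exists_ne_zero_of_sum_ne_zero h
  rw [mem_idealsOfNorm] at hI
  subst hI
  have h1 : IsPrimeIdealPower I := by
    by_contra h1
    exact hΛ (by rw [LambdaK, if_neg h1])
  obtain ⟨p, m, hp, hp0, hm, rfl⟩ := h1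
  rw [map_pow]
  refine IsPrimePow.pow ?_ (by omega)
  have := finite_quotient_of_ne_bot hp0
  have := Fintype.ofFinite (𝓞 K ⧸ p)
  have hmax : p.IsMaximal := hp.isMaximal hp0
  let _ := Ideal.Quotient.field p
  rw [← card_quotient_eq_absNorm, Nat.card_eq_fintype_card]
  exact FiniteField.isPrimePow_card _

theorem card_isPrimePow_not_coprime_le {q N : ℕ} (hq : 1 ≤ q) :
    ((Finset.Icc 1 N).filter fun n => IsPrimePow n ∧ ¬ n.Coprime q).card ≤
      (q + 1) * (Nat.log 2 N + 1) := by
  have h1 : ((Finset.Icc 1 N).filter fun n => IsPrimePow n ∧ ¬ n.Coprime q) ⊆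
      ((Finset.range (q + 1)) ×ˢ (Finset.range (Nat.log 2 N + 1))).image fun p => p.1 ^ p.2 := by
    intro n hn
    rw [Finset.mem_filter, Finset.mem_Icc] at hn
    obtain ⟨⟨hn1, hnN⟩, hpp, hcop⟩ := hn
    obtain ⟨p, k, hp, hk, rfl⟩ := (isPrimePow_nat_iff n).mp hpp
    rw [Finset.mem_image]
    refine ⟨(p, k), ?_, rfl⟩
    rw [Finset.mem_product, Finset.mem_range, Finset.mem_range]
    constructor
    · have : p ∣ q := by
        by_contra h
        exact hcop (Nat.Coprime.pow_left k ((Nat.Prime.coprime_iff_not_dvd hp).mpr h))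
      exact Nat.lt_succ_of_le (Nat.le_of_dvd (by omega) this)
    · refine Nat.lt_succ_of_le (Nat.le_log_of_pow_le (by norm_num) ?_)
      exact (Nat.pow_le_pow_left hp.two_le k).trans hnN
  refine (Finset.card_le_card h1).trans (Finset.card_image_le.trans ?_)
  rw [Finset.card_product, Finset.card_range, Finset.card_range]

/-- The prime powers dividing the modulus contribute little. -/
theorem exists_sum_not_coprime_le (K : Type*) [Field K] [NumberField K] (m : ℕ) :
    ∃ C : ℝ, 0 < C ∧ ∀ x : ℝ, Real.exp 1 ≤ x → ∀ q : ℕ, 1 ≤ q → (q : ℝ) ≤ Real.log x ^ m →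
      ∑ n ∈ (Finset.Icc 1 ⌊x⌋₊).filter (fun n => ¬ n.Coprime q), mangoldtCoeff K n ≤
        C * (x / Real.log x ^ m) := by
  obtain ⟨κ, A, c, hb, -⟩ := exists_twistBase_idealCount K
  set δ : ℝ := 1 / (Module.finrank ℚ K : ℝ) with hδdef
  have hm := isMangoldt_mangoldtCoeff K
  have hκ := hb.κ_pos
  have hA := hb.twist.one_le
  obtain ⟨C₂, hC₂, hlog⟩ := log_pow_le_rpow hb.δ_pos (2 * m + 2)
  refine ⟨6 * (κ + 2 * A) * C₂, by positivity, fun x hx q hq hqx => ?_⟩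
  have hx0 : 0 < x := (Real.exp_pos 1).trans_le hx
  have hL1 : 1 ≤ Real.log x := (Real.le_log_iff_exp_le hx0).mpr hx
  have hx1 : 1 ≤ x := by linarith [Real.add_one_le_exp 1]
  set L := Real.log x with hL
  have hterm : ∀ n ∈ Finset.Icc 1 ⌊x⌋₊,
      mangoldtCoeff K n ≤ (κ + 2 * A) * x ^ (1 - δ) * L := by
    intro n hn
    rw [Finset.mem_Icc] at hn
    have hnx : (n : ℝ) ≤ x := (Nat.le_floor_iff hx0.le).mp hn.2
    have hn1 : (1 : ℝ) ≤ n := by exact_mod_cast hn.1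
    have h0 : 0 ≤ 1 - δ := by linarith [hb.δ_le]
    refine (hm.le hb (by omega)).trans ?_
    have h1 := hb.le_rpow hn.1
    have h2 : Real.log n ≤ L := Real.log_le_log (by linarith) hnx
    have h3 : (n : ℝ) ^ (1 - δ) ≤ x ^ (1 - δ) := by gcongr
    have h4 : idealCount K n ≤ (κ + 2 * A) * x ^ (1 - δ) := h1.trans (by gcongr)
    have h5 := Real.log_natCast_nonneg n
    gcongr
  have hsub : ∑ n ∈ (Finset.Icc 1 ⌊x⌋₊).filter (fun n => ¬ n.Coprime q), mangoldtCoeff K n ≤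
      ∑ n ∈ (Finset.Icc 1 ⌊x⌋₊).filter (fun n => IsPrimePow n ∧ ¬ n.Coprime q),
        mangoldtCoeff K n := by
    refine le_of_eq (Finset.sum_subset_zero_on_sdiff ?_ ?_ fun _ _ => rfl).symm
    · intro n hn
      rw [Finset.mem_filter] at hn ⊢
      exact ⟨hn.1, hn.2.2⟩
    · intro n hn
      by_contra h
      rw [Finset.mem_sdiff, Finset.mem_filter, Finset.mem_filter] at hn
      exact hn.2 ⟨hn.1.1, isPrimePow_of_mangoldtCoeff h, hn.1.2⟩
  refine hsub.trans ((Finset.sum_le_card_nsmul _ _ _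
    fun n hn => hterm n (Finset.mem_filter.mp hn).1).trans ?_)
  rw [nsmul_eq_mul]
  have hcard : (((Finset.Icc 1 ⌊x⌋₊).filter fun n => IsPrimePow n ∧ ¬ n.Coprime q).card : ℝ) ≤
      (2 * L ^ m) * (3 * L) := by
    have h1 : (((Finset.Icc 1 ⌊x⌋₊).filter fun n => IsPrimePow n ∧ ¬ n.Coprime q).card : ℝ) ≤
      ((q + 1 : ℕ) : ℝ) * ((Nat.log 2 ⌊x⌋₊ + 1 : ℕ) : ℝ) := by
      exact_mod_cast card_isPrimePow_not_coprime_le hq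
    refine h1.trans ?_
    have h2 : ((q + 1 : ℕ) : ℝ) ≤ 2 * L ^ m := by
      push_cast
      linarith [one_le_pow₀ hL1 (n := m)]
    have h3 : ((Nat.log 2 ⌊x⌋₊ + 1 : ℕ) : ℝ) ≤ 3 * L := by
      have hfl : ⌊x⌋₊ ≠ 0 := (Nat.floor_pos.mpr hx1).ne'
      have h4 : (2 : ℝ) ^ Nat.log 2 ⌊x⌋₊ ≤ x := by
        have h5 : ((2 ^ Nat.log 2 ⌊x⌋₊ : ℕ) : ℝ) ≤ x :=
          (Nat.le_floor_iff hx0.le).mp (Nat.pow_log_le_self 2 hfl)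
        exact_mod_cast h5
      have h5 := Real.log_le_log (by positivity) h4
      rw [Real.log_pow] at h5
      have h6 := Real.log_two_gt_d9
      have h7 : (0 : ℝ) ≤ (Nat.log 2 ⌊x⌋₊ : ℝ) := Nat.cast_nonneg _
      push_cast
      nlinarith
    gcongr
  calc _ ≤ (2 * L ^ m) * (3 * L) * ((κ + 2 * A) * x ^ (1 - δ) * L) := by gcongr
    _ = 6 * (κ + 2 * A) * (x ^ (1 - δ) * (L ^ (2 * m + 2) / L ^ m)) := by
        rw [show 2 * m + 2 = m + 2 + m by ring, pow_add L (m + 2) m, pow_add L m 2,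
          mul_div_cancel_right₀ _ (by positivity)]
        ring
    _ ≤ 6 * (κ + 2 * A) * (x ^ (1 - δ) * (C₂ * x ^ δ / L ^ m)) := by
        gcongr
        exact hlog x hx
    _ = 6 * (κ + 2 * A) * C₂ * ((x ^ (1 - δ) * x ^ δ) / L ^ m) := by ring
    _ = _ := by rw [← Real.rpow_add hx0, sub_add_cancel, Real.rpow_one]

theorem exists_norm_psiKChi'_le (K : Type*) [Field K] [NumberField K] (m : ℕ) :
    ∃ C : ℝ, 0 < C ∧ ∀ x : ℝ, Real.exp 1 ≤ x → ∀ (q : ℕ) (χ : DirichletCharacter ℂ q), 1 ≤ q →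
      (q : ℝ) ≤ Real.log x ^ m → χ.IsPrimitive →
      ‖psiKChi' K x χ‖ ≤ C * (x / Real.log x ^ m) := by
  obtain ⟨κ, A, c, hF, hpole⟩ := exists_charFamily K
  obtain ⟨C₁, hC₁, h₁⟩ := hF.siegelWalfisz Module.finrank_pos m
  obtain ⟨C₂, hC₂, h₂⟩ := hF.mangoldt.exists_abs_sum_sub_le hF.base m
  obtain ⟨C₃, hC₃, h₃⟩ := exists_sum_not_coprime_le K m
  refine ⟨C₁ + C₂ + C₃, by positivity, fun x hx q χ hq hqx hχ => ?_⟩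
  have hx0 : 0 < x := (Real.exp_pos 1).trans_le hx
  have hL1 : 1 ≤ Real.log x := (Real.le_log_iff_exp_le hx0).mpr hx
  have hpos : 0 ≤ x / Real.log x ^ m := by positivity
  have hnn : ∀ n, 0 ≤ mangoldtCoeff K n := mangoldtCoeff_nonneg
  rw [psiKChi', psiKChi_eq χ x hx0.le]
  by_cases h : ∀ a ∈ Gq K q, χ (a : ZMod q) = 1
  · rw [if_pos h]
    have hq0 : NeZero q := ⟨by omega⟩
    have e1 : ∑ n ∈ Finset.Icc 1 ⌊x⌋₊, χ (n : ZMod q) * (mangoldtCoeff K n : ℂ) - x =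
        (((∑ n ∈ Finset.Icc 1 ⌊x⌋₊, mangoldtCoeff K n - x) -
          ∑ n ∈ (Finset.Icc 1 ⌊x⌋₊).filter (fun n => ¬ n.Coprime q), mangoldtCoeff K n : ℝ) : ℂ) := by
      rw [← Finset.sum_filter_add_sum_filter_not (Finset.Icc 1 ⌊x⌋₊) (fun n => n.Coprime q)
        (fun n => mangoldtCoeff K n)]
      have e2 : ∑ n ∈ Finset.Icc 1 ⌊x⌋₊, χ (n : ZMod q) * (mangoldtCoeff K n : ℂ) =
          ∑ n ∈ (Finset.Icc 1 ⌊x⌋₊).filter (fun n => n.Coprime q), (mangoldtCoeff K n : ℂ) := by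
        rw [Finset.sum_filter]
        refine Finset.sum_congr rfl fun n _ => ?_
        split_ifs with hn
        · by_cases hb : mangoldtCoeff K n = 0
          · rw [hb, Complex.ofReal_zero, mul_zero]
          · rw [apply_eq_one_of_idealCount h hn (idealCount_ne_zero_of_mangoldtCoeff hb), one_mul]
        · rw [χ.map_nonunit (by rwa [ZMod.isUnit_iff_coprime]), zero_mul]
      rw [e2]
      push_cast
      ring
    rw [e1, Complex.norm_real]
    refine (abs_sub _ _).trans ?_
    have e3 := h₃ x hx q hq hqx
    have e4 : 0 ≤ ∑ n ∈ (Finset.Icc 1 ⌊x⌋₊).filter (fun n => ¬ n.Coprime q), mangoldtCoeff K n :=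
      Finset.sum_nonneg fun n _ => hnn n
    rw [abs_of_nonneg e4]
    have e5 := h₂ x hx
    nlinarith [mul_nonneg hC₁.le hpos]
  · rw [if_neg h]
    have hc : c q χ = 0 := by
      by_contra hc
      exact h ((hpole q χ hq).mp hc)
    refine (h₁ x hx q χ hq hqx hχ hc).trans ?_
    gcongr
    linarith

theorem finsum_isPrimitive_le {q : ℕ} (hq : 1 ≤ q) {f : DirichletCharacter ℂ q → ℝ} {B : ℝ}
    (hB : 0 ≤ B) (hf : ∀ χ : DirichletCharacter ℂ q, χ.IsPrimitive → f χ ≤ B) :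
    ∑ᶠ χ ∈ {χ : DirichletCharacter ℂ q | χ.IsPrimitive}, f χ ≤ q.totient * B := by
  have : NeZero q := ⟨by omega⟩
  rw [finsum_mem_eq_finite_toFinset_sum f (Set.toFinite _)]
  refine (Finset.sum_le_card_nsmul _ _ B fun χ hχ => hf χ (by simpa using hχ)).trans ?_
  rw [nsmul_eq_mul]
  gcongr
  refine (Finset.card_le_univ _).trans (le_of_eq ?_)
  rw [← Nat.card_eq_fintype_card]
  exact DirichletCharacter.card_eq_totient_of_hasEnoughRootsOfUnity ℂ q

end Psi

/-- **Small moduli.** For fixed `M > 0`, with `Q₁ = (log x)^{M+1}`: for all `x ≥ 2` and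
`x (log x)^{-M} ≤ Q ≤ x`,
`∑_{q ≤ Q₁} (1/φ(q)) log(2Q/q) ∑_{χ primitive mod q} |ψ'_K(x, χ∘N)|² ≪ x Q log x`,
the implied constant depending only on `K` and `M`. -/
theorem small_moduli_bound (K : Type*) [Field K] [NumberField K] [IsGalois ℚ K]
    (M : ℝ) (hM : 0 < M) :
    ∃ C : ℝ, 0 < C ∧ ∀ x Q : ℝ, 2 ≤ x → x * Real.log x ^ (-M) ≤ Q → Q ≤ x →
      ∑ q ∈ Finset.Icc 1 ⌊Real.log x ^ (M + 1)⌋₊,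
          (1 / q.totient : ℝ) * Real.log (2 * Q / q) *
            ∑ᶠ χ ∈ {χ : DirichletCharacter ℂ q | χ.IsPrimitive}, ‖psiKChi' K x χ‖ ^ 2 ≤
        C * (x * Q * Real.log x) := by
  obtain ⟨m, hm⟩ := exists_nat_ge (M + 1)
  obtain ⟨C, hC, hbd⟩ := exists_norm_psiKChi'_le K m
  refine ⟨2 * C ^ 2, by positivity, fun x Q hx2 hQ hQx => ?_⟩
  have hx0 : 0 < x := by linarith
  have hL0 : 0 < Real.log x := Real.log_pos (by linarith)
  have hL1 : 1 ≤ Real.log x := by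
    by_contra h
    have h1 := Real.one_lt_rpow_of_pos_of_lt_one_of_neg hL0 (not_le.mp h)
      (by linarith : -M < 0)
    nlinarith
  have hxe : Real.exp 1 ≤ x := (Real.le_log_iff_exp_le hx0).mp hL1
  set L := Real.log x with hL
  have hQ0 : 0 < Q := lt_of_lt_of_le (by positivity) hQ
  have hterm : ∀ q ∈ Finset.Icc 1 ⌊L ^ (M + 1)⌋₊, (1 / q.totient : ℝ) * Real.log (2 * Q / q) *
      ∑ᶠ χ ∈ {χ : DirichletCharacter ℂ q | χ.IsPrimitive}, ‖psiKChi' K x χ‖ ^ 2 ≤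
      2 * L * (C * (x / L ^ m)) ^ 2 := by
    intro q hq
    rw [Finset.mem_Icc] at hq
    have hq1 : (1 : ℝ) ≤ q := by exact_mod_cast hq.1
    have hqL : (q : ℝ) ≤ L ^ m := by
      refine ((Nat.le_floor_iff (by positivity)).mp hq.2).trans ?_
      rw [← Real.rpow_natCast]
      exact Real.rpow_le_rpow_of_exponent_le hL1 hm
    have hS := finsum_isPrimitive_le hq.1 (f := fun χ => ‖psiKChi' K x χ‖ ^ 2)
      (B := (C * (x / L ^ m)) ^ 2) (by positivity) fun χ hχ => by
        have := hbd x hxe q χ hq.1 hqL hχ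
        gcongr
    have hS0 : 0 ≤ ∑ᶠ χ ∈ {χ : DirichletCharacter ℂ q | χ.IsPrimitive}, ‖psiKChi' K x χ‖ ^ 2 :=
      finsum_nonneg fun χ => finsum_nonneg fun _ => by positivity
    have hφ : (0 : ℝ) < q.totient := by exact_mod_cast Nat.totient_pos.mpr hq.1
    have hlog : Real.log (2 * Q / q) ≤ 2 * L := by
      have h1 : 2 * Q / q ≤ x * x := (div_le_self (by positivity) hq1).trans (by nlinarith)
      have h2 := Real.log_le_log (by positivity) h1
      rw [Real.log_mul hx0.ne' hx0.ne'] at h2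
      linarith
    calc _ ≤ (1 / q.totient : ℝ) * (2 * L) * (q.totient * (C * (x / L ^ m)) ^ 2) := by
          refine mul_le_mul ?_ hS hS0 (by positivity)
          exact mul_le_mul_of_nonneg_left hlog (by positivity)
      _ = _ := by field_simp
  refine (Finset.sum_le_card_nsmul _ _ _ hterm).trans ?_
  rw [nsmul_eq_mul, Nat.card_Icc, Nat.add_sub_cancel]
  have hfl : (⌊L ^ (M + 1)⌋₊ : ℝ) ≤ L ^ (M + 1) := Nat.floor_le (by positivity)
  have hpow : L ^ (M + 1) / (L ^ m) ^ 2 ≤ L ^ (-M) := by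
    rw [div_le_iff₀ (by positivity), ← Real.rpow_natCast L m, ← Real.rpow_mul_natCast hL0.le,
      ← Real.rpow_add hL0]
    refine Real.rpow_le_rpow_of_exponent_le hL1 ?_
    push_cast
    linarith
  calc _ ≤ L ^ (M + 1) * (2 * L * (C * (x / L ^ m)) ^ 2) := by gcongr
    _ = 2 * C ^ 2 * (x * (x * (L ^ (M + 1) / (L ^ m) ^ 2)) * L) := by ring
    _ ≤ 2 * C ^ 2 * (x * (x * L ^ (-M)) * L) := by gcongr
    _ ≤ _ := by gcongr
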